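/- (Polynomiality consequence of Theorem 1.1.) Let g ≥ 0 and n ≥ 1 be integers with 2g − 2 + n > 0. Then there exists a symmetric polynomial P_{g,n} ∈ ℚ[x1, …, xn], all of whose monomials have total degree at least 2g − 3 + n and at most 3g − 3 + n, such that for every n-tuple of positive integers (k1, …, kn), with k = k1 + ⋯ + kn and d = k + n + 2g − 2, the Hurwitz number satisfies h_{g;k1,…,kn} = (d! / #Aut(k1, …, kn)) · (∏_{i=1}^n k_i^{k_i} / k_i!) · P_{g,n}(k1, …, kn). (The coefficients of P_{g,n} are the Hodge integrals ±∫_{M̄_{g,n}} c_j(Λ_{g,n}) ψ1^{a1}⋯ψn^{an} appearing when the integrand of formula (1) of Theorem 1.1 is expanded.) -/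

import Mathlib

open Equiv

/-- The cycle type of a permutation of `Fin k` where fixed points are counted as
cycles of length 1 (Mathlib's `cycleType` records only nontrivial cycles). -/
def fullCycleType {k : ℕ} (σ : Perm (Fin k)) : Multiset ℕ :=
  σ.cycleType + Multiset.replicate (k - σ.support.card) 1

/-- The subgroup generated by the family `τ` acts transitively on `Fin k`. -/
def IsTransitiveFamily {k d : ℕ} (τ : Fin d → Perm (Fin k)) : Prop :=
  ∀ x y : Fin k, ∃ p ∈ Subgroup.closure (Set.range τ), p x = y

/-- The number of `d`-tuples (`d = k + n + 2g - 2`, `k = k₁ + ⋯ + kₙ`) of transpositions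
in `S_k` whose product has cycle type `(k₁, …, kₙ)` (fixed points counted as 1-cycles)
and which generate a transitive subgroup of `S_k`. -/
noncomputable def hurwitzCount (g n : ℕ) (kk : Fin n → ℕ) : ℕ :=
  Nat.card {τ : Fin ((∑ i, kk i) + n + 2 * g - 2) → Perm (Fin (∑ i, kk i)) //
    (∀ i, (τ i).IsSwap) ∧
    fullCycleType (List.ofFn τ).prod = (List.ofFn kk : Multiset ℕ) ∧
    IsTransitiveFamily τ}

/-- The Hurwitz number `h_{g; k₁, …, kₙ}`: `1/k!` times the number of transitive
transposition factorizations counted by `hurwitzCount`. -/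
noncomputable def hurwitzNumber (g n : ℕ) (kk : Fin n → ℕ) : ℚ :=
  (hurwitzCount g n kk : ℚ) / ((∑ i, kk i).factorial : ℚ)

/-- `#Aut(k₁, …, kₙ)`: the number of permutations `π` of `{1, …, n}` with
`k_{π(i)} = k_i` for all `i`. -/
noncomputable def autCount (n : ℕ) (kk : Fin n → ℕ) : ℕ :=
  Nat.card {π : Perm (Fin n) // ∀ i, kk (π i) = kk i}

namespace HurwitzPoly

open _root_.Finset hiding antidiagonal map_cons mem_antidiagonal sum_cons
open Finset.HasAntidiagonal (antidiagonal mem_antidiagonal)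
open Function (update update_self update_of_ne update_idem update_comm minimalPeriod)
open List (ofFn mem_ofFn map_cons sum_cons nodup_cons mem_cons_of_mem sum_toFinset)
open PowerSeries (coeff_mk rescale coeff_rescale coeff_succ_mul_X)
open Polynomial (eval_X eval_mul eval_C eval_pow eval_add eval_prod)
open Function (iterate_succ_apply' iterate_minimalPeriod IsPeriodicPt IsFixedPt
  minimalPeriod_pos_of_mem_periodicPts)
open scoped PowerSeries

noncomputable section

/-- The polynomial ring in the power sums. -/
abbrev Fock (K : Type*) [CommRing K] := MvPolynomial ℕ K

section Fock

open MvPolynomial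

variable {K : Type*} [CommRing K]

/-- The power sums: `pw 0 = 0` and `pw (k + 1)` is the `k`-th variable. -/
def pw : ℕ → Fock K
  | 0 => 0
  | k + 1 => X k

@[simp] lemma pw_zero : (pw 0 : Fock K) = 0 := rfl

lemma pw_succ (k : ℕ) : (pw (k + 1) : Fock K) = X k := rfl

/-- Induction on polynomials in the power sums. -/
lemma pw_induction {M : Fock K → Prop} (g : Fock K)
    (h1 : M 1) (hC : ∀ a g, M g → M (C a * g)) (hadd : ∀ f g, M f → M g → M (f + g))
    (hp : ∀ k g, M g → M (pw k * g)) : M g := by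
  induction g using MvPolynomial.induction_on with
  | C a => simpa using hC a 1 h1
  | add f g hf hg => exact hadd f g hf hg
  | mul_X g n hg => rw [mul_comm]; exact hp (n + 1) g hg

/-- The derivation `p_j ↦ j p_{k+j}`. -/
def shiftDer (k : ℕ) : Derivation K (Fock K) (Fock K) :=
  mkDerivation K fun j => ((j + 1 : ℕ) : Fock K) * pw (k + (j + 1))

lemma shiftDer_pw (k j : ℕ) :
    shiftDer k (pw j : Fock K) = (j : Fock K) * pw (k + j) := by
  cases j with
  | zero => simp
  | succ j => simp [shiftDer, pw_succ, mkDerivation_X]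

/-- The quadratic expression `∑_{i + j = k} p_i p_j`. -/
def quad (k : ℕ) : Fock K :=
  ∑ x ∈ antidiagonal k, pw x.1 * pw x.2

/-- The operator `∑_{i + j = k} p_i p_j + 2 ∑ j p_{k+j} ∂_j`. -/
def stepOp (k : ℕ) : Fock K →ₗ[K] Fock K :=
  LinearMap.mulLeft K (quad k) + (2 : K) • (shiftDer k : Derivation K _ _).toLinearMap

lemma stepOp_apply (k : ℕ) (g : Fock K) :
    stepOp k g = quad k * g + 2 * shiftDer k g := by
  simp [stepOp, smul_eq_C_mul, map_ofNat C 2]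

lemma stepOp_pw_mul (k l : ℕ) (g : Fock K) :
    stepOp k (pw l * g) = pw l * stepOp k g + 2 * (l : Fock K) * pw (k + l) * g := by
  simp only [stepOp_apply, Derivation.leibniz, shiftDer_pw, smul_eq_mul]
  ring

/-- Twice the cut-and-join operator, as a function. -/
def cutJoinFun (g : Fock K) : Fock K :=
  ∑ k ∈ g.vars, ((k + 1 : ℕ) : Fock K) * (quad (k + 1) * pderiv k g + shiftDer (k + 1) (pderiv k g))

lemma cutJoinFun_eq (g : Fock K) {T : Finset ℕ} (hT : g.vars ⊆ T) :
    cutJoinFun g = ∑ k ∈ T, ((k + 1 : ℕ) : Fock K) * (quad (k + 1) * pderiv k g + shiftDer (k + 1) (pderiv k g)) := by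
  refine sum_subset hT fun k _ hk => ?_
  rw [pderiv_eq_zero_of_notMem_vars hk]; simp

/-- Twice the cut-and-join operator. -/
def cutJoin : Fock K →ₗ[K] Fock K where
  toFun := cutJoinFun
  map_add' f g := by
    classical
    rw [cutJoinFun_eq f (T := f.vars ∪ g.vars ∪ (f + g).vars) (by intro; simp; tauto),
      cutJoinFun_eq g (T := f.vars ∪ g.vars ∪ (f + g).vars) (by intro; simp; tauto),
      cutJoinFun_eq (f + g) (T := f.vars ∪ g.vars ∪ (f + g).vars) (by intro; simp; tauto),
      ← sum_add_distrib]
    refine sum_congr rfl fun k _ => ?_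
    simp only [map_add]
    ring
  map_smul' a g := by
    classical
    rw [cutJoinFun_eq (a • g) (T := g.vars ∪ (a • g).vars) (by intro; simp; tauto),
      cutJoinFun_eq g (T := g.vars ∪ (a • g).vars) (by intro; simp; tauto), smul_sum]
    simp [← smul_add]

lemma cutJoin_one : cutJoin (1 : Fock K) = 0 := by
  change cutJoinFun 1 = 0
  simp [cutJoinFun]

lemma derivation_sum_apply {ι : Type*} (T : Finset ι) (D : ι → Derivation K (Fock K) (Fock K))
    (x : Fock K) : (∑ j ∈ T, D j) x = ∑ j ∈ T, D j x := by
  classical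
  induction T using Finset.induction_on with
  | empty => simp
  | insert a s ha ih => simp [sum_insert ha, ih]

lemma shiftDer_eq_sum (k : ℕ) (g : Fock K) {T : Finset ℕ} (hT : g.vars ⊆ T) :
    shiftDer k g = ∑ j ∈ T, ((j + 1 : ℕ) : Fock K) * pw (k + (j + 1)) * pderiv j g := by
  classical
  have h := derivation_eq_of_forall_mem_vars (f := g) (D₁ := shiftDer k)
    (D₂ := ∑ j ∈ T, (((j + 1 : ℕ) : Fock K) * pw (k + (j + 1))) • pderiv j) (by
      intro i hi
      rw [← pw_succ, shiftDer_pw, pw_succ, derivation_sum_apply, sum_eq_single i]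
      · simp
      · intro b _ hb; simp [hb.symm, pderiv_X]
      · intro h; exact absurd (hT hi) h)
  rw [h, derivation_sum_apply]
  simp

lemma cutJoin_pw_mul (k : ℕ) (g : Fock K) :
    cutJoin (pw k * g) = pw k * cutJoin g + (k : Fock K) * stepOp k g := by
  classical
  cases k with
  | zero => simp
  | succ k =>
    change cutJoinFun _ = _ * cutJoinFun _ + _
    set T := insert k (g.vars ∪ (pw (k + 1) * g).vars) with hT
    rw [cutJoinFun_eq _ (T := T) (by intro; simp [hT]; tauto),
      cutJoinFun_eq g (T := T) (by intro; simp [hT]; tauto)]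
    have h1 : ∀ j, pderiv j (pw (k + 1) * g)
        = pw (k + 1) * pderiv j g + if j = k then g else 0 := by
      intro j
      rw [Derivation.leibniz, pw_succ, pderiv_X]
      by_cases h : j = k
      · subst h; simp
      · simp [h, Ne.symm h]
    have h2 : ∑ j ∈ T, ((j + 1 : ℕ) : Fock K) * (quad (j + 1) * (if j = k then g else 0)
          + shiftDer (j + 1) (if j = k then g else 0))
        = ((k + 1 : ℕ) : Fock K) * (quad (k + 1) * g + shiftDer (k + 1) g) := by
      rw [sum_eq_single k]
      · simp
      · intro b _ hb; simp [hb]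
      · intro h; simp [hT] at h
    have h3 := shiftDer_eq_sum (k + 1) g (T := T) (by intro; simp [hT]; tauto)
    have h4 : ((k + 1 : ℕ) : Fock K) * stepOp (k + 1) g
        = ((k + 1 : ℕ) : Fock K) * (quad (k + 1) * g + shiftDer (k + 1) g)
          + ∑ x ∈ T, ((x + 1 : ℕ) : Fock K) *
            (((k + 1 : ℕ) : Fock K) * pw (x + 1 + (k + 1)) * pderiv x g) := by
      have : ∑ x ∈ T, ((x + 1 : ℕ) : Fock K) *
          (((k + 1 : ℕ) : Fock K) * pw (x + 1 + (k + 1)) * pderiv x g)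
          = ((k + 1 : ℕ) : Fock K) * shiftDer (k + 1) g := by
        rw [h3, mul_sum]
        exact sum_congr rfl fun x _ => by rw [add_comm (x + 1) (k + 1)]; ring
      rw [this, stepOp_apply]
      ring
    rw [h4, ← h2, mul_sum, ← sum_add_distrib, ← sum_add_distrib]
    refine sum_congr rfl fun x _ => ?_
    rw [h1, map_add, Derivation.leibniz, shiftDer_pw]
    simp only [smul_eq_mul]
    ring

end Fock

section Vertex

open MvPolynomial

variable {K : Type*} [CommRing K] [Algebra ℚ K]

/-- The coefficients of `exp (∑ e_k p_k x^k / k)`, indexed by natural numbers. -/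
def homogNat (e : ℕ → K) : ℕ → Fock K
  | 0 => 1
  | n + 1 => ((n + 1 : ℚ)⁻¹) • ∑ k : Fin (n + 1),
      C (e (k + 1)) * pw (k + 1) * homogNat e (n - k)
termination_by n => n
decreasing_by omega

/-- The coefficients of `exp (∑ e_k p_k x^k / k)`, extended by zero to negative indices. -/
def homog (e : ℕ → K) (s : ℤ) : Fock K :=
  if s < 0 then 0 else homogNat e s.toNat

lemma homog_of_neg (e : ℕ → K) {s : ℤ} (hs : s < 0) : homog e s = 0 := if_pos hs

@[simp] lemma homog_zero (e : ℕ → K) : homog e 0 = 1 := by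
  simp [homog, homogNat]

lemma mul_homog (e : ℕ → K) {s : ℤ} {N : ℕ} (hs : s < N) :
    (s : Fock K) * homog e s
      = ∑ k ∈ range N, C (e k) * pw k * homog e (s - k) := by
  rcases lt_trichotomy s 0 with h | h | h
  · rw [homog_of_neg _ h, mul_zero]
    symm
    exact sum_eq_zero fun k _ => by rw [homog_of_neg _ (by omega), mul_zero]
  · subst h
    rw [Int.cast_zero, zero_mul]
    symm
    refine sum_eq_zero fun k _ => ?_
    rcases Nat.eq_zero_or_pos k with rfl | hk
    · simp
    · rw [homog_of_neg _ (by omega), mul_zero]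
  · obtain ⟨n, rfl⟩ : ∃ n : ℕ, s = (n + 1 : ℕ) := ⟨s.toNat - 1, by omega⟩
    have hN : n + 2 ≤ N := by omega
    rw [← sum_subset (s₁ := range (n + 2))
      (range_subset_range.2 hN)]
    · rw [sum_range_succ']
      simp only [pw_zero, mul_zero, zero_mul, add_zero]
      have h0 : homog e ((n + 1 : ℕ) : ℤ) = homogNat e (n + 1) := by
        simp only [homog]; rw [if_neg (by omega)]; congr 1
      rw [h0, homogNat, sum_range]
      have h1 : (((n + 1 : ℕ) : ℤ) : Fock K) = C (algebraMap ℚ K (n + 1)) := by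
        simp
      rw [h1, ← smul_eq_C_mul, algebraMap_smul, smul_smul, mul_inv_cancel₀ (by positivity),
        one_smul]
      refine sum_congr rfl fun k _ => ?_
      congr 1
      simp only [homog]
      rw [if_neg (by have := k.2; push_cast; omega)]
      congr 1
      push_cast
      omega
    · intro k _ hk
      rw [homog_of_neg _ (by simp at hk; push_cast; omega), mul_zero]

/-- A nonzero integer can be cancelled in the Fock space. -/
lemma intCast_mul_cancel {R : Type*} [CommRing R] [Algebra ℚ R] {s : ℤ} (hs : s ≠ 0) {x y : R}
    (h : (s : R) * x = (s : R) * y) : x = y := by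
  have hu : algebraMap ℚ R ((s : ℚ)⁻¹) * (s : R) = 1 := by
    rw [← map_intCast (algebraMap ℚ R) s, ← map_mul, inv_mul_cancel₀ (by exact_mod_cast hs),
      map_one]
  calc x = algebraMap ℚ R ((s : ℚ)⁻¹) * ((s : R) * x) := by rw [← mul_assoc, hu, one_mul]
    _ = _ := by rw [h, ← mul_assoc, hu, one_mul]

/-- Strong induction on a family indexed by the integers that vanishes at negative indices. -/
lemma int_induction {M : ℤ → Prop} (h : ∀ s, (∀ t, t < s → 0 ≤ s → M t) → M s) : ∀ s, M s := by
  have key : ∀ n : ℕ, ∀ s : ℤ, s < n → M s := by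
    intro n
    induction n with
    | zero => intro s hs; exact h s fun t _ h0 => by omega
    | succ n ih => intro s hs; exact h s fun t ht _ => ih t (by push_cast at hs; omega)
  intro s
  exact key (s.toNat + 1) s (by omega)

/-- A sequence satisfying the defining recursion of `homog` coincides with it. -/
lemma eq_of_recursion {R : Type*} [CommRing R] [Algebra ℚ R] (w : ℕ → R) {y z : ℤ → R}
    (hw : w 0 = 0) (hy : ∀ s < 0, y s = 0) (hz : ∀ s < 0, z s = 0) (h0 : y 0 = z 0)
    (hyr : ∀ (s : ℤ) (N : ℕ), s < N → (s : R) * y s = ∑ k ∈ range N, w k * y (s - k))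
    (hzr : ∀ (s : ℤ) (N : ℕ), s < N → (s : R) * z s = ∑ k ∈ range N, w k * z (s - k))
    (s : ℤ) : y s = z s := by
  induction s using int_induction with
  | h s ih =>
    rcases lt_trichotomy s 0 with h | h | h
    · rw [hy s h, hz s h]
    · rw [h, h0]
    · refine intCast_mul_cancel h.ne' ?_
      have hN : s < ((s.toNat + 1 : ℕ) : ℤ) := by omega
      rw [hyr s _ hN, hzr s _ hN]
      refine sum_congr rfl fun k _ => ?_
      rcases Nat.eq_zero_or_pos k with rfl | hk
      · simp [hw]
      · rw [ih (s - k) (by omega) h.le]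

/-- The substitution `p_k ↦ p_k + e_k Y^k`. -/
def shiftHom (e : ℕ → K) : Fock K →ₐ[K] Polynomial (Fock K) :=
  aeval fun k => Polynomial.C (pw (k + 1)) +
    Polynomial.C (C (e (k + 1))) * Polynomial.X ^ (k + 1)

omit [Algebra ℚ K] in
lemma shiftHom_pw (e : ℕ → K) (he : e 0 = 0) (k : ℕ) :
    shiftHom e (pw k) = Polynomial.C (pw k) + Polynomial.C (C (e k)) * Polynomial.X ^ k := by
  cases k with
  | zero => simp [he]
  | succ k => rw [pw_succ, shiftHom, aeval_X, pw_succ]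

/-- The linear functional `b Y^r ↦ b h_{s+r}`. -/
def bracket (e : ℕ → K) (s : ℤ) : Polynomial (Fock K) →ₗ[Fock K] Fock K :=
  Polynomial.lsum fun r => LinearMap.toSpanSingleton (Fock K) (Fock K) (homog e (s + r))

lemma bracket_C_mul_X_pow (e : ℕ → K) (s : ℤ) (b : Fock K) (r : ℕ) :
    bracket e s (Polynomial.C b * Polynomial.X ^ r) = b * homog e (s + r) := by
  rw [Polynomial.C_mul_X_pow_eq_monomial, bracket, Polynomial.lsum_apply,
    Polynomial.sum_monomial_index _ _ (by simp)]
  simp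

lemma bracket_C_mul (e : ℕ → K) (s : ℤ) (b : Fock K) (q : Polynomial (Fock K)) :
    bracket e s (Polynomial.C b * q) = b * bracket e s q := by
  rw [← Polynomial.smul_eq_C_mul, map_smul, smul_eq_mul]

lemma bracket_X_pow_mul (e : ℕ → K) (s : ℤ) (k : ℕ) (q : Polynomial (Fock K)) :
    bracket e s (Polynomial.X ^ k * q) = bracket e (s + k) q := by
  induction q using Polynomial.induction_on' with
  | add p q hp hq => rw [mul_add, map_add, map_add, hp, hq]
  | monomial r b =>
    rw [← Polynomial.C_mul_X_pow_eq_monomial, mul_left_comm, ← pow_add, bracket_C_mul_X_pow,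
      bracket_C_mul_X_pow]
    push_cast
    rw [add_assoc]

/-- The vertex operator `∑ h_{s+r} ⟨Y^r⟩` of index `s` attached to the sequence `e`. -/
def vertex (e : ℕ → K) (s : ℤ) : Fock K →ₗ[K] Fock K :=
  ((bracket e s).restrictScalars K).comp (shiftHom e).toLinearMap

lemma vertex_apply (e : ℕ → K) (s : ℤ) (g : Fock K) :
    vertex e s g = bracket e s (shiftHom e g) := rfl

lemma vertex_one (e : ℕ → K) (s : ℤ) : vertex e s 1 = homog e s := by
  have := bracket_C_mul_X_pow e s 1 0
  simpa [vertex_apply] using this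

lemma vertex_pw_mul (e : ℕ → K) (he : e 0 = 0) (s : ℤ) (k : ℕ) (g : Fock K) :
    vertex e s (pw k * g) = pw k * vertex e s g + C (e k) * vertex e (s + k) g := by
  rw [vertex_apply, map_mul, shiftHom_pw e he, add_mul, map_add, bracket_C_mul, mul_assoc,
    bracket_C_mul, bracket_X_pow_mul]
  rfl

lemma vertex_C_mul (e : ℕ → K) (s : ℤ) (a : K) (g : Fock K) :
    vertex e s (C a * g) = C a * vertex e s g := by
  rw [← smul_eq_C_mul, map_smul, smul_eq_C_mul]

/-- Action of `p_j ↦ j p_{k+j}` on `h_s`. -/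
lemma shiftDer_homog (e : ℕ → K) (he : e 0 = 0) (k : ℕ) (s : ℤ) {N : ℕ} (hN : s < N) :
    shiftDer k (homog e s)
      = ∑ j ∈ range N, C (e j) * pw (k + j) * homog e (s - j) := by
  induction s using int_induction generalizing N with
  | h s ih =>
    rcases lt_trichotomy s 0 with h | h | h
    · rw [homog_of_neg _ h, map_zero]
      exact (sum_eq_zero fun j _ => by rw [homog_of_neg _ (by omega), mul_zero]).symm
    · subst h
      rw [homog_zero, Derivation.map_one_eq_zero]
      refine (sum_eq_zero fun j _ => ?_).symm
      rcases Nat.eq_zero_or_pos j with rfl | hj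
      · simp [he]
      · rw [homog_of_neg _ (by omega), mul_zero]
    · refine intCast_mul_cancel h.ne' ?_
      have h1 : (s : Fock K) * shiftDer k (homog e s) = shiftDer k ((s : Fock K) * homog e s) := by
        rw [Derivation.leibniz, Derivation.map_intCast]; simp
      have h2 : ∀ j ∈ range N, shiftDer k (C (e j) * pw j * homog e (s - j))
          = C (e j) * ((j : Fock K) * pw (k + j)) * homog e (s - j)
            + ∑ i ∈ range N,
              C (e j) * pw j * (C (e i) * pw (k + i) * homog e (s - j - i)) := by
        intro j _
        rw [← mul_sum]
        rcases Nat.eq_zero_or_pos j with rfl | hj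
        · simp
        · rw [← ih (s - j) (by omega) h.le (by omega), Derivation.leibniz, Derivation.leibniz,
            shiftDer_pw, derivation_C]
          simp only [smul_eq_mul]
          ring
      have h3 : ∀ j ∈ range N, (s : Fock K) * (C (e j) * pw (k + j) * homog e (s - j))
          = C (e j) * ((j : Fock K) * pw (k + j)) * homog e (s - j)
            + ∑ i ∈ range N,
              C (e i) * pw i * (C (e j) * pw (k + j) * homog e (s - i - j)) := by
        intro j _
        have h4 := mul_homog e (s := s - j) (N := N) (by omega)
        have h5 : ∑ i ∈ range N, C (e i) * pw i * (C (e j) * pw (k + j) *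
            homog e (s - i - j)) = C (e j) * pw (k + j) * (((s - j : ℤ) : Fock K) * homog e (s - j)) := by
          rw [h4, mul_sum]
          refine sum_congr rfl fun i _ => ?_
          rw [sub_right_comm]; ring
        rw [h5]; push_cast; ring
      rw [h1, mul_homog e hN, map_sum, sum_congr rfl h2, mul_sum,
        sum_congr rfl h3, sum_add_distrib, sum_add_distrib,
        sum_comm (s := range N) (t := range N)]

lemma sum_range_antidiagonal {R : Type*} [AddCommMonoid R] (f : ℕ → ℕ → R) (N : ℕ)
    (hf : ∀ i j, N ≤ i + j → f i j = 0) :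
    ∑ k ∈ range N, ∑ x ∈ antidiagonal k, f x.1 x.2
      = ∑ i ∈ range N, ∑ j ∈ range N, f i j := by
  rw [sum_sigma', ← sum_product' (f := f)]
  symm
  rw [← sum_filter_add_sum_filter_not (range N ×ˢ range N)
    (fun x => x.1 + x.2 < N)]
  have h0 : ∑ x ∈ range N ×ˢ range N with ¬ x.1 + x.2 < N, f x.1 x.2 = 0 := by
    refine sum_eq_zero fun x hx => ?_
    simp at hx
    exact hf _ _ (by omega)
  rw [h0, add_zero]
  · refine sum_bij' (fun x _ => ⟨x.1 + x.2, x⟩) (fun y _ => y.2) ?_ ?_ ?_ ?_ ?_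
    · intro x hx; simp at hx ⊢; omega
    · rintro ⟨k, x⟩ hx; simp at hx ⊢; omega
    · intro x hx; rfl
    · rintro ⟨k, x⟩ hx
      simp at hx
      obtain ⟨_, rfl⟩ := hx
      rfl
    · intro x hx; rfl

set_option maxHeartbeats 1000000 in
/-- Twice the cut-and-join operator on `h_s`. -/
lemma cutJoin_homog (e : ℕ → K) (s : ℤ) {N : ℕ} (he : e 0 = 0) (hN : s < N) :
    cutJoin (homog e s)
      = ∑ i ∈ range N, ∑ j ∈ range N,
          C (e (i + j)) * pw i * pw j * homog e (s - i - j)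
        + ∑ n ∈ range N,
          C (∑ x ∈ antidiagonal n, e x.1 * e x.2) * pw n *
            homog e (s - n) := by
  induction s using int_induction generalizing N with
  | h s ih =>
    set Q : ℕ → K := fun n => ∑ x ∈ antidiagonal n, e x.1 * e x.2 with hQ
    by_cases h : s ≤ 0
    · have h1 : cutJoin (homog e s) = 0 := by
        rcases h.lt_or_eq with h | rfl
        · rw [homog_of_neg _ h, map_zero]
        · rw [homog_zero, cutJoin_one]
      rw [h1]
      symm
      have h2 : ∀ k : ℕ, 0 < k → homog e (s - k) = 0 := fun k hk => homog_of_neg _ (by omega)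
      rw [sum_eq_zero, sum_eq_zero, add_zero]
      · intro n _
        rcases Nat.eq_zero_or_pos n with rfl | hn
        · simp
        · rw [h2 _ hn, mul_zero]
      · intro i _
        refine sum_eq_zero fun j _ => ?_
        rcases Nat.eq_zero_or_pos i with rfl | hi
        · simp
        · rw [homog_of_neg _ (by omega), mul_zero]
    · push Not at h
      refine intCast_mul_cancel h.ne' ?_
      have h1 : (s : Fock K) * cutJoin (homog e s) = cutJoin ((s : Fock K) * homog e s) := by
        have : (s : Fock K) = C (s : K) := by simp
        rw [this, ← smul_eq_C_mul, ← smul_eq_C_mul, map_smul]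
      have h2 : ∀ k ∈ range N, cutJoin (C (e k) * pw k * homog e (s - k))
          = C (e k) * pw k * (∑ i ∈ range N, ∑ j ∈ range N,
              C (e (i + j)) * pw i * pw j * homog e (s - k - i - j))
            + C (e k) * pw k * (∑ n ∈ range N, C (Q n) * pw n * homog e (s - k - n))
            + ∑ x ∈ antidiagonal k,
              C (e (x.1 + x.2)) * ((x.1 : Fock K) + (x.2 : Fock K)) * pw x.1 * pw x.2
                * homog e (s - x.1 - x.2)
            + 2 * ∑ j ∈ range N, (k : Fock K) * C (e k) * C (e j) * pw (k + j)
                * homog e (s - k - j) := by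
        intro k _
        rw [mul_assoc, ← smul_eq_C_mul, map_smul, cutJoin_pw_mul, smul_eq_C_mul, stepOp_apply,
          shiftDer_homog e he k (s - k) (N := N) (by omega), quad]
        have h3 : ∑ x ∈ antidiagonal k,
              C (e (x.1 + x.2)) * ((x.1 : Fock K) + (x.2 : Fock K)) * pw x.1 * pw x.2
                * homog e (s - x.1 - x.2)
            = C (e k) * (k : Fock K) * (∑ x ∈ antidiagonal k,
                pw x.1 * pw x.2) * homog e (s - k) := by
          rw [mul_sum, sum_mul]
          refine sum_congr rfl fun x hx => ?_
          rw [mem_antidiagonal] at hx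
          rw [← hx]
          push_cast
          rw [← sub_sub]
          ring
        have h4 : ∑ j ∈ range N, (k : Fock K) * C (e k) * C (e j) * pw (k + j)
              * homog e (s - k - j) = (k : Fock K) * C (e k) *
              ∑ j ∈ range N, C (e j) * pw (k + j) * homog e (s - k - j) := by
          rw [mul_sum]; exact sum_congr rfl fun _ _ => by ring
        rw [h3, h4]
        rcases Nat.eq_zero_or_pos k with rfl | hk
        · simp
        · rw [ih (s - k) (by omega) h.le (N := N) (by omega)]
          ring
      have h5 : ∀ i ∈ range N, ∀ j ∈ range N,
          (s : Fock K) * (C (e (i + j)) * pw i * pw j * homog e (s - i - j))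
          = C (e (i + j)) * ((i : Fock K) + (j : Fock K)) * pw i * pw j * homog e (s - i - j)
            + ∑ k ∈ range N, C (e k) * pw k * (C (e (i + j)) * pw i * pw j
              * homog e (s - k - i - j)) := by
        intro i _ j _
        have h6 : ∑ k ∈ range N, C (e k) * pw k * (C (e (i + j)) * pw i * pw j
              * homog e (s - k - i - j)) = C (e (i + j)) * pw i * pw j *
              (((s - i - j : ℤ) : Fock K) * homog e (s - i - j)) := by
          rw [mul_homog e (s := s - i - j) (N := N) (by omega), mul_sum]
          refine sum_congr rfl fun k _ => ?_
          rw [show s - k - i - j = s - i - j - k by ring]; ring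
        rw [h6]; push_cast; ring
      have h7 : ∀ n ∈ range N, (s : Fock K) * (C (Q n) * pw n * homog e (s - n))
          = (n : Fock K) * C (Q n) * pw n * homog e (s - n)
            + ∑ k ∈ range N, C (e k) * pw k * (C (Q n) * pw n * homog e (s - k - n)) := by
        intro n _
        have h6 : ∑ k ∈ range N, C (e k) * pw k * (C (Q n) * pw n * homog e (s - k - n))
            = C (Q n) * pw n * (((s - n : ℤ) : Fock K) * homog e (s - n)) := by
          rw [mul_homog e (s := s - n) (N := N) (by omega), mul_sum]
          refine sum_congr rfl fun k _ => ?_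
          rw [sub_right_comm]; ring
        rw [h6]; push_cast; ring
      have h8 := sum_range_antidiagonal (fun i j => C (e (i + j)) *
        ((i : Fock K) + (j : Fock K)) * pw i * pw j * homog e (s - i - j)) N
        (fun i j hij => by rw [homog_of_neg _ (by omega), mul_zero])
      have h9 := sum_range_antidiagonal (fun i j => ((i : Fock K) + (j : Fock K)) *
        C (e i) * C (e j) * pw (i + j) * homog e (s - i - j)) N
        (fun i j hij => by rw [homog_of_neg _ (by omega), mul_zero])
      have h10 : ∑ n ∈ range N, (n : Fock K) * C (Q n) * pw n * homog e (s - n)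
          = 2 * ∑ k ∈ range N, ∑ j ∈ range N,
              (k : Fock K) * C (e k) * C (e j) * pw (k + j) * homog e (s - k - j) := by
        have h11 : ∑ k ∈ range N, ∑ j ∈ range N,
              (j : Fock K) * C (e k) * C (e j) * pw (k + j) * homog e (s - k - j)
            = ∑ k ∈ range N, ∑ j ∈ range N,
              (k : Fock K) * C (e k) * C (e j) * pw (k + j) * homog e (s - k - j) := by
          rw [sum_comm]
          refine sum_congr rfl fun i _ => sum_congr rfl fun j _ => ?_
          rw [add_comm j i, sub_right_comm]; ring
        have h12 : ∑ n ∈ range N, (n : Fock K) * C (Q n) * pw n * homog e (s - n)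
            = ∑ k ∈ range N, ∑ x ∈ antidiagonal k,
              ((x.1 : Fock K) + (x.2 : Fock K)) *
                C (e x.1) * C (e x.2) * pw (x.1 + x.2) * homog e (s - x.1 - x.2) := by
          refine sum_congr rfl fun n _ => ?_
          rw [hQ, map_sum, mul_sum, sum_mul, sum_mul]
          refine sum_congr rfl fun x hx => ?_
          rw [mem_antidiagonal] at hx
          rw [← hx, map_mul]
          push_cast
          rw [← sub_sub]
          ring
        rw [h12, h9, two_mul]
        nth_rewrite 2 [← h11]
        simp_rw [← sum_add_distrib]
        exact sum_congr rfl fun _ _ => sum_congr rfl fun _ _ => by ring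
      rw [h1, mul_homog e hN, map_sum, sum_congr rfl h2]
      simp only [sum_add_distrib]
      rw [h8, ← mul_sum, ← h10, mul_add, mul_sum, mul_sum,
        sum_congr rfl h7, sum_add_distrib]
      have h13 : ∑ i ∈ range N, (s : Fock K) * ∑ j ∈ range N,
          C (e (i + j)) * pw i * pw j * homog e (s - i - j)
          = ∑ i ∈ range N, ∑ j ∈ range N,
            C (e (i + j)) * ((i : Fock K) + (j : Fock K)) * pw i * pw j * homog e (s - i - j)
          + ∑ k ∈ range N, C (e k) * pw k * ∑ i ∈ range N, ∑ j ∈ range N,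
              C (e (i + j)) * pw i * pw j * homog e (s - k - i - j) := by
        simp_rw [mul_sum]
        rw [sum_congr rfl fun i hi => sum_congr rfl (h5 i hi)]
        simp_rw [sum_add_distrib]
        rw [sum_comm_cycle]
      have h14 : ∑ k ∈ range N, C (e k) * pw k * ∑ n ∈ range N,
            C (Q n) * pw n * homog e (s - k - n)
          = ∑ n ∈ range N, ∑ k ∈ range N,
            C (e k) * pw k * (C (Q n) * pw n * homog e (s - k - n)) := by
        simp_rw [mul_sum]
        exact sum_comm
      rw [h13, h14]
      ring

end Vertex

section Trig

open MvPolynomial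

variable {K : Type*} [CommRing K]

/-- `a ^ k - a ^ (-k)`. -/
def sg (a : Kˣ) (k : ℤ) : K := ((a ^ k : Kˣ) : K) - ((a ^ (-k) : Kˣ) : K)

/-- `a ^ k + a ^ (-k)`. -/
def cs (a : Kˣ) (k : ℤ) : K := ((a ^ k : Kˣ) : K) + ((a ^ (-k) : Kˣ) : K)

@[simp] lemma sg_zero (a : Kˣ) : sg a 0 = 0 := by simp [sg]

lemma zpow_mul_neg (a : Kˣ) (k : ℤ) : ((a ^ k : Kˣ) : K) * ((a ^ (-k) : Kˣ) : K) = 1 := by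
  rw [← Units.val_mul, ← zpow_add]; simp

lemma two_mul_sg_add (a : Kˣ) (k l : ℤ) :
    2 * sg a (k + l) = sg a k * cs a l + cs a k * sg a l := by
  simp only [sg, cs, neg_add, zpow_add, Units.val_mul]
  ring

lemma two_mul_sg_sub (a : Kˣ) (k l : ℤ) :
    2 * sg a (k - l) = sg a k * cs a l - cs a k * sg a l := by
  rw [sub_eq_add_neg, two_mul_sg_add]
  simp only [sg, cs, neg_neg]
  ring

lemma sg_neg (a : Kˣ) (k : ℤ) : sg a (-k) = - sg a k := by
  simp only [sg, neg_neg]; ring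

lemma sg_one_mul_sum_zpow (a : Kˣ) (n : ℕ) :
    sg a 1 * ∑ x ∈ antidiagonal n, ((a ^ ((x.1 : ℤ) - x.2) : Kˣ) : K)
      = sg a (n + 1) := by
  induction n with
  | zero => simp
  | succ n ih =>
    rw [Finset.Nat.sum_antidiagonal_succ']
    have : ∀ x : ℕ × ℕ, ((a ^ ((x.1 : ℤ) - ((x.2 + 1 : ℕ) : ℤ)) : Kˣ) : K)
        = ((a ^ (-1 : ℤ) : Kˣ) : K) * ((a ^ ((x.1 : ℤ) - x.2) : Kˣ) : K) := by
      intro x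
      rw [← Units.val_mul, ← zpow_add]; congr 2; push_cast; ring
    simp_rw [this]
    rw [← mul_sum, mul_add, mul_left_comm, ih]
    have h := zpow_mul_neg a 1
    simp only [sg, neg_add, zpow_add, Units.val_mul, Nat.cast_add, Nat.cast_one, Nat.cast_zero,
      sub_zero] at h ⊢
    linear_combination 0 * h

/-- The discrete Dirichlet kernel identity. -/
lemma sg_one_mul_conv (a : Kˣ) (n : ℕ) :
    sg a 1 * ∑ x ∈ antidiagonal n, sg a x.1 * sg a x.2
      = n * sg a 1 * cs a n - cs a 1 * sg a n := by
  have h1 : ∀ x ∈ antidiagonal n, sg a x.1 * sg a x.2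
      = cs a n - ((a ^ ((x.1 : ℤ) - x.2) : Kˣ) : K) - ((a ^ ((x.2 : ℤ) - x.1) : Kˣ) : K) := by
    intro x hx
    rw [mem_antidiagonal] at hx
    rw [← hx]
    simp only [sg, cs, Nat.cast_add, neg_add, sub_eq_add_neg, zpow_add, Units.val_mul]
    ring
  have h2 := sg_one_mul_sum_zpow a n
  have h3 : ∑ x ∈ antidiagonal n, ((a ^ ((x.2 : ℤ) - x.1) : Kˣ) : K)
      = ∑ x ∈ antidiagonal n, ((a ^ ((x.1 : ℤ) - x.2) : Kˣ) : K) :=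
    Finset.Nat.sum_antidiagonal_swap (f := fun x : ℕ × ℕ => ((a ^ ((x.1 : ℤ) - x.2) : Kˣ) : K))
  rw [sum_congr rfl h1, sum_sub_distrib, sum_sub_distrib, h3]
  simp only [sum_const, Finset.Nat.card_antidiagonal, nsmul_eq_mul, mul_sub, h2]
  have := two_mul_sg_add a n 1
  push_cast
  linear_combination - this

end Trig

section CoeffDer

open MvPolynomial

variable {K : Type*} [CommRing K]

/-- A derivation of the coefficients acting coefficientwise on polynomials. -/
def coeffDer (D : Derivation ℤ K K) (g : Fock K) : Fock K :=
  ∑ m ∈ g.support, monomial m (D (coeff m g))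

lemma coeff_coeffDer (D : Derivation ℤ K K) (g : Fock K) (m : ℕ →₀ ℕ) :
    coeff m (coeffDer D g) = D (coeff m g) := by
  classical
  rw [coeffDer, coeff_sum]
  simp only [coeff_monomial]
  rw [sum_ite_eq' g.support m]
  split_ifs with h
  · rfl
  · rw [notMem_support_iff.1 h, map_zero]

variable (D : Derivation ℤ K K)

lemma coeffDer_add (f g : Fock K) : coeffDer D (f + g) = coeffDer D f + coeffDer D g := by
  ext m; simp [coeff_coeffDer]

@[simp] lemma coeffDer_zero : coeffDer D 0 = 0 := by ext m; simp [coeff_coeffDer]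

lemma coeffDer_one : coeffDer D 1 = 0 := by
  ext m
  classical
  rw [coeff_coeffDer, coeff_one]
  split_ifs <;> simp

lemma coeffDer_C_mul (a : K) (g : Fock K) :
    coeffDer D (C a * g) = C (D a) * g + C a * coeffDer D g := by
  ext m
  simp [coeff_coeffDer, coeff_C_mul]
  ring

lemma coeffDer_pw_mul (k : ℕ) (g : Fock K) :
    coeffDer D (pw k * g) = pw k * coeffDer D g := by
  cases k with
  | zero => simp
  | succ k =>
    ext m
    rw [pw_succ, coeff_coeffDer, coeff_X_mul', coeff_X_mul', coeff_coeffDer]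
    split_ifs <;> simp

lemma coeffDer_sum {ι : Type*} (s : Finset ι) (f : ι → Fock K) :
    coeffDer D (∑ i ∈ s, f i) = ∑ i ∈ s, coeffDer D (f i) := by
  classical
  induction s using Finset.induction_on with
  | empty => simp
  | insert a s ha ih => rw [sum_insert ha, sum_insert ha, coeffDer_add, ih]

lemma coeffDer_intCast_mul (n : ℤ) (g : Fock K) :
    coeffDer D ((n : Fock K) * g) = (n : Fock K) * coeffDer D g := by
  have := coeffDer_C_mul D (n : K) g
  simpa using this

end CoeffDer

section Evolution

open MvPolynomial

variable {K : Type*} [CommRing K] [Algebra ℚ K] {D : Derivation ℤ K K} {a : Kˣ}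

omit [Algebra ℚ K] in
lemma derivation_zpow (ha : D (a : K) = a) (k : ℤ) :
    D ((a ^ k : Kˣ) : K) = (k : K) * ((a ^ k : Kˣ) : K) := by
  have step : ∀ k : ℤ, D ((a ^ (k + 1) : Kˣ) : K)
      = ((a ^ k : Kˣ) : K) * a + a * D ((a ^ k : Kˣ) : K) := by
    intro k
    rw [zpow_add_one, Units.val_mul, Derivation.leibniz, ha, smul_eq_mul, smul_eq_mul]
  induction k using Int.induction_on with
  | zero => simp
  | succ i ih =>
    rw [step, ih, zpow_add_one, Units.val_mul]
    push_cast
    ring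
  | pred i ih =>
    have h := step (-(i : ℤ) - 1)
    rw [sub_add_cancel, ih] at h
    have h2 : ((a ^ (-(i : ℤ)) : Kˣ) : K) = ((a ^ (-(i : ℤ) - 1) : Kˣ) : K) * a := by
      rw [← Units.val_mul, ← zpow_add_one, sub_add_cancel]
    rw [h2] at h
    refine a.isUnit.mul_left_cancel ?_
    push_cast at h ⊢
    linear_combination - h

omit [Algebra ℚ K] in
lemma derivation_sg (ha : D (a : K) = a) (k : ℤ) : D (sg a k) = (k : K) * cs a k := by
  rw [sg, map_sub, derivation_zpow ha, derivation_zpow ha, cs]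
  push_cast
  ring

/-- Derivative of `h_s` with respect to the coefficients. -/
lemma coeffDer_homog (ha : D (a : K) = a) (s : ℤ) {N : ℕ} (hN : s < N) :
    coeffDer D (homog (fun k => sg a k) s)
      = ∑ j ∈ range N, C (cs a j) * pw j * homog (fun k => sg a k) (s - j) := by
  induction s using int_induction generalizing N with
  | h s ih =>
    set e : ℕ → K := fun k => sg a k with he
    rcases lt_trichotomy s 0 with h | h | h
    · rw [homog_of_neg _ h, coeffDer_zero]
      exact (sum_eq_zero fun j _ => by rw [homog_of_neg _ (by omega), mul_zero]).symm
    · subst h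
      rw [homog_zero, coeffDer_one]
      refine (sum_eq_zero fun j _ => ?_).symm
      rcases Nat.eq_zero_or_pos j with rfl | hj
      · simp
      · rw [homog_of_neg _ (by omega), mul_zero]
    · refine intCast_mul_cancel h.ne' ?_
      have h2 : ∀ j ∈ range N, coeffDer D (C (e j) * pw j * homog e (s - j))
          = C (cs a j) * ((j : Fock K) * pw j) * homog e (s - j)
            + ∑ i ∈ range N,
              C (e j) * pw j * (C (cs a i) * pw i * homog e (s - j - i)) := by
        intro j _
        rw [← mul_sum]
        rcases Nat.eq_zero_or_pos j with rfl | hj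
        · simp
        · rw [← ih (s - j) (by omega) h.le (by omega), mul_assoc, coeffDer_C_mul, coeffDer_pw_mul,
            he]
          simp only [derivation_sg ha, map_mul]
          simp
          ring
      have h3 : ∀ j ∈ range N, (s : Fock K) * (C (cs a j) * pw j * homog e (s - j))
          = C (cs a j) * ((j : Fock K) * pw j) * homog e (s - j)
            + ∑ i ∈ range N,
              C (e i) * pw i * (C (cs a j) * pw j * homog e (s - i - j)) := by
        intro j _
        have h4 := mul_homog e (s := s - j) (N := N) (by omega)
        have h5 : ∑ i ∈ range N, C (e i) * pw i * (C (cs a j) * pw j *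
            homog e (s - i - j)) = C (cs a j) * pw j * (((s - j : ℤ) : Fock K) * homog e (s - j)) := by
          rw [h4, mul_sum]
          refine sum_congr rfl fun i _ => ?_
          rw [sub_right_comm]; ring
        rw [h5]; push_cast; ring
      rw [← coeffDer_intCast_mul, mul_homog e hN, coeffDer_sum, sum_congr rfl h2,
        mul_sum,
        sum_congr rfl h3, sum_add_distrib, sum_add_distrib,
        sum_comm (s := range N) (t := range N)]

lemma vertex_quad (e : ℕ → K) (he : e 0 = 0) (s : ℤ) (k : ℕ) :
    vertex e s (quad k) = quad k * homog e s
      + 2 * ∑ x ∈ antidiagonal k,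
          C (e x.1) * pw x.2 * homog e (s + x.1)
      + C (∑ x ∈ antidiagonal k, e x.1 * e x.2) * homog e (s + k) := by
  have h1 : ∀ x ∈ antidiagonal k, vertex e s (pw x.1 * pw x.2)
      = pw x.1 * pw x.2 * homog e s + C (e x.2) * pw x.1 * homog e (s + x.2)
        + C (e x.1) * pw x.2 * homog e (s + x.1) + C (e x.1 * e x.2) * homog e (s + k) := by
    intro x hx
    rw [mem_antidiagonal] at hx
    rw [← mul_one (pw x.2), vertex_pw_mul e he, vertex_pw_mul e he, vertex_pw_mul e he,
      vertex_one, vertex_one, vertex_one, vertex_one, ← hx, map_mul]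
    push_cast
    rw [add_assoc s]
    ring
  rw [quad, map_sum, sum_congr rfl h1, sum_add_distrib, sum_add_distrib,
    sum_add_distrib, map_sum, sum_mul, sum_mul]
  have h2 : ∑ x ∈ antidiagonal k, C (e x.2) * pw x.1 * homog e (s + x.2)
      = ∑ x ∈ antidiagonal k, C (e x.1) * pw x.2 * homog e (s + x.1) :=
    Finset.Nat.sum_antidiagonal_swap (f := fun x : ℕ × ℕ => C (e x.1) * pw x.2 * homog e (s + x.1))
  rw [h2]
  ring

lemma vertex_coeffDer_C_mul (e : ℕ → K) (s : ℤ) (b : K) (g : Fock K) :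
    coeffDer D (vertex e s (C b * g)) - vertex e s (coeffDer D (C b * g))
      = C b * (coeffDer D (vertex e s g) - vertex e s (coeffDer D g)) := by
  rw [vertex_C_mul, coeffDer_C_mul, coeffDer_C_mul, map_add, vertex_C_mul, vertex_C_mul]
  ring

lemma vertex_coeffDer_pw_mul (ha : D (a : K) = a) (s : ℤ) (k : ℕ) (g : Fock K) :
    coeffDer D (vertex (fun k => sg a k) s (pw k * g))
        - vertex (fun k => sg a k) s (coeffDer D (pw k * g))
      = pw k * (coeffDer D (vertex (fun k => sg a k) s g)
          - vertex (fun k => sg a k) s (coeffDer D g))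
        + C (sg a k) * (coeffDer D (vertex (fun k => sg a k) (s + k) g)
          - vertex (fun k => sg a k) (s + k) (coeffDer D g))
        + (k : Fock K) * C (cs a k) * vertex (fun k => sg a k) (s + k) g := by
  rw [coeffDer_pw_mul, vertex_pw_mul _ (by simp), vertex_pw_mul _ (by simp), coeffDer_add,
    coeffDer_pw_mul, coeffDer_C_mul, derivation_sg ha]
  simp only [map_mul, Int.cast_natCast]
  rw [map_natCast C]
  ring

omit [Algebra ℚ K] in
lemma map_C_mul (T : Fock K →ₗ[K] Fock K) (b : K) (g : Fock K) : T (C b * g) = C b * T g := by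
  rw [← smul_eq_C_mul, map_smul, smul_eq_C_mul]

lemma sum_sg_split (a : Kˣ) (k N : ℕ) (s : ℤ) :
    ∑ j ∈ range (k + N), C (sg a (k - j)) * pw j * homog (fun k => sg a k) (s + k - j)
      = ∑ x ∈ antidiagonal k,
          C (sg a x.1) * pw x.2 * homog (fun k => sg a k) (s + x.1)
        - ∑ j ∈ range N, C (sg a j) * pw (k + j) * homog (fun k => sg a k) (s - j) := by
  rw [sum_range_add, sub_eq_add_neg, ← sum_neg_distrib]
  congr 1
  · rw [← Finset.Nat.sum_antidiagonal_swap, Finset.Nat.sum_antidiagonal_eq_sum_range_succ_mk,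
      sum_range_succ]
    simp only [Prod.swap, Nat.sub_self, Nat.cast_zero, sg_zero, map_zero, zero_mul, add_zero]
    refine sum_congr rfl fun j hj => ?_
    rw [mem_range] at hj
    rw [Nat.cast_sub hj.le, add_sub_assoc]
  · refine sum_congr rfl fun j _ => ?_
    push_cast
    rw [show (k : ℤ) - (k + j) = -(j : ℤ) by ring, sg_neg, show s + k - (k + j : ℤ) = s - j by ring]
    simp

lemma stepOp_vertex (ha : D (a : K) = a) (k : ℕ) (s : ℤ) (g : Fock K) :
    C (sg a 1) * (stepOp k (vertex (fun k => sg a k) s g)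
        - vertex (fun k => sg a k) s (stepOp k g))
      + C (sg a k * sg a 1) * (coeffDer D (vertex (fun k => sg a k) (s + k) g)
        - vertex (fun k => sg a k) (s + k) (coeffDer D g))
      - C (cs a 1 * sg a k) * vertex (fun k => sg a k) (s + k) g
      - (s : Fock K) * C (sg a 1 * cs a k) * vertex (fun k => sg a k) (s + k) g = 0 := by
  induction g using pw_induction generalizing s with
  | h1 =>
    obtain ⟨N, hN⟩ : ∃ N : ℕ, s < N := ⟨(s + 1).toNat, by omega⟩
    have hq : stepOp k (1 : Fock K) = quad k := by rw [stepOp_apply]; simp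
    rw [hq, stepOp_apply, coeffDer_one, map_zero, sub_zero, vertex_one, vertex_one,
      vertex_quad _ (by simp), shiftDer_homog _ (by simp) k s hN,
      coeffDer_homog ha (s + k) (N := k + N) (by push_cast; omega)]
    have h1 := mul_homog (fun k => sg a k) (s := s + k) (N := k + N) (by push_cast; omega)
    have h2 := congrArg (C (σ := ℕ)) (sg_one_mul_conv a k)
    have h3 := sum_sg_split a k N s
    have h4 : C (sg a k) * ∑ j ∈ range (k + N),
          C (cs a j) * pw j * homog (fun k => sg a k) (s + k - j)
        - C (cs a k) * ∑ j ∈ range (k + N),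
          C (sg a j) * pw j * homog (fun k => sg a k) (s + k - j)
        = 2 * ∑ j ∈ range (k + N),
          C (sg a (k - j)) * pw j * homog (fun k => sg a k) (s + k - j) := by
      rw [mul_sum, mul_sum, mul_sum, ← sum_sub_distrib]
      refine sum_congr rfl fun j _ => ?_
      have h := congrArg (C (σ := ℕ)) (two_mul_sg_sub a k j)
      simp only [map_mul, map_sub, map_ofNat C 2] at h
      linear_combination - pw j * homog (fun k => sg a k) (s + k - j) * h
    simp only [map_mul, map_sub, map_natCast] at h1 h2 h4 ⊢
    push_cast at h1
    rw [h3] at h4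
    linear_combination C (sg a 1) * h4 - homog (fun k => sg a k) (s + k) * h2
      - C (sg a 1) * C (cs a k) * h1
  | hC b g hg =>
    have h := hg s
    rw [vertex_coeffDer_C_mul, vertex_C_mul, vertex_C_mul, map_C_mul, map_C_mul, vertex_C_mul]
    linear_combination (C b : Fock K) * h
  | hadd f g hf hg =>
    have h1 := hf s
    have h2 := hg s
    simp only [map_add, coeffDer_add]
    linear_combination h1 + h2
  | hp l g hg =>
    have h1 := hg s
    have h2 := hg (s + l)
    have h3 := congrArg (C (σ := ℕ)) (two_mul_sg_add a k l)
    rw [vertex_coeffDer_pw_mul ha, vertex_pw_mul _ (by simp), vertex_pw_mul _ (by simp), map_add,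
      stepOp_pw_mul, stepOp_pw_mul, map_add, vertex_pw_mul _ (by simp), map_C_mul]
    have h4 : vertex (fun k => sg a k) s (2 * (l : Fock K) * pw (k + l) * g)
        = 2 * (l : Fock K) * (pw (k + l) * vertex (fun k => sg a k) s g
          + C (sg a (k + l)) * vertex (fun k => sg a k) (s + l + k) g) := by
      have : (2 * (l : Fock K) * pw (k + l) * g) = C (2 * (l : K)) * (pw (k + l) * g) := by
        simp [map_ofNat C 2]; ring
      rw [this, vertex_C_mul, vertex_pw_mul _ (by simp)]
      push_cast
      rw [show s + (k + l : ℤ) = s + l + k by ring]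
      simp [map_ofNat C 2]
    rw [h4]
    simp only [map_mul, map_add] at *
    rw [show s + (k : ℤ) + l = s + l + k by ring]
    rw [map_ofNat C 2] at h3
    push_cast at h2
    linear_combination pw l * h1 + C (sg a l) * h2 - (l : Fock K) * C (sg a 1) *
      vertex (fun k => sg a k) (s + l + k) g * h3

end Evolution

section Intertwine

open MvPolynomial

variable {K : Type*} [CommRing K] [Algebra ℚ K] {D : Derivation ℤ K K} {a : Kˣ}

lemma cutJoin_homog_sg (ha : D (a : K) = a) (s : ℤ) :
    C (sg a 1) * cutJoin (homog (fun k => sg a k) s)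
      - (s : Fock K) * (C (sg a 1) * coeffDer D (homog (fun k => sg a k) s)
        - C (cs a 1) * homog (fun k => sg a k) s) = 0 := by
  obtain ⟨N, hN⟩ : ∃ N : ℕ, s < N := ⟨(s + 1).toNat, by omega⟩
  set H : ℤ → Fock K := homog (fun k => sg a k) with hH
  have h1 : (s : Fock K) * coeffDer D (H s)
      = ∑ j ∈ range N, ∑ i ∈ range N,
          C (cs a j * sg a i) * pw j * pw i * H (s - j - i)
        + ∑ j ∈ range N, C ((j : K) * cs a j) * pw j * H (s - j) := by
    rw [hH, coeffDer_homog ha s hN, mul_sum, ← sum_add_distrib, ← hH]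
    refine sum_congr rfl fun j _ => ?_
    have h := mul_homog (fun k => sg a k) (s := s - j) (N := N) (by omega)
    rw [← hH] at h
    have h' : (s : Fock K) * (C (cs a j) * pw j * H (s - j))
        = C (cs a j) * pw j * (((s - j : ℤ) : Fock K) * H (s - j))
          + C ((j : K) * cs a j) * pw j * H (s - j) := by
      rw [map_mul, map_natCast]; push_cast; ring
    rw [h', h, mul_sum]
    congr 1
    refine sum_congr rfl fun i _ => ?_
    rw [map_mul]; ring
  have h2 : (2 : Fock K) * ∑ j ∈ range N, ∑ i ∈ range N,
          C (cs a j * sg a i) * pw j * pw i * H (s - j - i)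
      = 2 * ∑ i ∈ range N, ∑ j ∈ range N,
          C (sg a ((i + j : ℕ) : ℤ)) * pw i * pw j * H (s - i - j) := by
    rw [two_mul]
    nth_rewrite 1 [sum_comm]
    rw [← sum_add_distrib, mul_sum]
    refine sum_congr rfl fun i _ => ?_
    rw [← sum_add_distrib, mul_sum]
    refine sum_congr rfl fun j _ => ?_
    have h := congrArg (C (σ := ℕ)) (two_mul_sg_add a i j)
    rw [map_mul, map_add, map_ofNat C 2] at h
    push_cast
    rw [sub_right_comm s j i, mul_comm (cs a j)]
    linear_combination - pw i * pw j * H (s - i - j) * h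
  have h3 := mul_homog (fun k => sg a k) hN
  have h4 : C (sg a 1) * ∑ n ∈ range N,
        C (∑ x ∈ antidiagonal n, sg a x.1 * sg a x.2) * pw n * H (s - n)
      = C (sg a 1) * ∑ j ∈ range N, C ((j : K) * cs a j) * pw j * H (s - j)
        - C (cs a 1) * ∑ k ∈ range N, C (sg a k) * pw k * H (s - k) := by
    rw [mul_sum, mul_sum, mul_sum, ← sum_sub_distrib]
    refine sum_congr rfl fun n _ => ?_
    have h := congrArg (C (σ := ℕ)) (sg_one_mul_conv a n)
    simp only [map_mul, map_sub] at h ⊢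
    linear_combination pw n * H (s - n) * h
  have h5 := cutJoin_homog (fun k => sg a k) s (by simp) hN
  rw [← hH] at h3 h5
  rw [h5]
  refine intCast_mul_cancel (s := 2) two_ne_zero ?_
  rw [Int.cast_ofNat]
  linear_combination 2 * h4 - 2 * C (sg a 1) * h1 - C (sg a 1) * h2 + 2 * C (cs a 1) * h3

/-- The operator `cutJoin - D` intertwines with the vertex operators. -/
lemma cutJoin_vertex (ha : D (a : K) = a) (s : ℤ) (g : Fock K) :
    C (sg a 1) * (cutJoin (vertex (fun k => sg a k) s g)
        - vertex (fun k => sg a k) s (cutJoin g))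
      - (s : Fock K) * (C (sg a 1) * (coeffDer D (vertex (fun k => sg a k) s g)
          - vertex (fun k => sg a k) s (coeffDer D g))
        - C (cs a 1) * vertex (fun k => sg a k) s g) = 0 := by
  induction g using pw_induction generalizing s with
  | h1 =>
    have := cutJoin_homog_sg ha s
    rw [cutJoin_one, coeffDer_one, map_zero, vertex_one, sub_zero, sub_zero]
    exact this
  | hC b g hg =>
    have h := hg s
    rw [vertex_coeffDer_C_mul, vertex_C_mul, map_C_mul, map_C_mul, vertex_C_mul]
    linear_combination (C b : Fock K) * h
  | hadd f g hf hg =>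
    have h1 := hf s
    have h2 := hg s
    simp only [map_add, coeffDer_add]
    linear_combination h1 + h2
  | hp k g hg =>
    have h1 := hg s
    have h2 := hg (s + k)
    have h3 := stepOp_vertex ha k s g
    rw [vertex_coeffDer_pw_mul ha, vertex_pw_mul _ (by simp), map_add, cutJoin_pw_mul,
      cutJoin_pw_mul, map_add, map_C_mul, vertex_pw_mul _ (by simp)]
    have h4 : vertex (fun k => sg a k) s ((k : Fock K) * stepOp k g)
        = (k : Fock K) * vertex (fun k => sg a k) s (stepOp k g) := by
      have := vertex_C_mul (fun k => sg a k) s (k : K) (stepOp k g)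
      rwa [map_natCast] at this
    rw [h4]
    simp only [map_mul] at h3
    push_cast at h2
    linear_combination pw k * h1 + C (sg a k) * h2 + (k : Fock K) * h3

end Intertwine

section CoeffMap

open MvPolynomial

/-- Applying an additive map to all coefficients of a polynomial. -/
def coeffMap {A B : Type*} [CommRing A] [CommRing B] (φ : A →+ B) (g : Fock A) :
    Fock B :=
  ∑ m ∈ g.support, monomial m (φ (coeff m g))

variable {A B : Type*} [CommRing A] [CommRing B] (φ : A →+ B)

lemma coeff_coeffMap (g : Fock A) (m : ℕ →₀ ℕ) : coeff m (coeffMap φ g) = φ (coeff m g) := by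
  classical
  rw [coeffMap, coeff_sum]
  simp only [coeff_monomial]
  rw [sum_ite_eq' g.support m]
  split_ifs with h
  · rfl
  · rw [notMem_support_iff.1 h, map_zero]

lemma coeffMap_add (f g : Fock A) : coeffMap φ (f + g) = coeffMap φ f + coeffMap φ g := by
  ext m; simp [coeff_coeffMap]

lemma coeffMap_zero : coeffMap φ 0 = 0 := by ext m; simp [coeff_coeffMap]

lemma coeffMap_C (b : A) : coeffMap φ (C b) = C (φ b) := by
  ext m
  classical
  rw [coeff_coeffMap, coeff_C, coeff_C]
  split_ifs <;> simp

lemma coeffMap_pw_mul (k : ℕ) (g : Fock A) : coeffMap φ (pw k * g) = pw k * coeffMap φ g := by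
  cases k with
  | zero => simp [coeffMap_zero]
  | succ k =>
    ext m
    rw [pw_succ, pw_succ, coeff_coeffMap, coeff_X_mul', coeff_X_mul', coeff_coeffMap]
    split_ifs <;> simp

lemma coeffMap_sum {ι : Type*} (s : Finset ι) (f : ι → Fock A) :
    coeffMap φ (∑ i ∈ s, f i) = ∑ i ∈ s, coeffMap φ (f i) := by
  classical
  induction s using Finset.induction_on with
  | empty => simp [coeffMap_zero]
  | insert a s ha ih => rw [sum_insert ha, sum_insert ha, coeffMap_add, ih]

lemma coeffMap_natCast_mul (n : ℕ) (g : Fock A) :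
    coeffMap φ ((n : Fock A) * g) = (n : Fock B) * coeffMap φ g := by
  induction n with
  | zero => simp [coeffMap_zero]
  | succ n ih => rw [Nat.cast_succ, Nat.cast_succ, add_mul, add_mul, coeffMap_add, ih, one_mul, one_mul]

lemma pw_induction_C {M : Fock A → Prop} (g : Fock A)
    (hC : ∀ a, M (C a)) (hadd : ∀ f g, M f → M g → M (f + g))
    (hp : ∀ k g, M g → M (pw k * g)) : M g := by
  induction g using MvPolynomial.induction_on with
  | C a => exact hC a
  | add f g hf hg => exact hadd f g hf hg
  | mul_X f i hf => rw [mul_comm]; exact hp (i + 1) f hf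

omit [CommRing B] in
lemma stepOp_C (k : ℕ) (b : A) : stepOp k (C b : Fock A) = quad k * C b := by
  rw [stepOp_apply, derivation_C]; simp

omit [CommRing B] in
lemma cutJoin_C (b : A) : cutJoin (C b : Fock A) = 0 := by
  rw [← mul_one (C b), ← smul_eq_C_mul, map_smul, cutJoin_one, smul_zero]

lemma coeffMap_stepOp (k : ℕ) (g : Fock A) :
    coeffMap φ (stepOp k g) = stepOp k (coeffMap φ g) := by
  induction g using pw_induction_C with
  | hC b =>
    rw [stepOp_C, coeffMap_C, stepOp_C, quad, quad, sum_mul, sum_mul, coeffMap_sum]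
    refine sum_congr rfl fun x _ => ?_
    rw [mul_assoc, coeffMap_pw_mul, coeffMap_pw_mul, coeffMap_C, mul_assoc]
  | hadd f g hf hg => rw [map_add, coeffMap_add, hf, hg, coeffMap_add, map_add]
  | hp l g hg =>
    have h2 : (2 : Fock A) * (l : Fock A) * pw (k + l) * g = ((2 * l : ℕ) : Fock A) * (pw (k + l) * g) := by
      push_cast; ring
    rw [stepOp_pw_mul, coeffMap_add, coeffMap_pw_mul, coeffMap_pw_mul, stepOp_pw_mul, hg, h2,
      coeffMap_natCast_mul, coeffMap_pw_mul]
    push_cast; ring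

lemma coeffMap_cutJoin (g : Fock A) : coeffMap φ (cutJoin g) = cutJoin (coeffMap φ g) := by
  induction g using pw_induction_C with
  | hC b =>
    rw [cutJoin_C, coeffMap_C, cutJoin_C, coeffMap_zero]
  | hadd f g hf hg => rw [map_add, coeffMap_add, hf, hg, coeffMap_add, map_add]
  | hp l g hg =>
    rw [cutJoin_pw_mul, coeffMap_add, coeffMap_pw_mul, coeffMap_pw_mul, cutJoin_pw_mul, hg,
      coeffMap_natCast_mul, coeffMap_stepOp]

end CoeffMap

section Level

open MvPolynomial

variable {K : Type*} [CommRing K]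

/-- The evaluation `p_1 ↦ 1`, `p_k ↦ 0` for `k ≥ 2`. -/
def levelOne : Fock K →ₐ[K] K := aeval fun k => if k = 0 then 1 else 0

lemma levelOne_pw (k : ℕ) : levelOne (pw k : Fock K) = if k = 1 then 1 else 0 := by
  cases k with
  | zero => simp
  | succ k => simp [pw_succ, levelOne]

lemma levelOne_C (b : K) : levelOne (C b) = b := by simp [levelOne]

lemma levelOne_coeffMap {B : Type*} [CommRing B] (φ : K →+ B) (g : Fock K) :
    levelOne (coeffMap φ g) = φ (levelOne g) := by
  induction g using pw_induction_C with
  | hC b => rw [coeffMap_C, levelOne_C, levelOne_C]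
  | hadd f g hf hg => rw [map_add, coeffMap_add, map_add, map_add, hf, hg]
  | hp l g hg =>
    rw [coeffMap_pw_mul, map_mul, map_mul, hg, levelOne_pw, levelOne_pw]
    split_ifs <;> simp

lemma factorial_mul_levelOne_homog [Algebra ℚ K] (e : ℕ → K) (n : ℕ) :
    (n.factorial : K) * levelOne (homog e n) = e 1 ^ n := by
  induction n with
  | zero => simp
  | succ n ih =>
    have h := congrArg levelOne (mul_homog e (s := ((n + 1 : ℕ) : ℤ)) (N := n + 2)
      (by push_cast; omega))
    rw [map_sum, sum_eq_single 1] at h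
    · rw [map_mul, map_mul, map_mul, levelOne_C, levelOne_pw, if_pos rfl, mul_one, map_intCast,
        show (((n + 1 : ℕ) : ℤ) - ((1 : ℕ) : ℤ)) = n by push_cast; ring] at h
      rw [Nat.factorial_succ, pow_succ, ← ih]
      push_cast at h ⊢
      linear_combination (n.factorial : K) * h
    · intro b _ hb
      rw [map_mul, map_mul, levelOne_pw, if_neg hb]; simp
    · intro hb
      exact absurd (mem_range.2 (by omega)) hb

/-- The derivation `l ∂ / ∂ p_l`. -/
def lowerDer (l : ℕ) : Derivation K (Fock K) (Fock K) :=
  mkDerivation K fun j => if j + 1 = l then (l : Fock K) else 0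

lemma lowerDer_pw (l k : ℕ) :
    lowerDer l (pw k : Fock K) = if k = l then (l : Fock K) else 0 := by
  cases k with
  | zero => by_cases h : l = 0 <;> simp [h, eq_comm]

  | succ k => simp [pw_succ, lowerDer, mkDerivation_X]

/-- The bosonic operator: multiplication by `p_s` for `s > 0` and `l ∂ / ∂ p_l` for `s = -l`. -/
def alphaOp (s : ℤ) (g : Fock K) : Fock K :=
  pw s.toNat * g + lowerDer (-s).toNat g

lemma alphaOp_add (s : ℤ) (f g : Fock K) : alphaOp s (f + g) = alphaOp s f + alphaOp s g := by
  simp only [alphaOp, map_add]; ring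

lemma alphaOp_C {s : ℤ} (b : K) : alphaOp s (C b : Fock K) = pw s.toNat * C b := by
  rw [alphaOp, derivation_C, add_zero]

lemma alphaOp_pw_mul {s : ℤ} (k : ℕ) (g : Fock K) :
    alphaOp s (pw k * g) = pw k * alphaOp s g + (if s + k = 0 then (k : Fock K) else 0) * g := by
  simp only [alphaOp, Derivation.leibniz, lowerDer_pw, smul_eq_mul]
  by_cases h : s + k = 0
  · rw [if_pos h, if_pos (by omega), show (-s).toNat = k by omega]; ring
  · rcases lt_or_ge s 0 with hs | hs
    · rw [if_neg h, if_neg (by omega)]; ring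
    · rw [if_neg h, show (-s).toNat = 0 by omega]
      by_cases hk : k = 0
      · subst hk; simp
      · rw [if_neg hk]; ring

end Level

section Exp

open MvPolynomial

/-- The power series `exp (q u)`. -/
def ex (q : ℚ) : ℚ⟦X⟧ := rescale q (PowerSeries.exp ℚ)

lemma ex_mul (q r : ℚ) : ex q * ex r = ex (q + r) := PowerSeries.exp_mul_exp_eq_exp_add q r

lemma ex_zero : ex 0 = 1 := by simp [ex, PowerSeries.rescale_zero]

lemma coeff_ex (q : ℚ) (n : ℕ) : PowerSeries.coeff n (ex q) = q ^ n / n.factorial := by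
  rw [ex, coeff_rescale, PowerSeries.coeff_exp]
  simp [div_eq_mul_inv]

/-- The exponential `exp (q u)` as a homomorphism in `q`. -/
def exHom : Multiplicative ℚ →* ℚ⟦X⟧ where
  toFun q := ex q.toAdd
  map_one' := ex_zero
  map_mul' q r := (ex_mul q.toAdd r.toAdd).symm

/-- The power series `exp (q u)` as a unit. -/
def expU (q : ℚ) : ℚ⟦X⟧ˣ := exHom.toHomUnits (Multiplicative.ofAdd q)

lemma val_expU (q : ℚ) : (expU q : ℚ⟦X⟧) = ex q := rfl

lemma expU_mul (q r : ℚ) : expU q * expU r = expU (q + r) := by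
  rw [expU, expU, expU, ofAdd_add, map_mul]

lemma expU_zpow (q : ℚ) (k : ℤ) : expU q ^ k = expU (k * q) := by
  rw [expU, expU, ← map_zpow, ← ofAdd_zsmul, zsmul_eq_mul]

/-- The power series `exp (w u / 2) - exp (- w u / 2)`. -/
def svar (w : ℚ) : ℚ⟦X⟧ := ex (w / 2) - ex (-(w / 2))

lemma sg_expU (w : ℚ) (k : ℤ) : sg (expU (w / 2)) k = svar (k * w) := by
  rw [sg, expU_zpow, expU_zpow, val_expU, val_expU, svar]
  push_cast
  rw [mul_div_assoc, neg_mul]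

lemma coeff_zero_svar (w : ℚ) : PowerSeries.coeff 0 (svar w) = 0 := by
  rw [svar, map_sub, coeff_ex, coeff_ex]; simp

lemma coeff_one_svar (w : ℚ) : PowerSeries.coeff 1 (svar w) = w := by
  rw [svar, map_sub, coeff_ex, coeff_ex]; simp

lemma svar_ne_zero {w : ℚ} (hw : w ≠ 0) : svar w ≠ 0 := fun h => hw <| by
  rw [← coeff_one_svar w, h, map_zero]

/-- A derivation over the integers from a map satisfying the Leibniz rule. -/
def intDer {K : Type*} [CommRing K] (f : K →+ K)
    (h : ∀ a b, f (a * b) = a * f b + b * f a) : Derivation ℤ K K :=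
  Derivation.mk' f.toIntLinearMap h

/-- The derivations of a commutative ring. -/
abbrev IntDer (K : Type*) [CommRing K] := Derivation ℤ K K

/-- The derivation `d / du` over the integers. -/
def ddu : IntDer ℚ⟦X⟧ :=
  intDer (PowerSeries.derivative ℚ).toLinearMap.toAddMonoidHom
    fun a b => (PowerSeries.derivative ℚ).leibniz a b

lemma coeff_ddu (f : ℚ⟦X⟧) (n : ℕ) :
    PowerSeries.coeff n (ddu f) = PowerSeries.coeff (n + 1) f * (n + 1) := by
  exact PowerSeries.coeff_derivative f n

lemma ddu_ex (q : ℚ) : ddu (ex q) = PowerSeries.C q * ex q := by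
  ext n
  rw [coeff_ddu, PowerSeries.coeff_C_mul, coeff_ex, coeff_ex, Nat.factorial_succ]
  have : (n.factorial : ℚ) ≠ 0 := by positivity
  push_cast
  field_simp
  try ring

end Exp

section ODE

open MvPolynomial

lemma vertex_ode {K : Type*} [CommRing K] [IsDomain K] [Algebra ℚ K] (E : Derivation ℤ K K)
    (a : Kˣ) {m : ℤ} (hm : m ≠ 0) (hE : 2 * E (a : K) = m * a) (hu : IsUnit ((m : K) * cs a 1))
    (hne : sg a 1 ≠ 0) {g : Fock K} (hg : cutJoin g = 2 * coeffDer E g) :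
    ∃ h, vertex (fun k => sg a k) m g = C (sg a 1) * h ∧ cutJoin h = 2 * coeffDer E h := by
  have hm' : (m : ℚ) ≠ 0 := by exact_mod_cast hm
  set c : K := algebraMap ℚ K (2 / m : ℚ) with hc
  set D : Derivation ℤ K K := c • E with hD
  have hmc : (m : K) * c = 2 := by
    rw [hc, ← map_intCast (algebraMap ℚ K) m, ← map_mul, mul_div_cancel₀ _ hm', map_ofNat]
  have ha : D (a : K) = a := by
    rw [hD, Derivation.smul_apply, smul_eq_mul]
    refine intCast_mul_cancel hm (intCast_mul_cancel (s := 2) two_ne_zero ?_)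
    push_cast
    linear_combination 2 * E (a : K) * hmc + 2 * hE
  have hDc : ∀ x : Fock K, coeffDer D x = C c * coeffDer E x := by
    intro x
    ext1 n
    rw [coeff_coeffDer, coeff_C_mul, coeff_coeffDer, hD, Derivation.smul_apply, smul_eq_mul]
  set ς : K := sg a 1 with hς
  have hdς : (m : K) * cs a 1 = 2 * E ς := by
    have := derivation_sg ha 1
    rw [← hς, hD, Derivation.smul_apply, smul_eq_mul, Int.cast_one, one_mul] at this
    rw [← this, ← mul_assoc, hmc]
  set Y := vertex (fun k => sg a k) m g with hY
  set b : K := 2 * E ς with hb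
  have h2 : vertex (fun k => sg a k) m (2 * coeffDer E g)
      = 2 * vertex (fun k => sg a k) m (coeffDer E g) := by
    rw [two_mul, map_add, two_mul]
  have hmC : (m : Fock K) * C c = 2 := by
    rw [← map_intCast (C (σ := ℕ) (R := K)) m, ← map_mul, hmc, map_ofNat C 2]
  have hmC' : (m : Fock K) * C (cs a 1) = C b := by
    rw [← map_intCast (C (σ := ℕ) (R := K)) m, ← map_mul, hdς]
  have key : C ς * (cutJoin Y - 2 * coeffDer E Y) + C b * Y = 0 := by
    have h := cutJoin_vertex ha m g
    rw [hDc, hDc, vertex_C_mul, hg, h2] at h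
    linear_combination h + C ς * (coeffDer E Y - vertex (fun k => sg a k) m (coeffDer E g)) * hmC
      - Y * hmC'
  rw [hdς] at hu
  obtain ⟨β, hβ⟩ := hu.exists_right_inv
  have hβC : (C b : Fock K) * C β = 1 := by rw [← map_mul, hβ, map_one]
  have hYh : Y = C ς * (C β * (2 * coeffDer E Y - cutJoin Y)) := by
    linear_combination C β * key - Y * hβC
  refine ⟨C β * (2 * coeffDer E Y - cutJoin Y), hYh, ?_⟩
  set h := C β * (2 * coeffDer E Y - cutJoin Y) with hh
  rw [hYh, map_C_mul, coeffDer_C_mul] at key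
  have hne' : (C ς : Fock K) ≠ 0 := by rwa [Ne, C_eq_zero]
  have hbC : (C b : Fock K) = 2 * C (E ς) := by
    rw [hb, map_mul, map_ofNat C 2]
  refine mul_left_cancel₀ (mul_ne_zero hne' hne') ?_
  rw [hbC] at key
  linear_combination key

/-- The vertex operator attached to an integer `m`. -/
def vx (m : ℤ) : Fock ℚ⟦X⟧ →ₗ[ℚ⟦X⟧] Fock ℚ⟦X⟧ :=
  vertex (fun k => sg (expU (m / 2)) k) m

lemma vx_ode {m : ℤ} (hm : m ≠ 0) {g : Fock ℚ⟦X⟧}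
    (hg : cutJoin g = 2 * coeffDer ddu g) :
    ∃ h, vx m g = C (svar m) * h ∧ cutJoin h = 2 * coeffDer ddu h := by
  have hς : sg (expU (m / 2 : ℚ)) 1 = svar m := by rw [sg_expU]; simp
  have := vertex_ode ddu (expU (m / 2)) hm ?_ ?_ ?_ hg
  · rwa [hς] at this
  · rw [val_expU, ddu_ex, ← map_intCast (PowerSeries.C (R := ℚ)) m,
      ← map_ofNat (PowerSeries.C (R := ℚ)) 2, ← mul_assoc, ← map_mul]
    congr 2
    ring
  · rw [PowerSeries.isUnit_iff_constantCoeff, cs, expU_zpow, expU_zpow, val_expU, val_expU,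
      ← PowerSeries.coeff_zero_eq_constantCoeff_apply, ← map_intCast (PowerSeries.C (R := ℚ)) m,
      PowerSeries.coeff_C_mul, map_add, coeff_ex, coeff_ex]
    simpa using hm
  · rw [hς]
    exact svar_ne_zero (by exact_mod_cast hm)

/-- Extraction of the coefficient of `u ^ d`. -/
def extract (d : ℕ) : Fock ℚ⟦X⟧ → Fock ℚ :=
  coeffMap (PowerSeries.coeff d).toAddMonoidHom

lemma extract_zero_C_mul (b : ℚ⟦X⟧) (g : Fock ℚ⟦X⟧) :
    extract 0 (C b * g) = C (PowerSeries.coeff 0 b) * extract 0 g := by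
  ext m
  simp [extract, coeff_coeffMap, coeff_C_mul]

lemma extract_one_C_mul (b : ℚ⟦X⟧) (g : Fock ℚ⟦X⟧)
    (hb : PowerSeries.coeff 0 b = 0) :
    extract 1 (C b * g) = C (PowerSeries.coeff 1 b) * extract 0 g := by
  ext m
  simp only [extract, coeff_coeffMap, coeff_C_mul, LinearMap.toAddMonoidHom_coe,
    PowerSeries.coeff_mul, Finset.Nat.antidiagonal_succ, Finset.Nat.antidiagonal_zero]
  simp at hb
  simp [hb]

lemma extract_coeffDer (d : ℕ) (g : Fock ℚ⟦X⟧) :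
    extract d (coeffDer ddu g) = ((d + 1 : ℕ) : Fock ℚ) * extract (d + 1) g := by
  ext m
  rw [← map_natCast (C (σ := ℕ)) (d + 1), coeff_C_mul, extract, extract, coeff_coeffMap,
    coeff_coeffMap, coeff_coeffDer]
  simp [coeff_ddu, mul_comm]

lemma extract_of_ode {g : Fock ℚ⟦X⟧} (hg : cutJoin g = 2 * coeffDer ddu g) (d : ℕ) :
    ((2 ^ d * d.factorial : ℕ) : Fock ℚ) * extract d g = (cutJoin ^ d) (extract 0 g) := by
  induction d with
  | zero => simp
  | succ d ih =>
    have h : cutJoin (extract d g) = 2 * ((d + 1 : ℕ) : Fock ℚ) * extract (d + 1) g := by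
      have h1 : extract d (2 * coeffDer ddu g) = 2 * extract d (coeffDer ddu g) := by
        exact_mod_cast coeffMap_natCast_mul (PowerSeries.coeff (R := ℚ) d).toAddMonoidHom 2
          (coeffDer ddu g)
      rw [extract, ← coeffMap_cutJoin, hg]
      change extract d (2 * coeffDer ddu g) = _
      rw [h1, extract_coeffDer, mul_assoc]
    rw [pow_succ' cutJoin, Module.End.mul_apply, ← ih, ← map_natCast (C (σ := ℕ) (R := ℚ)) (2 ^ d * _), map_C_mul, h,
      Nat.factorial_succ, map_natCast]
    push_cast
    ring

end ODE

section Leading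

open MvPolynomial

lemma extract_one_C_mul' (b : ℚ⟦X⟧) (g : Fock ℚ⟦X⟧) :
    extract 1 (C b * g) = C (PowerSeries.coeff 1 b) * extract 0 g
      + C (PowerSeries.coeff 0 b) * extract 1 g := by
  ext m
  simp only [extract, coeff_coeffMap, coeff_C_mul, LinearMap.toAddMonoidHom_coe, coeff_add,
    PowerSeries.coeff_mul, Finset.Nat.antidiagonal_succ, Finset.Nat.antidiagonal_zero]
  simp
  ring

lemma extract_add (d : ℕ) (f g : Fock ℚ⟦X⟧) :
    extract d (f + g) = extract d f + extract d g := coeffMap_add _ f g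

lemma extract_sum {ι : Type*} (d : ℕ) (s : Finset ι) (f : ι → Fock ℚ⟦X⟧) :
    extract d (∑ i ∈ s, f i) = ∑ i ∈ s, extract d (f i) := coeffMap_sum _ s f

lemma extract_pw_mul (d k : ℕ) (g : Fock ℚ⟦X⟧) :
    extract d (pw k * g) = pw k * extract d g := coeffMap_pw_mul _ k g

lemma extract_zero_one : extract 0 (1 : Fock ℚ⟦X⟧) = 1 := by
  rw [← C_1, extract, coeffMap_C]; simp

lemma extract_intCast_mul (d : ℕ) (n : ℤ) (g : Fock ℚ⟦X⟧) :
    extract d ((n : Fock ℚ⟦X⟧) * g) = (n : Fock ℚ) * extract d g := by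
  ext m
  rw [← map_intCast (C (σ := ℕ) (R := ℚ)), ← map_intCast (C (σ := ℕ) (R := ℚ⟦X⟧)),
    coeff_C_mul, extract, coeff_coeffMap, coeff_coeffMap, coeff_C_mul, ← zsmul_eq_mul,
    ← zsmul_eq_mul, map_zsmul]

/-- The function `k ↦ svar (k * w)`. -/
def ew (w : ℚ) (k : ℕ) : ℚ⟦X⟧ := sg (expU (w / 2)) k

lemma ew_eq (w : ℚ) (k : ℕ) : ew w k = svar (k * w) := by
  rw [ew, sg_expU]; simp

lemma ew_zero (w : ℚ) : ew w 0 = 0 := by simp [ew]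

lemma coeff_zero_ew (w : ℚ) (k : ℕ) : PowerSeries.coeff 0 (ew w k) = 0 := by
  rw [ew_eq, coeff_zero_svar]

lemma coeff_one_ew (w : ℚ) (k : ℕ) : PowerSeries.coeff 1 (ew w k) = k * w := by
  rw [ew_eq, coeff_one_svar]

lemma extract_zero_homog (w : ℚ) (s : ℤ) :
    extract 0 (homog (ew w) s) = if s = 0 then 1 else 0 := by
  rcases lt_trichotomy s 0 with h | h | h
  · rw [homog_of_neg _ h, if_neg h.ne]
    exact coeffMap_zero _
  · rw [h, homog_zero, if_pos rfl, extract_zero_one]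
  · rw [if_neg h.ne']
    refine intCast_mul_cancel h.ne' ?_
    obtain ⟨N, hN⟩ : ∃ N : ℕ, s < N := ⟨(s + 1).toNat, by omega⟩
    rw [← extract_intCast_mul, mul_homog _ hN, extract_sum, mul_zero]
    refine sum_eq_zero fun k _ => ?_
    rw [mul_assoc, extract_zero_C_mul, coeff_zero_ew, map_zero, zero_mul]

lemma extract_zero_vertex (w : ℚ) (s : ℤ) (g : Fock ℚ⟦X⟧) :
    extract 0 (vertex (ew w) s g) = if s = 0 then extract 0 g else 0 := by
  induction g using pw_induction generalizing s with
  | h1 => rw [vertex_one, extract_zero_homog, extract_zero_one]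
  | hC b g hg =>
    rw [vertex_C_mul, extract_zero_C_mul, hg, extract_zero_C_mul]
    split_ifs <;> simp
  | hadd f g hf hg =>
    rw [map_add, extract_add, hf, hg, extract_add]
    split_ifs <;> simp
  | hp k g hg =>
    rw [vertex_pw_mul _ (ew_zero w), extract_add, extract_pw_mul, hg, extract_zero_C_mul,
      coeff_zero_ew, extract_pw_mul]
    split_ifs <;> simp

lemma extract_one_homog (w : ℚ) {s : ℤ} (hs : s ≠ 0) :
    extract 1 (homog (ew w) s) = C w * pw s.toNat := by
  rcases lt_or_gt_of_ne hs with h | h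
  · rw [homog_of_neg _ h, show s.toNat = 0 by omega, pw_zero, mul_zero]
    exact coeffMap_zero _
  · refine intCast_mul_cancel h.ne' ?_
    obtain ⟨n, rfl⟩ : ∃ n : ℕ, s = n := ⟨s.toNat, by omega⟩
    rw [← extract_intCast_mul, mul_homog _ (N := n + 1) (by push_cast; omega), extract_sum,
      sum_eq_single n]
    · rw [mul_assoc, extract_one_C_mul', extract_pw_mul, coeff_zero_ew, coeff_one_ew, sub_self,
        homog_zero, extract_zero_one, map_zero, Int.toNat_natCast]
      simp
      ring
    · intro b _ hb
      rw [mul_assoc, extract_one_C_mul', extract_pw_mul, coeff_zero_ew, extract_zero_homog,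
        if_neg (by omega)]
      simp
    · intro hb
      exact absurd (mem_range.2 (Nat.lt_succ_self n)) hb

lemma alphaOp_C_mul {K : Type*} [CommRing K] (s : ℤ) (b : K) (g : Fock K) :
    alphaOp s (C b * g) = C b * alphaOp s g := by
  simp only [alphaOp, Derivation.leibniz, derivation_C, smul_eq_mul]
  ring

lemma extract_one_vertex (w : ℚ) {s : ℤ} (hs : s ≠ 0) (g : Fock ℚ⟦X⟧) :
    extract 1 (vertex (ew w) s g) = C w * alphaOp s (extract 0 g) := by
  induction g using pw_induction with
  | h1 =>
    rw [vertex_one, extract_one_homog w hs, extract_zero_one, ← C_1, alphaOp_C]; simp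
  | hC b g hg =>
    rw [vertex_C_mul, extract_one_C_mul', hg, extract_zero_vertex, if_neg hs, extract_zero_C_mul,
      alphaOp_C_mul]
    ring
  | hadd f g hf hg =>
    rw [map_add, extract_add, hf, hg, extract_add, alphaOp_add]
    ring
  | hp k g hg =>
    rw [vertex_pw_mul _ (ew_zero w), extract_add, extract_pw_mul, hg, extract_one_C_mul',
      coeff_zero_ew, coeff_one_ew, extract_pw_mul, alphaOp_pw_mul, extract_zero_vertex]
    split_ifs <;> simp <;> ring

/-- Iterated vertex operators applied to the vacuum. -/
def vxList : List ℤ → Fock ℚ⟦X⟧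
  | [] => 1
  | m :: l => vx m (vxList l)

/-- Iterated bosonic operators applied to the vacuum. -/
def alphaList : List ℤ → Fock ℚ
  | [] => 1
  | m :: l => alphaOp m (alphaList l)

lemma vxList_factor (l : List ℤ) (hl : ∀ m ∈ l, m ≠ 0) :
    ∃ h, vxList l = C ((l.map fun m : ℤ => svar m).prod) * h ∧ cutJoin h = 2 * coeffDer ddu h ∧
      extract 0 h = alphaList l := by
  induction l with
  | nil =>
    refine ⟨1, by simp [vxList], ?_, extract_zero_one⟩
    rw [cutJoin_one, coeffDer_one, mul_zero]
  | cons m l ih =>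
    obtain ⟨g, hg, hode, h0⟩ := ih fun x hx => hl x (mem_cons_of_mem _ hx)
    have hm : m ≠ 0 := hl m (List.mem_cons_self ..)
    obtain ⟨h, hh, hode'⟩ := vx_ode hm hode
    refine ⟨h, ?_, hode', ?_⟩
    · rw [vxList, hg, vx, vertex_C_mul, ← vx, hh, map_cons, List.prod_cons, map_mul]
      ring
    · have h1 := extract_one_vertex m hm g
      change extract 1 (vx m g) = _ at h1
      rw [hh, extract_one_C_mul _ _ (coeff_zero_svar _), coeff_one_svar] at h1
      have hmC : (C (m : ℚ) : Fock ℚ) ≠ 0 := by rw [Ne, C_eq_zero]; exact_mod_cast hm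
      rw [mul_left_cancel₀ hmC h1, h0, alphaList]

/-- The exponential generating function of the values at `levelOne` of the powers of
`cutJoin / 2`. -/
def cutGF (g : Fock ℚ) : ℚ⟦X⟧ :=
  PowerSeries.mk fun d => levelOne ((cutJoin ^ d) g) / (2 ^ d * d.factorial)

lemma levelOne_vxList (l : List ℤ) (hl : ∀ m ∈ l, m ≠ 0) :
    levelOne (vxList l) = (l.map fun m : ℤ => svar m).prod * cutGF (alphaList l) := by
  obtain ⟨h, hh, hode, h0⟩ := vxList_factor l hl
  rw [hh, map_mul, levelOne_C]
  congr 1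
  ext d
  have h1 := congrArg levelOne (extract_of_ode hode d)
  rw [map_mul, map_natCast, extract, levelOne_coeffMap, h0] at h1
  rw [cutGF, coeff_mk, ← h1]
  have : (d.factorial : ℚ) ≠ 0 := by positivity
  push_cast
  field_simp
  rfl

end Leading

section Cross

open MvPolynomial

lemma range_sum_shift {R : Type*} [CommRing R] (c : ℕ → R) {y : ℤ → R} (hy : ∀ s < 0, y s = 0)
    {s : ℤ} {N N' : ℕ} (h : s < N) (h' : s < N') :
    ∑ k ∈ range N, c k * y (s - k) = ∑ k ∈ range N', c k * y (s - k) := by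
  wlog hN : N ≤ N' generalizing N N'
  · exact (this h' h (by omega)).symm
  refine sum_subset (range_subset_range.2 hN) fun k _ hk => ?_
  rw [mem_range, not_lt] at hk
  rw [hy _ (by omega), mul_zero]

variable {K : Type*} [CommRing K]

/-- The expansion coefficients of `(1 - x a / b) (1 - x b / a) / ((1 - x a b) (1 - x / (a b)))`. -/
def crossCoeff (a b : Kˣ) : ℕ → K
  | 0 => 1
  | f + 1 => sg a 1 * sg b 1 *
      ∑ x ∈ antidiagonal f, (((a * b) ^ ((x.1 : ℤ) - x.2) : Kˣ) : K)

lemma sg_mul_crossCoeff (a b : Kˣ) (f : ℕ) :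
    sg (a * b) 1 * crossCoeff a b (f + 1) = sg a 1 * sg b 1 * sg (a * b) (f + 1) := by
  rw [crossCoeff, mul_left_comm, sg_one_mul_sum_zpow]

/-- The geometric series. -/
def geo (q : Kˣ) : K⟦X⟧ := PowerSeries.mk fun n => ((q ^ (n : ℤ) : Kˣ) : K)

lemma geo_mul (q : Kˣ) : geo q * (1 - PowerSeries.C (q : K) * PowerSeries.X) = 1 := by
  ext n
  rw [mul_sub, mul_one, map_sub, ← mul_assoc]
  cases n with
  | zero => simp [geo]
  | succ n =>
    rw [coeff_succ_mul_X, mul_comm, PowerSeries.coeff_C_mul, geo, coeff_mk,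
      coeff_mk, PowerSeries.coeff_one, if_neg (Nat.succ_ne_zero n), Nat.cast_succ,
      zpow_add_one, Units.val_mul]
    ring

lemma sg_mul_sg (a b : Kˣ) (k : ℤ) :
    sg a k * sg b k = (((a * b) ^ k : Kˣ) : K) + (((a * b) ^ (-k) : Kˣ) : K)
      - (((a * b⁻¹) ^ k : Kˣ) : K) - (((a * b⁻¹) ^ (-k) : Kˣ) : K) := by
  simp only [sg, mul_zpow, inv_zpow, zpow_neg, mul_inv, inv_inv, Units.val_mul]
  ring

lemma crossCoeff_eq (a b : Kˣ) : (PowerSeries.mk (crossCoeff a b) : K⟦X⟧)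
    = 1 + PowerSeries.C (sg a 1 * sg b 1) * PowerSeries.X * (geo (a * b) * geo (a * b)⁻¹) := by
  ext n
  rw [map_add, mul_assoc, PowerSeries.coeff_C_mul]
  cases n with
  | zero => simp [crossCoeff]
  | succ n =>
    rw [mul_comm PowerSeries.X, coeff_succ_mul_X, coeff_mk, crossCoeff,
      PowerSeries.coeff_one, if_neg (Nat.succ_ne_zero n), zero_add, PowerSeries.coeff_mul]
    congr 1
    refine sum_congr rfl fun x _ => ?_
    rw [geo, geo, coeff_mk, coeff_mk, zpow_sub, Units.val_mul, inv_zpow]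

lemma succ_mul_crossCoeff (a b : Kˣ) (f : ℕ) :
    ((f + 1 : ℕ) : K) * crossCoeff a b (f + 1)
      = ∑ x ∈ antidiagonal f,
          sg a (x.1 + 1) * sg b (x.1 + 1) * crossCoeff a b x.2 := by
  set q : Kˣ := a * b with hq
  set r : Kˣ := a * b⁻¹ with hr
  set X : K⟦X⟧ := PowerSeries.X with hX
  set Q : K⟦X⟧ := PowerSeries.C (q : K) with hQ
  set Q' : K⟦X⟧ := PowerSeries.C ((q⁻¹ : Kˣ) : K) with hQ'
  set S : K⟦X⟧ := PowerSeries.C (r : K) with hS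
  set S' : K⟦X⟧ := PowerSeries.C ((r⁻¹ : Kˣ) : K) with hS'
  have hQQ : Q * Q' = 1 := by rw [hQ, hQ', ← map_mul, Units.mul_inv, map_one]
  have hSS : S * S' = 1 := by rw [hS, hS', ← map_mul, Units.mul_inv, map_one]
  set CR : K⟦X⟧ := PowerSeries.mk (crossCoeff a b) with hCR
  set P : K⟦X⟧ := PowerSeries.mk fun k => sg a (k + 1) * sg b (k + 1) with hP
  have hPe : P = Q * geo q + Q' * geo q⁻¹ - S * geo r - S' * geo r⁻¹ := by
    ext n
    simp only [hP, hQ, hQ', hS, hS', map_add, map_sub, PowerSeries.coeff_C_mul, geo,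
      coeff_mk, sg_mul_sg, ← hq, ← hr, zpow_neg, inv_zpow, zpow_add_one,
      mul_inv, Units.val_mul]
    ring
  set M : K⟦X⟧ := (1 - Q * X) * (1 - Q' * X) with hM
  set N : K⟦X⟧ := (1 - S * X) * (1 - S' * X) with hN
  have g1 : geo q * (1 - Q * X) = 1 := geo_mul q
  have g2 : geo q⁻¹ * (1 - Q' * X) = 1 := geo_mul q⁻¹
  have g3 : geo r * (1 - S * X) = 1 := geo_mul r
  have g4 : geo r⁻¹ * (1 - S' * X) = 1 := geo_mul r⁻¹
  have hPMN : P * M * N = (Q + Q' - 2 * X) * N - (S + S' - 2 * X) * M := by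
    rw [hPe]
    linear_combination (Q * (1 - Q' * X) * N) * g1 + (Q' * (1 - Q * X) * N) * g2
      - (S * (1 - S' * X) * M) * g3 - (S' * (1 - S * X) * M) * g4 - 2 * X * N * hQQ
      + 2 * X * M * hSS
  have hD : PowerSeries.C (sg a 1 * sg b 1) = Q + Q' - S - S' := by
    rw [sg_mul_sg, ← hq, ← hr, zpow_one, zpow_one, zpow_neg_one, zpow_neg_one]
    simp only [map_add, map_sub, hQ, hQ', hS, hS']
  have hCM : CR * M = N := by
    rw [hCR, crossCoeff_eq, hD, ← hq]
    linear_combination (Q + Q' - S - S') * X * (geo q⁻¹ * (1 - Q' * X)) * g1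
      + (Q + Q' - S - S') * X * g2 + X ^ 2 * hQQ - X ^ 2 * hSS
  have hMu : IsUnit M := by
    have h : M * (geo q * geo q⁻¹) = 1 := by
      linear_combination (geo q⁻¹ * (1 - Q' * X)) * g1 + g2
    exact IsUnit.of_mul_eq_one _ h
  set dd := PowerSeries.derivative K with hdd
  have dC : ∀ c : K, dd (PowerSeries.C c) = 0 := fun c => PowerSeries.derivative_C
  have dX : dd X = 1 := PowerSeries.derivative_X
  have dlin : ∀ c : K, dd (1 - PowerSeries.C c * X) = - PowerSeries.C c := by
    intro c
    rw [map_sub, Derivation.leibniz, dC, dX, Derivation.map_one_eq_zero]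
    simp
  have dM : dd M = -(Q + Q' - 2 * X) := by
    rw [hM, Derivation.leibniz, hQ, hQ', dlin, dlin, ← hQ, ← hQ']
    simp only [smul_eq_mul]
    linear_combination 2 * X * hQQ
  have dN : dd N = -(S + S' - 2 * X) := by
    rw [hN, Derivation.leibniz, hS, hS', dlin, dlin, ← hS, ← hS']
    simp only [smul_eq_mul]
    linear_combination 2 * X * hSS
  have hder : CR * dd M + M * dd CR = dd N := by
    have h := congrArg dd hCM
    rw [Derivation.leibniz, smul_eq_mul, smul_eq_mul] at h
    exact h
  have hfin : dd CR = P * CR := by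
    refine hMu.mul_left_cancel (hMu.mul_left_cancel ?_)
    rw [dM, dN] at hder
    linear_combination M * hder + (Q + Q' - 2 * X - M * P) * hCM - hPMN
  have h := congrArg (PowerSeries.coeff f) hfin
  rw [hdd, PowerSeries.coeff_derivative, PowerSeries.coeff_mul, hCR, hP] at h
  simp only [coeff_mk] at h
  rw [← h]
  push_cast
  ring

lemma mul_crossCoeff (a b : Kˣ) (f : ℕ) :
    (f : K) * crossCoeff a b f
      = ∑ x ∈ antidiagonal f,
          sg a x.1 * sg b x.1 * crossCoeff a b x.2 := by
  cases f with
  | zero => simp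
  | succ f =>
    rw [succ_mul_crossCoeff, Finset.Nat.sum_antidiagonal_succ]
    simp

lemma shiftHom_homog [Algebra ℚ K] (e e' : ℕ → K) (he : e 0 = 0) (cr : ℕ → K)
    (h0 : cr 0 = 1)
    (hcr : ∀ f : ℕ, (f : K) * cr f
      = ∑ x ∈ antidiagonal f, e x.1 * e' x.1 * cr x.2)
    {t : ℤ} {N : ℕ} (hN : t < N) :
    shiftHom e (homog e' t)
      = ∑ f ∈ range N,
          Polynomial.C (C (cr f)) * Polynomial.X ^ f * Polynomial.C (homog e' (t - f)) := by
  set H : ℤ → Polynomial (Fock K) := fun t => Polynomial.C (homog e' t) with hH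
  have hH0 : ∀ s < 0, H s = 0 := fun s hs => by rw [hH]; simp [homog_of_neg _ hs]
  set c : ℕ → Polynomial (Fock K) := fun f => Polynomial.C (C (cr f)) * Polynomial.X ^ f with hc
  set Z : ℤ → Polynomial (Fock K) := fun t =>
    ∑ f ∈ range (t.toNat + 1), c f * H (t - f) with hZ
  have hZN : ∀ (t : ℤ) (N : ℕ), t < N → Z t = ∑ f ∈ range N, c f * H (t - f) :=
    fun t N h => range_sum_shift c hH0 (by omega) h
  rw [← hZN t N hN]
  refine eq_of_recursion (y := fun t => shiftHom e (homog e' t)) (z := Z)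
    (fun k => shiftHom e (C (e' k) * pw k)) (by simp)
    (fun s hs => by simp only [homog_of_neg _ hs, map_zero]) ?_ ?_ ?_ ?_ t
  · intro s hs
    rw [hZN s 0 (by simpa using hs)]; simp
  · rw [hZN 0 1 (by simp)]
    simp [hc, hH, h0]
  · intro s N hs
    rw [← map_intCast (shiftHom e), ← map_mul, mul_homog e' hs, map_sum]
    exact sum_congr rfl fun k _ => by rw [map_mul]
  · intro s N hs
    have hw : ∀ k, shiftHom e (C (e' k) * pw k)
        = Polynomial.C (C (e' k) * pw k) + Polynomial.C (C (e k * e' k)) * Polynomial.X ^ k := by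
      intro k
      rw [map_mul, shiftHom_pw e he]
      have : shiftHom e (C (e' k)) = Polynomial.C (C (e' k)) := by
        rw [← MvPolynomial.algebraMap_eq, AlgHom.commutes]; rfl
      rw [this, map_mul, map_mul C, map_mul]
      ring
    have hHr : ∀ t : ℤ, t < N → (t : Polynomial (Fock K)) * H t
        = ∑ k ∈ range N, Polynomial.C (C (e' k) * pw k) * H (t - k) := by
      intro t ht
      have := congrArg Polynomial.C (mul_homog e' ht)
      rw [map_mul, map_sum, map_intCast] at this
      rw [hH]
      simp only
      rw [this]
      exact sum_congr rfl fun k _ => by rw [map_mul]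
    have h1 : ∀ k ∈ range N, shiftHom e (C (e' k) * pw k) * Z (s - k)
        = ∑ f ∈ range N, Polynomial.C (C (e' k) * pw k) * (c f * H (s - k - f))
          + ∑ f ∈ range N,
            Polynomial.C (C (e k * e' k)) * Polynomial.X ^ k * (c f * H (s - k - f)) := by
      intro k _
      rw [hw, add_mul, hZN (s - k) N (by omega), mul_sum, mul_sum]
    have h2 : ∀ f ∈ range N, (s : Polynomial (Fock K)) * (c f * H (s - f))
        = ∑ k ∈ range N, Polynomial.C (C (e' k) * pw k) * (c f * H (s - k - f))
          + ∑ x ∈ antidiagonal f,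
            Polynomial.C (C (e x.1 * e' x.1)) * Polynomial.X ^ x.1
              * (c x.2 * H (s - x.1 - x.2)) := by
      intro f _
      have h3 : ∑ k ∈ range N, Polynomial.C (C (e' k) * pw k) * (c f * H (s - k - f))
          = c f * (((s - f : ℤ) : Polynomial (Fock K)) * H (s - f)) := by
        rw [hHr _ (by omega), mul_sum]
        refine sum_congr rfl fun k _ => ?_
        rw [sub_right_comm]; ring
      have h4 : ∑ x ∈ antidiagonal f,
            Polynomial.C (C (e x.1 * e' x.1)) * Polynomial.X ^ x.1
              * (c x.2 * H (s - x.1 - x.2)) = (f : Polynomial (Fock K)) * (c f * H (s - f)) := by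
        have h5 := congrArg (fun y => Polynomial.C (C (σ := ℕ) y)) (hcr f)
        simp only [map_mul, map_sum, map_natCast] at h5
        rw [hc]
        simp only
        rw [← mul_assoc, ← mul_assoc, h5, sum_mul, sum_mul]
        refine sum_congr rfl fun x hx => ?_
        rw [mem_antidiagonal] at hx
        rw [← hx, pow_add, map_mul, map_mul]
        push_cast
        rw [sub_sub]
        ring
      rw [h3, h4]
      push_cast
      ring
    rw [sum_congr rfl h1, hZN s N hs, mul_sum, sum_congr rfl h2,
      sum_add_distrib, sum_add_distrib, sum_comm]
    congr 1
    refine sum_range_antidiagonal (fun k f => Polynomial.C (C (e k * e' k)) * Polynomial.X ^ k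
      * (c f * H (s - k - f))) N fun i j hij => ?_
    rw [hH0 _ (by omega), mul_zero, mul_zero]

end Cross

section NestedSum

open MvPolynomial

variable {ι R : Type*} [Fintype ι] [DecidableEq ι] [CommRing R]

/-- Exponent vectors supported on `l` with entries at most `B`. -/
def box (l : List ι) (B : ℕ) : Finset (ι → ℕ) :=
  Fintype.piFinset fun j => if j ∈ l then range (B + 1) else {0}

lemma mem_box {l : List ι} {B : ℕ} {f : ι → ℕ} :
    f ∈ box l B ↔ ∀ j, (j ∈ l → f j ≤ B) ∧ (j ∉ l → f j = 0) := by
  simp only [box, Fintype.mem_piFinset]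
  refine forall_congr' fun j => ?_
  by_cases h : j ∈ l <;> simp [h]

lemma box_nil (B : ℕ) : box ([] : List ι) B = {0} := by
  ext f
  simp [mem_box, funext_iff]

lemma sum_box_cons {i : ι} {l : List ι} (hi : i ∉ l) (B : ℕ) {A : Type*} [AddCommMonoid A]
    (Φ : (ι → ℕ) → A) :
    ∑ F ∈ box (i :: l) B, Φ F
      = ∑ a ∈ range (B + 1), ∑ f ∈ box l B, Φ (update f i a) := by
  rw [← sum_product']
  refine (sum_bij' (fun p _ => update p.2 i p.1)
    (fun F _ => (F i, update F i 0)) ?_ ?_ ?_ ?_ ?_).symm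
  · rintro ⟨a, f⟩ h
    rw [mem_product, mem_box, mem_range] at h
    rw [mem_box]
    intro j
    rcases eq_or_ne j i with rfl | hj
    · simpa using Nat.lt_succ_iff.1 h.1
    · simpa [hj] using h.2 j
  · intro F h
    rw [mem_box] at h
    rw [mem_product, mem_box, mem_range]
    refine ⟨Nat.lt_succ_iff.2 ((h i).1 (by simp)), fun j => ?_⟩
    rcases eq_or_ne j i with rfl | hj
    · simp [hi]
    · simpa [hj] using h j
  · rintro ⟨a, f⟩ h
    rw [mem_product, mem_box] at h
    have := (h.2 i).2 hi
    simp only at this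
    simp [← this]
  · intro F _
    simp
  · intros; rfl

lemma sum_eq_list_sum {l : List ι} (hl : l.Nodup) {B : ℕ} {f : ι → ℕ} (hf : f ∈ box l B) :
    ∑ j, (f j : ℤ) = (l.map fun j => (f j : ℤ)).sum := by
  rw [← sum_toFinset _ hl]
  refine (sum_subset (subset_univ _) fun j _ hj => ?_).symm
  rw [List.mem_toFinset] at hj
  rw [(mem_box.1 hf j).2 hj, Nat.cast_zero]

lemma list_sum_sub (l : List ι) (c d : ι → ℤ) :
    (l.map fun j => c j - d j).sum = (l.map c).sum - (l.map d).sum := by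
  induction l with
  | nil => simp
  | cons i l ih => simp only [map_cons, sum_cons, ih]; ring

/-- The nested sum obtained by contracting a list of vertex operators. -/
def nest (cr : ι → ι → ℕ → R) (t : ι → ℤ → R) (B : ℕ) : List ι → (ι → ℤ) → R
  | [], _ => 1
  | i :: l, c => ∑ f ∈ box l B, (∏ j, cr i j (f j)) * t i (c i + ∑ j, (f j : ℤ))
      * nest cr t B l fun j => c j - f j

lemma nest_eq_zero (cr : ι → ι → ℕ → R) (t : ι → ℤ → R) (B : ℕ) {l : List ι} (hl : l.Nodup)
    (ht : ∀ i ∈ l, ∀ s < 0, t i s = 0) {c : ι → ℤ} (hc : (l.map c).sum < 0) :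
    nest cr t B l c = 0 := by
  induction l generalizing c with
  | nil => simp at hc
  | cons i l ih =>
    rw [nodup_cons] at hl
    rw [nest]
    refine sum_eq_zero fun f hf => ?_
    have hs := sum_eq_list_sum hl.2 hf
    by_cases h : (l.map fun j => c j - (f j : ℤ)).sum < 0
    · rw [ih hl.2 (fun j hj => ht j (mem_cons_of_mem _ hj)) h, mul_zero]
    · rw [list_sum_sub] at h
      rw [map_cons, sum_cons] at hc
      rw [ht i (by simp) _ (by omega), mul_zero, zero_mul]

lemma map_nest {R' : Type*} [CommRing R'] (φ : R →+* R') (cr : ι → ι → ℕ → R) (t : ι → ℤ → R)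
    (B : ℕ) (l : List ι) (c : ι → ℤ) :
    φ (nest cr t B l c) = nest (fun i j f => φ (cr i j f)) (fun i s => φ (t i s)) B l c := by
  induction l generalizing c with
  | nil => simp [nest]
  | cons i l ih =>
    rw [nest, nest, map_sum]
    refine sum_congr rfl fun f _ => ?_
    rw [map_mul, map_mul, map_prod, ih]

lemma nest_scale (cr : ι → ι → ℕ → R) (t t' : ι → ℤ → R) (B : ℕ) {l : List ι} (hl : l.Nodup)
    (ρ : ι → R) (y : Rˣ) (h : ∀ i ∈ l, ∀ s, t' i s = ρ i * (y ^ s : Rˣ) * t i s) (c : ι → ℤ) :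
    nest cr t' B l c = (l.map ρ).prod * (y ^ (l.map c).sum : Rˣ) * nest cr t B l c := by
  induction l generalizing c with
  | nil => simp [nest]
  | cons i l ih =>
    rw [nodup_cons] at hl
    rw [nest, nest, mul_sum]
    refine sum_congr rfl fun f hf => ?_
    rw [ih hl.2 (fun j hj => h j (mem_cons_of_mem _ hj)), h i (by simp), list_sum_sub,
      sum_eq_list_sum hl.2 hf, map_cons, map_cons, List.prod_cons, sum_cons,
      zpow_add, zpow_add, zpow_sub]
    simp only [Units.val_mul]
    linear_combination (∏ j, cr i j (f j)) * ρ i * (y ^ c i : Rˣ)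
      * t i (c i + (l.map fun j => (f j : ℤ)).sum) * (l.map ρ).prod * (y ^ (l.map c).sum : Rˣ)
      * nest cr t B l (fun j => c j - f j)
      * Units.mul_inv (y ^ (l.map fun j => (f j : ℤ)).sum)

end NestedSum

section Contraction

open MvPolynomial

variable {ι K : Type*} [Fintype ι] [DecidableEq ι] [CommRing K] [Algebra ℚ K]

/-- All suffix sums of `c` along `l` are at most `B`. -/
def SuffixBound (l : List ι) (c : ι → ℤ) (B : ℕ) : Prop :=
  ∀ s, s <:+ l → (s.map c).sum ≤ B

lemma SuffixBound.tail {i : ι} {l : List ι} {c : ι → ℤ} {B : ℕ} (h : SuffixBound (i :: l) c B) :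
    SuffixBound l c B := fun s hs => h s (hs.trans (List.suffix_cons i l))

lemma SuffixBound.sub {l : List ι} {c : ι → ℤ} {B : ℕ} (h : SuffixBound l c B) (f : ι → ℕ) :
    SuffixBound l (fun j => c j - f j) B := by
  intro s hs
  rw [list_sum_sub]
  have h1 := h s hs
  have h2 : 0 ≤ (s.map fun j => (f j : ℤ)).sum :=
    List.sum_nonneg fun x hx => by
      obtain ⟨j, -, rfl⟩ := List.mem_map.1 hx
      positivity
  omega

lemma shiftHom_C (e : ℕ → K) (b : K) : shiftHom e (C b) = Polynomial.C (C b) := by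
  rw [← MvPolynomial.algebraMap_eq, AlgHom.commutes]; rfl

lemma shiftHom_nest (e : ι → ℕ → K) (he : ∀ i, e i 0 = 0) (cr : ι → ι → ℕ → K)
    (h0 : ∀ i j, cr i j 0 = 1)
    (hcr : ∀ i j (f : ℕ), (f : K) * cr i j f
      = ∑ x ∈ antidiagonal f, e i x.1 * e j x.1 * cr i j x.2)
    (k : ι) {l : List ι} (hl : l.Nodup) {B : ℕ} {c : ι → ℤ} (hc : SuffixBound l c B) :
    shiftHom (e k) (nest (fun i j f => C (cr i j f)) (fun i s => homog (e i) s) B l c)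
      = ∑ F ∈ box l B, Polynomial.C (C (∏ j, cr k j (F j))) * Polynomial.X ^ (∑ j, F j)
        * Polynomial.C (nest (fun i j f => C (cr i j f)) (fun i s => homog (e i) s) B l
            fun j => c j - F j) := by
  induction l generalizing c with
  | nil => simp [nest, box_nil, h0]
  | cons i l ih =>
    have hl' := List.nodup_cons.1 hl
    have hv : ∀ {c : ι → ℤ}, (l.map c).sum < 0 →
        nest (fun i j f => C (cr i j f)) (fun i s => homog (e i) s) B l c = 0 := fun h =>
      nest_eq_zero _ _ _ hl'.2 (fun i _ s hs => homog_of_neg _ hs) h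
    rw [nest, map_sum, sum_box_cons hl'.1]
    have key : ∀ f ∈ box l B, shiftHom (e k) ((∏ j, C (cr i j (f j)))
          * homog (e i) (c i + ∑ j, (f j : ℤ))
          * nest (fun i j f => C (cr i j f)) (fun i s => homog (e i) s) B l fun j => c j - f j)
        = ∑ a ∈ range (B + 1), ∑ F ∈ box l B,
          Polynomial.C (C (∏ j, cr i j (f j)))
          * (Polynomial.C (C (cr k i a)) * Polynomial.X ^ a
            * Polynomial.C (homog (e i) (c i + ∑ j, (f j : ℤ) - a)))
          * (Polynomial.C (C (∏ j, cr k j (F j))) * Polynomial.X ^ (∑ j, F j)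
            * Polynomial.C (nest (fun i j f => C (cr i j f)) (fun i s => homog (e i) s) B l
            fun j => c j - f j - F j)) := by
      intro f hf
      have hs := sum_eq_list_sum hl'.2 hf
      by_cases h : (l.map fun j => c j - (f j : ℤ)).sum < 0
      · rw [hv h, mul_zero, map_zero]
        refine (sum_eq_zero fun a _ => sum_eq_zero fun F hF => ?_).symm
        have h2 : 0 ≤ (l.map fun j => (F j : ℤ)).sum :=
          List.sum_nonneg fun x hx => by
            obtain ⟨j, -, rfl⟩ := List.mem_map.1 hx
            positivity
        rw [hv (c := fun j => c j - f j - F j) (by rw [list_sum_sub]; omega)]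
        simp
      · have hB := hc (i :: l) List.suffix_rfl
        rw [list_sum_sub] at h
        rw [map_cons, sum_cons] at hB
        rw [map_mul, map_mul, ih hl'.2 (hc.tail.sub f), ← map_prod C, shiftHom_C,
          shiftHom_homog (e k) (e i) (he k) (cr k i) (h0 k i) (hcr k i) (N := B + 1)
            (by push_cast; omega), mul_sum, sum_comm]
        refine sum_congr rfl fun a _ => ?_
        rw [mul_sum, sum_mul]
    rw [sum_congr rfl key, sum_comm]
    refine sum_congr rfl fun a _ => ?_
    rw [sum_comm]
    refine sum_congr rfl fun F hF => ?_
    have hFi := (mem_box.1 hF i).2 hl'.1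
    have hsum : ∑ j, update F i a j = a + ∑ j, F j := by
      rw [sum_update_of_mem (mem_univ i), ← sum_sdiff (subset_univ {i}),
        sum_singleton, hFi, add_zero]
    have hprod : ∏ j, cr k j (update F i a j) = cr k i a * ∏ j, cr k j (F j) := by
      rw [← mul_prod_erase _ _ (mem_univ i),
        ← mul_prod_erase (s := univ) (fun j => cr k j (F j)) (mem_univ i),
        hFi, h0, one_mul, update_self]
      congr 1
      refine prod_congr rfl fun j hj => ?_
      rw [update_of_ne (ne_of_mem_erase hj)]
    rw [hsum, hprod, nest, map_sum, mul_sum]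
    refine sum_congr rfl fun f hf => ?_
    have hnest : ∀ c c' : ι → ℤ, (∀ j ∈ l, c j = c' j) →
        nest (fun i j f => C (cr i j f)) (fun i s => homog (e i) s) B l c
        = nest (fun i j f => C (cr i j f)) (fun i s => homog (e i) s) B l c' := by
      clear ih hl hc hv key hF hl' hFi hsum hprod hf
      induction l with
      | nil => intros; rfl
      | cons i l ih =>
        intro c c' h
        rw [nest, nest]
        refine sum_congr rfl fun f _ => ?_
        rw [h i (by simp), ih _ _ fun j hj => by rw [h j (by simp [hj])]]
    rw [update_self, hnest (fun j => c j - f j - F j)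
      (fun j => c j - (update F i a j : ℕ) - f j) (fun j hj => by
        rw [update_of_ne (by rintro rfl; exact hl'.1 hj)]; ring),
      add_sub_right_comm, pow_add, ← map_prod C]
    simp only [map_mul]
    ring

/-- A product of vertex operators applied to the vacuum. -/
def vertexList (e : ι → ℕ → K) (c : ι → ℤ) : List ι → Fock K
  | [] => 1
  | i :: l => vertex (e i) (c i) (vertexList e c l)

lemma vertexList_eq_nest (e : ι → ℕ → K) (he : ∀ i, e i 0 = 0) (cr : ι → ι → ℕ → K)
    (h0 : ∀ i j, cr i j 0 = 1)
    (hcr : ∀ i j (f : ℕ), (f : K) * cr i j f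
      = ∑ x ∈ antidiagonal f, e i x.1 * e j x.1 * cr i j x.2)
    {l : List ι} (hl : l.Nodup) {B : ℕ} {c : ι → ℤ} (hc : SuffixBound l.tail c B) :
    vertexList e c l = nest (fun i j f => C (cr i j f)) (fun i s => homog (e i) s) B l c := by
  induction l with
  | nil => rfl
  | cons i l ih =>
    have hl' := List.nodup_cons.1 hl
    rw [List.tail_cons] at hc
    have hc' : SuffixBound l.tail c B := fun s hs => hc s (hs.trans (List.tail_suffix l))
    rw [vertexList, ih hl'.2 hc', vertex_apply, shiftHom_nest e he cr h0 hcr i hl'.2 hc, map_sum,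
      nest]
    refine sum_congr rfl fun F _ => ?_
    rw [mul_assoc, bracket_C_mul, mul_comm (Polynomial.X ^ _), bracket_C_mul_X_pow, map_prod]
    push_cast
    ring

/-- The value at level one of `homog e s`. -/
def expCoeff (ς : K) (s : ℤ) : K :=
  if s < 0 then 0 else algebraMap ℚ K (s.toNat.factorial : ℚ)⁻¹ * ς ^ s.toNat

lemma levelOne_homog (e : ℕ → K) (s : ℤ) : levelOne (homog e s) = expCoeff (e 1) s := by
  rw [expCoeff]
  split_ifs with h
  · rw [homog_of_neg _ h, map_zero]
  · obtain ⟨n, rfl⟩ := Int.eq_ofNat_of_zero_le (not_lt.1 h)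
    rw [Int.toNat_natCast, ← factorial_mul_levelOne_homog, ← mul_assoc,
      ← map_natCast (algebraMap ℚ K), ← map_mul, inv_mul_cancel₀ (by positivity), map_one, one_mul]

lemma levelOne_vertexList (a : ι → Kˣ) {l : List ι} (hl : l.Nodup) {B : ℕ} {c : ι → ℤ}
    (hc : SuffixBound l.tail c B) :
    levelOne (vertexList (fun i k => sg (a i) k) c l)
      = nest (fun i j => crossCoeff (a i) (a j)) (fun i => expCoeff (sg (a i) 1)) B l c := by
  rw [vertexList_eq_nest (fun i k => sg (a i) k) (fun i => by simp)
    (fun i j => crossCoeff (a i) (a j)) (fun i j => rfl) (fun i j f => mul_crossCoeff _ _ f) hl hc]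
  have := map_nest (levelOne (K := K)).toRingHom (fun i j f => C (crossCoeff (a i) (a j) f))
    (fun i s => homog (fun k => sg (a i) k) s) B l c
  refine this.trans ?_
  simp only [AlgHom.toRingHom_eq_coe, RingHom.coe_coe, levelOne_C, levelOne_homog, Nat.cast_one]

end Contraction

section Cut

open MvPolynomial

variable {ι : Type*} [Fintype ι] [DecidableEq ι]

lemma vertexList_eq_vxList (c : ι → ℤ) (l : List ι) :
    vertexList (fun i k => sg (expU (c i / 2)) k) c l = vxList (l.map c) := by
  induction l with
  | nil => rfl
  | cons i l ih => rw [vertexList, ih, map_cons, vxList]; rfl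

lemma prod_svar_mul_cutGF (c : ι → ℤ) {l : List ι} (hl : l.Nodup) (h0 : ∀ i ∈ l, c i ≠ 0) {B : ℕ}
    (hc : SuffixBound l.tail c B) :
    (l.map fun i => svar (c i)).prod * cutGF (alphaList (l.map c))
      = nest (fun i j => crossCoeff (expU (c i / 2)) (expU (c j / 2)))
          (fun i => expCoeff (svar (c i))) B l c := by
  have h1 := levelOne_vxList (l.map c) (by simpa using h0)
  rw [← vertexList_eq_vxList,
    levelOne_vertexList (K := ℚ⟦X⟧) (fun i => expU (c i / 2)) hl hc, List.map_map] at h1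
  simp only [sg_expU, Int.cast_one, one_mul] at h1
  exact h1.symm

end Cut

section Convolution

open MvPolynomial

variable {K : Type*} [CommRing K] [Algebra ℚ K]

lemma series_eq_of_logDeriv {R : Type*} [CommRing R] [Algebra ℚ R] {W F G : R⟦X⟧}
    (hW : PowerSeries.coeff 0 W = 0)
    (hF : ∀ n : ℕ, (n : R) * PowerSeries.coeff n F = PowerSeries.coeff n (W * F))
    (hG : ∀ n : ℕ, (n : R) * PowerSeries.coeff n G = PowerSeries.coeff n (W * G))
    (h0 : PowerSeries.coeff 0 F = PowerSeries.coeff 0 G) : F = G := by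
  ext n
  induction n using Nat.strong_induction_on with
  | _ n ih =>
    rcases Nat.eq_zero_or_pos n with rfl | hn
    · exact h0
    · refine intCast_mul_cancel (s := n) (by omega) ?_
      rw [Int.cast_natCast, hF, hG, PowerSeries.coeff_mul, PowerSeries.coeff_mul]
      refine sum_congr rfl fun x hx => ?_
      rw [mem_antidiagonal] at hx
      rcases Nat.eq_zero_or_pos x.1 with h | h
      · rw [h, hW, zero_mul, zero_mul]
      · rw [ih x.2 (by omega)]

/-- The generating series of the complete homogeneous functions with weights `e`. -/
def homogSeries (e : ℕ → K) : PowerSeries (Fock K) :=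
  PowerSeries.mk fun n => homog e n

/-- The logarithmic derivative of `homogSeries`. -/
def weightSeries (e : ℕ → K) : PowerSeries (Fock K) :=
  PowerSeries.mk fun n => C (e n) * pw n

lemma mul_coeff_homogSeries (e : ℕ → K) (n : ℕ) :
    (n : Fock K) * PowerSeries.coeff n (homogSeries e)
      = PowerSeries.coeff n (weightSeries e * homogSeries e) := by
  have := mul_homog e (s := n) (N := n + 1) (by push_cast; omega)
  rw [Int.cast_natCast] at this
  rw [homogSeries, coeff_mk, this, PowerSeries.coeff_mul,
    Finset.Nat.sum_antidiagonal_eq_sum_range_succ_mk]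
  refine sum_congr rfl fun k hk => ?_
  rw [mem_range] at hk
  rw [weightSeries, coeff_mk, coeff_mk, Nat.cast_sub (by omega)]

lemma mul_coeff_mul {R : Type*} [CommRing R] {W W' F G : R⟦X⟧}
    (hF : ∀ n : ℕ, (n : R) * PowerSeries.coeff n F = PowerSeries.coeff n (W * F))
    (hG : ∀ n : ℕ, (n : R) * PowerSeries.coeff n G = PowerSeries.coeff n (W' * G)) (n : ℕ) :
    (n : R) * PowerSeries.coeff n (F * G) = PowerSeries.coeff n ((W + W') * (F * G)) := by
  have h1 : (W + W') * (F * G) = (W * F) * G + F * (W' * G) := by ring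
  rw [h1, map_add, PowerSeries.coeff_mul, PowerSeries.coeff_mul, PowerSeries.coeff_mul,
    mul_sum, ← sum_add_distrib]
  refine sum_congr rfl fun x hx => ?_
  rw [mem_antidiagonal] at hx
  rw [← hF, ← hG, ← hx]
  push_cast
  ring

lemma mul_coeff_rescale {R : Type*} [CommRing R] {W F : R⟦X⟧} (q : R)
    (hF : ∀ n : ℕ, (n : R) * PowerSeries.coeff n F = PowerSeries.coeff n (W * F)) (n : ℕ) :
    (n : R) * PowerSeries.coeff n (rescale q F)
      = PowerSeries.coeff n (rescale q W * rescale q F) := by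
  rw [← map_mul, coeff_rescale, coeff_rescale, ← hF]
  ring

lemma sum_pow_homog (e e' e'' : ℕ → K) (Q P : K)
    (h : ∀ k : ℕ, Q ^ k * e k + e' k = P ^ k * e'' k) (n : ℕ) :
    ∑ x ∈ antidiagonal n, C (Q ^ x.1) * (homog e x.1 * homog e' x.2)
      = C (P ^ n) * homog e'' n := by
  have key : rescale (C Q) (homogSeries e) * homogSeries e'
      = rescale (C P) (homogSeries e'') := by
    refine series_eq_of_logDeriv (W := rescale (C P) (weightSeries e'')) ?_ ?_ ?_ ?_
    · simp [weightSeries]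
    · intro n
      rw [mul_coeff_mul (mul_coeff_rescale (C Q) (mul_coeff_homogSeries _))
        (mul_coeff_homogSeries _)]
      congr 2
      ext n : 1
      rw [map_add, coeff_rescale, coeff_rescale, weightSeries,
        weightSeries, weightSeries, coeff_mk, coeff_mk,
        coeff_mk, ← mul_assoc, ← mul_assoc, ← add_mul, ← map_pow, ← map_pow,
        ← map_mul, ← map_mul, ← map_add, h]
    · exact mul_coeff_rescale (C P) (mul_coeff_homogSeries _)
    · simp [PowerSeries.coeff_mul, homogSeries, homog_zero, coeff_rescale]
  have h := congrArg (PowerSeries.coeff n) key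
  simp only [PowerSeries.coeff_mul, coeff_rescale, homogSeries, coeff_mk,
    ← map_pow] at h
  rw [← h]
  exact sum_congr rfl fun x _ => (mul_assoc _ _ _).symm

end Convolution

section Commutator

open MvPolynomial

variable {K : Type*} [CommRing K] [Algebra ℚ K]

lemma sum_range_add_neg {A : Type*} [AddCommGroup A] (φ : ℤ → A) (h0 : φ 0 = 0) (N : ℕ) :
    ∑ f ∈ range (N + 1), (φ f + φ (-f)) = ∑ f ∈ Icc (-(N : ℤ)) N, φ f := by
  induction N with
  | zero => simp [h0]
  | succ N ih =>
    rw [sum_range_succ, ih]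
    have : Icc (-((N + 1 : ℕ) : ℤ)) (N + 1 : ℕ)
        = insert ((N + 1 : ℕ) : ℤ) (insert (-((N + 1 : ℕ) : ℤ)) (Icc (-(N : ℤ)) N)) := by
      ext x
      simp only [mem_insert, mem_Icc]
      push_cast
      omega
    rw [this, sum_insert (by simp; omega), sum_insert (by simp)]
    abel

/-- The normalized commutator coefficient. -/
def commCoeff (a b : Kˣ) (s t : ℤ) : K :=
  ((b ^ (-s) : Kˣ) : K) * ((a ^ t : Kˣ) : K) - ((b ^ s : Kˣ) : K) * ((a ^ (-t) : Kˣ) : K)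

lemma commCoeff_add (a b : Kˣ) (s t k : ℤ) :
    sg a k * commCoeff a b (s + k) t + sg b k * commCoeff a b s (t + k)
      = sg (a * b) k * commCoeff a b s t := by
  simp only [commCoeff, sg, neg_add, zpow_add, mul_zpow, zpow_neg, mul_inv, Units.val_mul]
  ring

lemma homog_mul_homog_comm (a b : Kˣ) (s t : ℤ) :
    C (sg (a * b) 1) * (vertex (fun k => sg a k) s (homog (fun k => sg b k) t)
        - vertex (fun k => sg b k) t (homog (fun k => sg a k) s))
      = C (sg a 1 * sg b 1 * commCoeff a b s t) * homog (fun k => sg (a * b) k) (s + t) := by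
  set A : ℤ → Fock K := homog (fun k => sg a k) with hA
  set B : ℤ → Fock K := homog (fun k => sg b k) with hB
  set N : ℕ := s.natAbs + t.natAbs with hN
  set D : K := sg a 1 * sg b 1 with hD
  have e1 : vertex (fun k => sg a k) s (B t)
      = ∑ f ∈ range (N + 1), C (crossCoeff a b f) * (A (s + f) * B (t - f)) := by
    rw [vertex_apply, hB, shiftHom_homog (fun k => sg a k) (fun k => sg b k) (by simp)
      (crossCoeff a b) rfl (mul_crossCoeff a b) (N := N + 1) (by push_cast; omega), map_sum]
    refine sum_congr rfl fun f _ => ?_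
    rw [mul_assoc, bracket_C_mul, mul_comm (Polynomial.X ^ _), bracket_C_mul_X_pow]
    ring
  have e2 : vertex (fun k => sg b k) t (A s)
      = ∑ f ∈ range (N + 1), C (crossCoeff b a f) * (B (t + f) * A (s - f)) := by
    rw [vertex_apply, hA, shiftHom_homog (fun k => sg b k) (fun k => sg a k) (by simp)
      (crossCoeff b a) rfl (mul_crossCoeff b a) (N := N + 1) (by push_cast; omega), map_sum]
    refine sum_congr rfl fun f _ => ?_
    rw [mul_assoc, bracket_C_mul, mul_comm (Polynomial.X ^ _), bracket_C_mul_X_pow]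
    ring
  have hcomm : ∀ f, crossCoeff b a f = crossCoeff a b f := by
    intro f
    cases f with
    | zero => rfl
    | succ f => rw [crossCoeff, crossCoeff, mul_comm b a, mul_comm (sg b 1)]
  set φ : ℤ → Fock K := fun f => C (D * sg (a * b) f) * (A (s + f) * B (t - f)) with hφ
  have hterm : ∀ f ∈ range (N + 1), C (sg (a * b) 1) *
      (C (crossCoeff a b f) * (A (s + f) * B (t - f))
        - C (crossCoeff b a f) * (B (t + f) * A (s - f))) = φ f + φ (-f) := by
    intro f _
    rw [hcomm, hφ]
    simp only
    rw [sg_neg, mul_neg, map_neg, sub_neg_eq_add, ← sub_eq_add_neg]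
    rcases Nat.eq_zero_or_pos f with rfl | hf
    · simp [mul_comm]
    · obtain ⟨f, rfl⟩ := Nat.exists_eq_succ_of_ne_zero hf.ne'
      have h := sg_mul_crossCoeff a b f
      rw [← hD] at h
      have h' : C (sg (a * b) 1) * C (crossCoeff a b (f + 1))
          = (C (D * sg (a * b) (f + 1)) : Fock K) := by rw [← map_mul, h]
      push_cast
      linear_combination (A (s + (f + 1)) * B (t - (f + 1)) - B (t + (f + 1)) * A (s - (f + 1)))
        * h'
  rw [e1, e2, ← sum_sub_distrib, mul_sum, sum_congr rfl hterm,
    sum_range_add_neg φ (by simp [hφ])]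
  have hz : ∀ f, (s + f < 0 ∨ t - f < 0) → φ f = 0 := by
    rintro f (h | h)
    · simp only [hφ, hA]; rw [homog_of_neg _ h]; simp
    · simp only [hφ, hB]; rw [homog_of_neg _ h]; simp
  by_cases hn : s + t < 0
  · rw [homog_of_neg _ hn, mul_zero]
    exact sum_eq_zero fun f _ => hz f (by omega)
  obtain ⟨n, hn'⟩ := Int.eq_ofNat_of_zero_le (not_lt.1 hn)
  have hre : ∑ x ∈ antidiagonal n, φ (x.1 - s)
      = ∑ f ∈ Icc (-(N : ℤ)) N, φ f := by
    rw [← sum_subset (s₁ := Icc (-s) t) (fun f hf => by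
      rw [mem_Icc] at hf ⊢; omega) (fun f _ hf => hz f (by
      rw [mem_Icc] at hf; omega))]
    refine sum_bij' (fun x _ => (x.1 : ℤ) - s) (fun f _ => ((s + f).toNat, (t - f).toNat))
      ?_ ?_ ?_ ?_ ?_
    · intro x hx
      rw [mem_antidiagonal] at hx
      rw [mem_Icc]; omega
    · intro f hf
      rw [mem_Icc] at hf
      rw [mem_antidiagonal]; omega
    · intro x hx
      rw [mem_antidiagonal] at hx
      ext <;> simp only <;> omega
    · intro f hf
      rw [mem_Icc] at hf
      simp only; omega
    · intros; rfl
  rw [← hre]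
  have hval : ∀ (c : Kˣ) (k : ℕ), (c : K) ^ k = ((c ^ (k : ℤ) : Kˣ) : K) := fun c k => by
    rw [zpow_natCast, Units.val_pow_eq_pow_val]
  have h1 := sum_pow_homog (fun k => sg a k) (fun k => sg b k) (fun k => sg (a * b) k)
    ((a * b : Kˣ) : K) (a : K) (fun k => by
      rw [hval, hval]
      simp only [sg, zpow_neg, mul_zpow, mul_inv, Units.val_mul]
      linear_combination (((b ^ (k : ℤ))⁻¹ : Kˣ) : K) * Units.mul_inv (a ^ (k : ℤ))
        - ((b ^ (k : ℤ) : Kˣ) : K) * Units.mul_inv (a ^ (k : ℤ))) n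
  have h2 := sum_pow_homog (fun k => sg a k) (fun k => sg b k) (fun k => sg (a * b) k)
    (((a * b)⁻¹ : Kˣ) : K) ((a⁻¹ : Kˣ) : K) (fun k => by
      rw [hval, hval]
      simp only [sg, zpow_neg, mul_zpow, mul_inv, inv_zpow, Units.val_mul]
      linear_combination (((b ^ (k : ℤ))⁻¹ : Kˣ) : K) * Units.mul_inv (a ^ (k : ℤ))
        - ((b ^ (k : ℤ) : Kˣ) : K) * Units.mul_inv (a ^ (k : ℤ))) n
  have hst : (n : ℤ) = s + t := hn'.symm
  have h3 : ∑ x ∈ antidiagonal n, φ (x.1 - s)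
      = C D * (C (((a * b) ^ (-s) : Kˣ) : K) * ∑ x ∈ antidiagonal n,
          C (((a * b : Kˣ) : K) ^ x.1) * (A x.1 * B x.2)
        - C (((a * b) ^ s : Kˣ) : K) * ∑ x ∈ antidiagonal n,
          C ((((a * b)⁻¹ : Kˣ) : K) ^ x.1) * (A x.1 * B x.2)) := by
    rw [mul_sum, mul_sum, ← sum_sub_distrib, mul_sum]
    refine sum_congr rfl fun x hx => ?_
    rw [mem_antidiagonal] at hx
    simp only [hφ]
    have i1 : s + ((x.1 : ℤ) - s) = x.1 := by ring
    have i2 : t - ((x.1 : ℤ) - s) = x.2 := by omega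
    have i3 : sg (a * b) ((x.1 : ℤ) - s) = (((a * b) ^ (-s) : Kˣ) : K) * ((a * b : Kˣ) : K) ^ x.1
        - (((a * b) ^ s : Kˣ) : K) * (((a * b)⁻¹ : Kˣ) : K) ^ x.1 := by
      rw [sg, hval, hval, ← Units.val_mul, ← Units.val_mul, inv_zpow', ← zpow_add, ← zpow_add]
      ring_nf
    rw [i1, i2, i3]
    simp only [map_mul, map_sub]
    ring
  rw [h3, h1, h2, hn', map_mul, hval, hval, hst]
  have h4 : (commCoeff a b s t : K) = (((a * b) ^ (-s) : Kˣ) : K) * ((a ^ (s + t) : Kˣ) : K)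
      - (((a * b) ^ s : Kˣ) : K) * ((a⁻¹ ^ (s + t) : Kˣ) : K) := by
    have e3 : b ^ (-s) * a ^ t = (a * b) ^ (-s) * a ^ (s + t) := by
      rw [mul_zpow, mul_right_comm, ← zpow_add, mul_comm, neg_add_cancel_left]
    have e4 : b ^ s * a ^ (-t) = (a * b) ^ s * a⁻¹ ^ (s + t) := by
      rw [mul_zpow, inv_zpow', mul_right_comm, ← zpow_add, mul_comm, neg_add, add_neg_cancel_left]
    rw [commCoeff, ← Units.val_mul, ← Units.val_mul, ← Units.val_mul, ← Units.val_mul, e3, e4]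
  rw [h4, hD]
  simp only [map_mul, map_sub]
  ring

lemma vertex_comm (a b : Kˣ) (s t : ℤ) (g : Fock K) :
    C (sg (a * b) 1) * (vertex (fun k => sg a k) s (vertex (fun k => sg b k) t g)
        - vertex (fun k => sg b k) t (vertex (fun k => sg a k) s g))
      = C (sg a 1 * sg b 1 * commCoeff a b s t) * vertex (fun k => sg (a * b) k) (s + t) g := by
  induction g using pw_induction_C generalizing s t with
  | hC c =>
    rw [← mul_one (C c)]
    simp only [vertex_C_mul, vertex_one]
    linear_combination C c * homog_mul_homog_comm a b s t
  | hadd f g hf hg =>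
    simp only [map_add]
    linear_combination hf s t + hg s t
  | hp k g hg =>
    have z : ∀ (c : Kˣ) (s : ℤ) (g : Fock K), vertex (fun k => sg c k) s (pw k * g)
        = pw k * vertex (fun k => sg c k) s g + C (sg c k) * vertex (fun k => sg c k) (s + k) g :=
      fun c s g => vertex_pw_mul _ (by simp) s k g
    simp only [z, map_add, vertex_C_mul]
    have h1 := hg s t
    have h2 := hg (s + k) t
    have h3 := hg s (t + k)
    have h4 := congrArg (C (σ := ℕ)) (commCoeff_add a b s t k)
    simp only [map_mul, map_add] at h1 h2 h3 h4 ⊢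
    rw [add_right_comm s (k : ℤ) t] at h2
    rw [← add_assoc s t (k : ℤ)] at h3
    linear_combination pw k * h1 + C (sg a k) * h2 + C (sg b k) * h3
      + C (sg a 1) * C (sg b 1) * vertex (fun k => sg (a * b) k) (s + t + k) g * h4

end Commutator

section Cumulant

variable {ι R : Type*} [DecidableEq ι] [CommRing R]

/-- The subsets of `S` that contain `r`. -/
def rooted (r : ι) (S : Finset ι) : Finset (Finset ι) := S.powerset.filter (r ∈ ·)

lemma mem_rooted {r : ι} {S B : Finset ι} : B ∈ rooted r S ↔ B ⊆ S ∧ r ∈ B := by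
  simp [rooted]

lemma rooted_self {r : ι} {S : Finset ι} (h : r ∈ S) : S ∈ rooted r S := by
  simp [mem_rooted, h]

lemma sdiff_ssubset_of_mem {r : ι} {S B : Finset ι} (h : B ∈ rooted r S) : S \ B ⊂ S := by
  rw [mem_rooted] at h
  exact sdiff_ssubset h.1 ⟨r, h.2⟩

lemma ssubset_of_mem_erase {r : ι} {S B : Finset ι} (h : B ∈ (rooted r S).erase S) : B ⊂ S := by
  rw [mem_erase, mem_rooted] at h
  exact h.2.1.ssubset_of_ne h.1

open Classical in
/-- The joint cumulants of a family of moments. -/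
def cumulant (M : Finset ι → R) (S : Finset ι) : R :=
  if h : S.Nonempty then
    M S - ∑ B ∈ ((rooted h.choose S).erase S).attach, cumulant M B.1 * M (S \ B.1)
  else 0
termination_by S.card
decreasing_by exact card_lt_card (ssubset_of_mem_erase B.2)

lemma sum_rooted_eq {A : Type*} [AddCommMonoid A] {r : ι} {S : Finset ι} (h : r ∈ S)
    (F : Finset ι → A) :
    ∑ B ∈ rooted r S, F B = F S + ∑ B ∈ (rooted r S).erase S, F B :=
  (add_sum_erase _ _ (rooted_self h)).symm

lemma cumulant_choose (M : Finset ι → R) (h0 : M ∅ = 1) {S : Finset ι} (h : S.Nonempty) :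
    M S = ∑ B ∈ rooted h.choose S, cumulant M B * M (S \ B) := by
  rw [sum_rooted_eq h.choose_spec, Finset.sdiff_self, h0, mul_one, cumulant, dif_pos h,
    sum_attach _ fun B => cumulant M B * M (S \ B)]
  ring

lemma sum_rooted_split {A : Type*} [AddCommMonoid A] (r r' : ι) (S : Finset ι)
    (F : Finset ι → A) :
    ∑ B ∈ rooted r S, F B = ∑ B ∈ (rooted r S).filter (r' ∈ ·), F B
      + ∑ B ∈ (rooted r S).filter (r' ∉ ·), F B :=
  (sum_filter_add_sum_filter_not _ _ _).symm

/-- The moments are recovered from the cumulants, whatever the root. -/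
lemma moment_eq_sum (M : Finset ι → R) (h0 : M ∅ = 1) {r : ι} {S : Finset ι} (h : r ∈ S) :
    M S = ∑ B ∈ rooted r S, cumulant M B * M (S \ B) := by
  induction S using strongInduction generalizing r with
  | H S ih =>
    have hS : S.Nonempty := ⟨r, h⟩
    set r' := hS.choose with hr'
    have h' : r' ∈ S := hS.choose_spec
    rw [cumulant_choose M h0 hS, ← hr', sum_rooted_split r' r, sum_rooted_split r r']
    have e1 : (rooted r' S).filter (r ∈ ·) = (rooted r S).filter (r' ∈ ·) := by
      ext B; simp only [mem_filter, mem_rooted]; tauto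
    rw [e1]
    congr 1
    have key : ∀ {a b : ι}, a ∈ S → b ∈ S →
        ∑ B ∈ (rooted a S).filter (b ∉ ·), cumulant M B * M (S \ B)
          = ∑ p ∈ (S.powerset ×ˢ S.powerset).filter
              (fun p => a ∈ p.1 ∧ b ∈ p.2 ∧ Disjoint p.1 p.2),
              cumulant M p.1 * cumulant M p.2 * M (S \ (p.1 ∪ p.2)) := by
      intro a b ha hb
      have : ∀ B ∈ (rooted a S).filter (b ∉ ·), cumulant M B * M (S \ B)
          = ∑ B' ∈ rooted b (S \ B), cumulant M B * cumulant M B' * M (S \ (B ∪ B')) := by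
        intro B hB
        rw [mem_filter] at hB
        rw [ih _ (sdiff_ssubset_of_mem hB.1) (mem_sdiff.2 ⟨hb, hB.2⟩), mul_sum]
        refine sum_congr rfl fun B' _ => ?_
        rw [sdiff_sdiff_left, mul_assoc]
        rfl
      rw [sum_congr rfl this, sum_sigma']
      refine sum_bij' (fun x _ => (x.1, x.2)) (fun p _ => ⟨p.1, p.2⟩) ?_ ?_ ?_ ?_ ?_
      · rintro ⟨B, B'⟩ hx
        simp only [mem_sigma, mem_filter, mem_rooted, subset_sdiff] at hx
        simp only [mem_filter, mem_product, mem_powerset]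
        exact ⟨⟨hx.1.1.1, hx.2.1.1⟩, hx.1.1.2, hx.2.2, hx.2.1.2.symm⟩
      · rintro ⟨B, B'⟩ hx
        simp only [mem_filter, mem_product, mem_powerset] at hx
        simp only [mem_sigma, mem_filter, mem_rooted, subset_sdiff]
        exact ⟨⟨⟨hx.1.1, hx.2.1⟩, fun hb' => disjoint_left.1 hx.2.2.2 hb' hx.2.2.1⟩,
          ⟨hx.1.2, hx.2.2.2.symm⟩, hx.2.2.1⟩
      · intros; rfl
      · intros; rfl
      · intros; rfl
    rw [key h' h, key h h']
    refine sum_bij' (fun p _ => p.swap) (fun p _ => p.swap) ?_ ?_ ?_ ?_ ?_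
    · rintro ⟨B, B'⟩ hx
      simp only [mem_filter, mem_product, Prod.swap, disjoint_comm] at hx ⊢
      tauto
    · rintro ⟨B, B'⟩ hx
      simp only [mem_filter, mem_product, Prod.swap, disjoint_comm] at hx ⊢
      tauto
    · intros; rfl
    · intros; rfl
    · rintro ⟨B, B'⟩ _
      simp only [Prod.swap]
      rw [union_comm, mul_comm (cumulant M B)]

/-- Cumulants containing a given site are determined by the moment formula rooted there. -/
lemma cumulant_unique (M k : Finset ι → R) (h0 : M ∅ = 1) (r : ι) {T : Finset ι}
    (hk : ∀ S ⊆ T, r ∈ S → M S = ∑ B ∈ rooted r S, k B * M (S \ B)) (h : r ∈ T) :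
    cumulant M T = k T := by
  induction T using strongInduction with
  | H S ih =>
    have h1 := hk S subset_rfl h
    rw [moment_eq_sum M h0 h, sum_rooted_eq h, sum_rooted_eq h, Finset.sdiff_self, h0, mul_one,
      mul_one] at h1
    rw [sum_congr rfl fun B hB => by
      rw [ih B (ssubset_of_mem_erase hB) (fun S' hS' => hk S' (hS'.trans (ssubset_of_mem_erase hB).1))
        (mem_rooted.1 (mem_of_mem_erase hB)).2]] at h1
    exact add_right_cancel h1

lemma cumulant_empty (M : Finset ι → R) : cumulant M ∅ = 0 := by
  rw [cumulant, dif_neg Finset.not_nonempty_empty]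

lemma cumulant_congr (M M' : Finset ι → R) (h0 : M ∅ = 1) {T : Finset ι}
    (h : ∀ S ⊆ T, M S = M' S) : cumulant M T = cumulant M' T := by
  rcases T.eq_empty_or_nonempty with rfl | ⟨r, hr⟩
  · rw [cumulant_empty, cumulant_empty]
  refine cumulant_unique M _ h0 r (fun S hS hrS => ?_) hr
  rw [h S hS, moment_eq_sum M' (by rw [← h ∅ (by simp), h0]) hrS]
  refine sum_congr rfl fun B _ => ?_
  rw [h (S \ B) (sdiff_subset.trans hS)]

lemma cumulant_scale (M M' : Finset ι → R) (h0 : M ∅ = 1) (φ : ι → R)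
    (h : ∀ S, M' S = (∏ i ∈ S, φ i) * M S) (T : Finset ι) :
    cumulant M' T = (∏ i ∈ T, φ i) * cumulant M T := by
  rcases T.eq_empty_or_nonempty with rfl | ⟨r, hr⟩
  · rw [cumulant_empty, cumulant_empty, mul_zero]
  refine cumulant_unique M' (fun B => (∏ i ∈ B, φ i) * cumulant M B) (by simp [h, h0]) r
    (fun S hS hrS => ?_) hr
  rw [h S, moment_eq_sum M h0 hrS, mul_sum]
  refine sum_congr rfl fun B hB => ?_
  rw [h, ← prod_sdiff (mem_rooted.1 hB).1]
  ring

lemma cumulant_sub (M M' M'' : Finset ι → R) (h0 : M ∅ = 1) (h0' : M' ∅ = 1) (h0'' : M'' ∅ = 1)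
    (r : ι) (T : Finset ι) (hr : r ∈ T) (h : ∀ S ⊆ T, r ∈ S → M S = M' S - M'' S)
    (hb : ∀ S ⊆ T, r ∉ S → M S = M' S) (ha : ∀ S ⊆ T, r ∉ S → M S = M'' S) :
    cumulant M T = cumulant M' T - cumulant M'' T := by
  refine cumulant_unique M (fun B => cumulant M' B - cumulant M'' B) h0 r (fun S hS hrS => ?_) hr
  rw [h S hS hrS, moment_eq_sum M' h0' hrS, moment_eq_sum M'' h0'' hrS, ← sum_sub_distrib]
  refine sum_congr rfl fun B hB => ?_
  have hn : r ∉ S \ B := fun hh => (mem_sdiff.1 hh).2 (mem_rooted.1 hB).2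
  have hs : S \ B ⊆ T := sdiff_subset.trans hS
  rw [sub_mul, hb _ hs hn, ← ha _ hs hn, ← hb _ hs hn]

/-- Cumulants containing a site `r` at which the moments reduce to moments with one site less. -/
lemma cumulant_of_reduction (M : Finset ι → R) (Mj : ι → Finset ι → R) (h0 : M ∅ = 1)
    (hj0 : ∀ j, Mj j ∅ = 1) (r : ι) (lam : ι → R) {T : Finset ι} (hr : r ∈ T)
    (hred : ∀ S ⊆ T, r ∈ S → M S = M (S.erase r) + ∑ j ∈ S.erase r, lam j * Mj j (S.erase r))
    (hloc : ∀ j, ∀ S ⊆ T, r ∉ S → j ∉ S → Mj j S = M S) (hT : T ≠ {r}) :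
    cumulant M T = ∑ j ∈ T.erase r, lam j * cumulant (Mj j) (T.erase r) := by
  have key := cumulant_unique M (fun B => if B = {r} then 1 else
      ∑ j ∈ B.erase r, lam j * cumulant (Mj j) (B.erase r)) h0 r (T := T) ?_ hr
  · rw [key, if_neg hT]
  intro S hS hrS
  have hb : ∑ B ∈ rooted r S, (if B = {r} then 1 else
      ∑ j ∈ B.erase r, lam j * cumulant (Mj j) (B.erase r)) * M (S \ B)
      = ∑ B ∈ (S.erase r).powerset, (if B = ∅ then 1 else
        ∑ j ∈ B, lam j * cumulant (Mj j) B) * M (S.erase r \ B) := by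
    refine sum_bij' (fun B _ => B.erase r) (fun B _ => insert r B) ?_ ?_ ?_ ?_ ?_
    · intro B hB
      exact mem_powerset.2 (erase_subset_erase r (mem_rooted.1 hB).1)
    · intro B hB
      rw [mem_powerset] at hB
      exact mem_rooted.2 ⟨insert_subset hrS (hB.trans (erase_subset _ _)), by simp⟩
    · intro B hB
      exact insert_erase (mem_rooted.1 hB).2
    · intro B hB
      rw [mem_powerset] at hB
      exact erase_insert fun h => by simpa using hB h
    · intro B hB
      have hrB := (mem_rooted.1 hB).2
      have e1 : B = {r} ↔ B.erase r = ∅ := by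
        rw [erase_eq_empty_iff]
        constructor
        · exact Or.inr
        · rintro (rfl | h)
          · simp at hrB
          · exact h
      have e2 : S \ B = S.erase r \ B.erase r := by
        ext x
        simp only [mem_sdiff, mem_erase]
        constructor
        · rintro ⟨h1, h2⟩
          exact ⟨⟨fun h => h2 (h ▸ hrB), h1⟩, fun h => h2 h.2⟩
        · rintro ⟨⟨h1, h2⟩, h3⟩
          exact ⟨h2, fun h => h3 ⟨h1, h⟩⟩
      simp only [e1, e2]
  rw [hred S hS hrS, hb, ← add_sum_erase _ _ (empty_mem_powerset _), if_pos rfl,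
    one_mul, sdiff_empty]
  congr 1
  have h2 : ∀ j ∈ S.erase r, lam j * Mj j (S.erase r)
      = ∑ B ∈ rooted j (S.erase r), lam j * cumulant (Mj j) B * M (S.erase r \ B) := by
    intro j hj
    rw [moment_eq_sum (Mj j) (hj0 j) hj, mul_sum]
    refine sum_congr rfl fun B hB => ?_
    rw [hloc j _ (sdiff_subset.trans ((erase_subset _ _).trans hS)) (by simp)
      (fun hh => (mem_sdiff.1 hh).2 (mem_rooted.1 hB).2), mul_assoc]
  rw [sum_congr rfl h2]
  have h3 : ∀ B ∈ (S.erase r).powerset.erase ∅,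
      (if B = ∅ then 1 else ∑ j ∈ B, lam j * cumulant (Mj j) B) * M (S.erase r \ B)
      = ∑ j ∈ B, lam j * cumulant (Mj j) B * M (S.erase r \ B) := by
    intro B hB
    rw [if_neg (ne_of_mem_erase hB), sum_mul]
  rw [sum_congr rfl h3]
  refine sum_comm' fun j B => ?_
  simp only [mem_rooted, mem_erase (a := B), mem_powerset]
  constructor
  · rintro ⟨-, h, hj⟩
    exact ⟨hj, fun hB => by simp [hB] at hj, h⟩
  · rintro ⟨h, -, hj⟩
    exact ⟨hj h, hj, h⟩

/-- Inclusion–exclusion for a function that is additive in each coordinate of a finite set. -/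
lemma sum_powerset_piecewise {A V : Type*} [AddCommGroup A] [AddCommGroup V] (F : (ι → V) → A)
    (x y : ι → V) (D : Finset ι)
    (hF : ∀ i ∈ D, ∀ (z : ι → V), F (update z i (x i - y i))
      = F (update z i (x i)) - F (update z i (y i))) :
    F (D.piecewise (x - y) x)
      = ∑ Z ∈ D.powerset, (-1 : ℤ) ^ Z.card • F (Z.piecewise y x) := by
  have gen : ∀ (D E : Finset ι), (∀ i ∈ D, ∀ (z : ι → V), F (update z i (x i - y i))
      = F (update z i (x i)) - F (update z i (y i))) → Disjoint D E →
      F (D.piecewise (x - y) (E.piecewise y x))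
      = ∑ Z ∈ D.powerset, (-1 : ℤ) ^ Z.card • F ((Z ∪ E).piecewise y x) := by
    intro D
    induction D using Finset.induction_on with
    | empty =>
      intro E _ _
      rw [powerset_empty, sum_singleton, card_empty, pow_zero, one_smul,
        empty_union, piecewise_empty]
    | insert i D hi ih =>
      intro E h hE
      rw [disjoint_insert_left] at hE
      rw [piecewise_insert, Pi.sub_apply, h i (by simp), sum_powerset_insert hi]
      have e1 : update (D.piecewise (x - y) (E.piecewise y x)) i (x i)
          = D.piecewise (x - y) (E.piecewise y x) := by
        rw [Function.update_eq_self_iff, piecewise_eq_of_notMem _ _ _ hi,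
          piecewise_eq_of_notMem _ _ _ hE.1]
      have e2 : update (D.piecewise (x - y) (E.piecewise y x)) i (y i)
          = D.piecewise (x - y) ((insert i E).piecewise y x) := by
        rw [piecewise_insert, update_piecewise_of_notMem _ _ _ hi]
      rw [e1, e2, ih E (fun j hj => h j (by simp [hj])) hE.2,
        ih (insert i E) (fun j hj => h j (by simp [hj])) (by
          rw [disjoint_insert_right]; exact ⟨hi, hE.2⟩), sub_eq_add_neg,
          ← sum_neg_distrib]
      congr 1
      refine sum_congr rfl fun Z hZ => ?_
      have hiZ : i ∉ Z := fun h => hi (mem_powerset.1 hZ h)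
      rw [card_insert_of_notMem hiZ, pow_succ, mul_neg_one, neg_smul, union_insert,
        insert_union]
  have := gen D ∅ hF (by simp)
  rw [piecewise_empty] at this
  rw [this]
  refine sum_congr rfl fun Z _ => ?_
  rw [union_empty]

end Cumulant

section CutJoinProduct

open MvPolynomial

variable {K β : Type*} [CommRing K] [DecidableEq β]

lemma shiftDer_prod (k : ℕ) (O : Finset β) (m : β → ℕ) :
    shiftDer k (∏ i ∈ O, pw (m i) : Fock K)
      = ∑ j ∈ O, (m j : Fock K) * pw (k + m j) * ∏ i ∈ O.erase j, pw (m i) := by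
  induction O using Finset.induction_on with
  | empty => simp
  | insert a O ha ih =>
    rw [prod_insert ha, Derivation.leibniz, shiftDer_pw, ih, sum_insert ha,
      erase_insert ha, smul_eq_mul, smul_eq_mul, mul_sum, add_comm]
    congr 1
    · ring
    · refine sum_congr rfl fun j hj => ?_
      have haj : a ≠ j := fun h => ha (h ▸ hj)
      rw [erase_insert_of_ne haj, prod_insert (by simp [ha])]
      ring

/-- The cut-and-join operator on a product of power sums. -/
lemma cutJoin_prod (O : Finset β) (m : β → ℕ) :
    cutJoin (∏ i ∈ O, pw (m i) : Fock K)
      = ∑ i ∈ O, (m i : Fock K) * (quad (m i) * ∏ l ∈ O.erase i, pw (m l)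
        + ∑ j ∈ O.erase i, (m j : Fock K) * pw (m i + m j)
          * ∏ l ∈ (O.erase i).erase j, pw (m l)) := by
  induction O using Finset.induction_on with
  | empty => simp [cutJoin_one]
  | insert a O ha ih =>
    rw [prod_insert ha, cutJoin_pw_mul, ih, sum_insert ha, erase_insert ha,
      stepOp_apply, shiftDer_prod]
    have h1 : ∀ i ∈ O, (m i : Fock K) * (quad (m i) * ∏ l ∈ (insert a O).erase i, pw (m l)
        + ∑ j ∈ (insert a O).erase i, (m j : Fock K) * pw (m i + m j)
          * ∏ l ∈ ((insert a O).erase i).erase j, pw (m l))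
        = pw (m a) * ((m i : Fock K) * (quad (m i) * ∏ l ∈ O.erase i, pw (m l)
        + ∑ j ∈ O.erase i, (m j : Fock K) * pw (m i + m j)
          * ∏ l ∈ (O.erase i).erase j, pw (m l)))
          + (m a : Fock K) * ((m i : Fock K) * pw (m a + m i) * ∏ l ∈ O.erase i, pw (m l)) := by
      intro i hi
      have hai : a ≠ i := fun h => ha (h ▸ hi)
      have ha' : a ∉ O.erase i := by simp [ha]
      rw [erase_insert_of_ne hai, prod_insert ha', sum_insert ha',
        erase_insert ha']
      have h2 : ∀ j ∈ O.erase i, (m j : Fock K) * pw (m i + m j)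
          * ∏ l ∈ (insert a (O.erase i)).erase j, pw (m l)
          = pw (m a) * ((m j : Fock K) * pw (m i + m j)
          * ∏ l ∈ (O.erase i).erase j, pw (m l)) := by
        intro j hj
        have haj : a ≠ j := fun h => ha' (h ▸ hj)
        rw [erase_insert_of_ne haj, prod_insert (by simp [ha])]
        ring
      rw [sum_congr rfl h2, ← mul_sum, add_comm (m i) (m a)]
      ring
    rw [sum_congr rfl h1, sum_add_distrib, ← mul_sum, ← mul_sum]
    ring

end CutJoinProduct

section Orbits

open MvPolynomial

variable {β : Type*} [Fintype β] [DecidableEq β]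

open Classical in
/-- The orbit of a point under a permutation. -/
def orb (σ : Perm β) (x : β) : Finset β := univ.filter (σ.SameCycle x)

lemma mem_orb {σ : Perm β} {x y : β} : y ∈ orb σ x ↔ σ.SameCycle x y := by simp [orb]

lemma self_mem_orb (σ : Perm β) (x : β) : x ∈ orb σ x := mem_orb.2 (Perm.SameCycle.refl σ x)

lemma orb_eq_iff {σ : Perm β} {x y : β} : orb σ x = orb σ y ↔ σ.SameCycle x y := by
  constructor
  · intro h
    exact mem_orb.1 (h ▸ self_mem_orb σ y)
  · intro h
    ext z
    rw [mem_orb, mem_orb]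
    exact ⟨fun h' => h.symm.trans h', fun h' => h.trans h'⟩

lemma orb_eq_of_mem {σ : Perm β} {x y : β} (h : y ∈ orb σ x) : orb σ y = orb σ x :=
  (orb_eq_iff.2 (mem_orb.1 h)).symm

lemma iterate_mem_orb (σ : Perm β) (x : β) (i : ℕ) : σ^[i] x ∈ orb σ x :=
  mem_orb.2 ⟨i, by rw [zpow_natCast, ← Perm.iterate_eq_pow]⟩

lemma period_pos (σ : Perm β) (x : β) : 0 < minimalPeriod σ x :=
  minimalPeriod_pos_of_mem_periodicPts (σ.injective.mem_periodicPts x)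

lemma orb_eq_image (σ : Perm β) (x : β) :
    orb σ x = (range (minimalPeriod σ x)).image fun i => σ^[i] x := by
  ext y
  rw [mem_orb, mem_image]
  constructor
  · intro h
    obtain ⟨i, -, hi⟩ := h.exists_pow_eq'
    refine ⟨i % minimalPeriod σ x,
      mem_range.2 (Nat.mod_lt _ (period_pos σ x)), ?_⟩
    rw [Function.iterate_mod_minimalPeriod_eq, Perm.iterate_eq_pow, hi]
  · rintro ⟨i, -, rfl⟩
    exact mem_orb.1 (iterate_mem_orb σ x i)

lemma card_orb (σ : Perm β) (x : β) : (orb σ x).card = minimalPeriod σ x := by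
  rw [orb_eq_image, card_image_of_injOn, card_range]
  intro i hi j hj h
  exact Function.iterate_injOn_Iio_minimalPeriod (by simpa using hi) (by simpa using hj) h

lemma minimalPeriod_eq_of {f : β → β} {x : β} {t : ℕ} (ht : 0 < t) (h : f^[t] x = x)
    (h' : ∀ i, 0 < i → i < t → f^[i] x ≠ x) : minimalPeriod f x = t := by
  refine le_antisymm (Function.IsPeriodicPt.minimalPeriod_le ht h) ?_
  by_contra! hlt
  exact h' _ (minimalPeriod_pos_of_mem_periodicPts ⟨t, ht, h⟩) hlt
    (iterate_minimalPeriod)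

lemma iterate_ne_of_lt {σ : Perm β} {x : β} {i j : ℕ} (hi : i < minimalPeriod σ x)
    (hj : j < minimalPeriod σ x) (h : i ≠ j) : σ^[i] x ≠ σ^[j] x :=
  fun h' => h (Function.iterate_injOn_Iio_minimalPeriod hi hj h')

lemma iterate_swap_mul {σ : Perm β} {a b : β} {t : ℕ}
    (h : ∀ i, 0 < i → i < t → σ^[i] a ≠ a ∧ σ^[i] a ≠ b) {i : ℕ} (hi : i < t) :
    (swap a b * σ)^[i] a = σ^[i] a := by
  induction i with
  | zero => rfl
  | succ i ih =>
    rw [iterate_succ_apply', ih (by omega), Perm.mul_apply,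
      ← iterate_succ_apply' (f := σ)]
    exact swap_apply_of_ne_of_ne (h _ (by omega) hi).1 (h _ (by omega) hi).2

lemma iterate_swap_mul_self {σ : Perm β} {a b : β} {t : ℕ} (ht : 0 < t)
    (h : ∀ i, 0 < i → i < t → σ^[i] a ≠ a ∧ σ^[i] a ≠ b) :
    (swap a b * σ)^[t] a = swap a b (σ^[t] a) := by
  obtain ⟨t, rfl⟩ := Nat.exists_eq_succ_of_ne_zero ht.ne'
  rw [iterate_succ_apply', iterate_swap_mul h (Nat.lt_succ_self t), Perm.mul_apply,
    ← iterate_succ_apply' (f := σ)]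

lemma split_left {σ : Perm β} {a b : β} {t : ℕ} (ht : 0 < t)
    (ht' : t < minimalPeriod σ a) (hb : σ^[t] a = b) :
    minimalPeriod (swap a b * σ) a = t ∧
      orb (swap a b * σ) a = (range t).image fun i => σ^[i] a := by
  have h : ∀ i, 0 < i → i < t → σ^[i] a ≠ a ∧ σ^[i] a ≠ b := fun i h1 h2 =>
    ⟨iterate_ne_of_lt (j := 0) (by omega) (by omega) (by omega),
      hb ▸ iterate_ne_of_lt (by omega) (by omega) (by omega)⟩
  have hp : minimalPeriod (swap a b * σ) a = t := by
    refine minimalPeriod_eq_of ht ?_ fun i h1 h2 => ?_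
    · rw [iterate_swap_mul_self ht h, hb, swap_apply_right]
    · rw [iterate_swap_mul h h2]
      exact (h i h1 h2).1
  refine ⟨hp, ?_⟩
  rw [orb_eq_image, hp]
  refine image_congr fun i hi => ?_
  exact iterate_swap_mul h (by simpa using hi)

lemma minimalPeriod_iterate' (σ : Perm β) (a : β) (t : ℕ) :
    minimalPeriod σ (σ^[t] a) = minimalPeriod σ a := by
  rw [← card_orb, ← card_orb, orb_eq_of_mem (iterate_mem_orb σ a t)]

lemma orb_swap_of_notMem {σ : Perm β} {a b x : β} (ha : x ∉ orb σ a) (hb : x ∉ orb σ b) :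
    orb (swap a b * σ) x = orb σ x := by
  have h : ∀ i, (swap a b * σ)^[i] x = σ^[i] x := by
    intro i
    induction i with
    | zero => rfl
    | succ i ih =>
      rw [iterate_succ_apply', ih, Perm.mul_apply, ← iterate_succ_apply' (f := σ)]
      refine swap_apply_of_ne_of_ne (fun h => ha ?_) (fun h => hb ?_)
      all_goals
        rw [← h, orb_eq_of_mem (iterate_mem_orb σ x _)]
        exact self_mem_orb σ x
  have hp : minimalPeriod (swap a b * σ) x = minimalPeriod σ x := by
    rw [Function.minimalPeriod_eq_minimalPeriod_iff]
    intro n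
    rw [IsPeriodicPt, IsPeriodicPt, IsFixedPt, IsFixedPt, h]
  rw [orb_eq_image, orb_eq_image, hp]
  exact image_congr fun i _ => h i

/-- The set of orbits of a permutation. -/
def orbits (σ : Perm β) : Finset (Finset β) := univ.image (orb σ)

lemma orb_mem_orbits (σ : Perm β) (x : β) : orb σ x ∈ orbits σ := by simp [orbits]

/-- Multiplying by a transposition of two points in the same orbit splits this orbit. -/
lemma split_orbits {σ : Perm β} {a b : β} {t : ℕ} (ht : 0 < t)
    (ht' : t < minimalPeriod σ a) (hb : σ^[t] a = b) :
    (orb (swap a b * σ) a).card = t ∧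
    (orb (swap a b * σ) b).card = minimalPeriod σ a - t ∧
    b ∉ orb (swap a b * σ) a ∧
    ((orbits (swap a b * σ)).erase (orb (swap a b * σ) a)).erase (orb (swap a b * σ) b)
      = (orbits σ).erase (orb σ a) := by
  have hl := split_left ht ht' hb
  have hpb : minimalPeriod σ b = minimalPeriod σ a := by
    rw [← hb, minimalPeriod_iterate']
  have hr := split_left (σ := σ) (a := b) (b := a) (t := minimalPeriod σ a - t) (by omega)
    (by omega) (by
      rw [← hb, ← Function.iterate_add_apply, Nat.sub_add_cancel ht'.le,
        iterate_minimalPeriod])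
  rw [swap_comm b a] at hr
  have hba : b ∉ orb (swap a b * σ) a := by
    rw [hl.2, mem_image]
    rintro ⟨i, hi, h⟩
    rw [mem_range] at hi
    exact iterate_ne_of_lt (hi.trans ht') ht' hi.ne (h.trans hb.symm)
  refine ⟨by rw [card_orb, hl.1], by rw [card_orb, hr.1], hba, ?_⟩
  have hbo : b ∈ orb σ a := hb ▸ iterate_mem_orb σ a t
  have hu : orb σ a ⊆ orb (swap a b * σ) a ∪ orb (swap a b * σ) b := by
    rw [orb_eq_image σ a, hl.2, hr.2]
    intro x hx
    obtain ⟨i, hi, rfl⟩ := mem_image.1 hx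
    rw [mem_range] at hi
    rw [mem_union, mem_image, mem_image]
    rcases lt_or_ge i t with h | h
    · exact Or.inl ⟨i, mem_range.2 h, rfl⟩
    · refine Or.inr ⟨i - t, mem_range.2 (by omega), ?_⟩
      rw [← hb, ← Function.iterate_add_apply, Nat.sub_add_cancel h]
  have hua : orb (swap a b * σ) a ⊆ orb σ a := by
    rw [hl.2]
    intro x hx
    obtain ⟨i, -, rfl⟩ := mem_image.1 hx
    exact iterate_mem_orb σ a i
  have hub : orb (swap a b * σ) b ⊆ orb σ a := by
    rw [hr.2]
    intro x hx
    obtain ⟨i, -, rfl⟩ := mem_image.1 hx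
    rw [← orb_eq_of_mem hbo]
    exact iterate_mem_orb σ b i
  have hout : ∀ x, x ∉ orb σ a → orb (swap a b * σ) x = orb σ x := fun x hx =>
    orb_swap_of_notMem hx (by rwa [orb_eq_of_mem hbo])
  ext o
  simp only [mem_erase, orbits, mem_image, mem_univ, true_and]
  constructor
  · rintro ⟨h1, h2, x, rfl⟩
    have hx : x ∉ orb σ a := by
      intro hx
      rcases mem_union.1 (hu hx) with h | h
      · exact h2 (orb_eq_of_mem h)
      · exact h1 (orb_eq_of_mem h)
    rw [hout x hx]
    exact ⟨fun h => hx (h ▸ self_mem_orb σ x), x, rfl⟩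
  · rintro ⟨h1, x, rfl⟩
    have hx : x ∉ orb σ a := fun h => h1 (orb_eq_of_mem h)
    rw [← hout x hx]
    refine ⟨fun h => hx (hub ?_), fun h => hx (hua ?_), x, rfl⟩
    all_goals
      rw [← h]
      exact self_mem_orb _ x

/-- The product of power sums attached to the orbits of a permutation. -/
def orbProd (K : Type*) [CommRing K] (σ : Perm β) : Fock K :=
  ∏ o ∈ orbits σ, pw o.card

variable {K : Type*} [CommRing K]

lemma orbProd_eq (σ : Perm β) (a : β) :
    orbProd K σ = pw (orb σ a).card * ∏ o ∈ (orbits σ).erase (orb σ a), pw o.card :=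
  (mul_prod_erase _ _ (orb_mem_orbits σ a)).symm

lemma orbProd_eq₂ {σ : Perm β} {a b : β} (h : b ∉ orb σ a) :
    orbProd K σ = pw (orb σ a).card * pw (orb σ b).card
      * ∏ o ∈ ((orbits σ).erase (orb σ a)).erase (orb σ b), pw o.card := by
  have hne : orb σ b ≠ orb σ a := fun h' => h (h' ▸ self_mem_orb σ b)
  rw [orbProd_eq σ a, ← mul_prod_erase _ _ (mem_erase.2 ⟨hne, orb_mem_orbits σ b⟩),
    mul_assoc]

lemma orbProd_split {σ : Perm β} {a : β} {t : ℕ} (ht : 0 < t)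
    (ht' : t < minimalPeriod σ a) :
    orbProd K (swap a (σ^[t] a) * σ) = pw t * pw (minimalPeriod σ a - t)
      * ∏ o ∈ (orbits σ).erase (orb σ a), pw o.card := by
  obtain ⟨h1, h2, h3, h4⟩ := split_orbits ht ht' rfl
  rw [orbProd_eq₂ h3, h1, h2, h4]

lemma orbProd_join {σ : Perm β} {a b : β} (h : b ∉ orb σ a) :
    orbProd K (swap a b * σ) = pw ((orb σ a).card + (orb σ b).card)
      * ∏ o ∈ ((orbits σ).erase (orb σ a)).erase (orb σ b), pw o.card := by
  set ρ := swap a b * σ with hρ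
  have hσ : σ = swap a b * ρ := by rw [hρ, swap_mul_self_mul]
  have hne : ∀ i, 0 < i → i < minimalPeriod σ a → σ^[i] a ≠ a ∧ σ^[i] a ≠ b :=
    fun i h1 h2 => ⟨iterate_ne_of_lt (j := 0) h2 (period_pos σ a) h1.ne',
      fun h' => h (h' ▸ iterate_mem_orb σ a i)⟩
  have hab : a ≠ b := fun h' => h (h' ▸ self_mem_orb σ a)
  have ht : ρ^[minimalPeriod σ a] a = b := by
    rw [hρ, iterate_swap_mul_self (period_pos σ a) hne, iterate_minimalPeriod,
      swap_apply_left]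
  have ht' : minimalPeriod σ a < minimalPeriod ρ a := by
    by_contra! hle
    rcases hle.lt_or_eq with hlt | heq
    · have := iterate_swap_mul hne hlt
      rw [← hρ, iterate_minimalPeriod] at this
      exact (hne _ (period_pos ρ a) hlt).1 this.symm
    · rw [← heq, iterate_minimalPeriod] at ht
      exact hab ht
  obtain ⟨h1, h2, h3, h4⟩ := split_orbits (period_pos σ a) ht' ht
  rw [← hσ] at h1 h2 h3 h4
  rw [orbProd_eq ρ a, ← h4, h2, card_orb σ a, card_orb ρ a, Nat.add_sub_cancel' ht'.le]

end Orbits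

section CutJoinOrbits

open MvPolynomial

variable {β : Type*} [Fintype β] [DecidableEq β] {K : Type*} [CommRing K]

lemma filter_orb_eq {σ : Perm β} {o : Finset β} (ho : o ∈ orbits σ) :
    univ.filter (fun x => orb σ x = o) = o := by
  obtain ⟨a, -, rfl⟩ := mem_image.1 ho
  ext x
  simp only [mem_filter, mem_univ, true_and]
  exact ⟨fun h => h ▸ self_mem_orb σ x, orb_eq_of_mem⟩

lemma sum_orb {A : Type*} [CommRing A] (σ : Perm β) (f : Finset β → A) :
    ∑ x, f (orb σ x) = ∑ o ∈ orbits σ, (o.card : A) * f o := by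
  rw [sum_comp f (orb σ)]
  refine sum_congr rfl fun o ho => ?_
  rw [filter_orb_eq ho, nsmul_eq_mul]

lemma sum_swap_orbProd (σ : Perm β) (a : β) :
    ∑ b ∈ univ.erase a, orbProd K (swap a b * σ)
      = quad (orb σ a).card * ∏ o ∈ (orbits σ).erase (orb σ a), pw o.card
        + ∑ o' ∈ (orbits σ).erase (orb σ a), (o'.card : Fock K) * pw ((orb σ a).card + o'.card)
          * ∏ o ∈ ((orbits σ).erase (orb σ a)).erase o', pw o.card := by
  rw [← sum_filter_add_sum_filter_not _ (· ∈ orb σ a)]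
  congr 1
  · have hset : (univ.erase a).filter (· ∈ orb σ a)
        = ((range (minimalPeriod σ a)).erase 0).image fun i => σ^[i] a := by
      rw [orb_eq_image]
      ext x
      simp only [mem_filter, mem_erase, mem_univ, mem_image,
        mem_range, and_true]
      constructor
      · rintro ⟨h, i, hi, rfl⟩
        exact ⟨i, ⟨fun h0 => h (by rw [h0]; rfl), hi⟩, rfl⟩
      · rintro ⟨i, ⟨h0, hi⟩, rfl⟩
        exact ⟨iterate_ne_of_lt (j := 0) hi (period_pos σ a) h0, i, hi, rfl⟩
    rw [hset, sum_image fun i hi j hj h => Function.iterate_injOn_Iio_minimalPeriod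
      (by simpa using (mem_of_mem_erase hi)) (by simpa using (mem_of_mem_erase hj)) h]
    have h1 : ∀ t ∈ (range (minimalPeriod σ a)).erase 0,
        orbProd K (swap a (σ^[t] a) * σ) = pw t * pw (minimalPeriod σ a - t)
          * ∏ o ∈ (orbits σ).erase (orb σ a), pw o.card := fun t ht => by
      rw [mem_erase, mem_range] at ht
      exact orbProd_split (Nat.pos_of_ne_zero ht.1) ht.2
    rw [sum_congr rfl h1, ← sum_mul, card_orb, quad,
      Finset.Nat.sum_antidiagonal_eq_sum_range_succ_mk, sum_range_succ, Nat.sub_self,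
      pw_zero, mul_zero, add_zero]
    congr 1
    refine sum_subset (erase_subset _ _) fun t ht ht' => ?_
    have : t = 0 := by
      by_contra h0
      exact ht' (mem_erase.2 ⟨h0, ht⟩)
    rw [this, pw_zero, zero_mul]
  · have hset : (univ.erase a).filter (· ∉ orb σ a)
        = univ.filter (fun x => orb σ x ≠ orb σ a) := by
      ext x
      simp only [mem_filter, mem_erase, mem_univ, true_and, and_true]
      constructor
      · rintro ⟨-, h⟩ h'
        exact h (h' ▸ self_mem_orb σ x)
      · intro h
        exact ⟨fun h' => h (by rw [h']), fun h' => h (orb_eq_of_mem h')⟩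
    have h1 : ∀ b ∈ univ.filter (fun x => orb σ x ≠ orb σ a),
        orbProd K (swap a b * σ) = pw ((orb σ a).card + (orb σ b).card)
          * ∏ o ∈ ((orbits σ).erase (orb σ a)).erase (orb σ b), pw o.card := fun b hb =>
      orbProd_join fun h => (mem_filter.1 hb).2 (orb_eq_of_mem h)
    rw [hset, sum_congr rfl h1, sum_filter,
      sum_orb σ fun o' => if o' ≠ orb σ a then pw ((orb σ a).card + o'.card)
          * ∏ o ∈ ((orbits σ).erase (orb σ a)).erase o', pw o.card else 0,
      ← add_sum_erase _ _ (orb_mem_orbits σ a), if_neg (by simp), mul_zero, zero_add]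
    refine sum_congr rfl fun o ho => ?_
    rw [if_pos (ne_of_mem_erase ho), mul_assoc]

lemma sum_sum_swap_orbProd (σ : Perm β) :
    ∑ a, ∑ b ∈ univ.erase a, orbProd K (swap a b * σ) = cutJoin (orbProd K σ) := by
  rw [sum_congr rfl fun a _ => sum_swap_orbProd σ a, orbProd, cutJoin_prod,
    sum_orb σ fun u => quad u.card * ∏ o ∈ (orbits σ).erase u, pw o.card
        + ∑ o' ∈ (orbits σ).erase u, (o'.card : Fock K) * pw (u.card + o'.card)
          * ∏ o ∈ ((orbits σ).erase u).erase o', pw o.card]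

open Classical in
/-- The set of all transpositions. -/
def swapSet (β : Type*) [Fintype β] [DecidableEq β] : Finset (Perm β) :=
  univ.filter Perm.IsSwap

lemma mem_swapSet {τ : Perm β} : τ ∈ swapSet β ↔ τ.IsSwap := by simp [swapSet]

lemma swap_eq_swap_iff {a b x y : β} (hxy : x ≠ y) :
    swap a b = swap x y ↔ a = x ∧ b = y ∨ a = y ∧ b = x := by
  constructor
  · intro h
    have h1 : swap a b x = y := by rw [h, swap_apply_left]
    rw [swap_apply_def] at h1
    split_ifs at h1 with h2 h3
    · exact Or.inl ⟨h2.symm, h1⟩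
    · exact Or.inr ⟨h1, h3.symm⟩
    · exact absurd h1 hxy
  · rintro (⟨rfl, rfl⟩ | ⟨rfl, rfl⟩)
    · rfl
    · exact swap_comm _ _

lemma sum_swapSet {A : Type*} [CommRing A] (f : Perm β → A) :
    ∑ a, ∑ b ∈ univ.erase a, f (swap a b) = 2 * ∑ τ ∈ swapSet β, f τ := by
  have e : ∑ a, ∑ b ∈ univ.erase a, f (swap a b)
      = ∑ p ∈ (univ : Finset β).offDiag, f (swap p.1 p.2) := by
    rw [sum_sigma']
    refine sum_bij' (fun x _ => (x.1, x.2)) (fun p _ => ⟨p.1, p.2⟩) ?_ ?_ ?_ ?_ ?_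
    · rintro ⟨a, b⟩ h
      simp only [mem_sigma, mem_erase] at h
      simpa using fun h' => h.2.1 h'.symm
    · rintro ⟨a, b⟩ h
      simp only [mem_offDiag] at h
      simpa using fun h' => h.2.2 h'.symm
    · intros; rfl
    · intros; rfl
    · intros; rfl
  rw [e, sum_comp f fun p : β × β => swap p.1 p.2, mul_sum]
  have him : ((univ : Finset β).offDiag.image fun p => swap p.1 p.2) = swapSet β := by
    ext τ
    rw [mem_swapSet, mem_image]
    constructor
    · rintro ⟨⟨a, b⟩, h, rfl⟩
      exact ⟨a, b, by simpa using h, rfl⟩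
    · rintro ⟨a, b, h, rfl⟩
      exact ⟨(a, b), by simpa using h, rfl⟩
  rw [him]
  refine sum_congr rfl fun τ hτ => ?_
  obtain ⟨x, y, hxy, rfl⟩ := mem_swapSet.1 hτ
  have : (univ : Finset β).offDiag.filter (fun p => swap p.1 p.2 = swap x y)
      = {(x, y), (y, x)} := by
    ext ⟨a, b⟩
    simp only [mem_filter, mem_offDiag, mem_univ, true_and,
      swap_eq_swap_iff hxy, mem_insert, mem_singleton, Prod.mk.injEq]
    constructor
    · exact fun h => h.2
    · rintro (⟨rfl, rfl⟩ | ⟨rfl, rfl⟩)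
      · exact ⟨hxy, Or.inl ⟨rfl, rfl⟩⟩
      · exact ⟨hxy.symm, Or.inr ⟨rfl, rfl⟩⟩
  rw [this, card_pair (by simp [hxy]), nsmul_eq_mul, Nat.cast_ofNat]

/-- The cut-and-join equation. -/
lemma cutJoin_orbProd (σ : Perm β) :
    cutJoin (orbProd K σ) = 2 * ∑ τ ∈ swapSet β, orbProd K (τ * σ) := by
  rw [← sum_sum_swap_orbProd, ← sum_swapSet fun τ => orbProd K (τ * σ)]

lemma levelOne_orbProd (σ : Perm β) :
    levelOne (orbProd K σ) = if σ = 1 then 1 else 0 := by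
  rw [orbProd, map_prod, prod_congr rfl fun o _ => levelOne_pw (K := K) o.card]
  split_ifs with h
  · refine prod_eq_one fun o ho => if_pos ?_
    obtain ⟨a, -, rfl⟩ := mem_image.1 ho
    rw [card_orb, h]
    exact minimalPeriod_eq_of one_pos rfl (by omega)
  · obtain ⟨a, ha⟩ : ∃ a, σ a ≠ a := by
      by_contra! hh
      exact h (Equiv.ext hh)
    refine prod_eq_zero (orb_mem_orbits σ a) (if_neg fun h1 => ha ?_)
    rw [card_orb] at h1
    have := iterate_minimalPeriod (f := σ) (x := a)
    rwa [h1] at this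

end CutJoinOrbits

section Words

open MvPolynomial

variable {G R : Type*} [CommRing R]

/-- The sum of a function over all words of length `d` in an alphabet. -/
def wordSum (A : Finset G) : ℕ → (List G → R) → R
  | 0, φ => φ []
  | d + 1, φ => ∑ τ ∈ A, wordSum A d fun l => φ (τ :: l)

lemma wordSum_congr {A : Finset G} {d : ℕ} {φ ψ : List G → R}
    (h : ∀ l : List G, (∀ τ ∈ l, τ ∈ A) → φ l = ψ l) : wordSum A d φ = wordSum A d ψ := by
  induction d generalizing φ ψ with
  | zero => exact h [] (by simp)
  | succ d ih =>
    refine sum_congr rfl fun τ hτ => ih fun l hl => h _ ?_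
    intro τ' h'
    rcases List.mem_cons.1 h' with rfl | h'
    · exact hτ
    · exact hl _ h'

lemma wordSum_zero_fun (A : Finset G) (d : ℕ) : wordSum A d (fun _ => (0 : R)) = 0 := by
  induction d with
  | zero => rfl
  | succ d ih => exact sum_eq_zero fun _ _ => ih

lemma wordSum_sum {κ : Type*} (A : Finset G) (d : ℕ) (s : Finset κ) (φ : κ → List G → R) :
    wordSum A d (fun l => ∑ k ∈ s, φ k l) = ∑ k ∈ s, wordSum A d (φ k) := by
  induction d generalizing φ with
  | zero => rfl
  | succ d ih =>
    simp only [wordSum, ih]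
    exact sum_comm

lemma wordSum_map {H : Type*} (f : H ↪ G) (A : Finset H) (d : ℕ) (φ : List G → R) :
    wordSum (A.map f) d φ = wordSum A d fun l => φ (l.map f) := by
  induction d generalizing φ with
  | zero => rfl
  | succ d ih => simp only [wordSum, sum_map, ih, map_cons]

lemma wordSum_subset {A A' : Finset G} (hA : A' ⊆ A) (d : ℕ) (φ : List G → R)
    (h : ∀ l : List G, (∀ τ ∈ l, τ ∈ A) → (∃ τ ∈ l, τ ∉ A') → φ l = 0) :
    wordSum A d φ = wordSum A' d φ := by
  induction d generalizing φ with
  | zero => rfl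
  | succ d ih =>
    simp only [wordSum]
    have h0 : ∀ τ ∈ A, τ ∉ A' → wordSum A d (fun l => φ (τ :: l)) = 0 := by
      intro τ hτ hτ'
      rw [wordSum_congr (ψ := fun _ => 0), wordSum_zero_fun]
      intro l hl
      refine h _ ?_ ⟨τ, by simp, hτ'⟩
      simpa [hτ] using hl
    rw [← sum_subset hA h0]
    refine sum_congr rfl fun τ hτ => ih _ fun l hl hl' => h _ ?_ ?_
    · simpa [hA hτ] using hl
    · obtain ⟨τ', h1, h2⟩ := hl'
      exact ⟨τ', by simp [h1], h2⟩

lemma wordSum_ofFn (A : Finset G) (d : ℕ) (φ : List G → R) :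
    wordSum A d φ = ∑ w ∈ Fintype.piFinset (fun _ : Fin d => A), φ (ofFn w) := by
  classical
  induction d generalizing φ with
  | zero => simp [wordSum]
  | succ d ih =>
    simp only [wordSum, ih]
    rw [sum_sigma']
    refine sum_bij' (fun x _ => Fin.cons x.1 x.2) (fun w _ => ⟨w 0, Fin.tail w⟩) ?_ ?_ ?_ ?_ ?_
    · rintro ⟨τ, w⟩ h
      simp only [mem_sigma, Fintype.mem_piFinset] at h
      rw [Fintype.mem_piFinset]
      intro i
      refine Fin.cases ?_ (fun j => ?_) i
      · simpa using h.1
      · simpa using h.2 j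
    · intro w h
      rw [Fintype.mem_piFinset] at h
      simp only [mem_sigma, Fintype.mem_piFinset]
      exact ⟨h 0, fun i => h i.succ⟩
    · rintro ⟨τ, w⟩ _
      simp
    · intro w _
      simp
    · rintro ⟨τ, w⟩ _
      simp [List.ofFn_succ]

end Words

section WordSeries

open MvPolynomial

variable {G : Type*}

/-- The exponential generating function of a word sum. -/
def wordGF (A : Finset G) (φ : List G → ℚ) : ℚ⟦X⟧ :=
  PowerSeries.mk fun d => wordSum A d φ / d.factorial

lemma derivative_wordGF (A : Finset G) (φ : List G → ℚ) :
    PowerSeries.derivative ℚ (wordGF A φ) = ∑ τ ∈ A, wordGF A fun l => φ (τ :: l) := by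
  ext d
  rw [PowerSeries.coeff_derivative, map_sum, wordGF, coeff_mk, wordSum]
  simp only [wordGF, coeff_mk]
  rw [← sum_div, Nat.factorial_succ]
  have : (d.factorial : ℚ) ≠ 0 := by exact_mod_cast d.factorial_ne_zero
  have : (d : ℚ) + 1 ≠ 0 := by positivity
  push_cast
  field_simp

lemma constantCoeff_wordGF (A : Finset G) (φ : List G → ℚ) :
    PowerSeries.constantCoeff (wordGF A φ) = φ [] := by
  rw [← PowerSeries.coeff_zero_eq_constantCoeff_apply, wordGF, coeff_mk]
  simp [wordSum]

/-- Words in a disjoint union of alphabets are shuffles. -/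
lemma wordGF_shuffle [DecidableEq G] {A B : Finset G} (h : Disjoint A B) (φ ψ : List G → ℚ) :
    wordGF (A ∪ B) (fun l => φ (l.filter (· ∈ A)) * ψ (l.filter (· ∈ B)))
      = wordGF A φ * wordGF B ψ := by
  ext d
  induction d generalizing φ ψ with
  | zero =>
    simp only [PowerSeries.coeff_zero_eq_constantCoeff_apply, map_mul, constantCoeff_wordGF,
      List.filter_nil]
  | succ d ih =>
    have h1 : ((d : ℚ) + 1) ≠ 0 := by positivity
    refine mul_right_cancel₀ h1 ?_
    rw [← PowerSeries.coeff_derivative, ← PowerSeries.coeff_derivative, derivative_wordGF,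
      Derivation.leibniz, derivative_wordGF, derivative_wordGF, sum_union h, map_add,
      map_add, map_sum, map_sum, smul_eq_mul, smul_eq_mul, mul_sum, mul_sum, map_sum,
      map_sum, add_comm]
    congr 1
    · refine sum_congr rfl fun τ hτ => ?_
      rw [← ih]
      have hτA : τ ∉ A := fun h' => disjoint_left.1 h h' hτ
      simp [List.filter_cons, hτ, hτA]
    · refine sum_congr rfl fun τ hτ => ?_
      rw [mul_comm, ← ih]
      have hτB : τ ∉ B := fun h' => disjoint_left.1 h hτ h'
      simp [List.filter_cons, hτ, hτB]

end WordSeries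

section WordCutJoin

open MvPolynomial

variable {β : Type*} [Fintype β] [DecidableEq β]

/-- Factorizations into transpositions are counted by the cut-and-join operator. -/
lemma two_pow_mul_wordSum (σ : Perm β) (d : ℕ) :
    2 ^ d * wordSum (swapSet β) d (fun l => if l.prod = σ then (1 : ℚ) else 0)
      = levelOne ((cutJoin ^ d) (orbProd ℚ σ)) := by
  induction d generalizing σ with
  | zero =>
    rw [pow_zero, pow_zero, one_mul, Module.End.one_apply, levelOne_orbProd, wordSum, List.prod_nil]
    simp only [eq_comm]
  | succ d ih =>
    have h2 : cutJoin (orbProd ℚ σ) = ∑ τ ∈ swapSet β, (2 : ℚ) • orbProd ℚ (τ * σ) := by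
      rw [cutJoin_orbProd, mul_sum]
      refine sum_congr rfl fun τ _ => ?_
      rw [smul_eq_C_mul, map_ofNat]
    rw [pow_succ, pow_succ, Module.End.mul_apply, h2, map_sum, map_sum, wordSum, mul_sum]
    refine sum_congr rfl fun τ hτ => ?_
    rw [map_smul, map_smul, ← ih, smul_eq_mul]
    have : ∀ l : List (Perm β), ((τ :: l).prod = σ) = (l.prod = τ * σ) := by
      intro l
      obtain ⟨x, y, -, rfl⟩ := mem_swapSet.1 hτ
      rw [List.prod_cons]
      refine propext ⟨fun h => by rw [← h, swap_mul_self_mul], fun h => by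
        rw [h, swap_mul_self_mul]⟩
    simp only [this]
    ring

lemma wordGF_eq_cutGF (σ : Perm β) :
    wordGF (swapSet β) (fun l => if l.prod = σ then (1 : ℚ) else 0) = cutGF (orbProd ℚ σ) := by
  ext d
  rw [wordGF, cutGF, coeff_mk, coeff_mk, ← two_pow_mul_wordSum,
    mul_div_mul_left _ _ (by positivity)]

end WordCutJoin

section Coloring

open MvPolynomial

variable {α ι : Type*} [Fintype α] [DecidableEq α] [DecidableEq ι]

/-- The transpositions moving only points whose colour belongs to `S`. -/
def swapsIn (c : α → ι) (S : Finset ι) : Finset (Perm α) :=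
  (swapSet α).filter fun τ => ∀ x, c x ∉ S → τ x = x

lemma mem_swapsIn {c : α → ι} {S : Finset ι} {τ : Perm α} :
    τ ∈ swapsIn c S ↔ τ.IsSwap ∧ ∀ x, c x ∉ S → τ x = x := by
  rw [swapsIn, mem_filter, mem_swapSet]

lemma color_apply_mem {c : α → ι} {S : Finset ι} {τ : Perm α} (h : ∀ x, c x ∉ S → τ x = x) {x : α}
    (hx : c x ∈ S) : c (τ x) ∈ S := by
  by_contra h'
  have := τ.injective (h _ h')
  exact h' (by rwa [this])

lemma swap_mem_swapsIn {c : α → ι} {S : Finset ι} {a b : α} (hab : a ≠ b) :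
    swap a b ∈ swapsIn c S ↔ c a ∈ S ∧ c b ∈ S := by
  rw [mem_swapsIn]
  constructor
  · rintro ⟨-, h⟩
    constructor
    · by_contra h'
      exact hab (by simpa using (h a h').symm)
    · by_contra h'
      exact hab (by simpa using h b h')
  · rintro ⟨ha, hb⟩
    exact ⟨⟨a, b, hab, rfl⟩, fun x hx => swap_apply_of_ne_of_ne (fun h => hx (h ▸ ha))
      fun h => hx (h ▸ hb)⟩

lemma swapsIn_mono {c : α → ι} {S T : Finset ι} (h : S ⊆ T) : swapsIn c S ⊆ swapsIn c T := by
  intro τ hτ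
  rw [mem_swapsIn] at hτ ⊢
  exact ⟨hτ.1, fun x hx => hτ.2 x fun h' => hx (h h')⟩

lemma disjoint_swapsIn {c : α → ι} {S T : Finset ι} (h : Disjoint S T) :
    Disjoint (swapsIn c S) (swapsIn c T) := by
  rw [disjoint_left]
  intro τ hS hT
  obtain ⟨a, b, hab, rfl⟩ := (mem_swapsIn.1 hS).1
  exact disjoint_left.1 h ((swap_mem_swapsIn hab).1 hS).1 ((swap_mem_swapsIn hab).1 hT).1

lemma prod_filter_apply {c : α → ι} {B B' : Finset ι} (h : Disjoint B B') (l : List (Perm α))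
    (hl : ∀ τ ∈ l, τ ∈ swapsIn c B ∪ swapsIn c B') {x : α} (hx : c x ∈ B) :
    l.prod x = (l.filter (· ∈ swapsIn c B)).prod x ∧ c (l.prod x) ∈ B := by
  induction l with
  | nil => simpa using hx
  | cons τ l ih =>
    obtain ⟨h1, h2⟩ := ih fun τ' h' => hl τ' (by simp [h'])
    rw [List.prod_cons, Perm.mul_apply]
    by_cases hτ : τ ∈ swapsIn c B
    · rw [List.filter_cons_of_pos (by simpa using hτ), List.prod_cons, Perm.mul_apply, ← h1]
      exact ⟨rfl, color_apply_mem (mem_swapsIn.1 hτ).2 h2⟩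
    · rw [List.filter_cons_of_neg (by simpa using hτ), ← h1]
      have hτ' : τ ∈ swapsIn c B' := by
        have := hl τ (by simp)
        rw [mem_union] at this
        tauto
      have : τ (l.prod x) = l.prod x :=
        (mem_swapsIn.1 hτ').2 _ fun h' => disjoint_left.1 h h2 h'
      rw [this]
      exact ⟨rfl, h2⟩

/-- The points reachable from `x` using the permutations of a list. -/
def reach (l : List (Perm α)) (x : α) : Set α :=
  {y | ∀ V : Set α, x ∈ V → (∀ τ ∈ l, ∀ z ∈ V, τ z ∈ V) → y ∈ V}

lemma self_mem_reach (l : List (Perm α)) (x : α) : x ∈ reach l x := fun _ h _ => h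

lemma apply_mem_reach {l : List (Perm α)} {x y : α} {τ : Perm α} (hτ : τ ∈ l) (hy : y ∈ reach l x) :
    τ y ∈ reach l x := fun V hV hl => hl τ hτ _ (hy V hV hl)

lemma prod_apply_mem_reach {l : List (Perm α)} {x y : α} (hy : y ∈ reach l x) :
    l.prod y ∈ reach l x := by
  have : ∀ l' : List (Perm α), l' ⊆ l → l'.prod y ∈ reach l x := by
    intro l'
    induction l' with
    | nil => exact fun _ => by simpa using hy
    | cons τ l' ih =>
      intro h
      rw [List.prod_cons, Perm.mul_apply]
      exact apply_mem_reach (h (by simp)) (ih fun τ' h' => h (by simp [h']))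
  exact this l (List.Subset.refl l)

variable (σ : Perm α) (c : α → ι) (x₀ : α)

/-- The product of the word agrees with `σ` on the points coloured by `S`. -/
def IsGood (S : Finset ι) (l : List (Perm α)) : Prop := ∀ x, c x ∈ S → l.prod x = σ x

open Classical in
/-- Generating function of the factorizations of `σ` restricted to the points coloured by `S`. -/
def factGF (S : Finset ι) : ℚ⟦X⟧ :=
  wordGF (swapsIn c S) fun l => if IsGood σ c S l then 1 else 0

open Classical in
/-- Generating function of the connected factorizations of `σ` restricted to the points coloured
by `S`. -/
def connGF (S : Finset ι) : ℚ⟦X⟧ :=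
  wordGF (swapsIn c S) fun l =>
    if IsGood σ c S l ∧ ∀ y, c y ∈ S → y ∈ reach l x₀ then 1 else 0

lemma wordGF_congr {G : Type*} {A : Finset G} {φ ψ : List G → ℚ}
    (h : ∀ l : List G, (∀ τ ∈ l, τ ∈ A) → φ l = ψ l) : wordGF A φ = wordGF A ψ := by
  ext d
  rw [wordGF, wordGF, coeff_mk, coeff_mk, wordSum_congr h]

lemma wordGF_sum {G κ : Type*} (A : Finset G) (s : Finset κ) (φ : κ → List G → ℚ) :
    wordGF A (fun l => ∑ k ∈ s, φ k l) = ∑ k ∈ s, wordGF A (φ k) := by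
  ext d
  rw [map_sum]
  simp only [wordGF, coeff_mk]
  rw [wordSum_sum, sum_div]

lemma wordGF_subset {G : Type*} {A A' : Finset G} (hA : A' ⊆ A) (φ : List G → ℚ)
    (h : ∀ l : List G, (∀ τ ∈ l, τ ∈ A) → (∃ τ ∈ l, τ ∉ A') → φ l = 0) :
    wordGF A φ = wordGF A' φ := by
  ext d
  rw [wordGF, wordGF, coeff_mk, coeff_mk, wordSum_subset hA d φ h]

variable {σ c x₀}

lemma reach_subset_color {S : Finset ι} {l : List (Perm α)} (hl : ∀ τ ∈ l, τ ∈ swapsIn c S)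
    (h₀ : c x₀ ∈ S) {y : α} (hy : y ∈ reach l x₀) : c y ∈ S :=
  hy {z | c z ∈ S} h₀ fun τ hτ _ hz => color_apply_mem (mem_swapsIn.1 (hl τ hτ)).2 hz

lemma exists_reach_eq (hc : ∀ x y, c x = c y ↔ σ.SameCycle x y) {S : Finset ι}
    {l : List (Perm α)} (hl : ∀ τ ∈ l, τ ∈ swapsIn c S) (h₀ : c x₀ ∈ S) (hg : IsGood σ c S l) :
    ∃ B ∈ rooted (c x₀) S, ∀ y, y ∈ reach l x₀ ↔ c y ∈ B := by
  classical
  refine ⟨S.filter fun i => ∃ y ∈ reach l x₀, c y = i, ?_, fun y => ?_⟩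
  · rw [mem_rooted, mem_filter]
    exact ⟨filter_subset _ _, h₀, x₀, self_mem_reach _ _, rfl⟩
  · rw [mem_filter]
    refine ⟨fun h => ⟨reach_subset_color hl h₀ h, y, h, rfl⟩, ?_⟩
    rintro ⟨-, y', hy', hyy'⟩
    obtain ⟨i, -, rfl⟩ := ((hc _ _).1 hyy').exists_pow_eq'
    clear hyy'
    rw [← Perm.iterate_eq_pow]
    induction i with
    | zero => exact hy'
    | succ i ih =>
      rw [iterate_succ_apply', ← hg _ (reach_subset_color hl h₀ ih)]
      exact prod_apply_mem_reach ih

lemma mem_union_of_reach_eq {S B : Finset ι} {l : List (Perm α)}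
    (hl : ∀ τ ∈ l, τ ∈ swapsIn c S) (hB : ∀ y, y ∈ reach l x₀ ↔ c y ∈ B) :
    ∀ τ ∈ l, τ ∈ swapsIn c B ∪ swapsIn c (S \ B) := by
  intro τ hτ
  have hτS := hl τ hτ
  obtain ⟨a, b, hab, rfl⟩ := (mem_swapsIn.1 hτS).1
  rw [swap_mem_swapsIn hab] at hτS
  rw [mem_union, swap_mem_swapsIn hab, swap_mem_swapsIn hab, mem_sdiff,
    mem_sdiff]
  have h1 : c a ∈ B → c b ∈ B := fun h => by
    have := apply_mem_reach hτ ((hB a).2 h)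
    rwa [swap_apply_left, hB] at this
  have h2 : c b ∈ B → c a ∈ B := fun h => by
    have := apply_mem_reach hτ ((hB b).2 h)
    rwa [swap_apply_right, hB] at this
  tauto

lemma good_and_reach_iff {S B : Finset ι} (hBS : B ⊆ S) (h₀ : c x₀ ∈ B)
    {l : List (Perm α)} (hl : ∀ τ ∈ l, τ ∈ swapsIn c B ∪ swapsIn c (S \ B)) :
    (IsGood σ c S l ∧ ∀ y, y ∈ reach l x₀ ↔ c y ∈ B) ↔
    ((IsGood σ c B (l.filter (· ∈ swapsIn c B)) ∧
      ∀ y, c y ∈ B → y ∈ reach (l.filter (· ∈ swapsIn c B)) x₀) ∧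
      IsGood σ c (S \ B) (l.filter (· ∈ swapsIn c (S \ B)))) := by
  have hd : Disjoint B (S \ B) := disjoint_sdiff
  have p1 : ∀ x, c x ∈ B → l.prod x = (l.filter (· ∈ swapsIn c B)).prod x :=
    fun x hx => (prod_filter_apply hd l hl hx).1
  have p2 : ∀ x, c x ∈ S \ B → l.prod x = (l.filter (· ∈ swapsIn c (S \ B))).prod x :=
    fun x hx => (prod_filter_apply hd.symm l (by simpa only [union_comm] using hl) hx).1
  have hg : IsGood σ c S l ↔ IsGood σ c B (l.filter (· ∈ swapsIn c B)) ∧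
      IsGood σ c (S \ B) (l.filter (· ∈ swapsIn c (S \ B))) := by
    constructor
    · intro h
      exact ⟨fun x hx => by rw [← p1 x hx, h x (hBS hx)],
        fun x hx => by rw [← p2 x hx, h x (sdiff_subset hx)]⟩
    · rintro ⟨h1, h2⟩ x hx
      by_cases hxB : c x ∈ B
      · rw [p1 x hxB, h1 x hxB]
      · have : c x ∈ S \ B := mem_sdiff.2 ⟨hx, hxB⟩
        rw [p2 x this, h2 x this]
  have hr : (∀ y, y ∈ reach l x₀ ↔ c y ∈ B) ↔
      ∀ y, c y ∈ B → y ∈ reach (l.filter (· ∈ swapsIn c B)) x₀ := by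
    have key : ∀ y, y ∈ reach l x₀ → y ∈ reach (l.filter (· ∈ swapsIn c B)) x₀ ∧ c y ∈ B := by
      intro y hy
      refine hy {z | z ∈ reach (l.filter (· ∈ swapsIn c B)) x₀ ∧ c z ∈ B}
        ⟨self_mem_reach _ _, h₀⟩ ?_
      rintro τ hτ z ⟨hz1, hz2⟩
      by_cases hτB : τ ∈ swapsIn c B
      · exact ⟨apply_mem_reach (by simp [hτ, hτB]) hz1, color_apply_mem (mem_swapsIn.1 hτB).2 hz2⟩
      · have hτ' : τ ∈ swapsIn c (S \ B) := by
          have := hl τ hτ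
          rw [mem_union] at this
          tauto
        have : τ z = z := (mem_swapsIn.1 hτ').2 _ fun h' => disjoint_left.1 hd hz2 h'
        rw [this]
        exact ⟨hz1, hz2⟩
    constructor
    · intro h y hy
      exact (key y ((h y).2 hy)).1
    · intro h y
      refine ⟨fun hy => (key y hy).2, fun hy V hV hVl => h y hy V hV fun τ hτ => hVl τ ?_⟩
      exact List.mem_of_mem_filter hτ
  rw [hg, hr]
  tauto

/-- The exponential formula: connected factorizations generate all factorizations. -/
lemma factGF_eq_sum (hc : ∀ x y, c x = c y ↔ σ.SameCycle x y) (hs : Function.Surjective c)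
    {S : Finset ι} (h₀ : c x₀ ∈ S) :
    factGF σ c S = ∑ B ∈ rooted (c x₀) S, connGF σ c x₀ B * factGF σ c (S \ B) := by
  classical
  have h1 : factGF σ c S = wordGF (swapsIn c S) fun l => ∑ B ∈ rooted (c x₀) S,
      if IsGood σ c S l ∧ ∀ y, y ∈ reach l x₀ ↔ c y ∈ B then 1 else 0 := by
    refine wordGF_congr fun l hl => ?_
    by_cases hg : IsGood σ c S l
    · obtain ⟨B, hB, hr⟩ := exists_reach_eq hc hl h₀ hg
      rw [if_pos hg, sum_eq_single B, if_pos ⟨hg, hr⟩]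
      · intro B' _ hne
        refine if_neg fun h => hne ?_
        ext i
        obtain ⟨y, rfl⟩ := hs i
        rw [← h.2, hr]
      · exact fun h => absurd hB h
    · simp [hg]
  rw [h1, wordGF_sum]
  refine sum_congr rfl fun B hB => ?_
  rw [mem_rooted] at hB
  rw [wordGF_subset (A' := swapsIn c B ∪ swapsIn c (S \ B))
    (union_subset (swapsIn_mono hB.1) (swapsIn_mono sdiff_subset)), connGF, factGF,
    ← wordGF_shuffle (disjoint_swapsIn disjoint_sdiff)]
  · refine wordGF_congr fun l hl => ?_
    rw [ite_zero_mul_ite_zero, mul_one]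
    simp only [good_and_reach_iff hB.1 hB.2 hl]
  · rintro l hl ⟨τ, hτ, hτ'⟩
    exact if_neg fun h => hτ' (mem_union_of_reach_eq hl h.2 τ hτ)

lemma swapsIn_eq_map (c : α → ι) (S : Finset ι) :
    swapsIn c S = (swapSet {x // c x ∈ S}).map
      ⟨Perm.ofSubtype, Perm.ofSubtype_injective⟩ := by
  ext τ
  rw [mem_map]
  constructor
  · intro h
    obtain ⟨a, b, hab, rfl⟩ := (mem_swapsIn.1 h).1
    rw [swap_mem_swapsIn hab] at h
    exact ⟨swap ⟨a, h.1⟩ ⟨b, h.2⟩, mem_swapSet.2 ⟨_, _, by simpa using hab, rfl⟩,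
      Perm.ofSubtype_swap_eq _ _⟩
  · rintro ⟨ρ, hρ, rfl⟩
    obtain ⟨a, b, hab, rfl⟩ := mem_swapSet.1 hρ
    change Perm.ofSubtype (swap a b) ∈ _
    rw [Perm.ofSubtype_swap_eq, swap_mem_swapsIn fun h => hab (Subtype.ext h)]
    exact ⟨a.2, b.2⟩

/-- The number of points of a given colour. -/
def colorSize (c : α → ι) (i : ι) : ℕ := (univ.filter fun x => c x = i).card

lemma orbProd_restrict (hc : ∀ x y, c x = c y ↔ σ.SameCycle x y) (hs : Function.Surjective c)
    (S : Finset ι) (h : ∀ x, c (σ x) ∈ S ↔ c x ∈ S) :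
    orbProd ℚ (σ.subtypePerm (p := fun x => c x ∈ S) h) = ∏ i ∈ S, pw (colorSize c i) := by
  have ho : ∀ x : {x // c x ∈ S}, orb (σ.subtypePerm (p := fun x => c x ∈ S) h) x
      = univ.filter fun y : {x // c x ∈ S} => c y = c x := by
    intro x
    ext y
    rw [mem_orb, Perm.sameCycle_subtypePerm, ← hc]
    simp [eq_comm]
  have him : orbits (σ.subtypePerm (p := fun x => c x ∈ S) h)
      = S.image fun i => univ.filter fun y : {x // c x ∈ S} => c y = i := by
    ext o
    simp only [orbits, mem_image, mem_univ, true_and]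
    constructor
    · rintro ⟨x, rfl⟩
      exact ⟨c x, x.2, (ho x).symm⟩
    · rintro ⟨i, hi, rfl⟩
      obtain ⟨x, rfl⟩ := hs i
      exact ⟨⟨x, hi⟩, ho _⟩
  rw [orbProd, him, prod_image]
  · refine prod_congr rfl fun i hi => ?_
    rw [colorSize, ← card_map (Function.Embedding.subtype _)]
    congr 2
    ext x
    simp only [mem_map, mem_filter, mem_univ, true_and,
      Function.Embedding.coe_subtype, Subtype.exists, exists_and_left, exists_prop]
    constructor
    · rintro ⟨y, rfl, -, rfl⟩
      rfl
    · rintro rfl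
      exact ⟨x, rfl, hi, rfl⟩
  · intro i hi j hj hij
    obtain ⟨x, rfl⟩ := hs i
    have := (Finset.ext_iff.1 hij ⟨x, hi⟩).1 (by simp)
    simpa using this

lemma factGF_eq_cutGF (hc : ∀ x y, c x = c y ↔ σ.SameCycle x y) (hs : Function.Surjective c)
    (S : Finset ι) : factGF σ c S = cutGF (∏ i ∈ S, pw (colorSize c i)) := by
  classical
  have h : ∀ x, c (σ x) ∈ S ↔ c x ∈ S := fun x => by
    rw [(hc (σ x) x).2 (Perm.sameCycle_apply_left.2 (Perm.SameCycle.refl σ x))]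
  rw [← orbProd_restrict hc hs S h, ← wordGF_eq_cutGF, factGF, swapsIn_eq_map]
  ext d
  rw [wordGF, wordGF, coeff_mk, coeff_mk, wordSum_map]
  congr 2
  funext l
  have : IsGood σ c S (l.map (Perm.ofSubtype : Perm {x // c x ∈ S} →* Perm α))
      ↔ l.prod = σ.subtypePerm (p := fun x => c x ∈ S) h := by
    rw [IsGood, ← map_list_prod]
    constructor
    · intro hg
      ext ⟨x, hx⟩
      have := hg x hx
      rw [Perm.ofSubtype_apply_of_mem (p := fun x => c x ∈ S) _ hx] at this
      exact this
    · intro hg x hx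
      rw [Perm.ofSubtype_apply_of_mem (p := fun x => c x ∈ S) _ hx, hg, Perm.subtypePerm_apply]
  change (if IsGood σ c S (l.map (Perm.ofSubtype : Perm {x // c x ∈ S} →* Perm α)) then _ else _) = _
  simp only [this]

lemma factGF_empty : factGF σ c ∅ = 1 := by
  classical
  have hA : swapsIn c ∅ = ∅ := by
    ext τ
    constructor
    · intro h
      obtain ⟨a, b, hab, rfl⟩ := (mem_swapsIn.1 h).1
      rw [swap_mem_swapsIn hab] at h
      simpa using h.1
    · simp
  ext d
  rw [factGF, wordGF, hA, coeff_mk, PowerSeries.coeff_one]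
  cases d with
  | zero => simp [wordSum, IsGood]
  | succ d => simp [wordSum]

/-- Connected factorizations are counted by the cumulants of the cut-and-join operator. -/
lemma connGF_eq_cumulant (hc : ∀ x y, c x = c y ↔ σ.SameCycle x y) (hs : Function.Surjective c)
    {T : Finset ι} (h : c x₀ ∈ T) :
    connGF σ c x₀ T = cumulant (fun S => cutGF (∏ i ∈ S, pw (colorSize c i))) T := by
  have e : (fun S => cutGF (∏ i ∈ S, pw (colorSize c i))) = factGF σ c :=
    funext fun S => (factGF_eq_cutGF hc hs S).symm
  rw [e]
  exact (cumulant_unique _ _ factGF_empty (c x₀) (fun S _ hS => factGF_eq_sum hc hs hS) h).symm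

end Coloring

section HurwitzCount

open MvPolynomial

variable {k : ℕ}

lemma sum_orbits_eq {A : Type*} [AddCommMonoid A] (σ : Perm (Fin k)) (f : Finset (Fin k) → A) :
    ∑ o ∈ orbits σ, f o = ∑ ρ ∈ σ.cycleFactorsFinset, f ρ.support + ∑ x ∈ σ.supportᶜ, f {x} := by
  have h1 : ∀ x ∈ σ.support, orb σ x = (σ.cycleOf x).support := by
    intro x hx
    ext y
    rw [mem_orb, Perm.mem_support_cycleOf_iff]
    exact ⟨fun h => ⟨h, hx⟩, fun h => h.1⟩
  have h2 : ∀ x ∉ σ.support, orb σ x = {x} := by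
    intro x hx
    ext y
    rw [Perm.notMem_support] at hx
    rw [mem_orb, mem_singleton]
    constructor
    · rintro ⟨i, rfl⟩
      exact Perm.zpow_apply_eq_self_of_apply_eq_self hx i
    · rintro rfl
      exact Perm.SameCycle.refl _ _
  have e : orbits σ = σ.cycleFactorsFinset.image Perm.support ∪ σ.supportᶜ.image ({·}) := by
    ext o
    simp only [orbits, mem_union, mem_image, mem_univ, true_and,
      mem_compl]
    constructor
    · rintro ⟨x, rfl⟩
      by_cases hx : x ∈ σ.support
      · exact Or.inl ⟨σ.cycleOf x, Perm.cycleOf_mem_cycleFactorsFinset_iff.2 hx, (h1 x hx).symm⟩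
      · exact Or.inr ⟨x, hx, (h2 x hx).symm⟩
    · rintro (⟨ρ, hρ, rfl⟩ | ⟨x, hx, rfl⟩)
      · have hc := (Perm.mem_cycleFactorsFinset_iff.1 hρ).1
        obtain ⟨x, hx⟩ := hc.nonempty_support
        have hx' := Perm.mem_cycleFactorsFinset_support_le hρ hx
        exact ⟨x, by rw [h1 x hx', ← Perm.cycle_is_cycleOf hx hρ]⟩
      · exact ⟨x, h2 x hx⟩
  rw [e, sum_union, sum_image, sum_image]
  · intro x _ y _ h
    simpa using h
  · intro ρ hρ ρ' hρ' h
    obtain ⟨x, hx⟩ := (Perm.mem_cycleFactorsFinset_iff.1 hρ).1.nonempty_support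
    rw [Perm.cycle_is_cycleOf hx hρ, Perm.cycle_is_cycleOf (show x ∈ ρ'.support from h ▸ hx) hρ']
  · rw [disjoint_left]
    intro o ho ho'
    obtain ⟨ρ, hρ, rfl⟩ := mem_image.1 ho
    obtain ⟨x, hx, hx'⟩ := mem_image.1 ho'
    rw [mem_compl] at hx
    exact hx (Perm.mem_cycleFactorsFinset_support_le hρ (by rw [← hx']; simp))

lemma fullCycleType_eq_map (σ : Perm (Fin k)) :
    fullCycleType σ = (orbits σ).val.map card := by
  have h := sum_orbits_eq σ fun o => ({o.card} : Multiset ℕ)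
  have e : ∑ o ∈ orbits σ, ({o.card} : Multiset ℕ) = (orbits σ).val.map card := by
    rw [← Multiset.sum_map_singleton ((orbits σ).val.map card), Multiset.map_map]
    rfl
  rw [← e, h, fullCycleType, Perm.cycleType_def,
    ← Multiset.sum_map_singleton (σ.cycleFactorsFinset.val.map _), Multiset.map_map]
  congr 1
  simp only [card_singleton, sum_const, card_compl, Fintype.card_fin,
    Multiset.nsmul_singleton]

lemma exists_equiv_of_map_eq {A B : Type*} [Fintype A] [Fintype B] (f : A → ℕ) (g : B → ℕ)
    (h : (univ : Finset A).val.map f = (univ : Finset B).val.map g) :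
    ∃ e : A ≃ B, ∀ a, g (e a) = f a := by
  classical
  have hc : ∀ c, Nonempty ({a // f a = c} ≃ {b // g b = c}) := by
    intro c
    rw [← Fintype.card_eq, Fintype.card_subtype, Fintype.card_subtype]
    have := congrArg (Multiset.count c) h
    rw [Multiset.count_map, Multiset.count_map] at this
    simpa [card, filter, eq_comm] using this
  exact ⟨Equiv.ofFiberEquiv fun c => (hc c).some, fun a => Equiv.ofFiberEquiv_map _ a⟩

lemma exists_coloring {n : ℕ} (kk : Fin n → ℕ) (σ : Perm (Fin k))
    (h : fullCycleType σ = (ofFn kk : Multiset ℕ)) :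
    ∃ c : Fin k → Fin n, (∀ x y, c x = c y ↔ σ.SameCycle x y) ∧ Function.Surjective c ∧
      colorSize c = kk := by
  have h' : (univ : Finset (orbits σ)).val.map (fun o => o.1.card)
      = (univ : Finset (Fin n)).val.map kk := by
    rw [Fin.univ_val_map, ← h, fullCycleType_eq_map]
    have := Multiset.attach_map_val (orbits σ).val
    conv_rhs => rw [← this, Multiset.map_map]
    rfl
  obtain ⟨e, he⟩ := exists_equiv_of_map_eq _ _ h'
  have hc : ∀ x i, e ⟨orb σ x, orb_mem_orbits σ x⟩ = i ↔ orb σ x = (e.symm i).1 := by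
    intro x i
    rw [← Equiv.eq_symm_apply, Subtype.ext_iff]
  refine ⟨fun x => e ⟨orb σ x, orb_mem_orbits σ x⟩, fun x y => ?_, fun i => ?_, ?_⟩
  · rw [e.injective.eq_iff, Subtype.mk.injEq, orb_eq_iff]
  · obtain ⟨x, -, hx⟩ := mem_image.1 (e.symm i).2
    exact ⟨x, (hc x i).2 hx⟩
  · funext i
    rw [colorSize]
    simp only [hc]
    rw [filter_orb_eq (e.symm i).2]
    have := he (e.symm i)
    rw [Equiv.apply_symm_apply] at this
    exact this.symm

lemma isTransitiveFamily_iff {d : ℕ} (τ : Fin d → Perm (Fin k)) (hτ : ∀ i, (τ i).IsSwap)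
    (x₀ : Fin k) : IsTransitiveFamily τ ↔ ∀ y, y ∈ reach (ofFn τ) x₀ := by
  have key : ∀ p ∈ Subgroup.closure (Set.range τ), ∀ y,
      p y ∈ reach (ofFn τ) x₀ ↔ y ∈ reach (ofFn τ) x₀ := by
    intro p hp
    induction hp using Subgroup.closure_induction with
    | mem p hp =>
      obtain ⟨i, rfl⟩ := hp
      have hi : τ i ∈ ofFn τ := by simp
      intro y
      refine ⟨fun h => ?_, apply_mem_reach hi⟩
      have := apply_mem_reach hi h
      obtain ⟨a, b, -, hab⟩ := hτ i
      rwa [hab, swap_apply_self] at this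
    | one => simp
    | mul p q _ _ hp hq =>
      intro y
      rw [Perm.mul_apply, hp, hq]
    | inv p _ hp =>
      intro y
      rw [← hp]; simp
  constructor
  · intro h y
    obtain ⟨p, hp, rfl⟩ := h x₀ y
    exact (key p hp x₀).2 (self_mem_reach _ _)
  · intro h
    have h1 : ∀ y, ∃ p ∈ Subgroup.closure (Set.range τ), p x₀ = y := by
      intro y
      refine h y {z | ∃ p ∈ Subgroup.closure (Set.range τ), p x₀ = z} ⟨1, one_mem _, rfl⟩ ?_
      rintro ρ hρ z ⟨p, hp, rfl⟩
      rw [mem_ofFn] at hρ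
      exact ⟨ρ * p, mul_mem (Subgroup.subset_closure hρ) hp, rfl⟩
    intro x y
    obtain ⟨p, hp, rfl⟩ := h1 x
    obtain ⟨q, hq, rfl⟩ := h1 y
    exact ⟨q * p⁻¹, mul_mem hq (inv_mem hp), by simp⟩

lemma count_ofFn {n : ℕ} (kk : Fin n → ℕ) (a : ℕ) :
    Multiset.count a (ofFn kk : Multiset ℕ) = Fintype.card {i // kk i = a} := by
  rw [← Fin.univ_val_map, Multiset.count_map, Fintype.card_subtype]
  simp [card, filter, eq_comm]

lemma autCount_eq {n : ℕ} (kk : Fin n → ℕ) :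
    autCount n kk = ∏ a ∈ univ.image kk,
      (Multiset.count a (ofFn kk : Multiset ℕ)).factorial := by
  simp only [count_ofFn]
  rw [← DomMulAct.stabilizer_card', autCount, ← Nat.card_eq_fintype_card]
  exact Nat.card_congr (Equiv.subtypeEquivRight fun π => by rw [funext_iff]; rfl)

lemma fullCycleType_eq_iff {n : ℕ} (kk : Fin n → ℕ) (hk : ∀ i, 0 < kk i) (hsum : ∑ i, kk i = k)
    (σ : Perm (Fin k)) : fullCycleType σ = (ofFn kk : Multiset ℕ) ↔
      σ.cycleType = (ofFn kk : Multiset ℕ).filter (2 ≤ ·) := by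
  set μ : Multiset ℕ := (ofFn kk : Multiset ℕ) with hμ
  have h1 : μ.filter (fun a => ¬ 2 ≤ a)
      = Multiset.replicate (μ.filter (fun a => ¬ 2 ≤ a)).card 1 := by
    rw [Multiset.eq_replicate]
    refine ⟨rfl, fun b hb => ?_⟩
    rw [Multiset.mem_filter, hμ, Multiset.mem_coe, mem_ofFn] at hb
    obtain ⟨⟨i, rfl⟩, hb⟩ := hb
    have := hk i
    omega
  have h2 := Multiset.filter_add_not (2 ≤ ·) μ
  constructor
  · intro h
    rw [← h, fullCycleType, Multiset.filter_add, Multiset.filter_eq_self.2 fun a ha =>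
      Perm.two_le_of_mem_cycleType ha, Multiset.filter_eq_nil.2, add_zero]
    intro a ha
    rw [Multiset.eq_of_mem_replicate ha]
    omega
  · intro h
    have hs : (μ.filter (2 ≤ ·)).sum + (μ.filter (fun a => ¬ 2 ≤ a)).card = k := by
      have := congrArg Multiset.sum h2
      rw [Multiset.sum_add, h1, Multiset.sum_replicate, smul_eq_mul, mul_one] at this
      rw [this, hμ, Multiset.sum_coe, List.sum_ofFn, hsum]
    have hc : k - σ.support.card = (μ.filter (fun a => ¬ 2 ≤ a)).card := by
      rw [← Perm.sum_cycleType, h]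
      omega
    rw [fullCycleType, h, hc, ← h1, h2]

open Classical in
lemma card_class {n : ℕ} (kk : Fin n → ℕ) (hk : ∀ i, 0 < kk i) (hsum : ∑ i, kk i = k) :
    (univ.filter fun σ : Perm (Fin k) => fullCycleType σ = (ofFn kk : Multiset ℕ)).card
      * ((∏ i, kk i) * autCount n kk) = k.factorial := by
  simp only [fullCycleType_eq_iff kk hk hsum]
  set μ : Multiset ℕ := (ofFn kk : Multiset ℕ) with hμ
  set m := μ.filter (2 ≤ ·) with hm
  have h1 : μ.filter (fun a => ¬ 2 ≤ a)
      = Multiset.replicate (μ.count 1) 1 := by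
    rw [Multiset.eq_replicate]
    constructor
    · rw [Multiset.count, Multiset.countP_eq_card_filter]
      congr 1
      refine Multiset.filter_congr fun a ha => ?_
      rw [hμ, Multiset.mem_coe, mem_ofFn] at ha
      obtain ⟨i, rfl⟩ := ha
      have := hk i
      omega
    · intro b hb
      rw [Multiset.mem_filter, hμ, Multiset.mem_coe, mem_ofFn] at hb
      obtain ⟨⟨i, rfl⟩, hb⟩ := hb
      have := hk i
      omega
  have h2 := Multiset.filter_add_not (2 ≤ ·) μ
  rw [h1, ← hm] at h2
  have hs : m.sum + μ.count 1 = k := by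
    have := congrArg Multiset.sum h2
    rw [Multiset.sum_add, Multiset.sum_replicate, smul_eq_mul, mul_one] at this
    rw [this, hμ, Multiset.sum_coe, List.sum_ofFn, hsum]
  have hp : m.prod = ∏ i, kk i := by
    have := congrArg Multiset.prod h2
    rw [Multiset.prod_add, Multiset.prod_replicate, one_pow, mul_one] at this
    rw [this, hμ, Multiset.prod_coe, List.prod_ofFn]
  have h := Perm.card_of_cycleType_mul_eq (Fin k) m
  rw [if_pos ⟨by rw [Fintype.card_fin]; omega, fun a ha => (Multiset.mem_filter.1 ha).2⟩,
    Fintype.card_fin, hp] at h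
  have ha : autCount n kk = (k - m.sum).factorial * ∏ a ∈ m.toFinset, (m.count a).factorial := by
    have h1m : 1 ∉ m.toFinset := by simp [hm]
    have hsub : univ.image kk ⊆ insert 1 m.toFinset := by
      intro a ha
      obtain ⟨i, -, rfl⟩ := mem_image.1 ha
      rw [mem_insert, Multiset.mem_toFinset, hm, Multiset.mem_filter, hμ, Multiset.mem_coe,
        mem_ofFn]
      have := hk i
      by_cases h1 : kk i = 1
      · exact Or.inl h1
      · exact Or.inr ⟨⟨i, rfl⟩, by omega⟩
    rw [autCount_eq, prod_subset hsub, prod_insert h1m, ← hμ]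
    · congr 1
      · congr 1; omega
      · refine prod_congr rfl fun a ha => ?_
        rw [hm, Multiset.count_filter, if_pos]
        rw [Multiset.mem_toFinset] at ha
        exact (Multiset.mem_filter.1 ha).2
    · intro a _ ha
      rw [Multiset.count_eq_zero_of_notMem, Nat.factorial_zero]
      rw [Multiset.mem_coe, mem_ofFn]
      rintro ⟨i, rfl⟩
      exact ha (mem_image_of_mem _ (mem_univ _))
  rw [ha, ← h]
  congr 1
  ring

lemma swapsIn_univ {α ι : Type*} [Fintype α] [DecidableEq α] [DecidableEq ι] [Fintype ι]
    (c : α → ι) : swapsIn c univ = swapSet α := by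
  ext τ
  rw [mem_swapsIn, mem_swapSet]
  simp

open Classical in
lemma hurwitzCount_eq (g n : ℕ) (hn : 1 ≤ n) (kk : Fin n → ℕ) (hk : ∀ i, 0 < kk i) :
    (hurwitzCount g n kk : ℚ)
      = (univ.filter fun σ : Perm (Fin (∑ i, kk i)) =>
          fullCycleType σ = (ofFn kk : Multiset ℕ)).card
        * (((∑ i, kk i) + n + 2 * g - 2).factorial
        * PowerSeries.coeff ((∑ i, kk i) + n + 2 * g - 2)
            (cumulant (fun S => cutGF (∏ i ∈ S, pw (kk i))) univ)) := by
  set d := (∑ i, kk i) + n + 2 * g - 2 with hd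
  have hpos : 0 < ∑ i, kk i := sum_pos (fun i _ => hk i) ⟨⟨0, hn⟩, mem_univ _⟩
  set x₀ : Fin (∑ i, kk i) := ⟨0, hpos⟩ with hx₀
  have h1 : (hurwitzCount g n kk : ℚ) = wordSum (swapSet (Fin (∑ i, kk i))) d fun l =>
      if fullCycleType l.prod = (ofFn kk : Multiset ℕ) ∧ ∀ y, y ∈ reach l x₀ then 1 else 0 := by
    rw [wordSum_ofFn, hurwitzCount, Nat.card_eq_fintype_card, Fintype.card_subtype,
      sum_boole, ← hd]
    congr 2
    ext τ
    simp only [mem_filter, mem_univ, true_and, Fintype.mem_piFinset, mem_swapSet]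
    constructor
    · rintro ⟨a, b, c⟩
      exact ⟨a, b, (isTransitiveFamily_iff τ a x₀).1 c⟩
    · rintro ⟨a, b, c⟩
      exact ⟨a, b, (isTransitiveFamily_iff τ a x₀).2 c⟩
  have h2 : ∀ l : List (Perm (Fin (∑ i, kk i))),
      (if fullCycleType l.prod = (ofFn kk : Multiset ℕ) ∧ ∀ y, y ∈ reach l x₀
        then (1 : ℚ) else 0)
      = ∑ σ ∈ univ.filter fun σ : Perm (Fin (∑ i, kk i)) =>
          fullCycleType σ = (ofFn kk : Multiset ℕ),
          if l.prod = σ ∧ ∀ y, y ∈ reach l x₀ then 1 else 0 := by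
    intro l
    by_cases hr : ∀ y, y ∈ reach l x₀
    · simp [hr]
    · simp [hr]
  rw [h1]
  simp only [h2]
  rw [wordSum_sum, ← nsmul_eq_mul]
  refine sum_eq_card_nsmul fun σ hσ => ?_
  obtain ⟨c, hc, hs, hcol⟩ := exists_coloring kk σ (mem_filter.1 hσ).2
  have h3 := connGF_eq_cumulant (x₀ := x₀) hc hs (mem_univ _)
  rw [hcol] at h3
  rw [← h3, connGF, wordGF, coeff_mk, swapsIn_univ,
    mul_div_cancel₀ _ (by positivity)]
  congr 1
  funext l
  have : IsGood σ c univ l ↔ l.prod = σ :=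
    ⟨fun h => Equiv.ext fun x => h x (mem_univ _), fun h x _ => by rw [h]⟩
  simp only [this, mem_univ, true_implies]

/-- The Hurwitz number in terms of the cumulants of the cut-and-join operator. -/
lemma hurwitzNumber_eq (g n : ℕ) (hn : 1 ≤ n) (kk : Fin n → ℕ) (hk : ∀ i, 0 < kk i) :
    hurwitzNumber g n kk = ((∑ i, kk i) + n + 2 * g - 2).factorial / (autCount n kk : ℚ)
      * (∏ i, (kk i : ℚ)⁻¹) * PowerSeries.coeff ((∑ i, kk i) + n + 2 * g - 2)
            (cumulant (fun S => cutGF (∏ i ∈ S, pw (kk i))) univ) := by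
  classical
  have h := card_class kk hk rfl
  have h' : ((univ.filter fun σ : Perm (Fin (∑ i, kk i)) =>
      fullCycleType σ = (ofFn kk : Multiset ℕ)).card : ℚ)
      * ((∏ i, (kk i : ℚ)) * autCount n kk) = (∑ i, kk i).factorial := by
    exact_mod_cast h
  have h0 : ((∑ i, kk i).factorial : ℚ) ≠ 0 := by positivity
  rw [hurwitzNumber, hurwitzCount_eq g n hn kk hk]
  have h1 : (∏ i, (kk i : ℚ)) * autCount n kk ≠ 0 := fun h => h0 (by rw [← h', h, mul_zero])
  have h2 := left_ne_zero_of_mul h1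
  have h3 := right_ne_zero_of_mul h1
  rw [prod_inv_distrib]
  field_simp
  linear_combination PowerSeries.coeff ((∑ i, kk i) + n + 2 * g - 2)
            (cumulant (fun S => cutGF (∏ i ∈ S, pw (kk i))) univ) * h'

end HurwitzCount

section Normalization

open PowerSeries

/-- The power series `(exp (q u / 2) - exp (- q u / 2)) / (q u)`. -/
def sinhc (q : ℚ) : ℚ⟦X⟧ :=
  mk fun j => if Even j then q ^ j / (2 ^ j * (j + 1).factorial) else 0

lemma coeff_sinhc (q : ℚ) (j : ℕ) : coeff j (sinhc q)
    = if Even j then q ^ j / (2 ^ j * (j + 1).factorial) else 0 := coeff_mk _ _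

lemma coeff_zero_sinhc (q : ℚ) : coeff 0 (sinhc q) = 1 := by simp [coeff_sinhc]

lemma constantCoeff_sinhc (q : ℚ) : constantCoeff (sinhc q) = 1 := by
  rw [← coeff_zero_eq_constantCoeff_apply, coeff_zero_sinhc]

lemma sinhc_neg (q : ℚ) : sinhc (-q) = sinhc q := by
  ext j
  rw [coeff_sinhc, coeff_sinhc]
  split_ifs with h
  · rw [h.neg_pow]
  · rfl

lemma svar_eq (q : ℚ) : svar q = C q * X * sinhc q := by
  ext j
  rw [svar, map_sub, coeff_ex, coeff_ex, mul_assoc, coeff_C_mul]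
  cases j with
  | zero => simp
  | succ j =>
    rw [coeff_succ_X_mul, coeff_sinhc]
    split_ifs with h
    · rw [h.add_one.neg_pow, div_pow]
      field_simp
      ring
    · rw [(Nat.not_even_iff_odd.1 h).add_one.neg_pow]
      simp

/-- `sinhc q` as a unit. -/
def sinhcU (q : ℚ) : ℚ⟦X⟧ˣ :=
  (show IsUnit (sinhc q) by
    rw [isUnit_iff_constantCoeff, constantCoeff_sinhc]; exact isUnit_one).unit

lemma val_sinhcU (q : ℚ) : (sinhcU q : ℚ⟦X⟧) = sinhc q := rfl

/-- The unit `q * sinhc q` for `q ≠ 0`. -/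
def eU (q : ℚ) : ℚ⟦X⟧ˣ :=
  (if h : q ≠ 0 then Units.map (C (R := ℚ)).toMonoidHom (Units.mk0 q h) else 1)
    * sinhcU q

lemma val_eU {q : ℚ} (h : q ≠ 0) : (eU q : ℚ⟦X⟧) = C q * sinhc q := by
  rw [eU, dif_pos h]; rfl

/-- Integer powers of `eU q`. -/
def eZ (q : ℚ) (k : ℤ) : ℚ⟦X⟧ := ((eU q ^ k : ℚ⟦X⟧ˣ) : ℚ⟦X⟧)

lemma eZ_add (q : ℚ) (a b : ℤ) : eZ q (a + b) = eZ q a * eZ q b := by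
  rw [eZ, zpow_add, Units.val_mul, eZ, eZ]

lemma eZ_zero (q : ℚ) : eZ q 0 = 1 := by rw [eZ, zpow_zero, Units.val_one]

lemma eZ_ne_zero (q : ℚ) (a : ℤ) : eZ q a ≠ 0 := Units.ne_zero _

lemma eZ_natCast {q : ℚ} (h : q ≠ 0) (m : ℕ) :
    eZ q m = C (q ^ m) * sinhc q ^ m := by
  rw [eZ, zpow_natCast, Units.val_pow_eq_pow_val, val_eU h, mul_pow, map_pow]

lemma svar_eq_eZ {q : ℚ} (h : q ≠ 0) : svar q = X * eZ q 1 := by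
  rw [svar_eq, eZ, zpow_one, val_eU h]; ring

lemma svar_pow {q : ℚ} (h : q ≠ 0) (m : ℕ) : svar q ^ m = X ^ m * eZ q m := by
  rw [svar_eq_eZ h, mul_pow, eZ, eZ, ← Units.val_pow_eq_pow_val, zpow_one, zpow_natCast]

/-- The normalized coefficients of the exponential of the first variable. -/
def momCoeff (σ : ℚ) (m : ℕ) (κ : ℤ) : ℚ⟦X⟧ :=
  if 0 ≤ m + κ then C ((m.factorial : ℚ) / (m + κ).toNat.factorial)
    * eZ σ κ else 0

lemma momCoeff_of_neg {σ : ℚ} {m : ℕ} {κ : ℤ} (h : m + κ < 0) : momCoeff σ m κ = 0 :=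
  if_neg (not_le.2 h)

lemma expCoeff_svar {σ : ℚ} (hσ : σ ≠ 0) (m : ℕ) (κ : ℤ) : expCoeff (svar σ) (m + κ)
    = X ^ (m + κ).toNat * (C ((m.factorial : ℚ)⁻¹)
      * eZ σ m) * momCoeff σ m κ := by
  by_cases h : 0 ≤ m + κ
  · rw [momCoeff, if_pos h, expCoeff, if_neg (not_lt.2 h), svar_pow hσ,
      Int.toNat_of_nonneg h, eZ_add]
    have e : (algebraMap ℚ ℚ⟦X⟧) (((m + κ).toNat.factorial : ℚ))⁻¹
        = C (m.factorial : ℚ)⁻¹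
          * C ((m.factorial : ℚ) / (m + κ).toNat.factorial) := by
      rw [← map_mul]
      congr 1
      field_simp
    rw [e]
    ring
  · rw [momCoeff_of_neg (not_le.1 h), expCoeff, if_pos (not_le.1 h), mul_zero]

variable {ι : Type*} [Fintype ι] [DecidableEq ι]

/-- The contraction coefficients between vertex operators of momenta `σ i`. -/
def cross (σ : ι → ℚ) (i j : ι) : ℕ → ℚ⟦X⟧ :=
  crossCoeff (expU (σ i / 2)) (expU (σ j / 2))

/-- The normalized nested sum. -/
def nestMom (σ : ι → ℚ) (μ : ι → ℕ) : ℕ → List ι → (ι → ℤ) → ℚ⟦X⟧ :=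
  nest (cross σ) fun i => momCoeff (σ i) (μ i)

lemma prod_pow_sum {R : Type*} [CommRing R] {a b : ℤ} (x A B : R) (ha : 0 ≤ a ∨ A = 0)
    (hb : 0 ≤ b ∨ B = 0) : x ^ (a + b).toNat * (A * B) = x ^ a.toNat * A * (x ^ b.toNat * B) := by
  rcases ha with ha | rfl
  · rcases hb with hb | rfl
    · rw [Int.toNat_add ha hb, pow_add]; ring
    · simp
  · simp

lemma nest_expCoeff (σ : ι → ℚ) (μ : ι → ℕ) (B : ℕ) {l : List ι} (hl : l.Nodup)
    (hσ : ∀ i ∈ l, σ i ≠ 0) (c : ι → ℤ) :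
    nest (cross σ) (fun i => expCoeff (svar (σ i))) B l (fun i => μ i + c i)
      = (l.map fun i => C ((μ i).factorial : ℚ)⁻¹
          * eZ (σ i) (μ i)).prod
        * (X ^ (l.map fun i => μ i + c i).sum.toNat * nestMom σ μ B l c) := by
  induction l generalizing c with
  | nil => simp [nest, nestMom]
  | cons i l ih =>
    rw [nodup_cons] at hl
    rw [nestMom, nest, nest, mul_sum, mul_sum]
    refine sum_congr rfl fun f hf => ?_
    have hs := sum_eq_list_sum hl.2 hf
    have e : ∀ j, (μ j + c j - (f j : ℤ)) = μ j + (c j - f j) := fun j => by ring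
    simp only [e]
    rw [ih hl.2 (fun j hj => hσ j (mem_cons_of_mem _ hj)), add_assoc,
      expCoeff_svar (hσ i (by simp)), map_cons, map_cons, List.prod_cons, sum_cons]
    have e2 : μ i + c i + (l.map fun j => μ j + c j).sum
        = (μ i + (c i + ∑ j, (f j : ℤ))) + (l.map fun j => μ j + (c j - (f j : ℤ))).sum := by
      simp only [← e]
      rw [list_sum_sub, hs]
      ring
    have h0 : 0 ≤ (l.map fun j => μ j + (c j - (f j : ℤ))).sum
        ∨ nest (cross σ) (fun i => momCoeff (σ i) (μ i)) B l (fun j => c j - f j) = 0 := by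
      by_contra! h
      have hp := ih hl.2 (fun j hj => hσ j (mem_cons_of_mem _ hj)) fun j => c j - f j
      rw [nest_eq_zero _ _ _ hl.2 (fun i _ s hs => by rw [expCoeff, if_pos hs]) h.1] at hp
      refine h.2 ?_
      rw [eq_comm, mul_eq_zero, mul_eq_zero] at hp
      rcases hp with hp | hp | hp
      · rw [List.prod_eq_zero_iff, List.mem_map] at hp
        obtain ⟨j, -, hj⟩ := hp
        rw [mul_eq_zero] at hj
        rcases hj with hj | hj
        · rw [map_eq_zero_iff _ C_injective] at hj
          exact absurd hj (by positivity)
        · exact absurd hj (eZ_ne_zero _ _)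
      · exact absurd hp (pow_ne_zero _ X_ne_zero)
      · exact hp
    have h1 : 0 ≤ μ i + (c i + ∑ j, (f j : ℤ)) ∨ momCoeff (σ i) (μ i) (c i + ∑ j, (f j : ℤ)) = 0 := by
      by_cases h : 0 ≤ μ i + (c i + ∑ j, (f j : ℤ))
      · exact Or.inl h
      · exact Or.inr (momCoeff_of_neg (not_le.1 h))
    have h2 := prod_pow_sum (X : ℚ⟦X⟧) _ _ h1 h0
    rw [← e2] at h2
    rw [nestMom]
    linear_combination (-(C ((μ i).factorial : ℚ)⁻¹
          * eZ (σ i) (μ i) * (l.map fun i => C ((μ i).factorial : ℚ)⁻¹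
          * eZ (σ i) (μ i)).prod * ∏ j, cross σ i j (f j))) * h2

end Normalization

section Moments

open MvPolynomial

lemma nest_congr {ι R : Type*} [Fintype ι] [DecidableEq ι] [CommRing R]
    {cr cr' : ι → ι → ℕ → R} {t t' : ι → ℤ → R} (B : ℕ) {l : List ι}
    (h0 : ∀ i j, cr i j 0 = cr' i j 0) (hcr : ∀ i ∈ l, ∀ j ∈ l, cr i j = cr' i j)
    (ht : ∀ i ∈ l, t i = t' i) {c c' : ι → ℤ} (hc : ∀ i ∈ l, c i = c' i) :
    nest cr t B l c = nest cr' t' B l c' := by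
  induction l generalizing c c' with
  | nil => rfl
  | cons i l ih =>
    rw [nest, nest]
    refine sum_congr rfl fun f hf => ?_
    rw [ih (fun i hi j hj => hcr i (mem_cons_of_mem _ hi) j (mem_cons_of_mem _ hj))
      (fun i hi => ht i (mem_cons_of_mem _ hi))
      (c := fun j => c j - f j) (c' := fun j => c' j - f j)
      (fun i hi => by rw [hc i (mem_cons_of_mem _ hi)]), ht i (by simp), hc i (by simp)]
    congr 2
    refine prod_congr rfl fun j _ => ?_
    by_cases hj : j ∈ l
    · rw [hcr i (by simp) j (mem_cons_of_mem _ hj)]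
    · rw [(mem_box.1 hf j).2 hj, h0]

lemma cutGF_add (f g : Fock ℚ) : cutGF (f + g) = cutGF f + cutGF g := by
  ext d
  simp only [cutGF, coeff_mk, map_add, add_div]

lemma cutGF_zero : cutGF 0 = 0 := by
  ext d
  simp only [cutGF, coeff_mk, map_zero, zero_div]

lemma cutGF_C_mul (a : ℚ) (g : Fock ℚ) : cutGF (C a * g) = PowerSeries.C a * cutGF g := by
  ext d
  rw [PowerSeries.coeff_C_mul]
  simp only [cutGF, coeff_mk, ← smul_eq_C_mul, map_smul, smul_eq_mul, mul_div_assoc]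

lemma cutGF_sum {ι : Type*} (s : Finset ι) (f : ι → Fock ℚ) :
    cutGF (∑ i ∈ s, f i) = ∑ i ∈ s, cutGF (f i) := by
  classical
  induction s using Finset.induction_on with
  | empty => simp [cutGF_zero]
  | insert i s hi ih => rw [sum_insert hi, sum_insert hi, cutGF_add, ih]

variable {ι : Type*} [DecidableEq ι]

lemma lowerDer_prod (l : ℕ) (S : Finset ι) (μ : ι → ℕ) :
    lowerDer l (∏ i ∈ S, pw (μ i) : Fock ℚ)
      = ∑ j ∈ S, (if μ j = l then C (l : ℚ) else 0) * ∏ i ∈ S.erase j, pw (μ i) := by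
  induction S using Finset.induction_on with
  | empty => simp
  | insert i S hi ih =>
    rw [prod_insert hi, Derivation.leibniz, ih, lowerDer_pw, sum_insert hi,
      erase_insert hi, smul_eq_mul, smul_eq_mul, add_comm, mul_sum]
    congr 1
    · rw [mul_comm]
      split_ifs <;> simp
    · refine sum_congr rfl fun j hj => ?_
      rw [erase_insert_of_ne (by rintro rfl; exact hi hj), prod_insert (by simp [hi])]
      ring

lemma alphaOp_natCast {m : ℕ} (g : Fock ℚ) : alphaOp (m : ℤ) g = pw m * g := by
  have : lowerDer (K := ℚ) 0 = 0 := by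
    refine MvPolynomial.derivation_ext fun k => ?_
    rw [← pw_succ, lowerDer_pw]; simp
  rw [alphaOp, Int.toNat_natCast, Int.toNat_neg_natCast, this]
  simp

lemma alphaList_natCast (μ : ι → ℕ) {l : List ι} (hl : l.Nodup) :
    alphaList (l.map fun i => (μ i : ℤ)) = ∏ i ∈ l.toFinset, pw (μ i) := by
  induction l with
  | nil => simp [alphaList]
  | cons i l ih =>
    rw [nodup_cons] at hl
    rw [map_cons, alphaList, ih hl.2, alphaOp_natCast, List.toFinset_cons,
      prod_insert (by simpa using hl.1)]

lemma suffixBound_natCast (μ : ι → ℕ) {l : List ι} {B : ℕ} (hB : (l.map μ).sum ≤ B) :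
    SuffixBound l (fun i => (μ i : ℤ)) B := by
  rintro s ⟨p, rfl⟩
  rw [List.map_append, List.sum_append] at hB
  have : (s.map fun i => (μ i : ℤ)).sum = ((s.map μ).sum : ℕ) := by
    rw [Nat.cast_list_sum, List.map_map]; rfl
  rw [this]
  omega

lemma list_prod_map {M : Type*} [CommMonoid M] {l : List ι} (hl : l.Nodup) (f : ι → M) :
    (l.map f).prod = ∏ i ∈ l.toFinset, f i := (List.prod_toFinset f hl).symm

variable [Fintype ι]

/-- The normalizing factor relating the moments to the generating function `cutGF`. -/
def momFactor (m : ℕ) : ℚ⟦X⟧ :=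
  PowerSeries.C ((m.factorial : ℚ)⁻¹) * eZ m m * PowerSeries.X ^ m

lemma momFactor_ne_zero (m : ℕ) : momFactor m ≠ 0 := by
  refine mul_ne_zero (mul_ne_zero ?_ (eZ_ne_zero _ _)) (pow_ne_zero _ PowerSeries.X_ne_zero)
  rw [Ne, map_eq_zero_iff _ PowerSeries.C_injective]
  positivity

lemma prod_svar_mul_cutGF_prod (μ : ι → ℕ) {l : List ι} (hl : l.Nodup) (h0 : ∀ i ∈ l, 0 < μ i)
    {B : ℕ} (hB : SuffixBound l.tail (fun i => (μ i : ℤ)) B) :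
    (∏ i ∈ l.toFinset, svar (μ i)) * cutGF (∏ i ∈ l.toFinset, pw (μ i))
      = (∏ i ∈ l.toFinset, momFactor (μ i)) * nestMom (fun i => μ i) μ B l 0 := by
  have h1 := prod_svar_mul_cutGF (fun i => (μ i : ℤ)) hl
    (fun i hi => by have := h0 i hi; omega) hB
  simp only [Int.cast_natCast] at h1
  have h2 := nest_expCoeff (fun i => (μ i : ℚ)) μ B hl
    (fun i hi => by have := h0 i hi; positivity) 0
  simp only [Pi.zero_apply, add_zero] at h2
  rw [alphaList_natCast μ hl, list_prod_map hl] at h1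
  rw [h1]
  refine h2.trans ?_
  have h3 : (l.map fun i => (μ i : ℤ)).sum.toNat = ∑ i ∈ l.toFinset, μ i := by
    rw [← sum_toFinset _ hl]
    exact_mod_cast Int.toNat_natCast _
  rw [h3, list_prod_map hl, ← prod_pow_eq_pow_sum, ← mul_assoc, ← prod_mul_distrib]
  rfl

/-- The normalized moments. -/
def mom (μ : ι → ℕ) (S : Finset ι) : ℚ⟦X⟧ :=
  nestMom (fun i => μ i) μ (∑ i ∈ S, μ i) S.toList 0

lemma mom_spec (μ : ι → ℕ) (S : Finset ι) (h0 : ∀ i ∈ S, 0 < μ i) :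
    (∏ i ∈ S, svar (μ i)) * cutGF (∏ i ∈ S, pw (μ i))
      = (∏ i ∈ S, momFactor (μ i)) * mom μ S := by
  have h := prod_svar_mul_cutGF_prod μ S.nodup_toList (by simpa using h0) (B := ∑ i ∈ S, μ i) ?_
  · rwa [toList_toFinset] at h
  · have : SuffixBound S.toList (fun i => (μ i : ℤ)) (∑ i ∈ S, μ i) :=
      suffixBound_natCast μ (by rw [← sum_map_toList])
    cases hS : S.toList with
    | nil => intro s hs; simp at hs; simp only [hs, List.map_nil, List.sum_nil]; positivity
    | cons i l => rw [hS] at this; exact this.tail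

lemma nestMom_eq_mom (μ : ι → ℕ) {l : List ι} (hl : l.Nodup) (h0 : ∀ i ∈ l, 0 < μ i)
    {B : ℕ} (hB : SuffixBound l.tail (fun i => (μ i : ℤ)) B) :
    nestMom (fun i => μ i) μ B l 0 = mom μ l.toFinset := by
  have h1 := prod_svar_mul_cutGF_prod μ hl h0 hB
  rw [mom_spec μ l.toFinset (by simpa using h0)] at h1
  exact (mul_left_cancel₀ (prod_ne_zero_iff.2 fun i _ => momFactor_ne_zero _) h1).symm

lemma mom_empty (μ : ι → ℕ) : mom μ ∅ = 1 := by
  unfold mom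
  rw [toList_empty]
  rfl

lemma mom_congr {μ μ' : ι → ℕ} {S : Finset ι} (h : ∀ i ∈ S, μ i = μ' i) : mom μ S = mom μ' S := by
  rw [mom, mom, sum_congr rfl h, nestMom, nestMom]
  apply nest_congr
  · exact fun i j => rfl
  · intro i hi j hj
    rw [mem_toList] at hi hj
    rw [cross, cross, h i hi, h j hj]
  · intro i hi
    rw [mem_toList] at hi
    rw [h i hi]
  · exact fun _ _ => rfl

/-- The nested sum over the remaining sites when a distinguished site is expanded. -/
def restMom (μ : ι → ℕ) (J : Finset ι) (f : ι → ℕ) : ℚ⟦X⟧ :=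
  nestMom (fun i => μ i) μ (∑ i ∈ J, μ i) J.toList fun j => -(f j : ℤ)

lemma prod_cross_update (σ : ι → ℚ) (i : ι) (q : ℚ) {J : Finset ι} (hi : i ∉ J) {B : ℕ} {f : ι → ℕ}
    (hf : f ∈ box J.toList B) : ∏ j, cross (update σ i q) i j (f j)
      = ∏ j ∈ J, crossCoeff (expU (q / 2)) (expU (σ j / 2)) (f j) := by
  rw [← prod_subset (subset_univ J)]
  · refine prod_congr rfl fun j hj => ?_
    rw [cross, update_self, update_of_ne (by rintro rfl; exact hi hj)]
  · intro j _ hj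
    rw [(mem_box.1 hf j).2 (by simpa using hj)]
    rfl

/-- The moment expanded at a distinguished site. -/
lemma mom_insert (μ : ι → ℕ) {i : ι} {J : Finset ι} (hi : i ∉ J) (h0 : ∀ j ∈ J, 0 < μ j) {m : ℕ}
    (hm : 0 < m) : mom (update μ i m) (insert i J)
      = ∑ f ∈ box J.toList (∑ j ∈ J, μ j),
          (∏ j ∈ J, crossCoeff (expU (m / 2)) (expU (μ j / 2)) (f j))
            * momCoeff m m (∑ j, (f j : ℤ)) * restMom μ J f := by
  have hu : ∀ j ∈ J, update μ i m j = μ j := fun j hj =>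
    update_of_ne (by rintro rfl; exact hi hj) _ _
  have hiL : i ∉ J.toList := by simpa using hi
  have h1 := nestMom_eq_mom (update μ i m) (l := i :: J.toList)
    (List.nodup_cons.2 ⟨hiL, J.nodup_toList⟩) (B := ∑ j ∈ J, μ j)
    (by
      intro j hj
      rw [List.mem_cons] at hj
      rcases hj with rfl | hj
      · rwa [update_self]
      · rw [mem_toList] at hj
        rw [hu j hj]; exact h0 j hj)
    (suffixBound_natCast _ (by
      rw [List.tail_cons, sum_map_toList, sum_congr rfl hu]))
  rw [List.toFinset_cons, toList_toFinset] at h1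
  rw [← h1, nestMom, nest]
  refine sum_congr rfl fun f hf => ?_
  have hσ : (fun j => ((update μ i m j : ℕ) : ℚ))
      = update (fun j => (μ j : ℚ)) i (m : ℚ) := by
    funext j
    by_cases h : j = i
    · subst h; simp
    · simp [h]
  rw [hσ, prod_cross_update _ i _ hi hf, update_self, restMom, nestMom]
  congr 1
  · simp
  · apply nest_congr
    · exact fun _ _ => rfl
    · intro j hj k hk
      rw [mem_toList] at hj hk
      rw [cross, cross, update_of_ne (by rintro rfl; exact hi hj),
        update_of_ne (by rintro rfl; exact hi hk)]
    · intro j hj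
      rw [mem_toList] at hj
      rw [update_of_ne (by rintro rfl; exact hi hj)]
    · simp

end Moments

section NegEval

open PowerSeries

variable {ι : Type*} [Fintype ι] [DecidableEq ι]

lemma prod_eZ_ne_zero (S : Finset ι) (μ : ι → ℕ) :
    ∏ j ∈ S, (C ((μ j).factorial : ℚ)⁻¹ * eZ (μ j) (μ j)) ≠ 0 := by
  refine prod_ne_zero_iff.2 fun j _ => mul_ne_zero ?_ (eZ_ne_zero _ _)
  rw [Ne, map_eq_zero_iff _ C_injective]
  positivity

lemma nest_expCoeff_restMom (μ : ι → ℕ) {J : Finset ι} (h0 : ∀ j ∈ J, 0 < μ j) {f : ι → ℕ}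
    (hf : ∀ j ∉ J, f j = 0) :
    nest (cross fun i => (μ i : ℚ)) (fun i => expCoeff (svar (μ i))) (∑ j ∈ J, μ j) J.toList
        (fun j => μ j - f j)
      = (∏ j ∈ J, (C ((μ j).factorial : ℚ)⁻¹ * eZ (μ j) (μ j)))
        * (X ^ ((∑ j ∈ J, μ j) - ∑ j, f j) * restMom μ J f) := by
  have h := nest_expCoeff (fun i => (μ i : ℚ)) μ (∑ j ∈ J, μ j) J.nodup_toList
    (fun i hi => by have := h0 i (by simpa using hi); positivity) (fun j => -(f j : ℤ))
  simp only [← sub_eq_add_neg] at h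
  rw [h, prod_map_toList, sum_map_toList, restMom]
  have e : (∑ j ∈ J, ((μ j : ℤ) - f j)).toNat = (∑ j ∈ J, μ j) - ∑ j, f j := by
    rw [← sum_subset (subset_univ J) fun j _ hj => hf j hj, sum_sub_distrib]
    push_cast [← Nat.cast_sum]
    omega
  rw [e]

lemma restMom_eq_zero (μ : ι → ℕ) {J : Finset ι} (h0 : ∀ j ∈ J, 0 < μ j) {f : ι → ℕ}
    (hf : ∀ j ∉ J, f j = 0) (h : ∑ j ∈ J, μ j < ∑ j, f j) : restMom μ J f = 0 := by
  have h1 := nest_expCoeff_restMom μ h0 hf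
  rw [nest_eq_zero _ _ _ J.nodup_toList (fun i _ s hs => by rw [expCoeff, if_pos hs])] at h1
  · have := (mul_eq_zero.1 h1.symm).resolve_left (prod_eZ_ne_zero J μ)
    exact (mul_eq_zero.1 this).resolve_left (pow_ne_zero _ X_ne_zero)
  · rw [sum_map_toList, sum_sub_distrib,
      sum_subset (subset_univ J) (f := fun j => (f j : ℤ))
        fun j _ hj => by rw [hf j hj]; rfl]
    rw [sub_neg]
    exact_mod_cast h

lemma prod_momFactor (J : Finset ι) (μ : ι → ℕ) : ∏ j ∈ J, momFactor (μ j)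
    = (∏ j ∈ J, (C ((μ j).factorial : ℚ)⁻¹ * eZ (μ j) (μ j)))
      * X ^ ∑ j ∈ J, μ j := by
  rw [← prod_pow_eq_pow_sum, ← prod_mul_distrib]
  rfl

lemma alphaOp_neg_natCast {l : ℕ} (hl : 0 < l) (g : Fock ℚ) :
    alphaOp (-(l : ℤ)) g = lowerDer l g := by
  rw [alphaOp, neg_neg, Int.toNat_natCast, Int.toNat_neg_natCast, pw_zero, zero_mul, zero_add]

lemma prod_svar_mul_cutGF_lowerDer (μ : ι → ℕ) {J : Finset ι} (h0 : ∀ j ∈ J, 0 < μ j) (l : ℕ) :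
    (∏ j ∈ J, svar (μ j)) * cutGF (lowerDer l (∏ j ∈ J, pw (μ j)))
        * momFactor l
      = C (l : ℚ) * svar l * (∏ j ∈ J, momFactor (μ j))
        * ∑ j ∈ J, if μ j = l then mom μ (J.erase j) else 0 := by
  rw [lowerDer_prod, cutGF_sum, mul_sum, mul_sum, sum_mul]
  refine sum_congr rfl fun j hj => ?_
  split_ifs with h
  · subst h
    rw [cutGF_C_mul, ← mul_prod_erase J (fun j => svar (μ j)) hj,
      ← mul_prod_erase J (fun j => momFactor (μ j)) hj]
    linear_combination (C ((μ j : ℕ) : ℚ) * svar (μ j) * momFactor (μ j))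
      * mom_spec μ (J.erase j) fun j hj => h0 j (mem_of_mem_erase hj)
  · rw [zero_mul, cutGF_zero]
    ring

lemma svar_neg_mul_svar (q : ℚ) :
    svar (-q) * svar q = -C (q ^ 2) * X ^ 2 * sinhc q ^ 2 := by
  rw [svar_eq, svar_eq, sinhc_neg, map_neg, map_pow]
  ring

/-- The expansion of the moments at a distinguished site, evaluated at a negative integer. -/
lemma sum_restMom_neg (μ : ι → ℕ) {i : ι} {J : Finset ι} (hi : i ∉ J) (h0 : ∀ j ∈ J, 0 < μ j)
    {l : ℕ} (hl : 0 < l) :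
    (∑ f ∈ box J.toList (∑ j ∈ J, μ j), if l ≤ ∑ j, f j then
        (∏ j ∈ J, crossCoeff (expU (-l / 2)) (expU (μ j / 2)) (f j))
          * (C (((∑ j, f j) - l).factorial : ℚ)⁻¹
            * (C (-l : ℚ) * sinhc l) ^ ((∑ j, f j) - l)) * restMom μ J f
        else 0) * (C (l.factorial : ℚ)⁻¹ * (C (l : ℚ) * sinhc l) ^ l)
      = -C (l ^ 3 : ℚ) * X ^ 2 * sinhc l ^ 2
          * ∑ j ∈ J, if μ j = l then mom μ (J.erase j) else 0 := by
  have hcJ : ∀ j ∈ J, update (fun j => (μ j : ℤ)) i (-l) j = μ j := fun j hj =>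
    update_of_ne (by rintro rfl; exact hi hj) _ _
  have hiL : i ∉ J.toList := by simpa using hi
  have h1 := prod_svar_mul_cutGF (update (fun j => (μ j : ℤ)) i (-l)) (l := i :: J.toList)
    (List.nodup_cons.2 ⟨hiL, J.nodup_toList⟩) (B := ∑ j ∈ J, μ j)
    (by
      intro j hj
      rw [List.mem_cons] at hj
      rcases hj with rfl | hj
      · rw [update_self]; omega
      · rw [mem_toList] at hj
        have := h0 j hj
        rw [hcJ j hj]; omega)
    (by
      have h2 := suffixBound_natCast μ (l := J.toList) (B := ∑ j ∈ J, μ j)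
        (by rw [sum_map_toList])
      intro s hs
      refine le_of_eq_of_le (congrArg List.sum (List.map_congr_left fun j hj => hcJ j ?_)) (h2 s hs)
      simpa using hs.subset hj)
  rw [map_cons, List.prod_cons, update_self, prod_map_toList,
    prod_congr rfl fun j hj => by rw [hcJ j hj], map_cons, update_self,
    alphaList, List.map_congr_left (g := fun j => (μ j : ℤ)) fun j hj => hcJ j (by simpa using hj),
    alphaList_natCast μ J.nodup_toList, toList_toFinset, alphaOp_neg_natCast hl, nest] at h1
  have h2 := prod_svar_mul_cutGF_lowerDer μ h0 l
  have h3 : X ^ l * (∑ f ∈ box J.toList (∑ j ∈ J, μ j),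
        (∏ j, crossCoeff (expU ((update (fun j => (μ j : ℤ)) i (-l) i : ℤ) / 2))
          (expU ((update (fun j => (μ j : ℤ)) i (-l) j : ℤ) / 2)) (f j))
        * expCoeff (svar (update (fun j => (μ j : ℤ)) i (-l) i : ℤ))
          (update (fun j => (μ j : ℤ)) i (-l) i + ∑ j, (f j : ℤ))
        * nest (fun i' j => crossCoeff
            (expU ((update (fun j => (μ j : ℤ)) i (-l) i' : ℤ) / 2))
            (expU ((update (fun j => (μ j : ℤ)) i (-l) j : ℤ) / 2)))
          (fun i' => expCoeff (svar (update (fun j => (μ j : ℤ)) i (-l) i' : ℤ)))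
          (∑ j ∈ J, μ j) J.toList
          (fun j => update (fun j => (μ j : ℤ)) i (-l) j - (f j : ℤ)))
      = (∏ j ∈ J, momFactor (μ j)) * ∑ f ∈ box J.toList (∑ j ∈ J, μ j), if l ≤ ∑ j, f j then
        (∏ j ∈ J, crossCoeff (expU (-l / 2)) (expU (μ j / 2)) (f j))
          * (C (((∑ j, f j) - l).factorial : ℚ)⁻¹
            * (C (-l : ℚ) * sinhc l) ^ ((∑ j, f j) - l)) * restMom μ J f
        else 0 := by
    rw [mul_sum, mul_sum]
    refine sum_congr rfl fun f hf => ?_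
    have hfJ : ∀ j ∉ J, f j = 0 := fun j hj => (mem_box.1 hf j).2 (by simpa using hj)
    have e1 : (∏ j, crossCoeff (expU ((update (fun j => (μ j : ℤ)) i (-l) i : ℤ) / 2))
          (expU ((update (fun j => (μ j : ℤ)) i (-l) j : ℤ) / 2)) (f j))
        = ∏ j ∈ J, crossCoeff (expU (-l / 2)) (expU (μ j / 2)) (f j) := by
      rw [← prod_subset (subset_univ J)]
      · refine prod_congr rfl fun j hj => ?_
        rw [hcJ j hj, update_self]
        push_cast
        rfl
      · intro j _ hj
        rw [hfJ j hj]
        rfl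
    have e2 : nest (fun i' j => crossCoeff
            (expU ((update (fun j => (μ j : ℤ)) i (-l) i' : ℤ) / 2))
            (expU ((update (fun j => (μ j : ℤ)) i (-l) j : ℤ) / 2)))
          (fun i' => expCoeff (svar (update (fun j => (μ j : ℤ)) i (-l) i' : ℤ)))
          (∑ j ∈ J, μ j) J.toList
          (fun j => update (fun j => (μ j : ℤ)) i (-l) j - (f j : ℤ))
        = nest (cross fun i => (μ i : ℚ)) (fun i => expCoeff (svar (μ i))) (∑ j ∈ J, μ j) J.toList
        (fun j => μ j - f j) := by
      apply nest_congr
      · exact fun _ _ => rfl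
      · intro j hj k hk
        rw [hcJ j (by simpa using hj), hcJ k (by simpa using hk)]
        rfl
      · intro j hj
        rw [hcJ j (by simpa using hj)]
        rfl
      · intro j hj
        rw [hcJ j (by simpa using hj)]
    rw [e1, e2, nest_expCoeff_restMom μ h0 hfJ, prod_momFactor, update_self, expCoeff]
    split_ifs with ha hb hb
    · rw [← Nat.cast_sum] at ha
      omega
    · ring
    · by_cases hr : ∑ j ∈ J, μ j < ∑ j, f j
      · rw [restMom_eq_zero μ h0 hfJ hr]
        ring
      · have e3 : (-(l : ℤ) + ∑ j, (f j : ℤ)).toNat = (∑ j, f j) - l := by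
          rw [← Nat.cast_sum]
          omega
        have e4 : ∑ j ∈ J, μ j = l + ((∑ j, f j) - l) + ((∑ j ∈ J, μ j) - ∑ j, f j) := by omega
        rw [e3, svar_eq, Int.cast_neg, Int.cast_natCast, sinhc_neg]
        have e5 : (X : ℚ⟦X⟧) ^ (∑ j ∈ J, μ j) = X ^ l
            * X ^ ((∑ j, f j) - l)
            * X ^ ((∑ j ∈ J, μ j) - ∑ j, f j) := by
          rw [← pow_add, ← pow_add, ← e4]
        rw [e5, mul_right_comm (C (-(l : ℚ))), mul_pow _ X]
        have e6 : algebraMap ℚ ℚ⟦X⟧ (((∑ j, f j) - l).factorial : ℚ)⁻¹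
          = C (((∑ j, f j) - l).factorial : ℚ)⁻¹ := rfl
        rw [e6]
        ring
    · rw [← Nat.cast_sum] at ha
      omega
  rw [← h1] at h3
  have hA : ∏ j ∈ J, momFactor (μ j) ≠ 0 :=
    prod_ne_zero_iff.2 fun j _ => momFactor_ne_zero _
  have e7 : C (l.factorial : ℚ)⁻¹ * (C (l : ℚ) * sinhc l) ^ l
      * X ^ l = momFactor l := by
    rw [momFactor, eZ_natCast (by positivity), mul_pow, map_pow]
  refine mul_left_cancel₀ hA ?_
  rw [← mul_assoc, ← h3]
  have e8 := svar_neg_mul_svar l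
  rw [map_pow] at e8
  rw [map_pow]
  push_cast
  linear_combination (svar (-l) * (∏ j ∈ J, svar (μ j)) * cutGF (lowerDer l (∏ j ∈ J, pw (μ j))))
    * e7 + svar (-l) * h2 + C (l : ℚ) * (∏ j ∈ J, momFactor (μ j))
        * (∑ j ∈ J, if μ j = l then mom μ (J.erase j) else 0) * e8

end NegEval

section PolyFamilies

open PowerSeries

/-- Evaluation of the coefficients of a power series over a polynomial ring. -/
def evP (m : ℚ) : PowerSeries (Polynomial ℚ) →+* ℚ⟦X⟧ :=
  map (Polynomial.evalRingHom m)

/-- The inclusion of constant coefficients. -/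
def constP : ℚ⟦X⟧ →+* PowerSeries (Polynomial ℚ) :=
  map Polynomial.C

lemma coeff_evP (m : ℚ) (F : PowerSeries (Polynomial ℚ)) (N : ℕ) :
    coeff N (evP m F) = (coeff N F).eval m := by
  rw [evP, coeff_map]; rfl

lemma evP_constP (m : ℚ) (F : ℚ⟦X⟧) : evP m (constP F) = F := by
  ext N
  rw [coeff_evP, constP, coeff_map, eval_C]

lemma evP_C (m : ℚ) (p : Polynomial ℚ) :
    evP m (C p) = C (p.eval m) := by
  rw [evP, map_C]; rfl

lemma evP_X (m : ℚ) : evP m X = X := map_X _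

lemma C_dvd_iff_forall_coeff {R : Type*} [CommRing R] {a : R} {F : R⟦X⟧} :
    C a ∣ F ↔ ∀ N, a ∣ coeff N F := by
  constructor
  · rintro ⟨G, rfl⟩ N
    rw [coeff_C_mul]
    exact dvd_mul_right _ _
  · intro h
    choose g hg using h
    refine ⟨mk g, ?_⟩
    ext N
    rw [coeff_C_mul, coeff_mk, hg]

/-- The family `sinhc m`. -/
def sinhcP : PowerSeries (Polynomial ℚ) :=
  mk fun j =>
    if Even j then Polynomial.C (1 / (2 ^ j * (j + 1).factorial) : ℚ) * Polynomial.X ^ j else 0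

lemma evP_sinhcP (m : ℚ) : evP m sinhcP = sinhc m := by
  ext N
  rw [coeff_evP, sinhcP, coeff_mk, coeff_sinhc]
  split_ifs
  · simp; ring
  · simp

lemma C_dvd_sinhcP_sub_one : C (Polynomial.X ^ 2) ∣ sinhcP - 1 := by
  rw [C_dvd_iff_forall_coeff]
  intro N
  rw [map_sub, sinhcP, coeff_mk, coeff_one]
  rcases N with _ | _ | N
  · simp
  · simp
  · rw [if_neg (by omega : ¬ N + 1 + 1 = 0), sub_zero]
    split_ifs
    · exact Dvd.dvd.mul_left (pow_dvd_pow _ (by omega)) _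
    · exact dvd_zero _

lemma constantCoeff_sinhcP : constantCoeff sinhcP = 1 := by
  rw [← coeff_zero_eq_constantCoeff_apply, sinhcP, coeff_mk]
  simp

/-- The family of the inverses of `sinhc m`. -/
def sinhcInvP : PowerSeries (Polynomial ℚ) := invOfUnit sinhcP 1

lemma sinhcP_mul_inv : sinhcP * sinhcInvP = 1 :=
  mul_invOfUnit _ _ (by rw [constantCoeff_sinhcP, Units.val_one])

lemma C_dvd_sinhcInvP_sub_one : C (Polynomial.X ^ 2) ∣ sinhcInvP - 1 := by
  have h : sinhcInvP - 1 = -((sinhcP - 1) * sinhcInvP) := by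
    linear_combination sinhcP_mul_inv
  rw [h, dvd_neg]
  exact C_dvd_sinhcP_sub_one.mul_right _

/-- The family `sinhc m ^ e m`. -/
def sinhcPowP (e : Polynomial ℚ) : PowerSeries (Polynomial ℚ) :=
  mk fun N => ∑ k ∈ range (N + 1),
    Polynomial.C (k.factorial : ℚ)⁻¹ * (descPochhammer ℚ k).comp e
      * coeff N ((sinhcP - 1) ^ k)

lemma coeff_pow_eq_zero {R : Type*} [CommRing R] {T : R⟦X⟧}
    (h : constantCoeff T = 0) {N k : ℕ} (hk : N < k) :
    coeff N (T ^ k) = 0 := by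
  obtain ⟨T', rfl⟩ := X_dvd_iff.2 h
  rw [mul_pow, coeff_X_pow_mul', if_neg (by omega)]

lemma coeff_one_add_pow {T : ℚ⟦X⟧} (h : constantCoeff T = 0) (N a : ℕ) :
    coeff N ((1 + T) ^ a)
      = ∑ k ∈ range (N + 1), (a.choose k : ℚ) * coeff N (T ^ k) := by
  have h1 : coeff N ((1 + T) ^ a)
      = ∑ k ∈ range (a + 1), (a.choose k : ℚ) * coeff N (T ^ k) := by
    rw [add_comm, add_pow, map_sum]
    refine sum_congr rfl fun k _ => ?_
    rw [one_pow, mul_one, ← map_natCast (C (R := ℚ)), coeff_mul_C, mul_comm]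
  rw [h1]
  rcases le_total a N with haN | haN
  · refine sum_subset (range_mono (by omega)) fun k _ hk => ?_
    rw [Nat.choose_eq_zero_of_lt (by simpa using hk), Nat.cast_zero, zero_mul]
  · symm
    refine sum_subset (range_mono (by omega)) fun k _ hk => ?_
    rw [coeff_pow_eq_zero h (by simpa using hk), mul_zero]

lemma evP_sinhcPowP {e : Polynomial ℚ} {m : ℚ} {a : ℕ} (h : e.eval m = a) :
    evP m (sinhcPowP e) = sinhc m ^ a := by
  have h0 : sinhc m = 1 + (sinhc m - 1) := by ring
  ext N
  rw [h0, coeff_one_add_pow (by rw [map_sub, constantCoeff_sinhc, map_one, sub_self]), coeff_evP,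
    sinhcPowP, coeff_mk, Polynomial.eval_finsetSum]
  refine sum_congr rfl fun k _ => ?_
  rw [eval_mul, eval_mul, eval_C, Polynomial.eval_comp, h,
    descPochhammer_eval_eq_descFactorial, ← coeff_evP, map_pow, map_sub, evP_sinhcP, map_one,
    Nat.descFactorial_eq_factorial_mul_choose]
  push_cast
  field_simp

lemma C_dvd_sinhcPowP_sub_one (e : Polynomial ℚ) :
    C (Polynomial.X ^ 2) ∣ sinhcPowP e - 1 := by
  rw [C_dvd_iff_forall_coeff]
  intro N
  rw [map_sub, sinhcPowP, coeff_mk, sum_range_succ']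
  simp only [Nat.factorial_zero, Nat.cast_one, inv_one, map_one, descPochhammer_zero,
    Polynomial.one_comp, one_mul, pow_zero, add_sub_cancel_right]
  refine dvd_sum fun k _ => Dvd.dvd.mul_left ?_ _
  rw [pow_succ]
  exact C_dvd_iff_forall_coeff.1 (C_dvd_sinhcP_sub_one.mul_left _) N

/-- The family `ex (a * m + b)`. -/
def exP (a b : ℚ) : PowerSeries (Polynomial ℚ) :=
  mk fun N => Polynomial.C (N.factorial : ℚ)⁻¹
    * (Polynomial.C a * Polynomial.X + Polynomial.C b) ^ N

lemma evP_exP (a b m : ℚ) : evP m (exP a b) = ex (a * m + b) := by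
  ext N
  rw [coeff_evP, exP, coeff_mk, coeff_ex]
  simp
  ring

/-- The family of contraction coefficients. -/
def crossP (q : ℚ) : ℕ → PowerSeries (Polynomial ℚ)
  | 0 => 1
  | f + 1 => C Polynomial.X * (X * sinhcP * constP (svar q)
      * ∑ x ∈ antidiagonal f,
        exP (((x.1 : ℤ) - x.2 : ℤ) / 2) (((x.1 : ℤ) - x.2 : ℤ) * (q / 2)))

lemma evP_crossP (q m : ℚ) (f : ℕ) :
    evP m (crossP q f) = crossCoeff (expU (m / 2)) (expU (q / 2)) f := by
  cases f with
  | zero => rw [crossP, crossCoeff, map_one]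
  | succ f =>
    rw [crossP, crossCoeff, sg_expU, sg_expU, Int.cast_one, one_mul, one_mul, svar_eq m, map_mul,
      map_mul, map_mul, map_mul, evP_C, eval_X, evP_X, evP_sinhcP, evP_constP, map_sum,
      ← mul_assoc, ← mul_assoc, ← mul_assoc]
    congr 1
    refine sum_congr rfl fun x _ => ?_
    rw [evP_exP, expU_mul, expU_zpow, val_expU]
    congr 1
    ring

lemma C_X_dvd_crossP (q : ℚ) {f : ℕ} (hf : f ≠ 0) :
    C Polynomial.X ∣ crossP q f := by
  cases f with
  | zero => exact absurd rfl hf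
  | succ f => exact dvd_mul_right _ _

end PolyFamilies

section OneVariable

open PowerSeries

/-- The product of the `X + x` for `r < x ≤ M`. -/
def risingP (r M : ℕ) : Polynomial ℚ :=
  ∏ x ∈ Ioc r M, (Polynomial.X + Polynomial.C (x : ℚ))

lemma eval_risingP (r M : ℕ) (q : ℚ) :
    (risingP r M).eval q = ∏ x ∈ Ioc r M, (q + x) := by
  rw [risingP, eval_prod]
  simp

lemma eval_risingP_neg {r M l : ℕ} (hr : r ≤ M) (hl : l ≤ r) :
    (risingP r M).eval (-l : ℚ) = (M - l).factorial / (r - l).factorial := by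
  rw [eval_risingP]
  induction M, hr using Nat.le_induction with
  | base => rw [Ioc_self, prod_empty]; field_simp
  | succ M hM ih =>
    rw [prod_Ioc_succ_top hM, ih, Nat.succ_sub (hl.trans hM), Nat.factorial_succ]
    push_cast [Nat.cast_sub (hl.trans hM)]
    ring

lemma eval_risingP_neg_of_lt {r M l : ℕ} (hr : r < l) (hl : l ≤ M) :
    (risingP r M).eval (-l : ℚ) = 0 := by
  rw [eval_risingP]
  exact prod_eq_zero (mem_Ioc.2 ⟨hr, hl⟩) (neg_add_cancel _)

lemma eval_risingP_natCast {r M : ℕ} (hr : r ≤ M) (m : ℕ) :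
    (risingP r M).eval (m : ℚ) = (m + M).factorial / (m + r).factorial := by
  rw [eval_risingP]
  induction M, hr using Nat.le_induction with
  | base => rw [Ioc_self, prod_empty]; field_simp
  | succ M hM ih =>
    rw [prod_Ioc_succ_top hM, ih, ← add_assoc, Nat.factorial_succ]
    push_cast
    ring

/-- The product of the `X + x` for `0 < x ≤ M` and `x ≠ l`. -/
def omitP (l M : ℕ) : Polynomial ℚ :=
  ∏ x ∈ (Ioc 0 M).erase l, (Polynomial.X + Polynomial.C (x : ℚ))

lemma mul_omitP {l M : ℕ} (hl : 0 < l) (hM : l ≤ M) :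
    (Polynomial.X + Polynomial.C (l : ℚ)) * omitP l M = risingP 0 M :=
  mul_prod_erase _ (fun x : ℕ => Polynomial.X + Polynomial.C (x : ℚ))
    (mem_Ioc.2 ⟨hl, hM⟩)

lemma eval_omitP_self {l M : ℕ} (hl : 0 < l) (hM : l ≤ M) :
    (omitP l M).eval (-l : ℚ) = (-1) ^ (l - 1) * (l - 1).factorial * (M - l).factorial := by
  have h : (Ioc 0 M).erase l = Ioc 0 (l - 1) ∪ Ioc l M := by
    ext x
    simp only [mem_erase, mem_Ioc, mem_union]
    omega
  have hd : Disjoint (Ioc 0 (l - 1)) (Ioc l M) := by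
    rw [disjoint_left]
    intro x hx
    simp only [mem_Ioc] at hx ⊢
    omega
  rw [omitP, h, prod_union hd, eval_mul]
  have h1 := eval_risingP_neg (le_refl l |>.trans hM) le_rfl
  rw [Nat.sub_self, Nat.factorial_zero, Nat.cast_one, div_one, risingP] at h1
  rw [h1]
  congr 1
  obtain ⟨p, rfl⟩ : ∃ p, l = p + 1 := ⟨l - 1, by omega⟩
  rw [Nat.add_sub_cancel, eval_prod]
  have h2 : Ioc 0 p = (range p).image fun x => p - x := by
    ext x
    simp only [mem_Ioc, mem_image, mem_range]
    constructor
    · intro hx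
      exact ⟨p - x, by omega, by omega⟩
    · rintro ⟨y, hy, rfl⟩
      omega
  rw [h2, prod_image fun x hx y hy hxy => by
    simp only [coe_range, Set.mem_Iio] at hx hy
    omega]
  rw [← prod_range_add_one_eq_factorial, Nat.cast_prod]
  have h3 : (-1 : ℚ) ^ p = ∏ _x ∈ range p, (-1 : ℚ) := by
    rw [prod_const, card_range]
  rw [h3, ← prod_mul_distrib]
  refine prod_congr rfl fun x hx => ?_
  rw [mem_range] at hx
  rw [eval_add, eval_X, eval_C, Nat.cast_sub hx.le]
  push_cast
  ring

lemma eval_omitP_of_ne {l l' M : ℕ} (hl : 0 < l) (hM : l ≤ M) (h : l' ≠ l) :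
    (omitP l' M).eval (-l : ℚ) = 0 := by
  rw [omitP, eval_prod]
  refine prod_eq_zero (mem_erase.2 ⟨h.symm, mem_Ioc.2 ⟨hl, hM⟩⟩) ?_
  simp

lemma risingP_dvd {M : ℕ} {p : Polynomial ℚ}
    (h : ∀ l : ℕ, 0 < l → l ≤ M → p.eval (-l : ℚ) = 0) : risingP 0 M ∣ p := by
  refine prod_dvd_of_coprime ?_ fun l hl => ?_
  · intro x _ y _ hxy
    have : Polynomial.X + Polynomial.C (x : ℚ) = Polynomial.X - Polynomial.C (-x : ℚ) := by simp
    have e2 : Polynomial.X + Polynomial.C (y : ℚ) = Polynomial.X - Polynomial.C (-y : ℚ) := by simp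
    simp only [Function.onFun, this, e2]
    refine Polynomial.isCoprime_X_sub_C_of_isUnit_sub ?_
    rw [isUnit_iff_ne_zero, sub_ne_zero, Ne, neg_inj, Nat.cast_inj]
    exact hxy
  · rw [mem_Ioc] at hl
    have : Polynomial.X + Polynomial.C (l : ℚ) = Polynomial.X - Polynomial.C (-l : ℚ) := by simp
    rw [this, Polynomial.dvd_iff_isRoot]
    exact h l hl.1 hl.2

variable {ι : Type*} [Fintype ι] [DecidableEq ι]

/-- The moments normalized to be polynomial up to simple poles. -/
def nmom (μ : ι → ℕ) (S : Finset ι) : ℚ⟦X⟧ :=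
  (∏ j ∈ S, sinhc (μ j) ^ (μ j - 1)) * mom μ S

lemma nmom_empty (μ : ι → ℕ) : nmom μ ∅ = 1 := by
  rw [nmom, mom_empty, prod_empty, one_mul]

lemma nmom_congr {μ μ' : ι → ℕ} {S : Finset ι} (h : ∀ i ∈ S, μ i = μ' i) :
    nmom μ S = nmom μ' S := by
  rw [nmom, nmom, mom_congr h, prod_congr rfl fun i hi => by rw [h i hi]]

/-- The family of the summands of the moment expanded at a distinguished site. -/
def termP (μ : ι → ℕ) (J : Finset ι) (f : ι → ℕ) : PowerSeries (Polynomial ℚ) :=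
  C (Polynomial.X ^ (∑ j, f j) * risingP (∑ j, f j) (∑ j ∈ J, μ j))
    * (sinhcPowP (Polynomial.X + Polynomial.C ((∑ j, f j : ℕ) : ℚ)) * sinhcInvP)
    * (∏ j ∈ J, crossP (μ j) (f j)) * constP (restMom μ J f)

lemma evP_mul_mul (m : ℚ) (p : Polynomial ℚ) (a b c d : PowerSeries (Polynomial ℚ)) :
    evP m (C p * (a * b) * c * d)
      = C (p.eval m) * (evP m a * evP m b) * evP m c * evP m d := by
  rw [map_mul, map_mul, map_mul, map_mul, evP_C]

lemma evP_termP (μ : ι → ℕ) {J : Finset ι} (h0 : ∀ j ∈ J, 0 < μ j) {f : ι → ℕ}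
    (hf : ∀ j ∉ J, f j = 0) {m : ℕ} (hm : 0 < m) :
    evP m (termP μ J f) = C ((risingP 0 (∑ j ∈ J, μ j)).eval (m : ℚ))
      * (sinhc m ^ (m - 1) * ((∏ j ∈ J, crossCoeff (expU (m / 2)) (expU (μ j / 2)) (f j))
            * momCoeff m m (∑ j, (f j : ℤ)) * restMom μ J f)) := by
  by_cases hr : ∑ j ∈ J, μ j < ∑ j, f j
  · rw [termP, restMom_eq_zero μ h0 hf hr]
    simp
  · have hs : sinhc m ^ (m - 1) * sinhc m = sinhc (m : ℚ) ^ m := by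
      rw [← pow_succ, Nat.sub_add_cancel hm]
    have hi := congrArg (evP m) sinhcP_mul_inv
    rw [map_mul, map_one, evP_sinhcP] at hi
    rw [termP, evP_mul_mul, evP_constP, map_prod,
      evP_sinhcPowP (a := m + ∑ j, f j) (by
        rw [eval_add, eval_X, eval_C, Nat.cast_add]), ← Nat.cast_sum, momCoeff,
      if_pos (by positivity), eZ_natCast (by positivity), ← Nat.cast_add, Int.toNat_natCast,
      eval_risingP_natCast (Nat.zero_le _), eval_mul,
      eval_risingP_natCast (not_lt.1 hr), eval_pow, eval_X]
    simp only [evP_crossP]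
    have e : C ((m : ℚ) ^ (∑ j, f j)
          * (((m + ∑ j ∈ J, μ j).factorial : ℚ) / (m + ∑ j, f j).factorial))
        = C (((m + ∑ j ∈ J, μ j).factorial : ℚ) / (m + 0).factorial)
          * (C ((m.factorial : ℚ) / (m + ∑ j, f j).factorial)
            * C ((m : ℚ) ^ (∑ j, f j))) := by
      rw [← map_mul, ← map_mul, add_zero]
      congr 1
      field_simp
    rw [e, pow_add, ← hs]
    linear_combination (C (((m + ∑ j ∈ J, μ j).factorial : ℚ) / (m + 0).factorial)
          * (C ((m.factorial : ℚ) / (m + ∑ j, f j).factorial)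
            * C ((m : ℚ) ^ (∑ j, f j)))) * sinhc m ^ (m - 1) * sinhc m ^ (∑ j, f j)
          * (∏ j ∈ J, crossCoeff (expU (m / 2)) (expU (μ j / 2)) (f j)) * restMom μ J f * hi

lemma evP_termP_neg (μ : ι → ℕ) {J : Finset ι} (h0 : ∀ j ∈ J, 0 < μ j) {f : ι → ℕ}
    (hf : ∀ j ∉ J, f j = 0) {l : ℕ} (hl : 0 < l) (hM : l ≤ ∑ j ∈ J, μ j) :
    evP (-l) (termP μ J f) = C (((∑ j ∈ J, μ j) - l).factorial * (-l) ^ l : ℚ)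
      * evP (-l) sinhcInvP * (if l ≤ ∑ j, f j then
        (∏ j ∈ J, crossCoeff (expU (-l / 2)) (expU (μ j / 2)) (f j))
          * (C (((∑ j, f j) - l).factorial : ℚ)⁻¹
            * (C (-l : ℚ) * sinhc l) ^ ((∑ j, f j) - l)) * restMom μ J f
        else 0) := by
  by_cases hr : ∑ j ∈ J, μ j < ∑ j, f j
  · rw [termP, restMom_eq_zero μ h0 hf hr]
    simp
  · rw [termP, evP_mul_mul, evP_constP, map_prod, eval_mul]
    split_ifs with h
    · rw [eval_risingP_neg (not_lt.1 hr) h,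
        evP_sinhcPowP (a := (∑ j, f j) - l) (by
          rw [Nat.cast_sub h, eval_add, eval_X, eval_C]; ring), sinhc_neg,
        eval_pow, eval_X]
      simp only [evP_crossP]
      have e : C ((-l : ℚ) ^ (∑ j, f j)
          * ((((∑ j ∈ J, μ j) - l).factorial : ℚ) / ((∑ j, f j) - l).factorial))
        = C (((∑ j ∈ J, μ j) - l).factorial * (-l) ^ l : ℚ)
          * (C (((∑ j, f j) - l).factorial : ℚ)⁻¹
            * C (-l : ℚ) ^ ((∑ j, f j) - l)) := by
        rw [← map_pow, ← map_mul, ← map_mul]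
        congr 1
        have : (-l : ℚ) ^ (∑ j, f j) = (-l) ^ l * (-l) ^ ((∑ j, f j) - l) := by
          rw [← pow_add]; congr 1; omega
        rw [this]
        field_simp
      rw [e, mul_pow]
      ring
    · rw [eval_risingP_neg_of_lt (not_le.1 h) hM]
      simp

end OneVariable

section Residues

open PowerSeries

variable {ι : Type*} [Fintype ι] [DecidableEq ι]

lemma restMom_zero (μ : ι → ℕ) (J : Finset ι) : restMom μ J 0 = mom μ J := by
  rw [restMom, mom]
  simp only [Pi.zero_apply, Nat.cast_zero, neg_zero]
  rfl

lemma momCoeff_zero (σ : ℚ) (m : ℕ) : momCoeff σ m 0 = 1 := by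
  rw [momCoeff, if_pos (by simp), eZ_zero, mul_one, add_zero, Int.toNat_natCast, div_self (by positivity),
    map_one]

/-- The family of all summands but the first of the moment expanded at a distinguished site. -/
def sumP (μ : ι → ℕ) (J : Finset ι) : PowerSeries (Polynomial ℚ) :=
  ∑ f ∈ (box J.toList (∑ j ∈ J, μ j)).erase 0, termP μ J f

lemma zero_mem_box (l : List ι) (B : ℕ) : (0 : ι → ℕ) ∈ box l B :=
  mem_box.2 fun _ => ⟨fun _ => Nat.zero_le _, fun _ => rfl⟩

lemma C_dvd_sumP (μ : ι → ℕ) (J : Finset ι) : C (Polynomial.X ^ 2) ∣ sumP μ J := by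
  refine dvd_sum fun f hf => ?_
  rw [mem_erase] at hf
  obtain ⟨j, hj⟩ := Function.ne_iff.1 hf.1
  have hjJ : j ∈ J := by
    by_contra h
    exact hj ((mem_box.1 hf.2 j).2 (by simpa using h))
  have hr : ∑ j, f j ≠ 0 := fun h => hj (sum_eq_zero_iff.1 h j (mem_univ _))
  have h1 : C Polynomial.X ∣
      C (Polynomial.X ^ (∑ j, f j) * risingP (∑ j, f j) (∑ j ∈ J, μ j)) :=
    map_dvd _ ((dvd_pow_self _ hr).mul_right _)
  have h2 : C Polynomial.X ∣ ∏ j ∈ J, crossP (μ j) (f j) :=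
    (C_X_dvd_crossP (μ j) hj).trans (dvd_prod_of_mem _ hjJ)
  rw [sq, map_mul, termP]
  exact (mul_dvd_mul (h1.mul_right _) h2).mul_right _

lemma nmom_insert_eq (μ : ι → ℕ) {i : ι} {J : Finset ι} (hi : i ∉ J) (h0 : ∀ j ∈ J, 0 < μ j) {m : ℕ}
    (hm : 0 < m) :
    C ((risingP 0 (∑ j ∈ J, μ j)).eval (m : ℚ))
        * nmom (update μ i m) (insert i J)
      = C ((risingP 0 (∑ j ∈ J, μ j)).eval (m : ℚ)) * (sinhc m ^ (m - 1) * nmom μ J)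
        + (∏ j ∈ J, sinhc (μ j) ^ (μ j - 1)) * evP m (sumP μ J) := by
  have hu : ∀ j ∈ J, update μ i m j = μ j := fun j hj =>
    update_of_ne (by rintro rfl; exact hi hj) _ _
  rw [nmom, mom_insert μ hi h0 hm, prod_insert hi, update_self,
    prod_congr rfl fun j hj => by rw [hu j hj],
    ← add_sum_erase _ _ (zero_mem_box J.toList (∑ j ∈ J, μ j)), sumP, map_sum,
    sum_congr (rfl : (box J.toList (∑ j ∈ J, μ j)).erase 0 = _) fun f hf =>
      evP_termP μ h0 (fun j hj => (mem_box.1 (mem_of_mem_erase hf) j).2 (by simpa using hj)) hm,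
    ← mul_sum, ← mul_sum, restMom_zero, nmom]
  have e : (∏ j ∈ J, crossCoeff (expU (m / 2)) (expU (μ j / 2)) ((0 : ι → ℕ) j))
      * momCoeff m m (∑ j, (((0 : ι → ℕ) j : ℕ) : ℤ)) = 1 := by
    simp [crossCoeff, momCoeff_zero]
  rw [e]
  ring

lemma evP_neg_sumP (μ : ι → ℕ) {i : ι} {J : Finset ι} (hi : i ∉ J) (h0 : ∀ j ∈ J, 0 < μ j) {l : ℕ}
    (hl : 0 < l) (hM : l ≤ ∑ j ∈ J, μ j) :
    (∏ j ∈ J, sinhc (μ j) ^ (μ j - 1)) * evP (-l) (sumP μ J)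
      = C ((-1) ^ (l - 1) * (l - 1).factorial * ((∑ j ∈ J, μ j) - l).factorial * l ^ 4 : ℚ)
          * X ^ 2 * ∑ j ∈ J, if μ j = l then nmom μ (J.erase j) else 0 := by
  have h1 := sum_restMom_neg μ hi h0 hl
  have h2 : evP (-l) (sumP μ J) = C (((∑ j ∈ J, μ j) - l).factorial * (-l) ^ l : ℚ)
      * evP (-l) sinhcInvP * ∑ f ∈ box J.toList (∑ j ∈ J, μ j), (if l ≤ ∑ j, f j then
        (∏ j ∈ J, crossCoeff (expU (-l / 2)) (expU (μ j / 2)) (f j))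
          * (C (((∑ j, f j) - l).factorial : ℚ)⁻¹
            * (C (-l : ℚ) * sinhc l) ^ ((∑ j, f j) - l)) * restMom μ J f
        else 0) := by
    rw [← add_sum_erase _ _ (zero_mem_box J.toList (∑ j ∈ J, μ j)), if_neg (by simp; omega),
      zero_add, sumP, map_sum, mul_sum]
    exact sum_congr rfl fun f hf => evP_termP_neg μ h0
      (fun j hj => (mem_box.1 (mem_of_mem_erase hf) j).2 (by simpa using hj)) hl hM
  have h3 : sinhc (l : ℚ) ^ (l - 1) * ∑ j ∈ J, (if μ j = l then nmom μ (J.erase j) else 0)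
      = (∏ j ∈ J, sinhc (μ j) ^ (μ j - 1))
        * ∑ j ∈ J, (if μ j = l then mom μ (J.erase j) else 0) := by
    rw [mul_sum, mul_sum]
    refine sum_congr rfl fun j hj => ?_
    split_ifs with h
    · subst h
      rw [nmom, ← mul_prod_erase J (fun j => sinhc (μ j) ^ (μ j - 1)) hj, mul_assoc]
    · rw [mul_zero, mul_zero]
  have h4 := congrArg (evP (-l : ℚ)) sinhcP_mul_inv
  rw [map_mul, map_one, evP_sinhcP, sinhc_neg] at h4
  have hS : sinhc (l : ℚ) ≠ 0 := fun h => by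
    have := constantCoeff_sinhc (l : ℚ)
    rw [h, map_zero] at this
    exact zero_ne_one this
  refine mul_left_cancel₀ (pow_ne_zero (l + 1) hS) ?_
  rw [h2]
  set s₁ := ∑ f ∈ box J.toList (∑ j ∈ J, μ j), (if l ≤ ∑ j, f j then
        (∏ j ∈ J, crossCoeff (expU (-l / 2)) (expU (μ j / 2)) (f j))
          * (C (((∑ j, f j) - l).factorial : ℚ)⁻¹
            * (C (-l : ℚ) * sinhc l) ^ ((∑ j, f j) - l)) * restMom μ J f
        else 0)
  set s₂ := ∑ j ∈ J, (if μ j = l then mom μ (J.erase j) else 0)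
  set s₃ := ∑ j ∈ J, (if μ j = l then nmom μ (J.erase j) else 0)
  set F := ∏ j ∈ J, sinhc (μ j) ^ (μ j - 1)
  set q : ℚ := ((((∑ j ∈ J, μ j) - l).factorial : ℕ) : ℚ)
  have e1 : C (q * (-l) ^ l : ℚ)
      = C (q * (-1) ^ l * l.factorial : ℚ) * (C (l.factorial : ℚ)⁻¹
        * C (l : ℚ) ^ l) := by
    rw [← map_pow, ← map_mul, ← map_mul, neg_pow]
    congr 1
    field_simp
  have e2 : C ((-1) ^ (l - 1) * (l - 1).factorial * q * l ^ 4 : ℚ)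
      = -C (q * (-1) ^ l * l.factorial : ℚ) * C (l ^ 3 : ℚ) := by
    rw [← map_neg, ← map_mul]
    congr 1
    obtain ⟨p, rfl⟩ : ∃ p, l = p + 1 := ⟨l - 1, by omega⟩
    rw [Nat.add_sub_cancel, Nat.factorial_succ]
    push_cast
    ring
  have e3 : sinhc (l : ℚ) ^ (l + 1) = sinhc l ^ (l - 1) * sinhc l ^ 2 := by
    rw [← pow_add]; congr 1; omega
  have e4 : sinhc (l : ℚ) ^ (l + 1) = sinhc l ^ l * sinhc l := pow_succ _ _
  rw [e1, e2]
  rw [mul_pow] at h1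
  linear_combination (C (q * (-1) ^ l * l.factorial : ℚ) * (C (l.factorial : ℚ)⁻¹
        * C (l : ℚ) ^ l)) * evP (-l) sinhcInvP * F * s₁ * e4
    + C (q * (-1) ^ l * l.factorial : ℚ) * (C (l.factorial : ℚ)⁻¹
        * C (l : ℚ) ^ l) * F * s₁ * sinhc l ^ l * h4
    + C (q * (-1) ^ l * l.factorial : ℚ) * F * h1
    + C (q * (-1) ^ l * l.factorial : ℚ) * C (l ^ 3 : ℚ) * X ^ 2
      * (s₃ * e3 + sinhc l ^ 2 * h3)

lemma evP_C_mul_constP (m : ℚ) (p : Polynomial ℚ) (F : ℚ⟦X⟧) :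
    evP m (C p * constP F) = C (p.eval m) * F := by
  rw [map_mul, evP_C, evP_constP]

/-- The dependence of the moments on the value at a distinguished site. -/
lemma exists_nmom_insert (μ : ι → ℕ) {i : ι} {J : Finset ι} (hi : i ∉ J) (h0 : ∀ j ∈ J, 0 < μ j) :
    ∃ A : PowerSeries (Polynomial ℚ), ∀ m : ℕ, 0 < m →
      nmom (update μ i m) (insert i J) = sinhc m ^ (m - 1) * nmom μ J
        + X ^ 2 * (∑ j ∈ J, C (m ^ 2 * μ j ^ 2 / (m + μ j) : ℚ)
          * nmom μ (J.erase j)) + C (m ^ 2 : ℚ) * evP m A := by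
  obtain ⟨N', hN⟩ := C_dvd_sumP μ J
  set M := ∑ j ∈ J, μ j with hMdef
  have hjM : ∀ j ∈ J, μ j ≤ M := fun j hj => single_le_sum (fun _ _ => Nat.zero_le _) hj
  have hG : C (risingP 0 M) ∣ constP (∏ j ∈ J, sinhc (μ j) ^ (μ j - 1)) * N'
      - ∑ j ∈ J, C (omitP (μ j) M * Polynomial.C (μ j ^ 2 : ℚ))
        * constP (X ^ 2 * nmom μ (J.erase j)) := by
    rw [C_dvd_iff_forall_coeff]
    intro N
    refine risingP_dvd fun l hl hlM => ?_
    rw [← coeff_evP]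
    suffices h : evP (-l : ℚ) (constP (∏ j ∈ J, sinhc (μ j) ^ (μ j - 1)) * N'
      - ∑ j ∈ J, C (omitP (μ j) M * Polynomial.C (μ j ^ 2 : ℚ))
        * constP (X ^ 2 * nmom μ (J.erase j))) = 0 by rw [h, map_zero]
    rw [map_sub, map_mul, evP_constP, map_sum, sub_eq_zero]
    have h1 := evP_neg_sumP μ hi h0 hl hlM
    rw [hN, map_mul, evP_C, eval_pow, eval_X] at h1
    have h2 : (C ((-l : ℚ) ^ 2)) ≠ 0 := by
      rw [Ne, map_eq_zero_iff _ C_injective, neg_sq]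
      positivity
    refine mul_left_cancel₀ h2 ?_
    rw [mul_left_comm, h1, mul_sum, mul_sum]
    refine sum_congr rfl fun j hj => ?_
    rw [evP_C_mul_constP, eval_mul, eval_C]
    split_ifs with h
    · subst h
      rw [eval_omitP_self hl hlM, ← mul_assoc, ← map_mul, mul_assoc]
      congr 2
      ring
    · rw [eval_omitP_of_ne hl hlM h, zero_mul, map_zero]
      ring
  obtain ⟨A, hA⟩ := hG
  refine ⟨A, fun m hm => ?_⟩
  have hR : (risingP 0 M).eval (m : ℚ) ≠ 0 := by
    rw [eval_risingP_natCast (Nat.zero_le _)]; positivity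
  have hR' : C ((risingP 0 M).eval (m : ℚ)) ≠ 0 := by
    rwa [Ne, map_eq_zero_iff _ C_injective]
  refine mul_left_cancel₀ hR' ?_
  have h1 := congrArg (evP m) hA
  rw [map_sub, map_mul, map_mul, evP_constP, evP_C, map_sum, sub_eq_iff_eq_add] at h1
  rw [nmom_insert_eq μ hi h0 hm, hN, map_mul, evP_C, eval_pow, eval_X,
    mul_left_comm (∏ j ∈ J, sinhc (μ j) ^ (μ j - 1)), h1, mul_add, mul_add, mul_add, add_assoc,
    add_comm (C ((m : ℚ) ^ 2) * _)]
  congr 2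
  · rw [mul_sum, mul_sum, mul_sum]
    refine sum_congr rfl fun j hj => ?_
    rw [evP_C_mul_constP, eval_mul, eval_C,
      ← mul_omitP (h0 j hj) (hjM j hj), eval_mul, eval_add, eval_X,
      eval_C]
    have e : C ((m : ℚ) ^ 2) * C ((omitP (μ j) M).eval (m : ℚ) * (μ j : ℚ) ^ 2)
        = C (((m : ℚ) + μ j) * (omitP (μ j) M).eval (m : ℚ))
          * C ((m : ℚ) ^ 2 * (μ j : ℚ) ^ 2 / (m + μ j)) := by
      rw [← map_mul, ← map_mul]
      congr 1
      field_simp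
    linear_combination X ^ 2 * nmom μ (J.erase j) * e
  · ring

end Residues

section CumulantFamilies

open PowerSeries

variable {ι : Type*} [DecidableEq ι]

lemma sum_rooted_insert {A : Type*} [AddCommMonoid A] {i : ι} {J : Finset ι} (hi : i ∉ J)
    (F : Finset ι → A) : ∑ B ∈ rooted i (insert i J), F B = ∑ B ∈ J.powerset, F (insert i B) := by
  symm
  refine sum_bij' (fun B _ => insert i B) (fun B _ => B.erase i) ?_ ?_ ?_ ?_ ?_
  · intro B hB
    rw [mem_powerset] at hB
    exact mem_rooted.2 ⟨insert_subset_insert _ hB, mem_insert_self _ _⟩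
  · intro B hB
    rw [mem_rooted] at hB
    rw [mem_powerset, ← erase_insert hi]
    exact erase_subset_erase _ hB.1
  · intro B hB
    exact erase_insert fun h => hi (mem_powerset.1 hB h)
  · intro B hB
    exact insert_erase (mem_rooted.1 hB).2
  · intro B _
    rfl

/-- A family of power series whose coefficients are polynomials divisible by the square of the
variable. -/
def IsQuadFamily (F : ℕ → ℚ⟦X⟧) : Prop :=
  ∃ A : PowerSeries (Polynomial ℚ), ∀ m : ℕ, 0 < m → F m = C (m ^ 2 : ℚ) * evP m A

lemma IsQuadFamily.sub {F G : ℕ → ℚ⟦X⟧} (hF : IsQuadFamily F) (hG : IsQuadFamily G) :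
    IsQuadFamily fun m => F m - G m := by
  obtain ⟨A, hA⟩ := hF
  obtain ⟨B, hB⟩ := hG
  exact ⟨A - B, fun m hm => by beta_reduce; rw [hA m hm, hB m hm, map_sub, mul_sub]⟩

lemma IsQuadFamily.mul_const {F : ℕ → ℚ⟦X⟧} (hF : IsQuadFamily F) (G : ℚ⟦X⟧) :
    IsQuadFamily fun m => F m * G := by
  obtain ⟨A, hA⟩ := hF
  exact ⟨A * constP G, fun m hm => by
    beta_reduce; rw [hA m hm, map_mul, evP_constP, mul_assoc]⟩

lemma IsQuadFamily.sum {κ : Type*} {s : Finset κ} {F : κ → ℕ → ℚ⟦X⟧}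
    (hF : ∀ k ∈ s, IsQuadFamily (F k)) : IsQuadFamily fun m => ∑ k ∈ s, F k m := by
  choose! A hA using hF
  refine ⟨∑ k ∈ s, A k, fun m hm => ?_⟩
  rw [map_sum, mul_sum]
  exact sum_congr rfl fun k hk => hA k hk m hm

lemma IsQuadFamily.congr {F G : ℕ → ℚ⟦X⟧} (hF : IsQuadFamily F)
    (h : ∀ m : ℕ, 0 < m → G m = F m) : IsQuadFamily G := by
  obtain ⟨A, hA⟩ := hF
  exact ⟨A, fun m hm => by rw [h m hm, hA m hm]⟩

variable [Fintype ι]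

/-- The part of the cumulants that need not have coefficients divisible by the square. -/
def leadTerm (μ : ι → ℕ) (J : Finset ι) (m : ℕ) : ℚ⟦X⟧ :=
  (if J = ∅ then sinhc m ^ (m - 1) else 0) + ∑ j, if J = {j} then
    X ^ 2 * C (m ^ 2 * μ j ^ 2 / (m + μ j) : ℚ) else 0

lemma sum_leadTerm (μ : ι → ℕ) (J : Finset ι) (m : ℕ) (G : Finset ι → ℚ⟦X⟧) :
    ∑ B ∈ J.powerset, leadTerm μ B m * G (J \ B) = sinhc m ^ (m - 1) * G J
      + X ^ 2 * ∑ j ∈ J, C (m ^ 2 * μ j ^ 2 / (m + μ j) : ℚ)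
        * G (J.erase j) := by
  simp only [leadTerm, add_mul, sum_add_distrib, sum_mul]
  congr 1
  · simp only [ite_mul, zero_mul]
    rw [sum_ite_eq' J.powerset ∅ fun B => sinhc m ^ (m - 1) * G (J \ B),
      if_pos (empty_mem_powerset J), sdiff_empty]
  · rw [sum_comm, mul_sum, ← sum_subset (subset_univ J)]
    · refine sum_congr rfl fun j hj => ?_
      simp only [ite_mul, zero_mul]
      rw [sum_ite_eq' J.powerset {j} fun B => X ^ 2
        * C (m ^ 2 * μ j ^ 2 / (m + μ j) : ℚ) * G (J \ B), if_pos (by simpa using hj),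
        sdiff_singleton_eq_erase, mul_assoc]
    · intro j _ hj
      refine sum_eq_zero fun B hB => ?_
      rw [if_neg, zero_mul]
      rintro rfl
      exact hj (by simpa using hB)

lemma isQuadFamily_cumulant (μ : ι → ℕ) {i : ι} {J : Finset ι} (hi : i ∉ J)
    (h0 : ∀ j ∈ J, 0 < μ j) : IsQuadFamily fun m =>
      cumulant (nmom (update μ i m)) (insert i J) - leadTerm μ J m := by
  induction J using strongInduction with
  | H J ih =>
    obtain ⟨A, hA⟩ := exists_nmom_insert μ hi h0
    have hsum : IsQuadFamily fun m => ∑ B ∈ J.powerset.erase J,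
        (cumulant (nmom (update μ i m)) (insert i B) - leadTerm μ B m)
          * nmom μ (J \ B) := by
      refine IsQuadFamily.sum fun B hB => ?_
      have hB' : B ⊂ J := by
        rw [mem_erase, mem_powerset] at hB
        exact hB.2.ssubset_of_ne hB.1
      exact (ih B hB' (fun h => hi (hB'.1 h)) fun j hj => h0 j (hB'.1 hj)).mul_const _
    have hAq : IsQuadFamily fun m => C (m ^ 2 : ℚ) * evP m A := ⟨A, fun m _ => rfl⟩
    refine (hAq.sub hsum).congr fun m hm => ?_
    have h1 := moment_eq_sum (nmom (update μ i m)) (nmom_empty _)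
      (mem_insert_self i J)
    rw [sum_rooted_insert hi, hA m hm, ← sum_leadTerm] at h1
    have h2 : ∀ B ∈ J.powerset, nmom (update μ i m) (insert i J \ insert i B)
        = nmom μ (J \ B) := fun B hB => by
      have : insert i J \ insert i B = J \ B := by
        rw [insert_sdiff_insert, sdiff_insert_of_notMem hi]
      rw [this]
      refine nmom_congr fun j hj => update_of_ne ?_ _ _
      rintro rfl
      exact hi (mem_sdiff.1 hj).1
    have h4 : ∑ B ∈ J.powerset, cumulant (nmom (update μ i m)) (insert i B)
          * nmom (update μ i m) (insert i J \ insert i B)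
        = ∑ B ∈ J.powerset, cumulant (nmom (update μ i m)) (insert i B) * nmom μ (J \ B) :=
      sum_congr rfl fun B hB => by rw [h2 B hB]
    rw [h4] at h1
    have h3 := add_sum_erase J.powerset (fun B =>
      (cumulant (nmom (update μ i m)) (insert i B) - leadTerm μ B m) * nmom μ (J \ B))
      (mem_powerset_self J)
    simp only [Finset.sdiff_self, nmom_empty, mul_one] at h3
    rw [eq_sub_of_add_eq h3]
    simp only [sub_mul, sum_sub_distrib]
    rw [← h1]
    ring

/-- The coefficients of the cumulants, as functions of the value at one site. -/
lemma exists_coeff_cumulant_update (μ : ι → ℕ) (h0 : ∀ j, 0 < μ j) (i : ι) {N : ℕ}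
    (h1 : Fintype.card ι = 1 → 0 < N) (h2 : Fintype.card ι = 2 → N ≠ 2) :
    ∃ q : Polynomial ℚ, ∀ m : ℕ, 0 < m →
      coeff N (cumulant (nmom (update μ i m)) univ)
        = m ^ 2 * q.eval (m : ℚ) := by
  have hi := notMem_erase i univ
  have hu : insert i (univ.erase i) = univ := insert_erase (mem_univ i)
  have hc : (univ.erase i).card + 1 = Fintype.card ι := by
    rw [card_erase_add_one (mem_univ i), card_univ]
  obtain ⟨A, hA⟩ := isQuadFamily_cumulant μ hi fun j _ => h0 j
  rw [hu] at hA
  obtain ⟨q, hq⟩ : ∃ q : Polynomial ℚ, ∀ m : ℕ, 0 < m →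
      coeff N (leadTerm μ (univ.erase i) m) = m ^ 2 * q.eval (m : ℚ) := by
    by_cases hE : univ.erase i = ∅
    · have hN : 0 < N := h1 (by rw [← hc, hE, card_empty])
      have hdvd : C (Polynomial.X ^ 2)
          ∣ sinhcPowP Polynomial.X * sinhcInvP - 1 := by
        have e : sinhcPowP Polynomial.X * sinhcInvP - 1 = (sinhcPowP Polynomial.X - 1) * sinhcInvP
            + (sinhcInvP - 1) := by ring
        rw [e]
        exact ((C_dvd_sinhcPowP_sub_one _).mul_right _).add C_dvd_sinhcInvP_sub_one
      obtain ⟨q, hq⟩ := C_dvd_iff_forall_coeff.1 hdvd N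
      refine ⟨q, fun m hm => ?_⟩
      have e1 : sinhc (m : ℚ) ^ (m - 1) = evP m (sinhcPowP Polynomial.X * sinhcInvP) := by
        have h4 := congrArg (evP (m : ℚ)) sinhcP_mul_inv
        rw [map_mul, map_one, evP_sinhcP] at h4
        have e2 : sinhc (m : ℚ) ^ m = sinhc (m : ℚ) ^ (m - 1) * sinhc m := by
          rw [← pow_succ, Nat.sub_add_cancel hm]
        rw [map_mul, evP_sinhcPowP (eval_X : _ = (m : ℚ)), e2, mul_assoc, h4, mul_one]
      have e3 := congrArg (Polynomial.eval (m : ℚ)) hq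
      rw [map_sub, coeff_one, if_neg hN.ne', sub_zero, eval_mul,
        eval_pow, eval_X] at e3
      rw [leadTerm, if_pos hE, sum_eq_zero, add_zero, e1, coeff_evP, e3]
      intro j _
      rw [if_neg]
      rw [hE]
      exact (singleton_ne_empty j).symm
    · refine ⟨0, fun m _ => ?_⟩
      rw [leadTerm, if_neg hE, zero_add, map_sum, Polynomial.eval_zero, mul_zero]
      refine sum_eq_zero fun j _ => ?_
      split_ifs with h
      · rw [coeff_mul_C, coeff_X_pow,
          if_neg (h2 (by rw [← hc, h, card_singleton])), zero_mul]
      · rw [map_zero]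
  refine ⟨q + coeff N A, fun m hm => ?_⟩
  have h3 := congrArg (coeff N) (hA m hm)
  rw [map_sub, coeff_C_mul, coeff_evP, hq m hm, sub_eq_iff_eq_add] at h3
  rw [h3, eval_add]
  ring

end CumulantFamilies

section Reduced

open PowerSeries

variable {ι : Type*} [DecidableEq ι] [Fintype ι]

lemma natCast_pow_div_factorial {m : ℕ} (hm : 0 < m) : svar (m : ℚ)
    * (C ((m : ℚ) ^ (m - 1) / m.factorial) * X ^ (m - 1)
      * sinhc m ^ (m - 1)) = momFactor m := by
  have hq : (m : ℚ) ≠ 0 := by positivity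
  obtain ⟨k, rfl⟩ : ∃ k, m = k + 1 := ⟨m - 1, by omega⟩
  rw [momFactor, eZ_natCast hq, svar_eq, Nat.add_sub_cancel, div_eq_mul_inv, map_mul, map_pow,
    map_pow]
  ring

lemma cutGF_prod_pw (μ : ι → ℕ) (h0 : ∀ i, 0 < μ i) (S : Finset ι) :
    cutGF (∏ i ∈ S, pw (μ i)) = (∏ i ∈ S, C ((μ i : ℚ) ^ (μ i - 1) / (μ i).factorial)
      * X ^ (μ i - 1)) * nmom μ S := by
  have h := mom_spec μ S fun i _ => h0 i
  rw [← prod_congr rfl fun i _ => natCast_pow_div_factorial (h0 i), prod_mul_distrib,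
    mul_assoc] at h
  rw [mul_left_cancel₀ (prod_ne_zero_iff.2 fun i _ => svar_ne_zero ?_) h,
    prod_mul_distrib, nmom, mul_assoc]
  exact Nat.cast_ne_zero.2 (h0 i).ne'

/-- The cumulant normalization of the Hurwitz numbers. -/
def reduced (N : ℕ) (μ : ι → ℕ) : ℚ :=
  (∏ i, (μ i : ℚ) ^ 2)⁻¹ * coeff N (cumulant (nmom μ) univ)

lemma cumulant_cutGF (μ : ι → ℕ) (h0 : ∀ i, 0 < μ i) (S : Finset ι) :
    cumulant (fun S => cutGF (∏ i ∈ S, pw (μ i))) S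
      = (∏ i ∈ S, C ((μ i : ℚ) ^ (μ i - 1) / (μ i).factorial)
      * X ^ (μ i - 1)) * cumulant (nmom μ) S :=
  cumulant_scale _ _ (nmom_empty _) _ (cutGF_prod_pw μ h0) S

lemma sum_pred_add_card (μ : ι → ℕ) (h0 : ∀ i, 0 < μ i) :
    ∑ i, (μ i - 1) + Fintype.card ι = ∑ i, μ i := by
  rw [← card_univ, card_eq_sum_ones, ← sum_add_distrib]
  exact sum_congr rfl fun i _ => Nat.sub_add_cancel (h0 i)

lemma coeff_cumulant_cutGF (μ : ι → ℕ) (h0 : ∀ i, 0 < μ i) (N : ℕ) :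
    (∏ i, (μ i : ℚ)⁻¹) * coeff (N + ∑ i, (μ i - 1))
        (cumulant (fun S => cutGF (∏ i ∈ S, pw (μ i))) univ)
      = (∏ i, (μ i : ℚ) ^ μ i / (μ i).factorial) * reduced N μ := by
  rw [cumulant_cutGF μ h0, prod_mul_distrib, ← map_prod, prod_pow_eq_pow_sum,
    mul_assoc, coeff_C_mul, coeff_X_pow_mul, reduced, ← mul_assoc,
    ← mul_assoc, ← prod_mul_distrib, ← prod_inv_distrib, ← prod_mul_distrib]
  congr 1
  refine prod_congr rfl fun i _ => ?_
  have hq : (μ i : ℚ) ≠ 0 := Nat.cast_ne_zero.2 (h0 i).ne'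
  obtain ⟨k, hk⟩ : ∃ k, μ i = k + 1 := ⟨μ i - 1, by have := h0 i; omega⟩
  rw [hk] at hq ⊢
  rw [Nat.add_sub_cancel]
  have := Nat.factorial_ne_zero (k + 1)
  field_simp
  ring

lemma cumulant_comp_map {R : Type*} [CommRing R] (M : Finset ι → R) (h0 : M ∅ = 1)
    (π : ι ↪ ι) (T : Finset ι) :
    cumulant (fun S => M (S.map π)) T = cumulant M (T.map π) := by
  rcases T.eq_empty_or_nonempty with rfl | ⟨r, hr⟩
  · rw [map_empty, cumulant_empty, cumulant_empty]
  refine cumulant_unique _ (fun B => cumulant M (B.map π)) (by simpa using h0) r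
    (fun S hS hrS => ?_) hr
  rw [moment_eq_sum M h0 (mem_map_of_mem π hrS)]
  symm
  refine sum_bij (fun B _ => B.map π) ?_ ?_ ?_ ?_
  · intro B hB
    rw [mem_rooted] at hB ⊢
    exact ⟨map_subset_map.2 hB.1, mem_map_of_mem π hB.2⟩
  · intro B _ B' _ h
    exact map_injective π h
  · intro B hB
    rw [mem_rooted] at hB
    obtain ⟨B', hB', rfl⟩ := subset_map_iff.1 hB.1
    exact ⟨B', mem_rooted.2 ⟨hB', by simpa using hB.2⟩, rfl⟩
  · intro B _
    rw [Finset.map_sdiff]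

lemma reduced_comp (N : ℕ) (μ : ι → ℕ) (h0 : ∀ i, 0 < μ i) (π : Equiv.Perm ι) :
    reduced N (μ ∘ π) = reduced N μ := by
  have h1 := coeff_cumulant_cutGF μ h0 N
  have h2 := coeff_cumulant_cutGF (μ ∘ π) (fun i => h0 _) N
  have h3 := cumulant_comp_map (fun S => cutGF (∏ i ∈ S, pw (μ i) : Fock ℚ))
    (by rw [cutGF_prod_pw μ h0, nmom_empty, prod_empty, one_mul]) π.toEmbedding univ
  simp only [prod_map, Equiv.coe_toEmbedding, map_univ_equiv] at h3
  simp only [Function.comp_apply] at h2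
  rw [h3, Equiv.prod_comp π fun i => (μ i : ℚ)⁻¹, Equiv.sum_comp π fun i => μ i - 1,
    Equiv.prod_comp π fun i => (μ i : ℚ) ^ μ i / (μ i).factorial, h1] at h2
  refine (mul_left_cancel₀ (prod_ne_zero_iff.2 fun i _ => ?_) h2).symm
  have : (μ i : ℚ) ≠ 0 := Nat.cast_ne_zero.2 (h0 i).ne'
  positivity

end Reduced

lemma hurwitzNumber_eq_reduced (g n : ℕ) (hn : 1 ≤ n) (kk : Fin n → ℕ) (hk : ∀ i, 0 < kk i) :
    hurwitzNumber g n kk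
      = ((((∑ i, kk i) + n + 2 * g - 2).factorial : ℚ) / (autCount n kk : ℚ))
          * (∏ i, (kk i : ℚ) ^ (kk i) / ((kk i).factorial : ℚ))
          * reduced (2 * n + 2 * g - 2) kk := by
  have h := sum_pred_add_card kk hk
  rw [Fintype.card_fin] at h
  have e : (∑ i, kk i) + n + 2 * g - 2 = 2 * n + 2 * g - 2 + ∑ i, (kk i - 1) := by omega
  rw [hurwitzNumber_eq g n hn kk hk, mul_assoc, mul_assoc _ _ (reduced _ _),
    ← coeff_cumulant_cutGF kk hk, ← e]

section Interpolation

variable {ι : Type*} [DecidableEq ι]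

lemma exists_mvPolynomial_piecewise (F : (ι → ℕ) → ℚ) (D : ℕ)
    (h : ∀ μ : ι → ℕ, (∀ i, 0 < μ i) → ∀ i, ∃ q : Polynomial ℚ, q.natDegree ≤ D ∧
      ∀ m : ℕ, 0 < m → F (update μ i m) = q.eval (m : ℚ)) (s : Finset ι) :
    ∀ ν : ι → ℕ, (∀ i, 0 < ν i) → ∃ P : MvPolynomial ι ℚ, ∀ μ : ι → ℕ, (∀ i, 0 < μ i) →
      F (s.piecewise μ ν) = MvPolynomial.eval (fun i => (μ i : ℚ)) P := by
  induction s using Finset.induction with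
  | empty => exact fun ν _ => ⟨MvPolynomial.C (F ν), fun μ _ => by simp⟩
  | insert i s hi ih =>
    intro ν hν
    have hup : ∀ t : ℕ, ∀ j, 0 < update ν i (t + 1) j := fun t j => by
      rcases eq_or_ne j i with rfl | hj
      · simp
      · rw [update_of_ne hj]; exact hν j
    choose P hP using fun t : ℕ => ih (update ν i (t + 1)) (hup t)
    set node : ℕ → ℚ := fun t => t + 1 with hnode
    have hinj : Set.InjOn node (range (D + 1) : Finset ℕ) := fun a _ b _ hab => by
      simpa [hnode] using hab
    refine ⟨∑ t ∈ range (D + 1), Polynomial.aeval (MvPolynomial.X i)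
      (Lagrange.basis (range (D + 1)) node t) * P t, fun μ hμ => ?_⟩
    have hpw : ∀ j, 0 < s.piecewise μ ν j := fun j => by
      rw [piecewise]; split_ifs; exacts [hμ j, hν j]
    obtain ⟨q, hq, hF⟩ := h _ hpw i
    have e0 : (insert i s).piecewise μ ν = update (s.piecewise μ ν) i (μ i) := by
      rw [piecewise_insert]
    have e1 : ∀ t : ℕ, s.piecewise μ (update ν i (t + 1))
        = update (s.piecewise μ ν) i (t + 1) := fun t => by
      rw [update_piecewise_of_notMem _ _ _ hi]
    have e2 := Lagrange.eq_interpolate hinj (f := q) (by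
      rw [card_range]
      exact Polynomial.degree_le_natDegree.trans_lt (by exact_mod_cast Nat.lt_succ_of_le hq))
    rw [e0, hF _ (hμ i), e2, Lagrange.interpolate_apply, Polynomial.eval_finsetSum, map_sum]
    refine sum_congr rfl fun t _ => ?_
    have e3 : MvPolynomial.eval (fun i => (μ i : ℚ)) (Polynomial.aeval (MvPolynomial.X i)
        (Lagrange.basis (range (D + 1)) node t))
        = (Lagrange.basis (range (D + 1)) node t).eval (μ i : ℚ) := by
      rw [Polynomial.aeval_def, Polynomial.hom_eval₂, MvPolynomial.eval_X, Polynomial.eval]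
      congr 1
      exact RingHom.ext fun x => by simp
    have e4 : q.eval (node t) = MvPolynomial.eval (fun i => (μ i : ℚ)) (P t) := by
      rw [← hP t μ hμ, e1, hF _ t.succ_pos, hnode]
      push_cast
      rfl
    rw [eval_mul, eval_C, map_mul, e3, e4, mul_comm]

/-- A function of positive integers that is a polynomial of bounded degree in each variable is a
polynomial. -/
lemma exists_mvPolynomial [Fintype ι] (F : (ι → ℕ) → ℚ) (D : ℕ)
    (h : ∀ μ : ι → ℕ, (∀ i, 0 < μ i) → ∀ i, ∃ q : Polynomial ℚ, q.natDegree ≤ D ∧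
      ∀ m : ℕ, 0 < m → F (update μ i m) = q.eval (m : ℚ)) :
    ∃ P : MvPolynomial ι ℚ, ∀ μ : ι → ℕ, (∀ i, 0 < μ i) →
      F μ = MvPolynomial.eval (fun i => (μ i : ℚ)) P := by
  obtain ⟨P, hP⟩ := exists_mvPolynomial_piecewise F D h univ (fun _ => 1) fun _ => one_pos
  exact ⟨P, fun μ hμ => by rw [← hP μ hμ, piecewise_univ]⟩

end Interpolation

section Growth

open Filter Topology

lemma natDegree_le_of_abs_eval_le (q : Polynomial ℚ) (C : ℝ) (D : ℕ)
    (h : ∀ m : ℕ, 0 < m → |((q.eval (m : ℚ) : ℚ) : ℝ)| ≤ C * (m : ℝ) ^ D) : q.natDegree ≤ D := by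
  by_contra hD
  rw [not_le] at hD
  set r : Polynomial ℝ := q.map (algebraMap ℚ ℝ) with hr
  have hdeg : (Polynomial.X ^ D : Polynomial ℝ).degree < r.degree := by
    rw [Polynomial.degree_X_pow, hr, Polynomial.degree_map]
    exact Polynomial.coe_lt_degree.2 hD
  have h1 := (Polynomial.abs_div_tendsto_atTop_atTop_of_degree_gt r (Polynomial.X ^ D) hdeg
    (pow_ne_zero _ Polynomial.X_ne_zero)).comp (tendsto_natCast_atTop_atTop (R := ℝ))
  obtain ⟨m, hm, hm0⟩ := ((h1.eventually_gt_atTop C).and (eventually_gt_atTop 0)).exists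
  have hm' : (0 : ℝ) < (m : ℝ) ^ D := by positivity
  have h2 := h m hm0
  have e : r.eval (m : ℝ) = ((q.eval (m : ℚ) : ℚ) : ℝ) := by
    have := Polynomial.eval_natCast_map (algebraMap ℚ ℝ) q m
    simpa [hr] using this
  simp only [Function.comp_apply, eval_pow, eval_X, e, abs_div] at hm
  rw [abs_of_pos hm', lt_div_iff₀ hm'] at hm
  exact absurd hm (not_lt.2 h2)

lemma exists_absoluteValue_eval_le (v : AbsoluteValue ℚ ℝ) (q : Polynomial ℚ) :
    ∃ C : ℝ, 0 ≤ C ∧ ∀ x : ℚ, v x ≤ 1 → v (q.eval x) ≤ C := by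
  refine ⟨∑ e ∈ range (q.natDegree + 1), v (q.coeff e),
    sum_nonneg fun _ _ => v.nonneg _, fun x hx => ?_⟩
  rw [Polynomial.eval_eq_sum_range]
  refine (v.sum_le _ _).trans (sum_le_sum fun e _ => ?_)
  rw [map_mul, map_pow]
  exact mul_le_of_le_one_right (v.nonneg _) (pow_le_one₀ (v.nonneg _) hx)

/-- A polynomial that is small at the points of a sequence tending to zero has vanishing
coefficients in low degrees. -/
lemma coeff_eq_zero_of_absoluteValue_le (v : AbsoluteValue ℚ ℝ) (b : ℚ) (hb0 : b ≠ 0)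
    (hb : v b < 1) (q : Polynomial ℚ) (C : ℝ) (E : ℕ)
    (h : ∀ a : ℕ, v (q.eval (b ^ a)) ≤ C * v (b ^ a) ^ E) : ∀ e < E, q.coeff e = 0 := by
  intro e
  induction e using Nat.strong_induction_on with
  | _ e ih =>
    intro he
    obtain ⟨r, hr⟩ : Polynomial.X ^ e ∣ q :=
      Polynomial.X_pow_dvd_iff.2 fun d hd => ih d hd (hd.trans he)
    have hc : q.coeff e = r.coeff 0 := by
      have := Polynomial.coeff_X_pow_mul r e 0
      rwa [← hr, zero_add] at this
    obtain ⟨C', hC', hC''⟩ := exists_absoluteValue_eval_le v r.divX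
    have hba : ∀ a : ℕ, v (b ^ a) ≤ 1 := fun a => by
      rw [map_pow]; exact pow_le_one₀ (v.nonneg _) hb.le
    have hC : 0 ≤ C := by
      have := (v.nonneg _).trans (h 0)
      simpa using this
    have key : ∀ a : ℕ, v (r.coeff 0) ≤ (C + C') * v b ^ a := fun a => by
      have hpos : 0 < v (b ^ a) := v.pos (pow_ne_zero _ hb0)
      have h1 := h a
      rw [hr, eval_mul, eval_pow, eval_X, map_mul,
        map_pow v (b ^ a)] at h1
      have h2 : v (b ^ a) ^ E ≤ v (b ^ a) ^ e * v (b ^ a) := by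
        rw [← pow_succ]
        exact pow_le_pow_of_le_one hpos.le (hba a) he
      have h3 : v (r.eval (b ^ a)) ≤ C * v (b ^ a) :=
        le_of_mul_le_mul_left (by nlinarith) (pow_pos hpos e)
      have h4 : r.coeff 0 = r.eval (b ^ a) - b ^ a * r.divX.eval (b ^ a) := by
        have := congrArg (Polynomial.eval (b ^ a)) (Polynomial.X_mul_divX_add r)
        rw [eval_add, eval_mul, eval_X, eval_C] at this
        rw [← this]
        ring
      rw [h4, ← map_pow]
      refine (v.sub_le_add _ _).trans ?_
      rw [map_mul, add_mul]
      have := hC'' _ (hba a)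
      nlinarith
    have hlim : Filter.Tendsto (fun a : ℕ => (C + C') * v b ^ a) atTop (𝓝 ((C + C') * 0)) :=
      (tendsto_pow_atTop_nhds_zero_of_lt_one (v.nonneg _) hb).const_mul _
    rw [mul_zero] at hlim
    rw [hc, ← v.eq_zero]
    exact le_antisymm (ge_of_tendsto' hlim key) (v.nonneg _)

end Growth

section Dilate

variable {ι : Type*}

/-- The restriction of a polynomial to the line spanned by a vector. -/
def dilate (P : MvPolynomial ι ℚ) (s : ι → ℚ) : Polynomial ℚ :=
  MvPolynomial.eval₂ Polynomial.C (fun i => Polynomial.C (s i) * Polynomial.X) P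

lemma eval_dilate (P : MvPolynomial ι ℚ) (s : ι → ℚ) (x : ℚ) :
    (dilate P s).eval x = MvPolynomial.eval (fun i => x * s i) P := by
  rw [dilate, ← Polynomial.coe_evalRingHom, MvPolynomial.hom_eval₂, MvPolynomial.eval]
  congr 1
  · exact RingHom.ext fun y => eval_C
  · funext i
    rw [Polynomial.coe_evalRingHom, eval_mul, eval_C, eval_X,
      mul_comm]

lemma coeff_dilate (P : MvPolynomial ι ℚ) (s : ι → ℚ) (e : ℕ) :
    (dilate P s).coeff e = MvPolynomial.eval s (MvPolynomial.homogeneousComponent e P) := by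
  induction P using MvPolynomial.induction_on' with
  | monomial d a =>
    have e1 : dilate (MvPolynomial.monomial d a) s
        = Polynomial.C (a * d.prod fun i k => s i ^ k) * Polynomial.X ^ d.degree := by
      rw [dilate, MvPolynomial.eval₂_monomial, map_mul, mul_assoc, Finsupp.prod, Finsupp.prod,
        map_prod, Finsupp.degree_apply, ← prod_pow_eq_pow_sum, ← prod_mul_distrib]
      simp only [mul_pow, map_pow]
    rw [e1, Polynomial.coeff_C_mul_X_pow, MvPolynomial.homogeneousComponent_of_mem
      (MvPolynomial.isHomogeneous_monomial a rfl)]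
    split_ifs with h1
    · rw [MvPolynomial.eval_monomial]
    · rw [map_zero]
  | add P Q hP hQ =>
    rw [map_add, map_add, ← hP, ← hQ, dilate, MvPolynomial.eval₂_add, Polynomial.coeff_add]
    rfl

lemma sum_ne_of_coeff_dilate [Finite ι] (P : MvPolynomial ι ℚ) (A : ι → Set ℚ)
    (hA : ∀ i, (A i).Infinite) (e : ℕ)
    (h : ∀ s ∈ Set.pi Set.univ A, (dilate P s).coeff e = 0) :
    ∀ m ∈ P.support, m.sum (fun _ e => e) ≠ e := by
  rintro m hm rfl
  have h0 : MvPolynomial.homogeneousComponent (m.sum fun _ e => e) P = 0 := by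
    refine MvPolynomial.funext_set A hA fun s hs => ?_
    rw [← coeff_dilate, h s hs, map_zero]
  have h1 := congrArg (MvPolynomial.coeff m) h0
  rw [MvPolynomial.coeff_homogeneousComponent, if_pos
    (show m.degree = m.sum fun _ e => e from Finsupp.degree_apply m),
    MvPolynomial.coeff_zero] at h1
  exact MvPolynomial.mem_support_iff.1 hm h1

end Dilate

section Assembly

open PowerSeries

variable {ι : Type*} [DecidableEq ι] [Fintype ι]

lemma reduced_mul (N : ℕ) (μ : ι → ℕ) (h0 : ∀ i, 0 < μ i) :
    coeff N (cumulant (nmom μ) univ) = (∏ i, (μ i : ℚ) ^ 2) * reduced N μ := by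
  rw [reduced, mul_inv_cancel_left₀]
  refine prod_ne_zero_iff.2 fun i _ => ?_
  have : (μ i : ℚ) ≠ 0 := Nat.cast_ne_zero.2 (h0 i).ne'
  positivity

/-- The polynomial growth of the cumulants. -/
def CumulantGrowth (ι : Type*) [DecidableEq ι] [Fintype ι] (N D : ℕ) : Prop :=
  ∃ C : ℝ, ∀ (M : ℕ) (μ : ι → ℕ), (∀ i, 0 < μ i) → (∀ i, μ i ≤ M) →
    |((coeff N (cumulant (nmom μ) univ) : ℚ) : ℝ)| ≤ C * (M : ℝ) ^ D

/-- The decay of the cumulants at highly divisible arguments. -/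
def CumulantDecay (ι : Type*) [DecidableEq ι] [Fintype ι] (v : AbsoluteValue ℚ ℝ) (b : ℕ)
    (N E : ℕ) (s : ι → ℕ) : Prop :=
  ∃ C : ℝ, ∀ a : ℕ, v (coeff N (cumulant (nmom fun i => b ^ a * s i) univ))
    ≤ C * v ((b : ℚ) ^ a) ^ E

lemma exists_reduced_update {N D : ℕ} (h1 : Fintype.card ι = 1 → 0 < N)
    (h2 : Fintype.card ι = 2 → N ≠ 2) (hup : CumulantGrowth ι N D) (μ : ι → ℕ)
    (h0 : ∀ i, 0 < μ i) (i : ι) : ∃ q : Polynomial ℚ, q.natDegree ≤ D ∧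
      ∀ m : ℕ, 0 < m → reduced N (update μ i m) = q.eval (m : ℚ) := by
  obtain ⟨q, hq⟩ := exists_coeff_cumulant_update μ h0 i h1 h2
  obtain ⟨C, hC⟩ := hup
  have h0' : ∀ m : ℕ, 0 < m → ∀ j, 0 < update μ i m j := fun m hm j => by
    rcases eq_or_ne j i with rfl | hj
    · simpa using hm
    · rw [update_of_ne hj]; exact h0 j
  have hprod : ∀ m : ℕ, ∏ j, (update μ i m j : ℚ) ^ 2
      = (m : ℚ) ^ 2 * ∏ j ∈ univ.erase i, (μ j : ℚ) ^ 2 := fun m => by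
    rw [← mul_prod_erase _ _ (mem_univ i), update_self]
    congr 1
    exact prod_congr rfl fun j hj => by rw [update_of_ne (ne_of_mem_erase hj)]
  have hA : (∏ j ∈ univ.erase i, (μ j : ℚ) ^ 2) ≠ 0 :=
    prod_ne_zero_iff.2 fun j _ => pow_ne_zero _ (Nat.cast_ne_zero.2 (h0 j).ne')
  refine ⟨Polynomial.C (∏ j ∈ univ.erase i, (μ j : ℚ) ^ 2)⁻¹ * q,
    (Polynomial.natDegree_C_mul_le _ _).trans ?_, fun m hm => ?_⟩
  · refine natDegree_le_of_abs_eval_le q (C * (∑ j, (μ j : ℝ)) ^ D) D fun m hm => ?_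
    have h3 := hC (m * ∑ j, μ j) _ (h0' m hm) fun j => by
      have h4 : ∀ k, μ k ≤ ∑ j, μ j := fun k =>
        single_le_sum (fun j _ => (μ j).zero_le) (mem_univ k)
      rcases eq_or_ne j i with rfl | hj
      · rw [update_self]
        exact Nat.le_mul_of_pos_right _ ((h0 j).trans_le (h4 j))
      · rw [update_of_ne hj]
        exact (h4 j).trans (Nat.le_mul_of_pos_left _ hm)
    rw [hq m hm] at h3
    push_cast at h3 ⊢
    rw [abs_mul, abs_of_pos (by positivity), mul_pow] at h3
    have hm1 : (1 : ℝ) ≤ (m : ℝ) ^ 2 := one_le_pow₀ (by exact_mod_cast hm)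
    have := mul_le_mul_of_nonneg_right hm1 (abs_nonneg ((q.eval (m : ℚ) : ℚ) : ℝ))
    linarith
  · have h3 := hq m hm
    rw [reduced_mul _ _ (h0' m hm), hprod] at h3
    rw [eval_mul, eval_C]
    have hm' : (m : ℚ) ≠ 0 := Nat.cast_ne_zero.2 hm.ne'
    field_simp
    refine mul_left_cancel₀ (pow_ne_zero 2 hm') ?_
    rw [← h3]
    ring

lemma exists_polynomial_reduced {N D E : ℕ} (h1 : Fintype.card ι = 1 → 0 < N)
    (h2 : Fintype.card ι = 2 → N ≠ 2) (hD : 2 * Fintype.card ι ≤ D)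
    (hup : CumulantGrowth ι N D) (v : AbsoluteValue ℚ ℝ) (b : ℕ)
    (hb0 : b ≠ 0) (hb : v b < 1) (A : ι → Set ℕ) (hA : ∀ i, (A i).Infinite)
    (hA0 : ∀ i, ∀ s ∈ A i, 0 < s) (hE : 2 * Fintype.card ι ≤ E)
    (hlow : ∀ s : ι → ℕ, (∀ i, s i ∈ A i) → CumulantDecay ι v b N E s) :
    ∃ P : MvPolynomial ι ℚ, P.IsSymmetric ∧
      (∀ m ∈ P.support, E - 2 * Fintype.card ι ≤ m.sum (fun _ e => e)
        ∧ m.sum (fun _ e => e) ≤ D - 2 * Fintype.card ι) ∧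
      ∀ μ : ι → ℕ, (∀ i, 0 < μ i) → reduced N μ = MvPolynomial.eval (fun i => (μ i : ℚ)) P := by
  obtain ⟨P, hP⟩ := exists_mvPolynomial (reduced N) D fun μ h0 i =>
    exists_reduced_update h1 h2 hup μ h0 i
  have hnat : ∀ B : ι → Set ℕ, (∀ i, (B i).Infinite) →
      ∀ i, ((fun x : ℕ => (x : ℚ)) '' B i).Infinite :=
    fun B hB i => (hB i).image Nat.cast_injective.injOn
  have hcoe : ∀ (B : ι → Set ℕ) (s : ι → ℚ),
      s ∈ Set.pi Set.univ (fun i => (fun x : ℕ => (x : ℚ)) '' B i) →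
      ∃ t : ι → ℕ, (∀ i, t i ∈ B i) ∧ s = fun i => (t i : ℚ) := fun B s hs => by
    choose t ht hts using fun i => hs i (Set.mem_univ i)
    exact ⟨t, ht, funext fun i => (hts i).symm⟩
  have hpos : ∀ i : ι, {x : ℕ | 0 < x}.Infinite := fun _ => Set.Ioi_infinite 0
  have hdil : ∀ (t : ι → ℕ) (x : ℕ), 0 < x → (∀ i, 0 < t i) →
      (dilate P fun i => (t i : ℚ)).eval (x : ℚ) = reduced N fun i => x * t i := fun t x hx ht => by
    rw [eval_dilate, hP _ fun i => Nat.mul_pos hx (ht i)]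
    push_cast
    rfl
  have hprod : ∀ (t : ι → ℕ) (x : ℕ), 0 < x → (∀ i, 0 < t i) →
      coeff N (cumulant (nmom fun i => x * t i) univ)
      = (x : ℚ) ^ (2 * Fintype.card ι) * (∏ i, (t i : ℚ) ^ 2)
        * (dilate P fun i => (t i : ℚ)).eval (x : ℚ) := fun t x hx ht => by
    rw [hdil t x hx ht, reduced_mul _ _ fun i => Nat.mul_pos hx (ht i)]
    simp only [Nat.cast_mul, mul_pow, prod_mul_distrib, prod_const, card_univ,
      ← pow_mul]
  refine ⟨P, fun π => ?_, fun m hm => ⟨?_, ?_⟩, hP⟩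
  · refine MvPolynomial.funext_set _ (hnat _ hpos) fun s hs => ?_
    obtain ⟨t, ht, rfl⟩ := hcoe _ s hs
    rw [MvPolynomial.eval_rename, ← hP t ht, ← reduced_comp N t ht π, hP (t ∘ π) fun i => ht (π i)]
    rfl
  · by_contra hlt
    rw [not_le] at hlt
    refine sum_ne_of_coeff_dilate P _ (hnat A hA) _ (fun s hs => ?_) m hm rfl
    obtain ⟨t, ht, rfl⟩ := hcoe _ s hs
    have ht0 : ∀ i, 0 < t i := fun i => hA0 i _ (ht i)
    obtain ⟨C, hC⟩ := hlow t ht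
    have hbq : (b : ℚ) ≠ 0 := Nat.cast_ne_zero.2 hb0
    have hv0 : 0 < v (∏ i, (t i : ℚ) ^ 2) := v.pos
      (prod_ne_zero_iff.2 fun j _ => pow_ne_zero _ (Nat.cast_ne_zero.2 (ht0 j).ne'))
    refine coeff_eq_zero_of_absoluteValue_le v b hbq hb _ (C / v (∏ i, (t i : ℚ) ^ 2))
      (E - 2 * Fintype.card ι) (fun a => ?_) _ hlt
    have h3 := hC a
    rw [hprod t (b ^ a) (by positivity) ht0, Nat.cast_pow, map_mul, map_mul, map_pow v,
      ← Nat.add_sub_cancel' hE, pow_add] at h3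
    have hv1 : 0 < v ((b : ℚ) ^ a) ^ (2 * Fintype.card ι) := pow_pos (v.pos (pow_ne_zero _ hbq)) _
    rw [div_mul_eq_mul_div, le_div_iff₀ hv0]
    refine le_of_mul_le_mul_left ?_ hv1
    linarith
  · by_contra hlt
    rw [not_le] at hlt
    refine sum_ne_of_coeff_dilate P _ (hnat _ hpos) _ (fun s hs => ?_) m hm rfl
    obtain ⟨t, ht, rfl⟩ := hcoe _ s hs
    obtain ⟨C, hC⟩ := hup
    refine Polynomial.coeff_eq_zero_of_natDegree_lt (lt_of_le_of_lt ?_ hlt)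
    have hp0 : (0 : ℚ) < ∏ i, (t i : ℚ) ^ 2 := prod_pos fun j _ => by
      have : (0 : ℚ) < t j := Nat.cast_pos.2 (ht j)
      positivity
    have hp1 : (0 : ℝ) < ((∏ i, (t i : ℚ) ^ 2 : ℚ) : ℝ) := by exact_mod_cast hp0
    refine natDegree_le_of_abs_eval_le _ (C * (∑ i, (t i : ℝ)) ^ D / ((∏ i, (t i : ℚ) ^ 2 : ℚ) : ℝ))
      _ fun x hx => ?_
    have h3 := hC (x * ∑ i, t i) (fun i => x * t i) (fun i => Nat.mul_pos hx (ht i))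
      fun i => Nat.mul_le_mul_left _ (single_le_sum (fun j _ => (t j).zero_le)
        (mem_univ i))
    rw [hprod t x hx ht, Rat.cast_mul, Rat.cast_mul, abs_mul, abs_mul, abs_of_pos hp1,
      Nat.cast_mul, mul_pow, ← Nat.add_sub_cancel' hD, pow_add (x : ℝ)] at h3
    have hx' : (0 : ℝ) < (x : ℝ) ^ (2 * Fintype.card ι) := by positivity
    rw [Rat.cast_pow, Rat.cast_natCast, abs_of_pos hx', Nat.add_sub_cancel' hD, Nat.cast_sum] at h3
    rw [div_mul_eq_mul_div, le_div_iff₀ hp1]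
    refine le_of_mul_le_mul_left ?_ hx'
    linarith

end Assembly

section TruncatedNorm

open PowerSeries

variable (v : AbsoluteValue ℚ ℝ) (N : ℕ) (r : ℝ)

/-- The sum of the weighted absolute values of the first coefficients of a power series. -/
def tnorm (hr : 0 ≤ r) : RingSeminorm ℚ⟦X⟧ where
  toFun φ := ∑ j ∈ range (N + 1), v (coeff j φ) * r ^ j
  map_zero' := by simp
  add_le' φ ψ := by
    rw [← sum_add_distrib]
    refine sum_le_sum fun j _ => ?_
    rw [map_add, ← add_mul]
    exact mul_le_mul_of_nonneg_right (v.add_le _ _) (pow_nonneg hr j)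
  neg' φ := by simp only [map_neg, AbsoluteValue.map_neg]
  mul_le' φ ψ := by
    set a : ℕ → ℝ := fun j => v (coeff j φ) * r ^ j with ha
    set b : ℕ → ℝ := fun j => v (coeff j ψ) * r ^ j with hb
    have ha0 : ∀ j, 0 ≤ a j := fun j => mul_nonneg (v.nonneg _) (pow_nonneg hr j)
    have hb0 : ∀ j, 0 ≤ b j := fun j => mul_nonneg (v.nonneg _) (pow_nonneg hr j)
    have h1 : ∀ j, v (coeff j (φ * ψ)) * r ^ j
        ≤ ∑ x ∈ antidiagonal j, a x.1 * b x.2 := fun j => by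
      rw [coeff_mul]
      refine (mul_le_mul_of_nonneg_right (v.sum_le _ _) (pow_nonneg hr j)).trans ?_
      rw [sum_mul]
      refine sum_le_sum fun x hx => ?_
      rw [← mem_antidiagonal.1 hx, map_mul, pow_add]
      exact le_of_eq (by simp only [ha, hb]; ring)
    refine (sum_le_sum fun j _ => h1 j).trans ?_
    rw [sum_mul_sum, ← sum_product', sum_sigma']
    have hinj : Set.InjOn (fun y : (_ : ℕ) × (ℕ × ℕ) => y.2) ((range (N + 1)).sigma
        fun j => antidiagonal j : Finset _) := by
      rintro ⟨j, y⟩ hy ⟨j', y'⟩ hy' h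
      simp only [coe_sigma, Set.mem_sigma_iff, mem_coe,
        mem_antidiagonal] at hy hy' h
      obtain rfl := h
      obtain rfl := hy.2.symm.trans hy'.2
      rfl
    rw [← sum_image (f := fun y : ℕ × ℕ => a y.1 * b y.2) hinj]
    refine sum_le_sum_of_subset_of_nonneg (fun y hy => ?_)
      fun y _ _ => mul_nonneg (ha0 _) (hb0 _)
    obtain ⟨⟨j, z⟩, hz, rfl⟩ := mem_image.1 hy
    simp only [mem_sigma, mem_antidiagonal,
      mem_range] at hz
    simp only [mem_product, mem_range]
    omega

lemma tnorm_apply (hr : 0 ≤ r) (φ : ℚ⟦X⟧) : tnorm v N r hr φ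
    = ∑ j ∈ range (N + 1), v (coeff j φ) * r ^ j := rfl

variable {v N r} (hr : 0 ≤ r)

lemma coeff_le_tnorm (φ : ℚ⟦X⟧) {j : ℕ} (hj : j ≤ N) :
    v (coeff j φ) * r ^ j ≤ tnorm v N r hr φ :=
  single_le_sum (f := fun j => v (coeff j φ) * r ^ j)
    (fun j _ => mul_nonneg (v.nonneg _) (pow_nonneg hr j)) (mem_range.2 (by omega))

lemma tnorm_C (q : ℚ) : tnorm v N r hr (C q) = v q := by
  rw [tnorm_apply, sum_eq_single 0]
  · simp
  · intro j _ hj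
    rw [coeff_C, if_neg hj, map_zero, zero_mul]
  · simp

lemma tnorm_one : tnorm v N r hr 1 = 1 := by
  rw [← map_one (C (R := ℚ)), tnorm_C, map_one]

lemma tnorm_X_le : tnorm v N r hr X ≤ r := by
  rw [tnorm_apply]
  refine (sum_le_sum (g := fun j => if j = 1 then r else 0) fun j _ => ?_).trans ?_
  · rw [coeff_X]
    split_ifs with h
    · simp [h]
    · simp
  · rw [sum_ite_eq']
    split_ifs
    exacts [le_rfl, hr]

end TruncatedNorm

section SeminormBounds

open PowerSeries

variable {R : Type*} [CommRing R] (p : RingSeminorm R)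

lemma seminorm_sum_le {κ : Type*} (s : Finset κ) (F : κ → R) :
    p (∑ k ∈ s, F k) ≤ ∑ k ∈ s, p (F k) :=
  le_sum_of_subadditive p (map_zero p).le (map_add_le_add p) s F

lemma seminorm_prod_le (h1 : p 1 ≤ 1) {κ : Type*} (s : Finset κ) (F : κ → R) :
    p (∏ k ∈ s, F k) ≤ ∏ k ∈ s, p (F k) := by
  classical
  induction s using Finset.induction with
  | empty => simpa using h1
  | insert k s hk ih =>
    rw [prod_insert hk, prod_insert hk]
    exact (map_mul_le_mul p _ _).trans (mul_le_mul_of_nonneg_left ih (apply_nonneg p _))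

lemma seminorm_pow_le (h1 : p 1 ≤ 1) (F : R) (k : ℕ) : p (F ^ k) ≤ p F ^ k := by
  simpa using seminorm_prod_le p h1 (range k) fun _ => F

variable {ι : Type*} [DecidableEq ι] [Fintype ι]

/-- A bound for the terms of nested sums. -/
lemma seminorm_nest_le (h1 : p 1 ≤ 1) (cr : ι → ι → ℕ → R) (t : ι → ℤ → R) (B : ℕ)
    (ω : ℤ → ℝ) (hω0 : ω 0 = 1) (hω1 : ∀ s, 0 < ω s) (hωm : ∀ s s', ω (s + s') ≤ ω s * ω s')
    (hωn : ∀ s, ω (-s) = ω s) (x A : ι → ℝ) (hx : ∀ i, 0 < x i) (hA : ∀ i, 0 ≤ A i) (Q : ℝ)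
    (hQ : 1 ≤ Q) {l : List ι} (hl : l.Nodup) (h0 : ∀ i j, cr i j 0 = 1)
    (ht : ∀ i ∈ l, ∀ s, p (t i s) ≤ A i * (ω s * x i ^ (-s)))
    (hcr : l.Pairwise fun i j => ∑ f ∈ range (B + 1),
      p (cr i j f) * (ω f ^ 2 * (x j / x i) ^ f) ≤ Q) (c : ι → ℤ) :
    p (nest cr t B l c) ≤ Q ^ (Fintype.card ι * l.length)
      * (l.map fun i => A i * (ω (c i) * x i ^ (-c i))).prod := by
  induction l generalizing c with
  | nil => simpa [nest] using h1
  | cons i l ih =>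
    rw [nodup_cons] at hl
    rw [List.pairwise_cons] at hcr
    have ih' := fun c => ih hl.2 (fun j hj => ht j (mem_cons_of_mem _ hj)) hcr.2 c
    have hQ0 : 0 ≤ Q := zero_le_one.trans hQ
    set W : (ι → ℤ) → ℝ := fun c => (l.map fun i => A i * (ω (c i) * x i ^ (-c i))).prod with hW
    have hW0 : ∀ c, 0 ≤ W c := fun c => List.prod_nonneg (by
      simp only [List.mem_map, forall_exists_index, and_imp]
      rintro _ j _ rfl
      have := hA j; have := hω1 (c j); have := hx j
      positivity)
    have hbox : ∀ f ∈ box l B, ∀ F : ι → ℕ → ℝ, (∀ j, F j 0 = 1) →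
        (l.map fun j => F j (f j)).prod = ∏ j, F j (f j) := fun f hf F hF => by
      rw [← List.prod_toFinset _ hl.2]
      refine prod_subset (subset_univ _) fun j _ hj => ?_
      have := Fintype.mem_piFinset.1 hf j
      rw [if_neg (by simpa using hj), mem_singleton] at this
      rw [this, hF]
    have hωs : ∀ (f : ι → ℕ) (s : ℤ), ω (s + ∑ j, (f j : ℤ)) ≤ ω s * ∏ j, ω (f j) := by
      intro f s
      induction (univ : Finset ι) using Finset.induction with
      | empty => simp
      | insert j S hj ih =>
        rw [sum_insert hj, prod_insert hj, add_left_comm]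
        refine (hωm _ _).trans ?_
        rw [mul_left_comm]
        exact mul_le_mul_of_nonneg_left ih (hω1 _).le
    have hWf : ∀ f ∈ box l B, W (fun j => c j - f j) ≤ W c * ∏ j, (ω (f j) * x j ^ f j) := by
      intro f hf
      rw [← hbox f hf (fun j k => ω k * x j ^ k) (by simp [hω0]), hW]
      beta_reduce
      rw [← List.prod_map_mul]
      refine List.prod_map_le_prod_map₀ _ _ (fun j _ => ?_) fun j _ => ?_
      · have := hA j; have := hω1 (c j - f j); have := hx j
        positivity
      · have e : x j ^ (-(c j - f j)) = x j ^ (-c j) * x j ^ f j := by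
          rw [neg_sub, sub_eq_neg_add, zpow_add₀ (hx j).ne', zpow_natCast]
        have h2 : ω (c j - f j) ≤ ω (c j) * ω (f j) := by
          rw [sub_eq_add_neg, ← hωn (f j)]
          exact hωm _ _
        rw [e, mul_assoc]
        refine mul_le_mul_of_nonneg_left ?_ (hA j)
        refine (mul_le_mul_of_nonneg_right h2 (mul_nonneg (zpow_nonneg (hx j).le _)
          (pow_nonneg (hx j).le _))).trans (le_of_eq (by ring))
    -- sum over the box
    have hsum : ∑ f ∈ box l B, ∏ j, p (cr i j (f j)) * (ω (f j) ^ 2 * (x j / x i) ^ f j)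
        ≤ Q ^ Fintype.card ι := by
      rw [box, ← prod_univ_sum (fun j => if j ∈ l then range (B + 1) else {0})
        (fun j f => p (cr i j f) * (ω f ^ 2 * (x j / x i) ^ f)), ← card_univ,
        ← prod_const]
      refine prod_le_prod (fun j _ => sum_nonneg fun f _ => ?_) fun j _ => ?_
      · have := hω1 f; have := hx j; have := hx i
        exact mul_nonneg (apply_nonneg p _) (by positivity)
      · split_ifs with hj
        · exact hcr.1 j hj
        · rw [sum_singleton, h0, Nat.cast_zero, hω0]
          simpa using h1.trans hQ
    set G := A i * (ω (c i) * x i ^ (-c i)) * (Q ^ (Fintype.card ι * l.length) * W c) with hG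
    have hG0 : 0 ≤ G := by
      have := hA i; have := hω1 (c i); have := hx i; have := hW0 c
      positivity
    have hterm : ∀ f ∈ box l B, p ((∏ j, cr i j (f j)) * t i (c i + ∑ j, (f j : ℤ))
          * nest cr t B l fun j => c j - f j)
        ≤ G * ∏ j, p (cr i j (f j)) * (ω (f j) ^ 2 * (x j / x i) ^ f j) := by
      intro f hf
      have hP : 0 ≤ ∏ j, p (cr i j (f j)) := prod_nonneg fun j _ => apply_nonneg p _
      have hxz : x i ^ (-(c i + ∑ j, (f j : ℤ))) = x i ^ (-c i) * ∏ j, (x i ^ f j)⁻¹ := by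
        rw [neg_add, zpow_add₀ (hx i).ne', prod_inv_distrib, prod_pow_eq_pow_sum,
          ← Nat.cast_sum, zpow_neg _ ((_ : ℕ) : ℤ), zpow_natCast]
      have hW1 : 0 ≤ ∏ j, (ω (f j) * x j ^ f j) := prod_nonneg fun j _ =>
        mul_nonneg (hω1 _).le (pow_nonneg (hx j).le _)
      refine (map_mul_le_mul p _ _).trans ?_
      calc _ ≤ (∏ j, p (cr i j (f j))) * (A i * ((ω (c i) * ∏ j, ω (f j))
            * (x i ^ (-c i) * ∏ j, (x i ^ f j)⁻¹)))
            * (Q ^ (Fintype.card ι * l.length) * (W c * ∏ j, (ω (f j) * x j ^ f j))) := by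
            refine mul_le_mul ((map_mul_le_mul p _ _).trans (mul_le_mul
              (seminorm_prod_le p h1 _ _) ?_ (apply_nonneg p _) hP))
              ((ih' _).trans (mul_le_mul_of_nonneg_left (hWf f hf) (pow_nonneg hQ0 _)))
              (apply_nonneg p _) ?_
            · refine (ht i List.mem_cons_self _).trans (mul_le_mul_of_nonneg_left ?_ (hA i))
              rw [hxz]
              refine mul_le_mul_of_nonneg_right (hωs f _) (mul_nonneg (zpow_nonneg (hx i).le _)
                (prod_nonneg fun j _ => inv_nonneg.2 (pow_nonneg (hx i).le _)))
            · refine mul_nonneg hP (mul_nonneg (hA i) (mul_nonneg (mul_nonneg (hω1 _).le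
                (prod_nonneg fun j _ => (hω1 _).le)) (mul_nonneg (zpow_nonneg (hx i).le _)
                (prod_nonneg fun j _ => inv_nonneg.2 (pow_nonneg (hx i).le _)))))
        _ = _ := by
            simp only [div_eq_mul_inv, mul_pow, inv_pow, prod_mul_distrib, prod_pow, hG]
            ring
    rw [nest]
    refine (seminorm_sum_le p _ _).trans ((sum_le_sum hterm).trans ?_)
    rw [← mul_sum]
    refine (mul_le_mul_of_nonneg_left hsum hG0).trans (le_of_eq ?_)
    rw [map_cons, List.prod_cons, List.length_cons, Nat.mul_succ, pow_add, hG, hW]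
    ring

end SeminormBounds

section RealEstimates

open Real

lemma sqrt_mul_pow_div_factorial_le {z : ℝ} (hz : 0 < z) (s : ℕ) :
    √z * (z ^ s / s.factorial) ≤ 2 * exp z := by
  have hs0 : (0 : ℝ) < s.factorial := by exact_mod_cast s.factorial_pos
  rcases lt_or_ge (s : ℝ) (z / 4) with h | h
  · have h1 : √z ≤ exp (z / 4) := by
      rw [sqrt_le_left (exp_pos _).le, ← exp_nat_mul]
      have := quadratic_le_exp_of_nonneg (x := z / 2) (by positivity)
      have e : ((2 : ℕ) : ℝ) * (z / 4) = z / 2 := by push_cast; ring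
      rw [e]
      nlinarith [sq_nonneg (z / 2 - 1)]
    have h2 : z ^ s / s.factorial = 2 ^ s * ((z / 2) ^ s / s.factorial) := by
      rw [← mul_div_assoc, ← mul_pow, mul_div_cancel₀ z (two_ne_zero)]
    have h3 : (2 : ℝ) ^ s ≤ exp (z / 4) := by
      have : (2 : ℝ) ≤ exp 1 := by have := add_one_le_exp (1 : ℝ); linarith
      refine (pow_le_pow_left₀ two_pos.le this s).trans ?_
      rw [← exp_nat_mul, mul_one]
      exact exp_le_exp.2 h.le
    have h4 := pow_div_factorial_le_exp (x := z / 2) (by positivity) s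
    rw [h2]
    calc _ ≤ exp (z / 4) * (exp (z / 4) * exp (z / 2)) := by gcongr
      _ = exp z := by rw [← exp_add, ← exp_add]; ring_nf
      _ ≤ _ := by linarith [exp_pos z]
  · have hs : (0 : ℝ) < s := lt_of_lt_of_le (by positivity) h
    have h1 := Stirling.le_factorial_stirling s
    have h2 : √s ≤ √(2 * π * s) := sqrt_le_sqrt (by nlinarith [pi_gt_three])
    have h3 : √z ≤ 2 * √s := by
      rw [sqrt_le_left (by positivity), mul_pow, sq_sqrt hs.le]
      linarith
    have h4 : z ^ s ≤ exp z * (s / exp 1) ^ s := by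
      have h5 : z / s ≤ exp (z / s - 1) := by have := add_one_le_exp (z / s - 1); linarith
      have h6 := pow_le_pow_left₀ (by positivity) h5 s
      rw [← exp_nat_mul, mul_sub, mul_div_cancel₀ _ hs.ne', mul_one, exp_sub, div_pow] at h6
      rw [div_pow, ← exp_nat_mul, mul_one]
      rw [div_le_div_iff₀ (by positivity) (by positivity)] at h6
      rw [← mul_div_assoc, le_div_iff₀ (by positivity)]
      linarith
    rw [← mul_div_assoc, div_le_iff₀ hs0]
    calc √z * z ^ s ≤ 2 * √s * (exp z * (s / exp 1) ^ s) := by gcongr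
      _ = 2 * exp z * (√s * (s / exp 1) ^ s) := by ring
      _ ≤ 2 * exp z * s.factorial := by
          gcongr
          exact le_trans (by gcongr) h1

lemma factorial_le_mul_sqrt {m : ℕ} (hm : 0 < m) :
    (m.factorial : ℝ) ≤ exp 1 * √m * (m / exp 1) ^ m := by
  have h : Stirling.stirlingSeq m ≤ Stirling.stirlingSeq 1 := by
    have := Stirling.stirlingSeq'_antitone (Nat.zero_le (m - 1))
    simpa [Nat.sub_add_cancel hm] using this
  rw [Stirling.stirlingSeq_one, Stirling.stirlingSeq, div_le_iff₀ (by positivity)] at h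
  refine h.trans (le_of_eq ?_)
  rw [sqrt_mul two_pos.le]
  have := sqrt_pos.2 (two_pos : (0 : ℝ) < 2)
  field_simp

/-- The saddle point estimate for one site. -/
lemma site_bound {T : ℝ} (hT : 1 ≤ T) {m : ℕ} (hm : 0 < m) (hmT : (m : ℝ) ≤ T ^ 2) {n k : ℕ}
    (hk : k ≤ n) {u w x : ℝ} (hu : u = (T ^ 3)⁻¹) (hw : w = u * m)
    (hx : x = u⁻¹ * exp (-(2 * k / T))) :
    ∃ A : ℝ, 0 ≤ A ∧ (∀ s : ℕ, (w * (1 + w ^ 2)) ^ s / s.factorial ≤ A * x ^ (-(s : ℤ))) ∧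
      A * x ^ (-(m : ℤ)) ≤ 2 * exp (2 + n + 4 * n ^ 2) * (u ^ m * (m ^ m / m.factorial)) := by
  have hT0 : 0 < T := by linarith
  have hu0 : 0 < u := by rw [hu]; positivity
  have hm0 : (0 : ℝ) < m := by exact_mod_cast hm
  have hw0 : 0 < w := by rw [hw]; positivity
  have hx0 : 0 < x := by rw [hx]; positivity
  set δ : ℝ := 2 * k / T with hδ
  have hδ0 : 0 ≤ δ := by positivity
  have hkn : (k : ℝ) ≤ n := by exact_mod_cast hk
  have hδn : δ ≤ 2 * n := by
    rw [hδ, div_le_iff₀ hT0]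
    nlinarith [mul_nonneg (Nat.cast_nonneg n : (0 : ℝ) ≤ n) (sub_nonneg.2 hT)]
  set z := w * (1 + w ^ 2) * x with hz
  have hz0 : 0 < z := by positivity
  have hzm : z = m * (1 + w ^ 2) * exp (-δ) := by
    rw [hz, hx, hw]; field_simp
  have hmw : m * w ^ 2 ≤ 1 := by
    have e : m * w ^ 2 = (m / T ^ 2) ^ 3 := by rw [hw, hu]; field_simp
    rw [e]
    exact pow_le_one₀ (by positivity) (by rwa [div_le_one (by positivity)])
  have hmδ : m * δ ^ 2 ≤ 4 * n ^ 2 := by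
    calc (m : ℝ) * δ ^ 2 ≤ T ^ 2 * δ ^ 2 := by gcongr
      _ = 4 * (k : ℝ) ^ 2 := by rw [hδ]; field_simp; ring
      _ ≤ _ := by gcongr
  have hexp : exp (-δ) ≤ 1 - δ + δ ^ 2 := by
    rw [exp_neg]
    refine inv_le_of_inv_le₀ (by nlinarith) (le_trans ?_ (add_one_le_exp δ))
    rw [inv_le_iff_one_le_mul₀ (by nlinarith)]
    nlinarith [pow_nonneg hδ0 3]
  have hexp1 : exp (-δ) ≤ 1 := exp_le_one_iff.2 (by linarith)
  have hzle : z + m * δ ≤ m + 1 + 4 * n ^ 2 := by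
    have h1 : m * exp (-δ) ≤ m * (1 - δ + δ ^ 2) := by gcongr
    have h2 : m * w ^ 2 * exp (-δ) ≤ 1 * 1 := by gcongr
    rw [hzm]
    nlinarith
  have hzge : exp (-n) * √m ≤ √z := by
    refine le_sqrt_of_sq_le ?_
    rw [mul_pow, sq_sqrt hm0.le, ← exp_nat_mul, hzm]
    have h1 : exp (((2 : ℕ) : ℝ) * -n) ≤ exp (-δ) := exp_le_exp.2 (by push_cast; linarith)
    have h2 : (m : ℝ) ≤ m * (1 + w ^ 2) := by nlinarith [mul_pos hm0 (pow_pos hw0 2)]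
    rw [mul_comm]
    gcongr
  refine ⟨2 * exp z / √z, by positivity, fun s => ?_, ?_⟩
  · rw [zpow_neg, zpow_natCast, div_mul_eq_mul_div, le_div_iff₀ (sqrt_pos.2 hz0),
      ← div_eq_mul_inv, le_div_iff₀ (by positivity)]
    refine le_trans (le_of_eq ?_) (sqrt_mul_pow_div_factorial_le hz0 s)
    rw [hz, mul_pow _ x]
    ring
  · have hfac := factorial_le_mul_sqrt hm
    have hs0 : (0 : ℝ) < m.factorial := by exact_mod_cast m.factorial_pos
    have hxm : x ^ (-(m : ℤ)) = u ^ m * exp (m * δ) := by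
      rw [zpow_neg, zpow_natCast, hx, mul_pow, ← exp_nat_mul, mul_inv, inv_pow, inv_inv,
        ← exp_neg]
      ring_nf
    have hst : exp m / (exp 1 * √m) ≤ m ^ m / m.factorial := by
      rw [div_le_div_iff₀ (by positivity) hs0]
      rw [div_pow, ← exp_nat_mul, mul_one, ← mul_div_assoc, le_div_iff₀ (exp_pos _)] at hfac
      linarith
    have hsm : 0 < √(m : ℝ) := sqrt_pos.2 hm0
    rw [hxm]
    calc _ ≤ 2 * exp z / (exp (-n) * √m) * (u ^ m * exp (m * δ)) := by gcongr
      _ = 2 * exp (z + m * δ) * exp n * u ^ m / √m := by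
          rw [exp_neg, exp_add]; field_simp
      _ ≤ 2 * exp (m + 1 + 4 * n ^ 2) * exp n * u ^ m / √m := by gcongr
      _ = 2 * exp (2 + n + 4 * n ^ 2) * (u ^ m * (exp m / (exp 1 * √m))) := by
          have : exp ((2 : ℝ) + n + 4 * n ^ 2) * exp m
            = exp (m + 1 + 4 * n ^ 2) * exp n * exp 1 := by
            rw [← exp_add, ← exp_add, ← exp_add]; ring_nf
          field_simp
          linear_combination -this
      _ ≤ _ := by gcongr

end RealEstimates

section CumulantSeminorm

open PowerSeries

variable {R : Type*} [CommRing R] {ι : Type*} [DecidableEq ι] [Fintype ι]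

lemma exists_seminorm_cumulant_le {C : ℝ} (hC : 0 ≤ C) (n : ℕ) : ∃ K : ℝ, 0 ≤ K ∧
    ∀ (p : RingSeminorm R) (ρ : ℝ) (M : Finset ι → R), 0 ≤ ρ → M ∅ = 1 →
      (∀ S, p (M S) ≤ C * ρ ^ S.card) → ∀ S : Finset ι, S.card ≤ n →
        p (cumulant M S) ≤ K * ρ ^ S.card := by
  induction n with
  | zero =>
    refine ⟨0, le_rfl, fun p ρ M _ _ _ S hS => ?_⟩
    rw [card_eq_zero.1 (Nat.le_zero.1 hS), cumulant_empty, map_zero, zero_mul]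
  | succ n ih =>
    obtain ⟨K, hK, h⟩ := ih
    refine ⟨C + (univ : Finset (Finset ι)).card * (K * C), by positivity,
      fun p ρ M hρ h0 hM S hS => ?_⟩
    rcases S.eq_empty_or_nonempty with rfl | ⟨r, hr⟩
    · rw [cumulant_empty, map_zero]
      positivity
    have h1 := moment_eq_sum M h0 hr
    rw [sum_rooted_eq hr, Finset.sdiff_self, h0, mul_one] at h1
    rw [eq_sub_of_add_eq h1.symm]
    refine (map_sub_le_add p _ _).trans ?_
    rw [add_mul]
    refine add_le_add (hM S) ((seminorm_sum_le p _ _).trans ?_)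
    refine (sum_le_card_nsmul _ _ (K * C * ρ ^ S.card) fun B hB => ?_).trans ?_
    · have hB' := mem_rooted.1 (mem_of_mem_erase hB)
      have hlt : B.card < S.card := card_lt_card
        (Finset.ssubset_iff_subset_ne.2 ⟨hB'.1, ne_of_mem_erase hB⟩)
      refine (map_mul_le_mul p _ _).trans ((mul_le_mul (h p ρ M hρ h0 hM B (by omega)) (hM _)
        (apply_nonneg p _) (by positivity)).trans (le_of_eq ?_))
      rw [← card_sdiff_add_card_eq_card hB'.1, pow_add]
      ring
    · rw [nsmul_eq_mul, mul_assoc _ (K * C)]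
      refine mul_le_mul_of_nonneg_right ?_ (by positivity)
      exact_mod_cast card_le_card (subset_univ _)

end CumulantSeminorm

section Divide

open PowerSeries

lemma seminorm_le_of_prod_mul {R : Type*} [CommRing R] (p : RingSeminorm R) {ι : Type*}
    (S : Finset ι) (s : ι → R) (hs : ∀ i ∈ S, p (s i - 1) ≤ 1 / 2) (φ : R) :
    p φ ≤ 2 ^ S.card * p ((∏ i ∈ S, s i) * φ) := by
  classical
  induction S using Finset.induction generalizing φ with
  | empty => simp
  | insert i S hi ih =>
    have h1 := ih (fun j hj => hs j (mem_insert_of_mem hj)) φ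
    have h2 := hs i (mem_insert_self i S)
    rw [prod_insert hi, card_insert_of_notMem hi]
    set ψ := (∏ i ∈ S, s i) * φ with hψ
    have h3 : p ψ ≤ p (s i * ψ) + p (s i - 1) * p ψ := by
      have e : ψ = s i * ψ - (s i - 1) * ψ := by ring
      calc p ψ = p (s i * ψ - (s i - 1) * ψ) := by rw [← e]
        _ ≤ _ := (map_sub_le_add p _ _).trans (add_le_add le_rfl (map_mul_le_mul p _ _))
    have h4 : p ψ ≤ 2 * p (s i * ψ) := by nlinarith [apply_nonneg p ψ]
    rw [mul_assoc, ← hψ, pow_succ, mul_assoc]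
    exact h1.trans (mul_le_mul_of_nonneg_left h4 (by positivity))

lemma tnorm_X_pow_mul (v : AbsoluteValue ℚ ℝ) (N : ℕ) {r : ℝ} (hr : 0 ≤ r) (k : ℕ)
    (φ : ℚ⟦X⟧) :
    r ^ k * tnorm v N r hr φ ≤ tnorm v (N + k) r hr (X ^ k * φ) := by
  rw [tnorm_apply, tnorm_apply, mul_sum, add_right_comm, add_comm _ k,
    sum_range_add _ k]
  refine le_add_of_nonneg_of_le (sum_nonneg fun j _ =>
    mul_nonneg (v.nonneg _) (pow_nonneg hr j)) (sum_le_sum fun j _ => le_of_eq ?_)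
  rw [add_comm k j, coeff_X_pow_mul, pow_add]
  ring

end Divide

section RealNorm

open PowerSeries

local notation "vR" => Rat.AbsoluteValue.real

variable (N : ℕ) {r : ℝ} (hr : 0 ≤ r)

lemma tnorm_real_ex_le (q : ℚ) {w : ℝ} (hw : |(q : ℝ)| * r ≤ w) :
    tnorm vR N r hr (ex q) ≤ Real.exp w := by
  have hw0 : 0 ≤ |(q : ℝ)| * r := by positivity
  refine le_trans ?_ (Real.exp_le_exp.2 hw)
  refine le_trans (le_of_eq ?_) (Real.sum_le_exp_of_nonneg hw0 (N + 1))
  rw [tnorm_apply]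
  refine sum_congr rfl fun j _ => ?_
  rw [coeff_ex, Rat.AbsoluteValue.real_eq_abs, Rat.cast_abs, Rat.cast_div, Rat.cast_pow, Rat.cast_natCast,
    abs_div, abs_pow, Nat.abs_cast, mul_pow]
  ring

lemma tnorm_real_sinhc_sub_one_le {q : ℚ} (hq : 0 ≤ q) {w : ℝ} (hw : r * q = w) (hw1 : w ≤ 1) :
    tnorm vR N r hr (sinhc q - 1) ≤ w ^ 2 / 2 := by
  have hw0 : 0 ≤ w := by rw [← hw]; exact mul_nonneg hr (by exact_mod_cast hq)
  have h1 : ∀ j : ℕ, vR (coeff j (sinhc q - 1)) * r ^ j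
      ≤ w ^ 2 / 4 * ((1 / 2) ^ j) := by
    intro j
    rw [map_sub, coeff_sinhc, coeff_one]
    have h0 : 0 ≤ w ^ 2 / 4 * ((1 / 2) ^ j) := by positivity
    rcases Nat.lt_or_ge j 2 with h | h
    · interval_cases j <;> simpa using h0
    · rw [show (if j = 0 then (1 : ℚ) else 0) = 0 from if_neg (by omega), sub_zero]
      split_ifs
      · rw [Rat.AbsoluteValue.real_eq_abs, abs_of_nonneg (by positivity)]
        have hf : (4 : ℝ) ≤ (j + 1).factorial := by
          have := Nat.factorial_le (show 3 ≤ j + 1 by omega)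
          have h6 : Nat.factorial 3 = 6 := rfl
          exact_mod_cast (by omega : 4 ≤ (j + 1).factorial)
        have e : ((q ^ j / (2 ^ j * (j + 1).factorial) : ℚ) : ℝ) * r ^ j
            = w ^ j * (1 / 2) ^ j / (j + 1).factorial := by
          push_cast
          rw [← hw, mul_pow, one_div, inv_pow]
          field_simp
        have hwj : w ^ j ≤ w ^ 2 := pow_le_pow_of_le_one hw0 hw1 h
        rw [e]
        calc _ ≤ w ^ 2 * (1 / 2) ^ j / 4 := by gcongr
          _ = _ := by ring
      · simpa using h0
  rw [tnorm_apply]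
  refine (sum_le_sum fun j _ => h1 j).trans ?_
  rw [← mul_sum]
  have := sum_geometric_two_le (N + 1)
  nlinarith [sq_nonneg w]

lemma tnorm_real_svar_le {q : ℚ} (hq : 0 ≤ q) {w : ℝ} (hw : r * q = w) (hw1 : w ≤ 1) :
    tnorm vR N r hr (svar q) ≤ w * (1 + w ^ 2) := by
  have hw0 : 0 ≤ w := by rw [← hw]; exact mul_nonneg hr (by exact_mod_cast hq)
  have hC : tnorm vR N r hr (C q * X) ≤ w := by
    refine (map_mul_le_mul _ _ _).trans ?_
    rw [tnorm_C, Rat.AbsoluteValue.real_eq_abs, abs_of_nonneg (by exact_mod_cast hq), ← hw,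
      mul_comm r]
    exact mul_le_mul_of_nonneg_left (tnorm_X_le hr) (by exact_mod_cast hq)
  have hs : tnorm vR N r hr (sinhc q) ≤ 1 + w ^ 2 := by
    have := map_add_le_add (tnorm vR N r hr) (sinhc q - 1) 1
    rw [sub_add_cancel, tnorm_one] at this
    have := tnorm_real_sinhc_sub_one_le N hr hq hw hw1
    nlinarith [sq_nonneg w]
  rw [svar_eq]
  exact (map_mul_le_mul _ _ _).trans (mul_le_mul hC hs (apply_nonneg _ _) hw0)

lemma tnorm_real_cross_succ_le {ι : Type*} (σ : ι → ℚ) (i j : ι) (hi : 0 ≤ σ i) (hj : 0 ≤ σ j)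
    {b : ℝ} (hbi : r * σ i ≤ b) (hbj : r * σ j ≤ b) (hb : b ≤ 1) (f : ℕ) :
    tnorm vR N r hr (cross σ i j (f + 1)) ≤ 4 * b ^ 2 * ((f + 1) * Real.exp b ^ f) := by
  have hb0 : 0 ≤ b := (mul_nonneg hr (by exact_mod_cast hi : (0 : ℝ) ≤ σ i)).trans hbi
  have hs : ∀ q : ℚ, 0 ≤ q → r * q ≤ b → tnorm vR N r hr (svar q) ≤ 2 * b := by
    intro q hq hqb
    have hw0 : 0 ≤ r * (q : ℝ) := mul_nonneg hr (by exact_mod_cast hq)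
    refine (tnorm_real_svar_le N hr hq rfl (hqb.trans hb)).trans ?_
    calc r * (q : ℝ) * (1 + (r * q) ^ 2) ≤ b * (1 + 1 ^ 2) := by
          have := hqb.trans hb
          gcongr
      _ = _ := by ring
  have hsum : tnorm vR N r hr (∑ x ∈ antidiagonal f,
      (((expU (σ i / 2) * expU (σ j / 2)) ^ ((x.1 : ℤ) - x.2) : ℚ⟦X⟧ˣ)
        : ℚ⟦X⟧)) ≤ (f + 1) * Real.exp b ^ f := by
    refine (seminorm_sum_le _ _ _).trans ((sum_le_card_nsmul _ _ (Real.exp b ^ f)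
      fun x hx => ?_).trans ?_)
    · rw [mem_antidiagonal] at hx
      rw [expU_mul, expU_zpow, val_expU, ← Real.exp_nat_mul]
      refine tnorm_real_ex_le N hr _ ?_
      have h1 : |((x.1 : ℝ) - x.2)| ≤ f := by
        rw [abs_le, ← hx]
        push_cast
        constructor <;> linarith [(Nat.cast_nonneg x.1 : (0 : ℝ) ≤ x.1),
          (Nat.cast_nonneg x.2 : (0 : ℝ) ≤ x.2)]
      have h2 : 0 ≤ (σ i : ℝ) / 2 + σ j / 2 := by
        have : (0 : ℝ) ≤ σ i := by exact_mod_cast hi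
        have : (0 : ℝ) ≤ σ j := by exact_mod_cast hj
        positivity
      push_cast
      rw [abs_mul, abs_of_nonneg h2, mul_assoc]
      exact mul_le_mul h1 (by linarith) (mul_nonneg h2 hr) (Nat.cast_nonneg f)
    · rw [Finset.Nat.card_antidiagonal, nsmul_eq_mul]
      push_cast
      exact le_rfl
  rw [cross, crossCoeff, sg_expU, sg_expU, Int.cast_one, one_mul, one_mul]
  refine (map_mul_le_mul _ _ _).trans (mul_le_mul ((map_mul_le_mul _ _ _).trans ?_) hsum
    (apply_nonneg _ _) (by positivity))
  refine (mul_le_mul (hs _ hi hbi) (hs _ hj hbj) (apply_nonneg _ _) (by positivity)).trans ?_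
  exact le_of_eq (by ring)

end RealNorm

lemma tnorm_C_mul (v : AbsoluteValue ℚ ℝ) (N : ℕ) {r : ℝ} (hr : 0 ≤ r) (q : ℚ)
    (φ : ℚ⟦X⟧) : tnorm v N r hr (PowerSeries.C q * φ) = v q * tnorm v N r hr φ := by
  rw [tnorm_apply, tnorm_apply, mul_sum]
  refine sum_congr rfl fun j _ => ?_
  rw [PowerSeries.coeff_C_mul, map_mul, mul_assoc]

lemma sum_succ_mul_pow_le {q : ℝ} (hq0 : 0 ≤ q) (hq1 : q < 1) (B : ℕ) :
    ∑ f ∈ range B, ((f : ℝ) + 1) * q ^ f ≤ ((1 - q)⁻¹) ^ 2 := by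
  have h1 := hasSum_coe_mul_geometric_of_norm_lt_one (r := q)
    (by rwa [Real.norm_of_nonneg hq0])
  have h2 := hasSum_geometric_of_lt_one hq0 hq1
  have h3 := h1.add h2
  have h4 := sum_le_hasSum (range B) (fun f _ => by positivity) h3
  refine le_trans (le_of_eq (sum_congr rfl fun f _ => by ring)) (h4.trans (le_of_eq ?_))
  have : 1 - q ≠ 0 := by linarith
  field_simp
  ring

section Growth

open PowerSeries

variable {ι : Type*} [DecidableEq ι] [Fintype ι]

local notation "vR" => Rat.AbsoluteValue.real

lemma nest_expCoeff_eq (μ : ι → ℕ) (h0 : ∀ i, 0 < μ i) (S : Finset ι) :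
    nest (cross fun i => (μ i : ℚ)) (fun i => expCoeff (svar (μ i))) (∑ i ∈ S, μ i) S.toList
      (fun i => (μ i : ℤ))
      = C (∏ i ∈ S, (μ i : ℚ) ^ μ i / (μ i).factorial)
        * (X ^ (∑ i ∈ S, μ i) * ((∏ i ∈ S, sinhc (μ i)) * nmom μ S)) := by
  have h := nest_expCoeff (fun i => (μ i : ℚ)) μ (∑ i ∈ S, μ i) S.nodup_toList
    (fun i _ => by have := h0 i; positivity) 0
  simp only [Pi.zero_apply, add_zero] at h
  rw [h, prod_map_toList, sum_map_toList, ← Nat.cast_sum, Int.toNat_natCast,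
    show nestMom (fun i => (μ i : ℚ)) μ (∑ i ∈ S, μ i) S.toList 0 = mom μ S from rfl, nmom,
    ← mul_assoc (∏ i ∈ S, sinhc (μ i)), ← prod_mul_distrib, map_prod]
  rw [mul_left_comm, mul_left_comm (∏ i ∈ S, C _), ← mul_assoc (∏ i ∈ S, _),
    ← prod_mul_distrib]
  congr 2
  refine prod_congr rfl fun i _ => ?_
  have hi := h0 i
  rw [eZ_natCast (by positivity), ← pow_succ', Nat.sub_add_cancel hi, ← mul_assoc, ← map_mul,
    inv_mul_eq_div]

lemma exists_tnorm_nmom_le (N : ℕ) : ∃ C : ℝ, 0 ≤ C ∧ ∀ (T : ℝ) (u : ℝ) (hu : 0 ≤ u)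
    (μ : ι → ℕ), 1 ≤ T → u = (T ^ 3)⁻¹ → (∀ i, 0 < μ i) → (∀ i, (μ i : ℝ) ≤ T ^ 2) →
    ∀ S, tnorm vR N u hu (nmom μ S) ≤ C := by
  set n := Fintype.card ι with hn
  set K : ℝ := 2 * Real.exp (2 + n + 4 * n ^ 2) with hK
  have hK1 : 1 ≤ K := by
    have := Real.one_le_exp (show (0 : ℝ) ≤ 2 + n + 4 * n ^ 2 by positivity)
    linarith
  refine ⟨2 ^ n * (17 ^ (n * n) * K ^ n), by positivity, fun T u hu μ hT huT h0 hμ S => ?_⟩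
  have hT0 : 0 < T := by linarith
  have hu0 : 0 < u := by rw [huT]; positivity
  have hSn : S.card ≤ n := card_le_univ S
  have hpos : ∀ i, S.toList.idxOf i ≤ n := fun i =>
    List.idxOf_le_length.trans (by rwa [length_toList])
  have hw : ∀ i, u * μ i ≤ 1 / T := fun i => by
    rw [huT, inv_mul_eq_div, div_le_div_iff₀ (by positivity) hT0]
    have := mul_le_mul_of_nonneg_right (hμ i) hT0.le
    nlinarith
  have hT1 : 1 / T ≤ 1 := by rw [div_le_one hT0]; exact hT
  set x : ι → ℝ := fun i => u⁻¹ * Real.exp (-(2 * S.toList.idxOf i / T)) with hx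
  have hx0 : ∀ i, 0 < x i := fun i => by positivity
  choose A hA0 hA1 hA2 using fun i => site_bound hT (h0 i) (hμ i) (hpos i) huT
    (rfl : u * μ i = u * μ i) (rfl : x i = _)
  set p := tnorm vR (N + ∑ i ∈ S, μ i) u hu with hp
  have ht : ∀ i ∈ S.toList, ∀ s, p (expCoeff (svar (μ i)) s) ≤ A i * (1 * x i ^ (-s)) := by
    intro i _ s
    rw [one_mul, expCoeff]
    split_ifs with hs
    · rw [map_zero]
      exact mul_nonneg (hA0 i) (zpow_nonneg (hx0 i).le _)
    · obtain ⟨s, rfl⟩ := Int.eq_ofNat_of_zero_le (not_lt.1 hs)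
      refine le_trans ?_ (hA1 i s)
      rw [Int.toNat_natCast, ← C_eq_algebraMap, hp, tnorm_C_mul,
        Rat.AbsoluteValue.real_eq_abs, abs_of_nonneg (by positivity), div_eq_inv_mul]
      push_cast
      refine mul_le_mul_of_nonneg_left ((seminorm_pow_le _ (tnorm_one hu).le _ _).trans
        (pow_le_pow_left₀ (apply_nonneg _ _) ?_ s)) (by positivity)
      exact tnorm_real_svar_le _ hu (by positivity) (by push_cast; rfl) ((hw i).trans hT1)
  have hcr : S.toList.Pairwise fun i j => ∑ f ∈ range ((∑ i ∈ S, μ i) + 1),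
      p (cross (fun i => (μ i : ℚ)) i j f) * (1 ^ 2 * (x j / x i) ^ f) ≤ 17 := by
    have hpw : S.toList.Pairwise fun i j => S.toList.idxOf i < S.toList.idxOf j := by
      rw [List.pairwise_iff_getElem]
      intro i j hi hj hij
      rwa [S.nodup_toList.idxOf_getElem i hi, S.nodup_toList.idxOf_getElem j hj]
    refine hpw.imp fun {i j} hij => ?_
    have hxx : x j / x i ≤ Real.exp (-(2 / T)) := by
      rw [hx, mul_div_mul_left _ _ (inv_ne_zero hu0.ne'), ← Real.exp_sub, Real.exp_le_exp]
      have h1 : ((S.toList.idxOf i : ℕ) : ℝ) + 1 ≤ (S.toList.idxOf j : ℕ) := by exact_mod_cast hij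
      have h2 : 2 * ((S.toList.idxOf i : ℝ) + 1) / T ≤ 2 * (S.toList.idxOf j : ℝ) / T := by gcongr
      rw [mul_add, add_div, mul_one] at h2
      linarith
    have hxx0 : 0 ≤ x j / x i := (div_pos (hx0 j) (hx0 i)).le
    set q := Real.exp (-(1 / T)) with hq
    have hq1 : q ≤ 1 - 1 / (2 * T) := by
      have h1 : q ≤ (1 + 1 / T)⁻¹ := by
        rw [hq, Real.exp_neg]
        exact inv_anti₀ (by positivity) (by linarith [Real.add_one_le_exp (1 / T)])
      refine h1.trans ?_
      rw [inv_le_iff_one_le_mul₀ (by positivity)]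
      field_simp
      nlinarith
    have hT2 : 0 < 1 / (2 * T) := by positivity
    have hterm : ∀ f : ℕ, p (cross (fun i => (μ i : ℚ)) i j (f + 1))
        * (1 ^ 2 * (x j / x i) ^ (f + 1)) ≤ 4 * (1 / T) ^ 2 * (((f : ℝ) + 1) * q ^ f) := by
      intro f
      have h1 := tnorm_real_cross_succ_le (N + ∑ i ∈ S, μ i) hu (fun i => (μ i : ℚ)) i j
        (by positivity) (by positivity) (b := 1 / T) (by push_cast; exact hw i)
        (by push_cast; exact hw j) hT1 f
      have h2 : (x j / x i) ^ (f + 1) ≤ Real.exp (-(2 / T)) ^ f * 1 := by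
        rw [pow_succ]
        refine mul_le_mul (pow_le_pow_left₀ hxx0 hxx f) (hxx.trans ?_) hxx0 (by positivity)
        rw [Real.exp_le_one_iff, neg_nonpos]
        positivity
      rw [one_pow, one_mul]
      refine (mul_le_mul h1 h2 (pow_nonneg hxx0 _) (by positivity)).trans (le_of_eq ?_)
      have e : q = Real.exp (1 / T) * Real.exp (-(2 / T)) := by
        rw [hq, ← Real.exp_add]; congr 1; ring
      rw [e, mul_pow]
      ring
    rw [sum_range_succ']
    have h00 : p (cross (fun i => (μ i : ℚ)) i j 0) = 1 := tnorm_one hu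
    rw [h00, show (1 : ℝ) * (1 ^ 2 * (x j / x i) ^ 0) = 1 by norm_num]
    have h5 : ((1 - q)⁻¹) ^ 2 ≤ (2 * T) ^ 2 := by
      have : 0 < 1 - q := by linarith
      refine pow_le_pow_left₀ (by positivity) ?_ 2
      rw [inv_le_comm₀ this (by positivity), ← one_div]
      linarith
    have h6 := sum_succ_mul_pow_le (Real.exp_pos _).le (show q < 1 by linarith) (∑ i ∈ S, μ i)
    calc _ ≤ 4 * (1 / T) ^ 2 * (2 * T) ^ 2 + 1 := by
          refine add_le_add ((sum_le_sum fun f _ => hterm f).trans ?_) le_rfl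
          rw [← mul_sum]
          exact mul_le_mul_of_nonneg_left (h6.trans h5) (by positivity)
      _ = 17 := by field_simp; norm_num
  have key := seminorm_nest_le p (tnorm_one hu).le (cross fun i => (μ i : ℚ))
    (fun i => expCoeff (svar (μ i))) (∑ i ∈ S, μ i) (fun _ => 1) rfl (fun _ => one_pos)
    (fun _ _ => by norm_num) (fun _ => rfl) x A hx0 hA0 17 (by norm_num) S.nodup_toList
    (fun i j => rfl) ht hcr (fun i => (μ i : ℤ))
  rw [nest_expCoeff_eq μ h0, hp, tnorm_C_mul, length_toList] at key
  set a : ℚ := ∏ i ∈ S, (μ i : ℚ) ^ μ i / (μ i).factorial with ha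
  have ha0 : 0 < a := prod_pos fun i _ => by have := h0 i; positivity
  have hva : (vR a : ℝ) = ∏ i ∈ S, (μ i : ℝ) ^ μ i / (μ i).factorial := by
    rw [Rat.AbsoluteValue.real_eq_abs, abs_of_pos ha0, ha]
    push_cast
    rfl
  have hprod : (S.toList.map fun i => A i * (1 * x i ^ (-(μ i : ℤ)))).prod
      ≤ K ^ n * (u ^ (∑ i ∈ S, μ i) * vR a) := by
    rw [prod_map_toList]
    refine (prod_le_prod (fun i _ => ?_) fun i _ => ?_).trans
      (b := ∏ i ∈ S, (K * (u ^ μ i * ((μ i : ℝ) ^ μ i / (μ i).factorial)))) ?_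
    · exact mul_nonneg (hA0 i) (mul_nonneg one_pos.le (zpow_nonneg (hx0 i).le _))
    · rw [one_mul]; exact hA2 i
    · clear_value K
      rw [prod_mul_distrib, prod_mul_distrib, prod_const,
        prod_pow_eq_pow_sum, hva]
      have hnn : 0 ≤ ∏ i ∈ S, (μ i : ℝ) ^ μ i / (μ i).factorial :=
        prod_nonneg fun i _ => by positivity
      gcongr
  set H := (∏ i ∈ S, sinhc (μ i)) * nmom μ S with hH
  have hfin : tnorm vR N u hu H ≤ 17 ^ (n * n) * K ^ n := by
    have hva0 : 0 < vR a := AbsoluteValue.pos _ ha0.ne'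
    have h1 := mul_le_mul_of_nonneg_left (tnorm_X_pow_mul vR N hu (∑ i ∈ S, μ i) H) hva0.le
    have h2 : (17 : ℝ) ^ (n * S.card) ≤ 17 ^ (n * n) :=
      pow_le_pow_right₀ (by norm_num) (Nat.mul_le_mul_left n hSn)
    have h3 := h1.trans (key.trans (mul_le_mul h2 hprod (by
      rw [prod_map_toList]
      exact prod_nonneg fun i _ =>
        mul_nonneg (hA0 i) (mul_nonneg one_pos.le (zpow_nonneg (hx0 i).le _))) (by positivity)))
    have h4 : 0 < u ^ (∑ i ∈ S, μ i) * vR a := by positivity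
    refine le_of_mul_le_mul_left (le_trans (le_of_eq ?_) (h3.trans (le_of_eq ?_))) h4
    · ring
    · ring
  refine (seminorm_le_of_prod_mul (tnorm vR N u hu) S (fun i => sinhc (μ i)) (fun i _ => ?_)
    (nmom μ S)).trans ?_
  · have h1 := tnorm_real_sinhc_sub_one_le N hu (q := (μ i : ℚ)) (by positivity)
      (w := u * μ i) (by push_cast; rfl) ((hw i).trans hT1)
    have h2 : u * (μ i : ℝ) ≤ 1 := (hw i).trans hT1
    have h3 : 0 ≤ u * (μ i : ℝ) := by positivity
    nlinarith
  · gcongr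
    norm_num

lemma cumulantGrowth (L : ℕ) : CumulantGrowth ι (2 * L) (3 * L) := by
  obtain ⟨C, hC, h⟩ := exists_tnorm_nmom_le (ι := ι) (2 * L)
  obtain ⟨K, hK, hk⟩ := exists_seminorm_cumulant_le (R := ℚ⟦X⟧) (ι := ι) hC
    (Fintype.card ι)
  refine ⟨K, fun M μ h0 hM => ?_⟩
  rcases isEmpty_or_nonempty ι with hι | ⟨⟨i₀⟩⟩
  · rw [univ_eq_empty, cumulant_empty, map_zero, Rat.cast_zero, abs_zero]
    positivity
  have hM1 : (1 : ℝ) ≤ M := by exact_mod_cast (h0 i₀).trans_le (hM i₀)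
  set T := √(M : ℝ) with hT
  have hT2 : T ^ 2 = M := Real.sq_sqrt (by positivity)
  have hT1 : 1 ≤ T := Real.one_le_sqrt.2 hM1
  have hu : 0 ≤ (T ^ 3)⁻¹ := by positivity
  have h1 := hk (tnorm vR (2 * L) _ hu) 1 (nmom μ) zero_le_one (nmom_empty μ)
    (fun S => by
      rw [one_pow, mul_one]
      exact h T _ hu μ hT1 rfl h0 (fun i => by rw [hT2]; exact_mod_cast hM i) S)
    univ (card_univ).le
  have h2 := (coeff_le_tnorm (v := vR) hu (cumulant (nmom μ) univ) le_rfl).trans h1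
  have e : ((T ^ 3)⁻¹) ^ (2 * L) = ((M : ℝ) ^ (3 * L))⁻¹ := by
    rw [inv_pow, ← hT2]; ring
  rw [e, one_pow, mul_one, ← div_eq_mul_inv, div_le_iff₀ (by positivity),
    Rat.AbsoluteValue.real_eq_abs, Rat.cast_abs] at h2
  exact h2

end Growth

section TwoAdic

open PowerSeries

/-- The `2`-adic absolute value. -/
def v2 : AbsoluteValue ℚ ℝ := Rat.AbsoluteValue.padic 2

lemma v2_apply (q : ℚ) : v2 q = (padicNorm 2 q : ℚ) := Rat.AbsoluteValue.padic_eq_padicNorm 2 q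

lemma v2_add_le (a b : ℚ) : v2 (a + b) ≤ max (v2 a) (v2 b) := by
  rw [v2_apply, v2_apply, v2_apply]
  exact_mod_cast padicNorm.nonarchimedean

lemma v2_int_le (z : ℤ) : v2 z ≤ 1 := Rat.AbsoluteValue.padic_le_one 2 z

lemma v2_nat_le (m : ℕ) : v2 m ≤ 1 := by exact_mod_cast v2_int_le m

lemma v2_two : v2 2 = 1 / 2 := by
  have h := padicNorm.padicNorm_p_of_prime (p := 2)
  rw [v2_apply]
  rw [Nat.cast_ofNat] at h
  rw [h]
  norm_num

lemma v2_inv_nat {m : ℕ} (hm : m ≠ 0) : v2 (m : ℚ)⁻¹ = 2 ^ padicValNat 2 m := by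
  rw [map_inv₀, v2_apply, padicNorm.eq_zpow_of_nonzero (by exact_mod_cast hm),
    padicValRat.of_nat, zpow_neg, zpow_natCast]
  push_cast
  rw [inv_inv]

lemma le_padicValNat_two_factorial (a s : ℕ) :
    2 ^ a * s ≤ padicValNat 2 (2 ^ a * s).factorial + s := by
  induction a with
  | zero => simp
  | succ a ih =>
    have h := padicValNat_factorial_mul (p := 2) (2 ^ a * s)
    rw [pow_succ', mul_assoc, h]
    omega

lemma v2_inv_factorial_le (m : ℕ) : v2 (m.factorial : ℚ)⁻¹ ≤ 2 ^ m := by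
  rw [v2_inv_nat m.factorial_ne_zero]
  exact pow_le_pow_right₀ one_le_two (padicValNat_factorial_le 2 m)

lemma v2_factorial_div_le (a s e : ℕ) :
    v2 (((2 ^ a * s).factorial : ℚ) / (2 ^ a * s + e).factorial) ≤ 2 ^ (s + e) := by
  set m := 2 ^ a * s with hm
  rw [div_eq_mul_inv, map_mul, v2_inv_nat (Nat.factorial_ne_zero _), ← inv_inv (m.factorial : ℚ),
    map_inv₀, v2_inv_nat (Nat.factorial_ne_zero _), inv_mul_le_iff₀ (by positivity), ← pow_add]
  refine pow_le_pow_right₀ one_le_two ?_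
  have h1 := le_padicValNat_two_factorial a s
  have h2 := padicValNat_factorial_le 2 (m + e)
  rw [← hm] at h1
  omega

/-- The subring of power series whose coefficients grow `2`-adically at most as `4 ^ j`. -/
def geomSubring : Subring ℚ⟦X⟧ where
  carrier := {φ | ∀ j, v2 (coeff j φ) ≤ 4 ^ j}
  mul_mem' {φ ψ} hφ hψ j := by
    rw [coeff_mul]
    refine sum_induction _ (fun q => v2 q ≤ 4 ^ j)
      (fun a b ha hb => (v2_add_le a b).trans (max_le ha hb)) (by simp) fun x hx => ?_
    rw [map_mul, ← mem_antidiagonal.1 hx, pow_add]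
    exact mul_le_mul (hφ _) (hψ _) (apply_nonneg _ _) (by positivity)
  one_mem' j := by
    rw [coeff_one]
    split_ifs with h
    · simp [h]
    · simp
  add_mem' {φ ψ} hφ hψ j := by
    rw [map_add]
    exact (v2_add_le _ _).trans (max_le (hφ j) (hψ j))
  zero_mem' j := by simp
  neg_mem' {φ} hφ j := by
    rw [map_neg, AbsoluteValue.map_neg]
    exact hφ j

lemma mem_geomSubring {φ : ℚ⟦X⟧} :
    φ ∈ geomSubring ↔ ∀ j, v2 (coeff j φ) ≤ 4 ^ j := Iff.rfl

lemma C_mem_geomSubring {q : ℚ} (h : v2 q ≤ 1) : C q ∈ geomSubring := fun j => by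
  rw [coeff_C]
  split_ifs with hj
  · simpa [hj] using h
  · simp

lemma X_mem_geomSubring : (X : ℚ⟦X⟧) ∈ geomSubring := fun j => by
  rw [coeff_X]
  split_ifs with hj
  · simp [hj]
  · simp

lemma mem_geomSubring_of_mul_eq_one {φ ψ : ℚ⟦X⟧} (hφ : φ ∈ geomSubring)
    (h1 : constantCoeff φ = 1) (h : φ * ψ = 1) : ψ ∈ geomSubring := fun j => by
  induction j using Nat.strong_induction_on with
  | _ j ih =>
    have e : ψ = 1 - (φ - 1) * ψ := by rw [sub_mul, h]; ring
    rw [e, map_sub, coeff_mul, sub_eq_add_neg]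
    refine (v2_add_le _ _).trans (max_le (geomSubring.one_mem j) ?_)
    rw [AbsoluteValue.map_neg]
    refine sum_induction _ (fun q => v2 q ≤ 4 ^ j)
      (fun a b ha hb => (v2_add_le a b).trans (max_le ha hb)) (by simp) fun x hx => ?_
    have hx' := mem_antidiagonal.1 hx
    rcases Nat.eq_zero_or_pos x.1 with h0 | h0
    · rw [h0, map_sub, coeff_zero_eq_constantCoeff_apply, h1]
      simp
    · rw [map_mul, ← hx', pow_add]
      exact mul_le_mul (geomSubring.sub_mem hφ geomSubring.one_mem _) (ih _ (by omega))
        (apply_nonneg _ _) (by positivity)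

lemma zpow_mem_geomSubring {φ : ℚ⟦X⟧ˣ} (hφ : (φ : ℚ⟦X⟧) ∈ geomSubring)
    (h1 : constantCoeff (φ : ℚ⟦X⟧) = 1) (k : ℤ) :
    ((φ ^ k : ℚ⟦X⟧ˣ) : ℚ⟦X⟧) ∈ geomSubring := by
  obtain ⟨k, rfl | rfl⟩ := k.eq_nat_or_neg
  · rw [zpow_natCast, Units.val_pow_eq_pow_val]
    exact pow_mem hφ k
  · rw [zpow_neg, zpow_natCast, ← inv_pow, Units.val_pow_eq_pow_val]
    exact pow_mem (mem_geomSubring_of_mul_eq_one hφ h1 φ.mul_inv) k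

lemma ex_mem_geomSubring {q : ℚ} (h : v2 q ≤ 2) : ex q ∈ geomSubring := fun j => by
  rw [coeff_ex, div_eq_mul_inv, map_mul, map_pow, show (4 : ℝ) = 2 * 2 by norm_num, mul_pow]
  exact mul_le_mul (pow_le_pow_left₀ (apply_nonneg _ _) h j) (v2_inv_factorial_le j)
    (apply_nonneg _ _) (by positivity)

lemma v2_div_two_le {q : ℚ} (h : v2 q ≤ 1) : v2 (q / 2) ≤ 2 := by
  rw [map_div₀, v2_two]
  linarith

lemma svar_mem_geomSubring {q : ℚ} (h : v2 q ≤ 1) : svar q ∈ geomSubring := by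
  refine geomSubring.sub_mem (ex_mem_geomSubring (v2_div_two_le h)) (ex_mem_geomSubring ?_)
  rw [AbsoluteValue.map_neg]
  exact v2_div_two_le h

lemma sinhc_mem_geomSubring {q : ℚ} (h : v2 q ≤ 1) : sinhc q ∈ geomSubring := fun j => by
  rw [coeff_sinhc]
  split_ifs with hj
  · rw [div_eq_mul_inv, mul_inv, map_mul, map_mul, map_pow, map_inv₀, map_pow, v2_two,
      v2_inv_nat (Nat.factorial_ne_zero _)]
    have h1 := pow_le_one₀ (n := j) (apply_nonneg v2 q) h
    have h2 : (2 : ℝ) ^ padicValNat 2 (j + 1).factorial ≤ 2 ^ j :=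
      pow_le_pow_right₀ one_le_two (Nat.lt_succ_iff.1 (padicValNat_factorial_lt_of_ne_zero 2 j.succ_ne_zero))
    calc _ ≤ 1 * (((1 / 2 : ℝ) ^ j)⁻¹ * 2 ^ j) := by gcongr
      _ = 4 ^ j := by
        rw [one_mul, ← inv_pow, ← mul_pow]; norm_num
  · simp

lemma cross_mem_geomSubring {ι : Type*} {σ : ι → ℚ} {i j : ι}
    (hi : v2 (σ i) ≤ 1) (hj : v2 (σ j) ≤ 1) (f : ℕ) : cross σ i j f ∈ geomSubring := by
  cases f with
  | zero => exact geomSubring.one_mem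
  | succ f =>
    rw [cross, crossCoeff, sg_expU, sg_expU]
    simp only [Int.cast_one, one_mul]
    refine mul_mem (mul_mem (svar_mem_geomSubring hi) (svar_mem_geomSubring hj))
      (sum_mem fun x _ => ?_)
    rw [expU_mul, expU_zpow, val_expU]
    refine ex_mem_geomSubring ?_
    rw [← add_div, mul_div_assoc', map_div₀, map_mul, v2_two]
    have h1 := v2_int_le ((x.1 : ℤ) - x.2)
    have h2 := (v2_add_le (σ i) (σ j)).trans (max_le hi hj)
    have h3 := mul_le_mul h1 h2 (apply_nonneg _ _) zero_le_one
    linarith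

lemma eZ_eq {q : ℚ} (h : q ≠ 0) (k : ℤ) : eZ q k
    = C (q ^ k) * ((sinhcU q ^ k : ℚ⟦X⟧ˣ) : ℚ⟦X⟧) := by
  rw [eZ, eU, dif_pos h, mul_zpow, Units.val_mul, ← map_zpow]
  congr 1
  rw [Units.coe_map, Units.val_zpow_eq_zpow_val, Units.val_mk0]
  rfl

lemma sinhcU_zpow_mem {q : ℚ} (h : v2 q ≤ 1) (k : ℤ) :
    ((sinhcU q ^ k : ℚ⟦X⟧ˣ) : ℚ⟦X⟧) ∈ geomSubring :=
  zpow_mem_geomSubring (sinhc_mem_geomSubring h) (constantCoeff_sinhc q) k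

/-- The truncated norm attached to the `2`-adic absolute value. -/
def pn (N : ℕ) : RingSeminorm ℚ⟦X⟧ := tnorm v2 N 1 zero_le_one

lemma pn_C_mul (N : ℕ) (q : ℚ) (φ : ℚ⟦X⟧) :
    pn N (C q * φ) = v2 q * pn N φ := tnorm_C_mul _ _ _ _ _

lemma pn_one (N : ℕ) : pn N 1 = 1 := tnorm_one _

/-- The bound of the truncated norm on `geomSubring`. -/
def geomBound (N : ℕ) : ℝ := ∑ j ∈ range (N + 1), 4 ^ j

lemma one_le_geomBound (N : ℕ) : 1 ≤ geomBound N := by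
  rw [geomBound, sum_range_succ', pow_zero]
  have : (0 : ℝ) ≤ ∑ k ∈ range N, 4 ^ (k + 1) := sum_nonneg fun _ _ => by positivity
  linarith

lemma pn_le_geomBound (N : ℕ) {φ : ℚ⟦X⟧} (h : φ ∈ geomSubring) : pn N φ ≤ geomBound N := by
  rw [pn, tnorm_apply]
  refine sum_le_sum fun j _ => ?_
  rw [one_pow, mul_one]
  exact h j

end TwoAdic

section ZeroSite

open MvPolynomial

variable {ι K : Type*} [Fintype ι] [DecidableEq ι] [CommRing K] [Algebra ℚ K]

lemma vertexList_congr {e e' : ι → ℕ → K} {c c' : ι → ℤ} {l : List ι} (he : ∀ i ∈ l, e i = e' i)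
    (hc : ∀ i ∈ l, c i = c' i) : vertexList e c l = vertexList e' c' l := by
  induction l with
  | nil => rfl
  | cons i l ih =>
    rw [vertexList, vertexList, he i (by simp), hc i (by simp),
      ih (fun j hj => he j (mem_cons_of_mem _ hj))
        fun j hj => hc j (mem_cons_of_mem _ hj)]

/-- The vertex operators of the momenta `a i`. -/
def sgList (a : ι → Kˣ) (c : ι → ℤ) (l : List ι) : Fock K :=
  vertexList (fun i k => sg (a i) k) c l

lemma sgList_cons (a : ι → Kˣ) (c : ι → ℤ) (i : ι) (l : List ι) :
    sgList a c (i :: l) = vertex (fun k => sg (a i) k) (c i) (sgList a c l) := rfl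

lemma sgList_update (a : ι → Kˣ) (c : ι → ℤ) {i : ι} {l : List ι} (hi : i ∉ l) (b : Kˣ) :
    sgList (update a i b) c l = sgList a c l :=
  vertexList_congr (fun j hj => by
    rw [update_of_ne (by rintro rfl; exact hi hj)]) fun _ _ => rfl

lemma vertex_sum_map (e : ℕ → K) (s : ℤ) (lam : ι → K) (F : ι → Fock K) (l : List ι) :
    vertex e s (l.map fun j => C (lam j) * F j).sum
      = (l.map fun j => C (lam j) * vertex e s (F j)).sum := by
  induction l with
  | nil => simp
  | cons i l ih =>
    rw [map_cons, map_cons, sum_cons, sum_cons, map_add, ih, vertex_C_mul]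

lemma vertex_zero_sgList [IsDomain K] (a : ι → Kˣ) (b : Kˣ) (lam : ι → K) (c : ι → ℤ)
    {l : List ι} (hl : l.Nodup)
    (h : ∀ j ∈ l, sg (b * a j) 1 * lam j = sg b 1 * sg (a j) 1 * sg b (c j))
    (hne : ∀ j ∈ l, sg (b * a j) 1 ≠ 0) :
    vertex (fun k => sg b k) 0 (sgList a c l) = sgList a c l
      + (l.map fun j => C (lam j) * sgList (update a j (b * a j)) c l).sum := by
  induction l with
  | nil => simp [sgList, vertexList, vertex_one]
  | cons j l ih =>
    rw [nodup_cons] at hl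
    have ih' := ih hl.2 (fun i hi => h i (mem_cons_of_mem _ hi))
      fun i hi => hne i (mem_cons_of_mem _ hi)
    have key : vertex (fun k => sg b k) 0 (vertex (fun k => sg (a j) k) (c j) (sgList a c l))
        - vertex (fun k => sg (a j) k) (c j) (vertex (fun k => sg b k) 0 (sgList a c l))
        = C (lam j) * vertex (fun k => sg (b * a j) k) (c j) (sgList a c l) := by
      have h0 : (C (sg (b * a j) 1) : Fock K) ≠ 0 := by
        rw [Ne, map_eq_zero_iff _ (C_injective _ _)]
        exact hne j (by simp)
      refine mul_left_cancel₀ h0 ?_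
      rw [vertex_comm, ← mul_assoc, ← map_mul, h j (by simp), zero_add]
      congr 3
      simp [commCoeff, sg]
    rw [sgList_cons, eq_add_of_sub_eq key, ih', map_add, vertex_sum_map, map_cons,
      sum_cons, sgList_cons, update_self, sgList_update a c hl.1]
    have e : (l.map fun i => C (lam i) * vertex (fun k => sg (a j) k) (c j)
        (sgList (update a i (b * a i)) c l))
        = l.map fun i => C (lam i) * sgList (update a i (b * a i)) c (j :: l) := by
      refine List.map_congr_left fun i hi => ?_
      rw [sgList_cons, update_of_ne (by rintro rfl; exact hl.1 hi)]
    rw [e]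
    ring

lemma sgList_zero_site [IsDomain K] (a : ι → Kˣ) (lam : ι → K) (c : ι → ℤ) {i : ι}
    (hci : c i = 0) {l₁ l₂ : List ι} (hl : (l₁ ++ i :: l₂).Nodup)
    (h : ∀ j ∈ l₂, sg (a i * a j) 1 * lam j = sg (a i) 1 * sg (a j) 1 * sg (a i) (c j))
    (hne : ∀ j ∈ l₂, sg (a i * a j) 1 ≠ 0) :
    sgList a c (l₁ ++ i :: l₂) = sgList a c (l₁ ++ l₂)
      + (l₂.map fun j => C (lam j)
        * sgList (update a j (a i * a j)) c (l₁ ++ l₂)).sum := by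
  induction l₁ with
  | nil =>
    rw [List.nil_append, List.nil_append, sgList_cons, hci]
    rw [List.nil_append, nodup_cons] at hl
    rw [vertex_zero_sgList a (a i) lam c hl.2 h hne]
  | cons j l₁ ih =>
    rw [List.cons_append, nodup_cons] at hl
    rw [List.cons_append, List.cons_append, sgList_cons, ih hl.2, map_add, vertex_sum_map,
      sgList_cons]
    refine congrArg (_ + ·) (congrArg List.sum (List.map_congr_left fun k hk => ?_))
    rw [sgList_cons, update_of_ne]
    rintro rfl
    exact hl.1 (by simp [hk])

end ZeroSite

section OrderedMoment

open PowerSeries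

variable {n : ℕ}

/-- The increasing enumeration of a set of sites. -/
def siteList (S : Finset (Fin n)) : List (Fin n) := (List.finRange n).filter (· ∈ S)

lemma nodup_siteList (S : Finset (Fin n)) : (siteList S).Nodup := (List.nodup_finRange n).filter _

lemma mem_siteList {S : Finset (Fin n)} {i : Fin n} : i ∈ siteList S ↔ i ∈ S := by
  simp [siteList]

lemma toFinset_siteList (S : Finset (Fin n)) : (siteList S).toFinset = S := by
  ext i; rw [List.mem_toFinset, mem_siteList]

lemma pairwise_siteList (S : Finset (Fin n)) : (siteList S).Pairwise (· < ·) :=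
  (List.pairwise_lt_finRange n).filter _

lemma length_siteList (S : Finset (Fin n)) : (siteList S).length = S.card := by
  rw [← List.toFinset_card_of_nodup (nodup_siteList S), toFinset_siteList]

lemma prod_map_siteList {R : Type*} [CommMonoid R] (S : Finset (Fin n)) (F : Fin n → R) :
    ((siteList S).map F).prod = ∏ i ∈ S, F i := by
  rw [← List.prod_toFinset F (nodup_siteList S), toFinset_siteList]

lemma sum_map_siteList {R : Type*} [AddCommMonoid R] (S : Finset (Fin n)) (F : Fin n → R) :
    ((siteList S).map F).sum = ∑ i ∈ S, F i := by
  rw [← sum_toFinset F (nodup_siteList S), toFinset_siteList]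

lemma siteList_split {S : Finset (Fin n)} {r : Fin n} (hr : r ∈ S) : ∃ l₁ l₂,
    siteList S = l₁ ++ r :: l₂ ∧ siteList (S.erase r) = l₁ ++ l₂ ∧ l₂.Nodup ∧
      l₂.toFinset = (S.erase r).filter (r < ·) := by
  obtain ⟨l₁, l₂, h⟩ := List.append_of_mem (mem_siteList.2 hr)
  have hp := pairwise_siteList S
  have hn := nodup_siteList S
  rw [h, List.pairwise_append, List.pairwise_cons] at hp
  have h1 : r ∉ l₁ := fun hh => lt_irrefl r (hp.2.2 r hh r (by simp))
  have h2 : r ∉ l₂ := fun hh => lt_irrefl r (hp.2.1.1 r hh)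
  refine ⟨l₁, l₂, h, ?_, ?_, ?_⟩
  · have e : siteList (S.erase r) = (siteList S).filter (· ≠ r) := by
      rw [siteList, siteList, List.filter_filter]
      refine List.filter_congr fun i _ => ?_
      simp
    rw [e, h, List.filter_append, List.filter_cons_of_neg (by simp),
      List.filter_eq_self.2 fun i hi => by simpa using fun hh : i = r => h1 (hh ▸ hi),
      List.filter_eq_self.2 fun i hi => by simpa using fun hh : i = r => h2 (hh ▸ hi)]
  · rw [h] at hn
    exact ((List.nodup_append.1 hn).2.1).of_cons
  · ext j
    rw [List.mem_toFinset, mem_filter, mem_erase, ← mem_siteList, h,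
      List.mem_append, List.mem_cons]
    constructor
    · intro hj
      have := hp.2.1.1 j hj
      exact ⟨⟨this.ne', Or.inr (Or.inr hj)⟩, this⟩
    · rintro ⟨⟨hne, hj | hj | hj⟩, hlt⟩
      · exact absurd (hp.2.2 j hj r (by simp)) hlt.asymm
      · exact absurd hj hne
      · exact hj

/-- The normalized moments for the increasing ordering of the sites. -/
def ordMom (B : ℕ) (σ : Fin n → ℚ) (t : Fin n → ℤ → ℚ⟦X⟧)
    (S : Finset (Fin n)) : ℚ⟦X⟧ := nest (cross σ) t B (siteList S) 0

lemma ordMom_empty (B : ℕ) (σ : Fin n → ℚ) (t : Fin n → ℤ → ℚ⟦X⟧) :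
    ordMom B σ t ∅ = 1 := by
  rw [ordMom, List.eq_nil_iff_forall_not_mem.2 fun i hi => absurd (mem_siteList.1 hi) (by simp),
    nest]

lemma ordMom_congr {B : ℕ} {σ σ' : Fin n → ℚ} {t t' : Fin n → ℤ → ℚ⟦X⟧}
    {S : Finset (Fin n)} (hσ : ∀ i ∈ S, σ i = σ' i) (ht : ∀ i ∈ S, t i = t' i) :
    ordMom B σ t S = ordMom B σ' t' S := by
  rw [ordMom, ordMom]
  apply nest_congr
  · exact fun i j => rfl
  · intro i hi j hj
    rw [cross, cross, hσ i (mem_siteList.1 hi), hσ j (mem_siteList.1 hj)]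
  · exact fun i hi => ht i (mem_siteList.1 hi)
  · exact fun _ _ => rfl

/-- The family of coefficients entering the normalized moments. -/
def momFam (σ : Fin n → ℚ) (μ : Fin n → ℕ) (i : Fin n) : ℤ → ℚ⟦X⟧ :=
  momCoeff (σ i) (μ i)

/-- The expectation of the product of the vertex operators. -/
def sgExp (σ : Fin n → ℚ) (μ : Fin n → ℕ) (l : List (Fin n)) : ℚ⟦X⟧ :=
  levelOne (sgList (fun i => expU (σ i / 2)) (fun i => (μ i : ℤ)) l)

/-- The normalization factor of a site. -/
def siteFactor (σ : Fin n → ℚ) (μ : Fin n → ℕ) (i : Fin n) : ℚ⟦X⟧ :=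
  C ((μ i).factorial : ℚ)⁻¹ * eZ (σ i) (μ i)

lemma siteFactor_ne_zero (σ : Fin n → ℚ) (μ : Fin n → ℕ) (i : Fin n) : siteFactor σ μ i ≠ 0 := by
  refine mul_ne_zero ?_ (eZ_ne_zero _ _)
  rw [Ne, map_eq_zero_iff _ C_injective]
  positivity

lemma sgExp_siteList {B : ℕ} {σ : Fin n → ℚ} {μ : Fin n → ℕ} (hσ : ∀ i, σ i ≠ 0)
    (hB : ∑ i, μ i ≤ B) (S : Finset (Fin n)) : sgExp σ μ (siteList S)
      = (∏ i ∈ S, siteFactor σ μ i)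
        * (X ^ (∑ i ∈ S, μ i) * ordMom B σ (momFam σ μ) S) := by
  have hS : ((siteList S).map μ).sum ≤ B := by
    rw [sum_map_siteList]
    exact (sum_le_sum_of_subset (subset_univ S)).trans hB
  have h := nest_expCoeff σ μ B (nodup_siteList S) (fun i _ => hσ i) 0
  simp only [Pi.zero_apply, add_zero] at h
  rw [sgExp, sgList, levelOne_vertexList _ (nodup_siteList S) (B := B)]
  · simp only [sg_expU, Int.cast_one, one_mul]
    rw [prod_map_siteList, sum_map_siteList, ← Nat.cast_sum, Int.toNat_natCast] at h
    exact h
  · intro s hs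
    exact suffixBound_natCast μ hS s (hs.trans (List.tail_suffix _))

/-- The coefficients of the expansion of the moments at a site of order zero. -/
def zeroCoeff (σ : Fin n → ℚ) (μ : Fin n → ℕ) (r j : Fin n) : ℚ⟦X⟧ :=
  if r < j then X * eZ (σ r) 1 * eZ (σ j) 1 * svar (μ j * σ r) * eZ (σ r + σ j) (-1)
    * (eZ (σ r + σ j) (μ j) * eZ (σ j) (-(μ j))) else 0

lemma ordMom_zero_site {B : ℕ} {σ : Fin n → ℚ} {μ : Fin n → ℕ} (hσ : ∀ i, σ i ≠ 0)
    (hB : ∑ i, μ i ≤ B) {S : Finset (Fin n)} {r : Fin n} (hr : r ∈ S) (hμ : μ r = 0)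
    (hσr : ∀ j, r < j → σ r + σ j ≠ 0) :
    ordMom B σ (momFam σ μ) S = ordMom B σ (momFam σ μ) (S.erase r)
      + ∑ j ∈ S.erase r, zeroCoeff σ μ r j
        * ordMom B (update σ j (σ r + σ j))
          (momFam (update σ j (σ r + σ j)) μ) (S.erase r) := by
  obtain ⟨l₁, l₂, h1, h2, h3, h4⟩ := siteList_split hr
  have hlt : ∀ j ∈ l₂, r < j := fun j hj => by
    have := List.mem_toFinset.2 hj
    rw [h4, mem_filter] at this
    exact this.2
  set lam : Fin n → ℚ⟦X⟧ := fun j =>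
    X * eZ (σ r) 1 * eZ (σ j) 1 * svar (μ j * σ r) * eZ (σ r + σ j) (-1) with hlam
  have hsum : ∀ j, expU (σ r / 2) * expU (σ j / 2) = expU ((σ r + σ j) / 2) := fun j => by
    rw [expU_mul]; congr 1; ring
  have key := sgList_zero_site (fun i => expU (σ i / 2)) lam (fun i => (μ i : ℤ)) (i := r)
    (by rw [hμ]; rfl) (l₁ := l₁) (l₂ := l₂) (h1 ▸ nodup_siteList S) (fun j hj => by
      rw [hsum, sg_expU, sg_expU, sg_expU, sg_expU, Int.cast_one, one_mul, one_mul, one_mul,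
        svar_eq_eZ (hσr j (hlt j hj)), svar_eq_eZ (hσ r), svar_eq_eZ (hσ j), hlam]
      have := eZ_add (σ r + σ j) 1 (-1)
      rw [add_neg_cancel, eZ_zero] at this
      push_cast
      linear_combination (-(X * eZ (σ r) 1 * (X * eZ (σ j) 1)
        * svar (μ j * σ r))) * this) (fun j hj => by
      rw [hsum, sg_expU, Int.cast_one, one_mul, svar_eq_eZ (hσr j (hlt j hj))]
      exact mul_ne_zero X_ne_zero (eZ_ne_zero _ _))
  have hupd : ∀ j, update (fun i => expU (σ i / 2)) j (expU (σ r / 2) * expU (σ j / 2))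
      = fun i => expU (update σ j (σ r + σ j) i / 2) := fun j => by
    funext i
    rcases eq_or_ne i j with rfl | hij
    · rw [update_self, update_self, hsum]
    · rw [update_of_ne hij, update_of_ne hij]
  simp only [hupd] at key
  rw [← h1, ← h2] at key
  have key2 := congrArg (levelOne (K := ℚ⟦X⟧)) key
  rw [map_add, map_list_sum, List.map_map, ← sum_toFinset _ h3, h4, sum_filter] at key2
  simp only [Function.comp_apply, map_mul, levelOne_C] at key2
  change sgExp σ μ _ = sgExp σ μ _ + ∑ j ∈ S.erase r, (if r < j then lam j
    * sgExp (update σ j (σ r + σ j)) μ _ else 0) at key2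
  have hr0 : siteFactor σ μ r = 1 := by simp [siteFactor, hμ, eZ_zero]
  have hm : ∑ i ∈ S, μ i = ∑ i ∈ S.erase r, μ i := by
    rw [← add_sum_erase S _ hr, hμ, zero_add]
  rw [sgExp_siteList hσ hB, sgExp_siteList hσ hB, ← mul_prod_erase S _ hr, hr0, one_mul,
    hm] at key2
  set P := ∏ i ∈ S.erase r, siteFactor σ μ i with hP
  set E := ∑ i ∈ S.erase r, μ i with hE
  have hne : P * X ^ E ≠ 0 :=
    mul_ne_zero (prod_ne_zero_iff.2 fun i _ => siteFactor_ne_zero σ μ i)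
      (pow_ne_zero _ X_ne_zero)
  refine mul_left_cancel₀ hne ?_
  rw [mul_assoc, key2, mul_add, mul_sum, mul_assoc]
  congr 1
  refine sum_congr rfl fun j hj => ?_
  rw [zeroCoeff]
  split_ifs with hrj
  · have hσ' : ∀ i, update σ j (σ r + σ j) i ≠ 0 := fun i => by
      rcases eq_or_ne i j with rfl | hij
      · rw [update_self]; exact hσr i hrj
      · rw [update_of_ne hij]; exact hσ i
    rw [sgExp_siteList hσ' hB, ← mul_prod_erase _ _ hj, hP, ← mul_prod_erase _ _ hj,
      prod_congr rfl fun i hi => show siteFactor (update σ j (σ r + σ j)) μ i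
        = siteFactor σ μ i by
          rw [siteFactor, siteFactor, update_of_ne (ne_of_mem_erase hi)],
      siteFactor, siteFactor, update_self]
    have := eZ_add (σ j) (μ j) (-(μ j))
    rw [add_neg_cancel, eZ_zero] at this
    rw [← hE, hlam]
    linear_combination (X * eZ (σ r) 1 * eZ (σ j) 1 * svar (μ j * σ r)
      * eZ (σ r + σ j) (-1) * (C ((μ j).factorial : ℚ)⁻¹ * eZ (σ r + σ j) (μ j)
      * (∏ i ∈ (S.erase r).erase j, siteFactor σ μ i) * (X ^ E
      * ordMom B (update σ j (σ r + σ j))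
          (momFam (update σ j (σ r + σ j)) μ) (S.erase r)))) * this
  · rw [zero_mul, mul_zero]

end OrderedMoment

section Difference

open PowerSeries

/-- The rational factor of `momCoeff`. -/
def momRat (m : ℕ) (κ : ℤ) : ℚ :=
  if 0 ≤ m + κ then (m.factorial : ℚ) / (m + κ).toNat.factorial else 0

lemma momCoeff_eq (σ : ℚ) (m : ℕ) (κ : ℤ) :
    momCoeff σ m κ = C (momRat m κ) * eZ σ κ := by
  rw [momCoeff, momRat]
  split_ifs <;> simp

lemma exists_ascFactorial_eq (m e : ℕ) : ∃ z, (m + 1).ascFactorial e = e.factorial + m * z := by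
  induction e with
  | zero => exact ⟨0, by simp⟩
  | succ e ih =>
    obtain ⟨z, hz⟩ := ih
    refine ⟨(m + 1 + e) * z + e.factorial, ?_⟩
    rw [Nat.ascFactorial_succ, hz, Nat.factorial_succ]
    ring

lemma v2_momRat_sub_le (a s : ℕ) (κ : ℤ) :
    v2 (momRat (2 ^ a * s) κ - momRat 0 κ) ≤ v2 ((2 ^ a * s : ℕ) : ℚ) * 2 ^ s * 4 ^ κ.natAbs := by
  have hfac := v2_factorial_div_le a s
  set m := 2 ^ a * s with hm
  have hone : ∀ k : ℕ, (1 : ℝ) ≤ 2 ^ s * 4 ^ k := fun k =>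
    one_le_mul_of_one_le_of_one_le (one_le_pow₀ one_le_two) (one_le_pow₀ (by norm_num))
  obtain ⟨e, rfl | rfl⟩ := κ.eq_nat_or_neg
  · obtain ⟨z, hz⟩ := exists_ascFactorial_eq m e
    have h := Nat.factorial_mul_ascFactorial m e
    rw [hz] at h
    have hq : ((m + e).factorial : ℚ) = m.factorial * (e.factorial + m * z) := by
      rw [← h]; push_cast; ring
    have e1 : momRat m e - momRat 0 e
        = -(((m.factorial : ℚ) / (m + e).factorial) * (e.factorial : ℚ)⁻¹ * (m * z)) := by
      rw [momRat, momRat, if_pos (by positivity), if_pos (by simp), ← Nat.cast_add,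
        Int.toNat_natCast]
      simp only [Nat.cast_zero, zero_add, Int.toNat_natCast, Nat.factorial_zero, Nat.cast_one]
      have h1 : (m.factorial : ℚ) ≠ 0 := by positivity
      have h2 : (e.factorial : ℚ) ≠ 0 := by positivity
      have h3 : (e.factorial + m * z : ℚ) ≠ 0 := by positivity
      rw [hq]
      field_simp
      ring
    rw [e1, AbsoluteValue.map_neg, map_mul, map_mul, map_mul, Int.natAbs_natCast]
    have h1 := hfac e
    have h2 := v2_inv_factorial_le e
    have h3 := v2_nat_le z
    calc _ ≤ 2 ^ (s + e) * 2 ^ e * (v2 m * 1) := by gcongr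
      _ = v2 m * 2 ^ s * 4 ^ e := by
        rw [show (4 : ℝ) = 2 * 2 by norm_num, mul_pow]; ring
  · rw [Int.natAbs_neg, Int.natAbs_natCast, mul_assoc]
    have hm0 : 0 ≤ v2 (m : ℚ) := apply_nonneg _ _
    rcases e with _ | e
    · have e1 : momRat m (-((0 : ℕ) : ℤ)) - momRat 0 (-((0 : ℕ) : ℤ)) = 0 := by
        have : (m.factorial : ℚ) ≠ 0 := by positivity
        simp [momRat, this]
      rw [e1, map_zero]
      positivity
    · have e0 : momRat 0 (-((e + 1 : ℕ) : ℤ)) = 0 := by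
        rw [momRat, if_neg (by push_cast; omega)]
      rw [e0, sub_zero, momRat]
      split_ifs with h
      · obtain ⟨k, hk⟩ : ∃ k, m = k + 1 := ⟨m - 1, by omega⟩
        have h1 := Nat.factorial_mul_descFactorial (show e + 1 ≤ m by omega)
        rw [show ((m : ℤ) + -((e + 1 : ℕ) : ℤ)).toNat = m - (e + 1) by omega, ← h1]
        have h2 : m.descFactorial (e + 1) = m * k.descFactorial e := by
          rw [hk, Nat.succ_descFactorial_succ]
        rw [h2]
        have h3 : ((m - (e + 1)).factorial : ℚ) ≠ 0 := by positivity
        push_cast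
        rw [mul_div_cancel_left₀ _ h3, map_mul]
        exact mul_le_mul_of_nonneg_left ((v2_nat_le _).trans (hone _)) hm0
      · rw [map_zero]
        positivity

lemma pn_momCoeff_sub_le (N : ℕ) {σ : ℚ} (h0 : σ ≠ 0) (h1 : v2 σ ≤ 1) (a s : ℕ) (κ : ℤ) :
    pn N (momCoeff σ (2 ^ a * s) κ - momCoeff σ 0 κ)
      ≤ (v2 ((2 ^ a * s : ℕ) : ℚ) * 2 ^ s * geomBound N) * (4 ^ κ.natAbs * (v2 σ)⁻¹ ^ (-κ)) := by
  rw [momCoeff_eq, momCoeff_eq, ← sub_mul, ← map_sub, eZ_eq h0, pn_C_mul, pn_C_mul, map_zpow₀,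
    inv_zpow, zpow_neg, inv_inv]
  have h2 := v2_momRat_sub_le a s κ
  have h3 := pn_le_geomBound N (sinhcU_zpow_mem h1 κ)
  have h4 : 0 ≤ v2 σ ^ κ := zpow_nonneg (apply_nonneg _ _) _
  calc _ ≤ (v2 ((2 ^ a * s : ℕ) : ℚ) * 2 ^ s * 4 ^ κ.natAbs) * (v2 σ ^ κ * geomBound N) := by
        refine mul_le_mul h2 (mul_le_mul_of_nonneg_left h3 h4)
          (mul_nonneg h4 (apply_nonneg _ _)) ?_
        have := apply_nonneg v2 ((2 ^ a * s : ℕ) : ℚ)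
        positivity
    _ = _ := by ring

variable {n : ℕ}

/-- The condition that the `2`-adic absolute values of the momenta increase rapidly. -/
structure Gapped (σ : Fin n → ℚ) : Prop where
  ne_zero : ∀ i, σ i ≠ 0
  le_one : ∀ i, v2 (σ i) ≤ 1
  gap : ∀ i j, i < j → v2 (σ i) ≤ v2 (σ j) / 64

lemma Gapped.pos {σ : Fin n → ℚ} (h : Gapped σ) (i : Fin n) : 0 < v2 (σ i) :=
  AbsoluteValue.pos _ (h.ne_zero i)

lemma Gapped.add_eq {σ : Fin n → ℚ} (h : Gapped σ) {r j : Fin n} (hrj : r < j) :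
    v2 (σ r + σ j) = v2 (σ j) := by
  have h1 := h.gap r j hrj
  have h2 := h.pos j
  have h3 : v2 (σ r) < v2 (σ j) := by linarith
  rw [v2_apply, v2_apply] at h3
  have h4 := padicNorm.add_eq_max_of_ne (p := 2) (q := σ r) (r := σ j) (by
    intro hh; rw [hh] at h3; exact lt_irrefl _ h3)
  rw [v2_apply, v2_apply, h4, max_eq_right]
  exact_mod_cast h3.le

lemma Gapped.add_ne_zero {σ : Fin n → ℚ} (h : Gapped σ) {r j : Fin n} (hrj : r < j) :
    σ r + σ j ≠ 0 := by
  intro hh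
  have := h.add_eq hrj
  rw [hh, map_zero] at this
  exact (h.pos j).ne this

lemma Gapped.update {σ : Fin n → ℚ} (h : Gapped σ) {r j : Fin n} (hrj : r < j) :
    Gapped (Function.update σ j (σ r + σ j)) := by
  have hv : ∀ i, v2 (Function.update σ j (σ r + σ j) i) = v2 (σ i) := fun i => by
    rcases eq_or_ne i j with rfl | hij
    · rw [Function.update_self, h.add_eq hrj]
    · rw [Function.update_of_ne hij]
  refine ⟨fun i => ?_, fun i => ?_, fun i k hik => ?_⟩
  · rw [← AbsoluteValue.ne_zero_iff v2, hv]
    exact (h.pos i).ne'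
  · rw [hv]; exact h.le_one i
  · rw [hv, hv]; exact h.gap i k hik

lemma eZ_mul_mem {q : ℚ} (h0 : q ≠ 0) (h1 : v2 q ≤ 1) (k : ℤ) :
    ∃ φ ∈ geomSubring, eZ q k = C (q ^ k) * φ :=
  ⟨_, sinhcU_zpow_mem h1 k, eZ_eq h0 k⟩

lemma pn_zeroCoeff_le (N : ℕ) {σ : Fin n → ℚ} (h : Gapped σ) (μ : Fin n → ℕ) (r j : Fin n) :
    pn N (zeroCoeff σ μ r j) ≤ v2 (μ j : ℚ) * geomBound N := by
  have hg := (zero_le_one.trans (one_le_geomBound N))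
  have hμ0 : 0 ≤ v2 (μ j : ℚ) := apply_nonneg _ _
  rw [zeroCoeff]
  split_ifs with hrj
  · have hs0 := h.add_ne_zero hrj
    have hs1 : v2 (σ r + σ j) ≤ 1 := by rw [h.add_eq hrj]; exact h.le_one j
    obtain ⟨φ₁, m1, e1⟩ := eZ_mul_mem (h.ne_zero r) (h.le_one r) 1
    obtain ⟨φ₂, m2, e2⟩ := eZ_mul_mem (h.ne_zero j) (h.le_one j) 1
    obtain ⟨φ₃, m3, e3⟩ := eZ_mul_mem hs0 hs1 (-1)
    obtain ⟨φ₄, m4, e4⟩ := eZ_mul_mem hs0 hs1 (μ j)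
    obtain ⟨φ₅, m5, e5⟩ := eZ_mul_mem (h.ne_zero j) (h.le_one j) (-(μ j))
    have h6 : v2 ((μ j : ℚ) * σ r) ≤ 1 := by
      rw [map_mul]
      exact mul_le_one₀ (v2_nat_le _) (apply_nonneg _ _) (h.le_one r)
    have m6 := sinhc_mem_geomSubring h6
    have e : X * eZ (σ r) 1 * eZ (σ j) 1 * svar (μ j * σ r) * eZ (σ r + σ j) (-1)
        * (eZ (σ r + σ j) (μ j) * eZ (σ j) (-(μ j)))
        = C (σ r ^ (1 : ℤ) * σ j ^ (1 : ℤ) * (σ r + σ j) ^ (-1 : ℤ)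
            * ((σ r + σ j) ^ (μ j : ℤ) * σ j ^ (-(μ j : ℤ))) * (μ j * σ r))
          * (X * φ₁ * φ₂ * (X * sinhc (μ j * σ r)) * φ₃ * (φ₄ * φ₅)) := by
      rw [e1, e2, e3, e4, e5, svar_eq]
      simp only [map_mul]
      ring
    rw [e, pn_C_mul]
    refine mul_le_mul ?_ (pn_le_geomBound N ?_) (apply_nonneg _ _) hμ0
    · simp only [map_mul, map_zpow₀, h.add_eq hrj]
      have hj := (h.pos j).ne'
      have hr := h.le_one r
      have hr0 := h.pos r
      rw [zpow_neg_one, mul_assoc _ (v2 (σ j) ^ (1 : ℤ)), zpow_one, zpow_one,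
        mul_inv_cancel₀ hj, mul_one, ← zpow_add₀ hj, add_neg_cancel, zpow_zero, mul_one]
      calc v2 (σ r) * (v2 (μ j : ℚ) * v2 (σ r)) ≤ 1 * (v2 (μ j : ℚ) * 1) := by gcongr
        _ = _ := by ring
    · exact mul_mem (mul_mem (mul_mem (mul_mem (mul_mem X_mem_geomSubring m1) m2)
        (mul_mem X_mem_geomSubring m6)) m3) (mul_mem m4 m5)
  · rw [map_zero]
    positivity

lemma pn_ordMom_sub_le (N : ℕ) {σ : Fin n → ℚ} (h : Gapped σ) (B a : ℕ) {A : ℝ} (hA : 0 ≤ A)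
    (s : Fin n → ℕ) (hs : ∀ i, 2 ^ s i ≤ A) (S : Finset (Fin n)) :
    pn N (ordMom B σ (momFam σ (fun i => 2 ^ a * s i) - momFam σ 0) S)
      ≤ (2 * geomBound N) ^ (n * n) * ((A * geomBound N) ^ S.card * ((1 / 2) ^ a) ^ S.card) := by
  have hg := one_le_geomBound N
  have key := seminorm_nest_le (pn N) (pn_one N).le (cross σ)
    (momFam σ (fun i => 2 ^ a * s i) - momFam σ 0) B (fun κ => 4 ^ κ.natAbs) (by simp)
    (fun _ => by positivity) (fun k l => by
      rw [← pow_add]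
      exact pow_le_pow_right₀ (by norm_num) (Int.natAbs_add_le k l))
    (fun k => by rw [Int.natAbs_neg]) (fun i => (v2 (σ i))⁻¹)
    (fun i => v2 ((2 ^ a * s i : ℕ) : ℚ) * 2 ^ s i * geomBound N)
    (fun i => inv_pos.2 (h.pos i))
    (fun i => by have := apply_nonneg v2 ((2 ^ a * s i : ℕ) : ℚ); positivity)
    (2 * geomBound N) (by linarith) (nodup_siteList S) (fun i j => rfl)
    (fun i _ κ => pn_momCoeff_sub_le N (h.ne_zero i) (h.le_one i) a (s i) κ) ?_ 0
  · rw [← ordMom, prod_map_siteList, length_siteList, Fintype.card_fin] at key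
    refine key.trans ?_
    have hS : S.card ≤ n := by simpa using card_le_univ S
    have h2 : (2 * geomBound N) ^ (n * S.card) ≤ (2 * geomBound N) ^ (n * n) :=
      pow_le_pow_right₀ (by linarith) (Nat.mul_le_mul_left n hS)
    refine mul_le_mul h2 ?_ (prod_nonneg fun i _ => ?_) (by positivity)
    · rw [← mul_pow, ← prod_const]
      refine prod_le_prod (fun i _ => ?_) fun i _ => ?_
      · have := apply_nonneg v2 ((2 ^ a * s i : ℕ) : ℚ)
        simp only [Pi.zero_apply, neg_zero, zpow_zero]
        positivity
      · simp only [Pi.zero_apply, neg_zero, zpow_zero, Int.natAbs_zero, pow_zero, mul_one]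
        have h3 : v2 ((2 ^ a * s i : ℕ) : ℚ) ≤ (1 / 2) ^ a := by
          push_cast
          rw [map_mul, map_pow, v2_two]
          exact mul_le_of_le_one_right (by positivity) (v2_nat_le _)
        calc _ ≤ (1 / 2) ^ a * A * geomBound N := by
              have := hs i
              gcongr
          _ = _ := by ring
    · have := apply_nonneg v2 ((2 ^ a * s i : ℕ) : ℚ)
      simp only [Pi.zero_apply, neg_zero, zpow_zero]
      positivity
  · refine (pairwise_siteList S).imp fun {i j} hij => ?_
    have hterm : ∀ f ∈ range (B + 1), pn N (cross σ i j f)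
        * ((4 ^ (f : ℤ).natAbs) ^ 2 * ((v2 (σ j))⁻¹ / (v2 (σ i))⁻¹) ^ f)
        ≤ geomBound N * (1 / 4) ^ f := by
      intro f _
      have h1 := pn_le_geomBound N (cross_mem_geomSubring (h.le_one i) (h.le_one j) f)
      have hi := h.pos i
      have hj := h.pos j
      have h2 : (v2 (σ j))⁻¹ / (v2 (σ i))⁻¹ ≤ 1 / 64 := by
        rw [inv_div_inv, div_le_iff₀ hj]
        linarith [h.gap i j hij]
      rw [Int.natAbs_natCast]
      calc _ ≤ geomBound N * ((4 ^ f) ^ 2 * (1 / 64) ^ f) := by gcongr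
        _ = geomBound N * (1 / 4) ^ f := by
          rw [← pow_mul, mul_comm f 2, pow_mul, ← mul_pow]; norm_num
    refine (sum_le_sum hterm).trans ?_
    rw [← mul_sum, mul_comm]
    refine mul_le_mul_of_nonneg_right ?_ (by linarith)
    rw [geom_sum_eq (by norm_num)]
    have : (0 : ℝ) ≤ (1 / 4) ^ (B + 1) := by positivity
    rw [div_le_iff_of_neg (by norm_num)]
    linarith

end Difference

lemma nest_update_sub {ι R : Type*} [Fintype ι] [DecidableEq ι] [CommRing R]
    (cr : ι → ι → ℕ → R) (z : ι → ℤ → R) (B : ℕ) {l : List ι} (hl : l.Nodup) {i : ι} (hi : i ∈ l)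
    (u v : ℤ → R) (c : ι → ℤ) :
    nest cr (update z i (u - v)) B l c
      = nest cr (update z i u) B l c - nest cr (update z i v) B l c := by
  induction l generalizing c with
  | nil => simp at hi
  | cons j l ih =>
    rw [nodup_cons] at hl
    rw [nest, nest, nest, ← sum_sub_distrib]
    refine sum_congr rfl fun f _ => ?_
    rcases eq_or_ne j i with rfl | hne
    · have e : ∀ w w' : ℤ → R, ∀ c', nest cr (update z j w) B l c'
          = nest cr (update z j w') B l c' := fun w w' c' =>
        nest_congr B (fun _ _ => rfl) (fun _ _ _ _ => rfl) (fun m hm => by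
          have hmj : m ≠ j := fun h => hl.1 (h ▸ hm)
          rw [update_of_ne hmj, update_of_ne hmj]) fun _ _ => rfl
      rw [update_self, update_self, update_self, e (u - v) u, e v u,
        Pi.sub_apply]
      ring
    · rw [update_of_ne hne, update_of_ne hne, update_of_ne hne,
        ih hl.2 ((List.mem_cons.1 hi).resolve_left hne.symm)]
      ring

section Decay

variable {n : ℕ}

lemma cumulant_ordMom_update_sub (B : ℕ) (σ : Fin n → ℚ) (z : Fin n → ℤ → ℚ⟦X⟧)
    {T : Finset (Fin n)} {i : Fin n} (hi : i ∈ T) (u v : ℤ → ℚ⟦X⟧) :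
    cumulant (ordMom B σ (update z i (u - v))) T
      = cumulant (ordMom B σ (update z i u)) T
        - cumulant (ordMom B σ (update z i v)) T := by
  have e : ∀ w w' : ℤ → ℚ⟦X⟧, ∀ S ⊆ T, i ∉ S → ordMom B σ (update z i w) S
      = ordMom B σ (update z i w') S := fun w w' S _ hS =>
    ordMom_congr (fun _ _ => rfl) fun m hm => by
      have hmi : m ≠ i := fun h => hS (h ▸ hm)
      rw [update_of_ne hmi, update_of_ne hmi]
  refine cumulant_sub _ _ _ (ordMom_empty _ _ _) (ordMom_empty _ _ _) (ordMom_empty _ _ _) i T hi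
    (fun S _ hiS => ?_) (e _ _) (e _ _)
  exact nest_update_sub _ _ _ (nodup_siteList S) (mem_siteList.2 hiS) _ _ _

lemma ordMom_singleton (B : ℕ) (σ : Fin n → ℚ) (μ : Fin n → ℕ) (r : Fin n) :
    ordMom B σ (momFam σ μ) {r} = 1 := by
  have h : siteList {r} = [r] := by
    have h1 := length_siteList {r}
    rw [card_singleton, List.length_eq_one_iff] at h1
    obtain ⟨x, hx⟩ := h1
    have : x ∈ siteList {r} := by rw [hx]; simp
    rw [mem_siteList, mem_singleton] at this
    rw [hx, this]
  have hb : box ([] : List (Fin n)) B = {0} := by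
    ext f
    simp [box, funext_iff]
  have hc : ∀ i j, cross σ i j 0 = 1 := fun i j => rfl
  have hm : ((μ r).factorial : ℚ) ≠ 0 := by positivity
  rw [ordMom, h, nest, hb, sum_singleton, nest]
  simp [hc, momFam, momCoeff, hm, eZ_zero]

lemma cumulant_ordMom_zero_site {B : ℕ} {σ : Fin n → ℚ} {μ : Fin n → ℕ} (h : Gapped σ)
    (hB : ∑ i, μ i ≤ B) {T : Finset (Fin n)} {r : Fin n} (hr : r ∈ T) (hμ : μ r = 0)
    (hT : T ≠ {r}) :
    cumulant (ordMom B σ (momFam σ μ)) T = ∑ j ∈ T.erase r, zeroCoeff σ μ r j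
      * cumulant (ordMom B (update σ j (σ r + σ j))
          (momFam (update σ j (σ r + σ j)) μ)) (T.erase r) := by
  refine cumulant_of_reduction _ (fun j => ordMom B (update σ j (σ r + σ j))
    (momFam (update σ j (σ r + σ j)) μ)) (ordMom_empty _ _ _)
    (fun j => ordMom_empty _ _ _) r _ hr
    (fun S _ hrS => ordMom_zero_site h.ne_zero hB hrS hμ fun j hj => h.add_ne_zero hj)
    (fun j S _ _ hjS => ?_) hT
  have hne : ∀ i ∈ S, i ≠ j := fun i hi h' => hjS (h' ▸ hi)
  refine ordMom_congr (fun i hi => update_of_ne (hne i hi) _ _) fun i hi => ?_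
  rw [momFam, momFam, update_of_ne (hne i hi)]

lemma exists_pn_cumulant_ordMom_le (n N : ℕ) {A : ℝ} (hA : 1 ≤ A) (k : ℕ) :
    ∃ C : ℝ, 0 ≤ C ∧ ∀ (a B : ℕ) (σ : Fin n → ℚ) (s : Fin n → ℕ) (T : Finset (Fin n)), Gapped σ →
      (∀ i, 2 ^ s i ≤ A) → ∑ i, 2 ^ a * s i ≤ B → T.card = k + 1 →
      pn N (cumulant (ordMom B σ (momFam σ fun i => 2 ^ a * s i)) T) ≤ C * ((1 / 2) ^ a) ^ k := by
  have hG := one_le_geomBound N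
  induction k with
  | zero =>
    refine ⟨pn N 1, apply_nonneg _ _, fun a B σ s T _ _ _ hT => ?_⟩
    obtain ⟨r, rfl⟩ := card_eq_one.1 hT
    have h := moment_eq_sum (ordMom B σ (momFam σ fun i => 2 ^ a * s i)) (ordMom_empty _ _ _)
      (mem_singleton_self r)
    have h2 : rooted r {r} = {{r}} := by
      ext S
      rw [mem_rooted, mem_singleton, subset_singleton_iff]
      constructor
      · rintro ⟨rfl | rfl, h'⟩
        · simp at h'
        · rfl
      · rintro rfl
        simp
    rw [h2, sum_singleton, Finset.sdiff_self, ordMom_empty, mul_one,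
      ordMom_singleton] at h
    rw [← h, pow_zero, mul_one]
  | succ k ih =>
    obtain ⟨C, hC, ih⟩ := ih
    obtain ⟨K, hK, hcum⟩ := exists_seminorm_cumulant_le (R := ℚ⟦X⟧) (ι := Fin n)
      (C := (2 * geomBound N) ^ (n * n) * (A * geomBound N) ^ n) (by positivity) n
    refine ⟨K + 2 ^ n * (n * (geomBound N * C)), by positivity,
      fun a B σ s T hσ hs hB hT => ?_⟩
    have hρ0 : (0 : ℝ) ≤ (1 / 2) ^ a := by positivity
    have hρ1 : ((1 : ℝ) / 2) ^ a ≤ 1 := pow_le_one₀ (by norm_num) (by norm_num)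
    set x := momFam σ fun i => 2 ^ a * s i with hx
    set y := momFam σ 0 with hy
    have key := sum_powerset_piecewise (fun t => cumulant (ordMom B σ t) T) x y T
      fun i hi z => cumulant_ordMom_update_sub B σ z hi _ _
    have hfirst : pn N (cumulant (ordMom B σ (T.piecewise (x - y) x)) T)
        ≤ K * ((1 / 2) ^ a) ^ (k + 1) := by
      rw [cumulant_congr _ (ordMom B σ (x - y)) (ordMom_empty _ _ _) fun S hS =>
        ordMom_congr (fun _ _ => rfl) fun i hi => piecewise_eq_of_mem _ _ _ (hS hi)]
      refine (hcum (pn N) ((1 / 2) ^ a) _ hρ0 (ordMom_empty _ _ _) (fun S => ?_) T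
        (by simpa using card_le_univ T)).trans ?_
      · refine (pn_ordMom_sub_le N hσ B a (by linarith) s hs S).trans ?_
        rw [mul_assoc]
        have h1 : (1 : ℝ) ≤ A * geomBound N := one_le_mul_of_one_le_of_one_le hA hG
        have hS : S.card ≤ n := by simpa using card_le_univ S
        gcongr
      · rw [hT, pow_succ _ (k + 1)]
        have : ((1 / 2 : ℝ) ^ a) ^ (k + 1) * (1 / 2) ^ a ≤ ((1 / 2) ^ a) ^ (k + 1) :=
          mul_le_of_le_one_right (by positivity) hρ1
        gcongr
    have hrest : ∀ Z ∈ T.powerset.erase ∅,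
        pn N ((-1 : ℤ) ^ Z.card • cumulant (ordMom B σ (Z.piecewise y x)) T)
          ≤ n * (geomBound N * C) * ((1 / 2) ^ a) ^ (k + 1) := by
      intro Z hZ
      rw [mem_erase, mem_powerset] at hZ
      obtain ⟨r, hr⟩ := nonempty_iff_ne_empty.2 hZ.1
      set s' : Fin n → ℕ := Z.piecewise 0 s with hs'
      have hle : ∀ i, s' i ≤ s i := fun i => by
        by_cases hi : i ∈ Z
        · rw [hs', piecewise_eq_of_mem _ _ _ hi]; exact Nat.zero_le _
        · rw [hs', piecewise_eq_of_notMem _ _ _ hi]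
      have hfam : Z.piecewise y x = momFam σ fun i => 2 ^ a * s' i := by
        funext i
        by_cases hi : i ∈ Z
        · rw [piecewise_eq_of_mem _ _ _ hi, momFam, hs',
            piecewise_eq_of_mem _ _ _ hi, hy, momFam, Pi.zero_apply, mul_zero]
        · rw [piecewise_eq_of_notMem _ _ _ hi, momFam, hs',
            piecewise_eq_of_notMem _ _ _ hi, hx, momFam]
      have hB' : ∑ i, 2 ^ a * s' i ≤ B :=
        (sum_le_sum fun i _ => Nat.mul_le_mul_left _ (hle i)).trans hB
      have hA' : ∀ i, (2 : ℝ) ^ s' i ≤ A := fun i =>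
        (pow_le_pow_right₀ one_le_two (hle i)).trans (hs i)
      have hsign : pn N ((-1 : ℤ) ^ Z.card • cumulant (ordMom B σ (Z.piecewise y x)) T)
          = pn N (cumulant (ordMom B σ (Z.piecewise y x)) T) := by
        rcases neg_one_pow_eq_or ℤ Z.card with h | h <;> rw [h]
        · rw [one_smul]
        · rw [neg_smul, one_smul, map_neg_eq_map]
      have hrT := hZ.2 hr
      have hcard : (T.erase r).card = k + 1 := by rw [card_erase_of_mem hrT, hT]; rfl
      rw [hsign, hfam, cumulant_ordMom_zero_site hσ hB' hrT
        (by rw [hs', piecewise_eq_of_mem _ _ _ hr]; rfl)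
        (fun h => by rw [h, card_singleton] at hT; omega)]
      refine (seminorm_sum_le _ _ _).trans ?_
      have hterm : ∀ j ∈ T.erase r, pn N (zeroCoeff σ (fun i => 2 ^ a * s' i) r j
          * cumulant (ordMom B (update σ j (σ r + σ j))
            (momFam (update σ j (σ r + σ j)) fun i => 2 ^ a * s' i)) (T.erase r))
          ≤ geomBound N * C * ((1 / 2) ^ a) ^ (k + 1) := by
        intro j _
        by_cases hrj : r < j
        · refine (map_mul_le_mul _ _ _).trans ?_
          have h1 := pn_zeroCoeff_le N hσ (fun i => 2 ^ a * s' i) r j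
          have h2 := ih a B _ s' (T.erase r) (hσ.update hrj) hA' hB' hcard
          have h3 : v2 ((2 ^ a * s' j : ℕ) : ℚ) ≤ (1 / 2) ^ a := by
            push_cast
            rw [map_mul, map_pow, v2_two]
            exact mul_le_of_le_one_right (by positivity) (v2_nat_le _)
          calc _ ≤ ((1 / 2) ^ a * geomBound N) * (C * ((1 / 2) ^ a) ^ k) :=
                mul_le_mul (h1.trans (mul_le_mul_of_nonneg_right h3 (by linarith))) h2
                  (apply_nonneg _ _) (by positivity)
            _ = _ := by rw [pow_succ]; ring
        · rw [zeroCoeff, if_neg hrj, zero_mul, map_zero]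
          positivity
      refine (sum_le_sum hterm).trans ?_
      rw [sum_const, nsmul_eq_mul, mul_assoc (n : ℝ)]
      have : ((T.erase r).card : ℝ) ≤ n := by
        exact_mod_cast (by simpa using card_le_univ (T.erase r))
      gcongr
    have hsplit : cumulant (ordMom B σ x) T
        = cumulant (ordMom B σ (T.piecewise (x - y) x)) T
          - ∑ Z ∈ T.powerset.erase ∅,
            (-1 : ℤ) ^ Z.card • cumulant (ordMom B σ (Z.piecewise y x)) T := by
      rw [← add_sum_erase _ _ (empty_mem_powerset T)] at key
      simp only [card_empty, pow_zero, one_smul, piecewise_empty] at key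
      rw [key]
      abel
    rw [hsplit]
    refine (map_sub_le_add _ _ _).trans ?_
    rw [add_mul]
    refine add_le_add hfirst ?_
    refine ((seminorm_sum_le _ _ _).trans (sum_le_sum hrest)).trans ?_
    rw [sum_const, nsmul_eq_mul, mul_assoc (2 ^ n : ℝ)]
    refine mul_le_mul_of_nonneg_right ?_ (by positivity)
    have h1 : (T.powerset.erase ∅).card ≤ 2 ^ n := by
      refine (card_erase_le).trans ?_
      rw [card_powerset]
      exact Nat.pow_le_pow_right two_pos (by simpa using card_le_univ T)
    exact_mod_cast h1

end Decay

section Rescale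

open PowerSeries

variable (c : ℚ)

lemma rescale_ex (q : ℚ) : rescale c (ex q) = ex (c * q) := by
  rw [ex, ex, rescale_rescale, mul_comm]

lemma rescale_sinhc (q : ℚ) : rescale c (sinhc q) = sinhc (c * q) := by
  ext j
  rw [coeff_rescale, coeff_sinhc, coeff_sinhc]
  split_ifs
  · rw [mul_pow, mul_div_assoc]
  · rw [mul_zero]

lemma rescale_C (q : ℚ) : rescale c (C q) = C q := by
  ext j
  rw [coeff_rescale, coeff_C]
  split_ifs with h
  · rw [h, pow_zero, one_mul]
  · rw [mul_zero]

lemma rescale_expU (q : ℚ) :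
    Units.map (rescale c).toMonoidHom (expU q) = expU (c * q) :=
  Units.ext (rescale_ex c q)

lemma rescale_sinhcU (q : ℚ) :
    Units.map (rescale c).toMonoidHom (sinhcU q) = sinhcU (c * q) :=
  Units.ext (rescale_sinhc c q)

lemma rescale_cross {ι : Type*} (σ : ι → ℚ) (i j : ι) (f : ℕ) :
    rescale c (cross σ i j f) = cross (fun i => c * σ i) i j f := by
  cases f with
  | zero => exact map_one _
  | succ f =>
    rw [cross, cross, crossCoeff, crossCoeff, map_mul, map_mul, map_sum]
    simp only [sg_expU, expU_mul, expU_zpow, val_expU, svar, map_sub, rescale_ex]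
    congr 1
    · congr 1 <;> congr 2 <;> ring
    · refine sum_congr rfl fun x _ => ?_
      congr 1
      ring

lemma momCoeff_mul (hc : c ≠ 0) {q : ℚ} (hq : q ≠ 0) (m : ℕ) (κ : ℤ) :
    momCoeff (c * q) m κ
      = C (c ^ κ) * rescale c (momCoeff q m κ) := by
  have h : rescale c ((sinhcU q ^ κ : ℚ⟦X⟧ˣ) : ℚ⟦X⟧)
      = ((sinhcU (c * q) ^ κ : ℚ⟦X⟧ˣ) : ℚ⟦X⟧) := by
    rw [← rescale_sinhcU, ← map_zpow]
    rfl
  rw [momCoeff_eq, momCoeff_eq, eZ_eq (mul_ne_zero hc hq), eZ_eq hq, map_mul, map_mul, rescale_C,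
    rescale_C, h, mul_zpow, map_mul]
  ring

variable {n : ℕ}

lemma ordMom_mul (hc : c ≠ 0) (B : ℕ) {σ : Fin n → ℚ} (hσ : ∀ i, σ i ≠ 0) (μ : Fin n → ℕ)
    (S : Finset (Fin n)) :
    ordMom B (fun i => c * σ i) (momFam (fun i => c * σ i) μ) S
      = rescale c (ordMom B σ (momFam σ μ) S) := by
  set y : ℚ⟦X⟧ˣ :=
    Units.map (C (R := ℚ)).toMonoidHom (Units.mk0 c hc) with hy
  have hyk : ∀ k : ℤ, ((y ^ k : ℚ⟦X⟧ˣ) : ℚ⟦X⟧) = C (c ^ k) :=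
    fun k => by
      rw [hy, ← map_zpow, Units.coe_map, Units.val_zpow_eq_zpow_val, Units.val_mk0]
      rfl
  rw [ordMom, ordMom, map_nest]
  have h := nest_scale (cross fun i => c * σ i)
    (fun i k => rescale c (momFam σ μ i k)) (momFam (fun i => c * σ i) μ) B
    (nodup_siteList S) (fun _ => 1) y (fun i _ k => by
      rw [momFam, momFam, momCoeff_mul c hc (hσ i), one_mul, hyk]) 0
  have hz : ((siteList S).map (0 : Fin n → ℤ)).sum = 0 := List.sum_map_zero
  rw [h, hz, zpow_zero, Units.val_one, mul_one, List.map_const', List.prod_replicate, one_pow,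
    one_mul]
  exact nest_congr B (fun i j => (rescale_cross c σ i j 0).symm)
    (fun i _ j _ => funext fun f => (rescale_cross c σ i j f).symm) (fun _ _ => rfl)
    fun _ _ => rfl

lemma mom_eq_ordMom {μ : Fin n → ℕ} (h0 : ∀ i, 0 < μ i) {B : ℕ} (hB : ∑ i, μ i ≤ B)
    (S : Finset (Fin n)) :
    mom μ S = ordMom B (fun i => (μ i : ℚ)) (momFam (fun i => (μ i : ℚ)) μ) S := by
  have hS : ((siteList S).map μ).sum ≤ B := by
    rw [sum_map_siteList]
    exact (sum_le_sum_of_subset (subset_univ S)).trans hB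
  have h := nestMom_eq_mom μ (nodup_siteList S) (fun i _ => h0 i) (B := B) fun s hs =>
    suffixBound_natCast μ hS s (hs.trans (List.tail_suffix _))
  rw [toFinset_siteList] at h
  exact h.symm

lemma map_cumulant {ι R R' : Type*} [DecidableEq ι] [CommRing R] [CommRing R'] (φ : R →+* R')
    (M : Finset ι → R) (h0 : M ∅ = 1) (T : Finset ι) :
    cumulant (fun S => φ (M S)) T = φ (cumulant M T) := by
  rcases T.eq_empty_or_nonempty with rfl | ⟨r, hr⟩
  · rw [cumulant_empty, cumulant_empty, map_zero]
  refine cumulant_unique _ (fun B => φ (cumulant M B)) (by simp [h0]) r (fun S _ hrS => ?_) hr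
  simp only [moment_eq_sum M h0 hrS, map_sum, map_mul]

lemma cumulantDecay_of_gapped (N : ℕ) (hn : 1 ≤ n) (s : Fin n → ℕ) (h0 : ∀ i, 0 < s i)
    (hs : Gapped fun i => (s i : ℚ)) : CumulantDecay (Fin n) v2 2 N (N + n - 1) s := by
  obtain ⟨C, hC, h⟩ := exists_pn_cumulant_ordMom_le n N (A := 2 ^ ∑ i, s i)
    (one_le_pow₀ one_le_two) (n - 1)
  refine ⟨geomBound N * C, fun a => ?_⟩
  have h2a : ((2 : ℚ) ^ a) ≠ 0 := by positivity
  set μ : Fin n → ℕ := fun i => 2 ^ a * s i with hμ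
  have hμ0 : ∀ i, 0 < μ i := fun i => Nat.mul_pos (by positivity) (h0 i)
  have hcast : (fun i => (μ i : ℚ)) = fun i => 2 ^ a * (s i : ℚ) := by
    funext i
    rw [hμ]
    push_cast
    rfl
  set M := ordMom (∑ i, μ i) (fun i => (s i : ℚ)) (momFam (fun i => (s i : ℚ)) μ) with hM
  have hM0 : M ∅ = 1 := ordMom_empty _ _ _
  have e1 : ∀ S, mom μ S = rescale (2 ^ a : ℚ) (M S) := fun S => by
    rw [mom_eq_ordMom hμ0 le_rfl, hcast, ordMom_mul _ h2a _ hs.ne_zero]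
  have e2 : cumulant (nmom μ) univ = rescale (2 ^ a : ℚ)
      ((∏ i, sinhc (s i) ^ (μ i - 1)) * cumulant M univ) := by
    rw [cumulant_scale (mom μ) (nmom μ) (mom_empty μ) (fun i => sinhc (μ i) ^ (μ i - 1))
      (fun S => rfl), cumulant_congr _ _ (mom_empty μ) fun S _ => e1 S,
      map_cumulant _ _ hM0, map_mul, map_prod]
    congr 1
    refine prod_congr rfl fun i _ => ?_
    rw [map_pow, rescale_sinhc, ← congrFun hcast i]
  have h1 := h a (∑ i, μ i) _ s univ hs (fun i =>
    pow_le_pow_right₀ one_le_two (single_le_sum (fun _ _ => Nat.zero_le _)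
      (mem_univ i))) le_rfl (by rw [card_univ, Fintype.card_fin]; omega)
  rw [← hμ, ← hM] at h1
  have hmem : (∏ i, sinhc (s i) ^ (μ i - 1)) ∈ geomSubring :=
    prod_mem fun i _ => pow_mem (sinhc_mem_geomSubring (hs.le_one i)) _
  have h3 := coeff_le_tnorm (v := v2) (r := 1) zero_le_one
    ((∏ i, sinhc (s i) ^ (μ i - 1)) * cumulant M univ) (le_refl N)
  rw [one_pow, mul_one, ← pn] at h3
  have h4 := h3.trans ((map_mul_le_mul _ _ _).trans
    (mul_le_mul (pn_le_geomBound N hmem) h1 (apply_nonneg _ _)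
      (zero_le_one.trans (one_le_geomBound N))))
  rw [e2, coeff_rescale, map_mul, map_pow, map_pow, Nat.cast_ofNat, map_pow, v2_two,
    show N + n - 1 = N + (n - 1) by omega, pow_add]
  calc _ ≤ ((1 / 2 : ℝ) ^ a) ^ N * (geomBound N * (C * ((1 / 2) ^ a) ^ (n - 1))) := by gcongr
    _ = _ := by ring

/-- The positive integers whose `2`-adic valuations are prescribed. -/
def gapSet (i : Fin n) : Set ℕ := Set.range fun k : ℕ => 2 ^ (6 * (n - 1 - i)) * (2 * k + 1)

lemma gapSet_infinite (i : Fin n) : (gapSet i).Infinite := by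
  refine Set.infinite_range_of_injective fun k l h => ?_
  have := Nat.eq_of_mul_eq_mul_left (by positivity) h
  omega

lemma pos_of_mem_gapSet {i : Fin n} {s : ℕ} (hs : s ∈ gapSet i) : 0 < s := by
  obtain ⟨k, rfl⟩ := hs
  positivity

lemma v2_of_mem_gapSet {i : Fin n} {s : ℕ} (hs : s ∈ gapSet i) :
    v2 (s : ℚ) = (1 / 2) ^ (6 * (n - 1 - i)) := by
  obtain ⟨k, rfl⟩ := hs
  have h1 : v2 ((2 * k + 1 : ℕ) : ℚ) = 1 := by
    rw [v2_apply, (padicNorm.nat_eq_one_iff (p := 2) _).2 (by omega), Rat.cast_one]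
  push_cast at h1 ⊢
  rw [map_mul, map_pow, v2_two, h1, mul_one]

lemma gapped_of_mem_gapSet {s : Fin n → ℕ} (hs : ∀ i, s i ∈ gapSet i) :
    Gapped fun i => (s i : ℚ) := by
  refine ⟨fun i => ?_, fun i => v2_nat_le _, fun i j hij => ?_⟩
  · exact_mod_cast (pos_of_mem_gapSet (hs i)).ne'
  · rw [v2_of_mem_gapSet (hs i), v2_of_mem_gapSet (hs j),
      show (1 / 2 : ℝ) ^ (6 * (n - 1 - j)) / 64 = (1 / 2) ^ (6 * (n - 1 - j) + 6) by
        rw [pow_add, div_eq_mul_inv]; norm_num]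
    refine pow_le_pow_of_le_one (by norm_num) (by norm_num) ?_
    have := j.isLt
    have : i.val < j.val := hij
    omega

lemma exists_polynomial_reduced_fin (g n : ℕ) (hn : 1 ≤ n) (h : 2 < 2 * g + n) :
    ∃ P : MvPolynomial (Fin n) ℚ, P.IsSymmetric ∧
      (∀ m ∈ P.support,
        2 * g + n - 3 ≤ m.sum (fun _ e => e) ∧ m.sum (fun _ e => e) ≤ 3 * g + n - 3) ∧
      ∀ μ : Fin n → ℕ, (∀ i, 0 < μ i) →
        reduced (2 * n + 2 * g - 2) μ = MvPolynomial.eval (fun i => (μ i : ℚ)) P := by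
  have hL : 2 * (g + n - 1) = 2 * n + 2 * g - 2 := by omega
  have hup := cumulantGrowth (ι := Fin n) (g + n - 1)
  rw [hL] at hup
  obtain ⟨P, h1, h2, h3⟩ := exists_polynomial_reduced (ι := Fin n)
    (E := 2 * n + 2 * g - 2 + n - 1) (by rw [Fintype.card_fin]; omega)
    (by rw [Fintype.card_fin]; omega) (by rw [Fintype.card_fin]; omega) hup v2 2 two_ne_zero
    (by rw [Nat.cast_ofNat, v2_two]; norm_num) gapSet gapSet_infinite
    (fun _ _ => pos_of_mem_gapSet) (by rw [Fintype.card_fin]; omega) fun s hs =>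
      cumulantDecay_of_gapped _ hn s (fun i => pos_of_mem_gapSet (hs i)) (gapped_of_mem_gapSet hs)
  refine ⟨P, h1, fun m hm => ?_, h3⟩
  have := h2 m hm
  rw [Fintype.card_fin] at this
  omega

end Rescale

end

end HurwitzPoly

/-- Polynomiality consequence of Theorem 1.1: for `2g - 2 + n > 0` there is a symmetric
polynomial `P_{g,n} ∈ ℚ[x₁,…,xₙ]`, with all monomials of total degree between `2g-3+n`
and `3g-3+n`, such that
`h_{g;k₁,…,kₙ} = (d!/#Aut(k₁,…,kₙ)) ⬝ (∏ kᵢ^{kᵢ}/kᵢ!) ⬝ P_{g,n}(k₁,…,kₙ)`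
for all positive integers `k₁, …, kₙ`, where `d = k + n + 2g - 2`. -/
theorem hurwitz_polynomiality (g n : ℕ) (hn : 1 ≤ n) (h : 2 < 2 * g + n) :
    ∃ P : MvPolynomial (Fin n) ℚ,
      P.IsSymmetric ∧
      (∀ m ∈ P.support,
        2 * g + n - 3 ≤ m.sum (fun _ e => e) ∧ m.sum (fun _ e => e) ≤ 3 * g + n - 3) ∧
      ∀ kk : Fin n → ℕ, (∀ i, 0 < kk i) →
        hurwitzNumber g n kk
          = ((((∑ i, kk i) + n + 2 * g - 2).factorial : ℚ) / (autCount n kk : ℚ))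
              * (∏ i, (kk i : ℚ) ^ (kk i) / ((kk i).factorial : ℚ))
              * MvPolynomial.eval (fun i => (kk i : ℚ)) P := by
  obtain ⟨P, h1, h2, h3⟩ := HurwitzPoly.exists_polynomial_reduced_fin g n hn h
  refine ⟨P, h1, h2, fun kk hk => ?_⟩
  rw [HurwitzPoly.hurwitzNumber_eq_reduced g n hn kk hk, h3 kk hk]
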